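/- Let G=(V,E,I,T) be an inner Eulerian grapht of arbitrary cardinality. Then there exists a system 𝒫 of pairwise edge-disjoint T-paths such that for every t∈T there is a cut separating t and T−t that consists of exactly one edge from each path in 𝒫 having t as an endpoint. -/

import Mathlib

/-! Common definitions: graphts (multigraphs with terminals), walks, paths, cycles,
edge cuts, inner Eulerian graphts, path systems, linkages, Erdős–Menger cuts,
restriction (edge deletion) and contraction. -/

universe u v

/-- A *grapht*: a multigraph (no loops, parallel edges allowed) given by an incidence
function `I : E → Sym2 V`, together with a set `T` of at least two terminal vertices. -/
structure Grapht (V : Type u) (E : Type v) where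
  I : E → Sym2 V
  loopless : ∀ e : E, ¬ (I e).IsDiag
  T : Set V
  T_nontrivial : T.Nontrivial

namespace Grapht

variable {V : Type u} {E : Type v}

/-- `G.IsWalk vs es` holds when `vs` is the vertex sequence and `es` the edge sequence
of a walk in `G`. -/
inductive IsWalk (G : Grapht V E) : List V → List E → Prop
  | nil (v : V) : IsWalk G [v] []
  | cons {u w : V} {vs : List V} {e : E} {es : List E} :
      G.I e = s(u, w) → IsWalk G (w :: vs) es → IsWalk G (u :: w :: vs) (e :: es)

/-- A finite path in the grapht `G` (no repeated vertices), with endpoints `first`, `last`. -/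
structure Path (G : Grapht V E) where
  first : V
  last : V
  verts : List V
  edges : List E
  isWalk : G.IsWalk verts edges
  nodup : verts.Nodup
  head_eq : verts.head? = some first
  getLast_eq : verts.getLast? = some last

/-- A finite cycle in the grapht `G`. -/
structure Cycle (G : Grapht V E) where
  verts : List V
  edges : List E
  isWalk : G.IsWalk verts edges
  closed : verts.head? = verts.getLast?
  nontrivial : edges ≠ []
  edges_nodup : edges.Nodup
  tail_nodup : verts.tail.Nodup

variable {G : Grapht V E}

/-- The internal (inner) vertices of a path. -/
def Path.inner (P : G.Path) : List V := (P.verts.drop 1).dropLast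

/-- The edge set of a path. -/
def Path.edgeSet (P : G.Path) : Set E := {e | e ∈ P.edges}

/-- The edge set of a cycle. -/
def Cycle.edgeSet (C : G.Cycle) : Set E := {e | e ∈ C.edges}

variable (G)

/-- `δ_G(X)`: the set of edges with exactly one endpoint in `X`. -/
def edgeCut (X : Set V) : Set E :=
  {e | ∃ u w, G.I e = s(u, w) ∧ u ∈ X ∧ w ∉ X}

/-- A grapht is *inner Eulerian* if there is no `X ⊆ V ∖ T` whose cut `δ(X)` is a
finite set of odd size. -/
def InnerEulerian : Prop :=
  ∀ X : Set V, Disjoint X G.T → ¬ ((G.edgeCut X).Finite ∧ Odd (G.edgeCut X).ncard)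

/-- An `AB`-path: a path with first vertex in `A`, last vertex in `B` and no internal
vertex in `A ∪ B`. -/
def IsABPath (A B : Set V) (P : G.Path) : Prop :=
  P.first ∈ A ∧ P.last ∈ B ∧ ∀ v ∈ P.inner, v ∉ A ∪ B

/-- A `T`-path: a path between two distinct terminal vertices without internal
terminal vertices. -/
def IsTPath (P : G.Path) : Prop :=
  P.first ∈ G.T ∧ P.last ∈ G.T ∧ P.first ≠ P.last ∧ ∀ v ∈ P.inner, v ∉ G.T

/-- A system of pairwise edge-disjoint paths. -/
def EdgeDisjoint (Ps : Set G.Path) : Prop :=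
  Ps.Pairwise fun P Q => ∀ e, e ∈ P.edges → e ∉ Q.edges

/-- A system of pairwise edge-disjoint `T`-paths. -/
def IsTPathSystem (Ps : Set G.Path) : Prop :=
  G.EdgeDisjoint Ps ∧ ∀ P ∈ Ps, G.IsTPath P

/-- The set of edges used by a path system. -/
def sysEdges (Ps : Set G.Path) : Set E := ⋃ P ∈ Ps, P.edgeSet

/-- `C` is *orthogonal* to the path system `Ps`: `C` consists of exactly one edge from
each path of `Ps`. -/
def Orthogonal (C : Set E) (Ps : Set G.Path) : Prop :=
  (∀ P ∈ Ps, ∃! e, e ∈ C ∧ e ∈ P.edges) ∧ ∀ e ∈ C, ∃ P ∈ Ps, e ∈ P.edges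

/-- `C` separates `A` and `B`: every `AB`-path meets `C` (i.e. `G − C` has no `AB`-path). -/
def Separates (C : Set E) (A B : Set V) : Prop :=
  ∀ P : G.Path, G.IsABPath A B P → ∃ e ∈ C, e ∈ P.edges

/-- An `AB`-cut. -/
def IsABCut (A B : Set V) (C : Set E) : Prop :=
  ∀ P : G.Path, G.IsABPath A B P → ∃ e ∈ C, e ∈ P.edges

/-- An Erdős–Menger `AB`-cut: an `AB`-cut orthogonal to some system of pairwise
edge-disjoint `AB`-paths. -/
def IsEMABCut (A B : Set V) (C : Set E) : Prop :=
  G.IsABCut A B C ∧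
    ∃ Ps : Set G.Path, G.EdgeDisjoint Ps ∧ (∀ P ∈ Ps, G.IsABPath A B P) ∧ G.Orthogonal C Ps

/-- The order `⊴` on (Erdős–Menger) `AB`-cuts: on every `AB`-path the first edge of `C`
comes no later than the first edge of `C'`. -/
def ABCutLE (A B : Set V) (C C' : Set E) : Prop :=
  ∀ P : G.Path, G.IsABPath A B P →
    ∀ i : Fin P.edges.length, P.edges.get i ∈ C' →
      ∃ j : Fin P.edges.length, (j : ℕ) ≤ (i : ℕ) ∧ P.edges.get j ∈ C

/-- `C` is the `⊴`-largest Erdős–Menger `AB`-cut. -/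
def IsLargestEMABCut (A B : Set V) (C : Set E) : Prop :=
  G.IsEMABCut A B C ∧ ∀ C', G.IsEMABCut A B C' → G.ABCutLE A B C' C

/-- A system `Ps` of pairwise edge-disjoint `T`-paths *links* the terminal `t`:
it covers `δ(t)`. -/
def Links (Ps : Set G.Path) (t : V) : Prop :=
  G.IsTPathSystem Ps ∧ ∀ e ∈ G.edgeCut {t}, ∃ P ∈ Ps, e ∈ P.edges

/-- The terminal `t` is linked. -/
def Linked (t : V) : Prop := ∃ Ps : Set G.Path, G.Links Ps t

/-- The linkability condition: every terminal is linked. -/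
def LinkabilityCondition : Prop := ∀ t ∈ G.T, G.Linked t

/-- A perfect linkage: a system of pairwise edge-disjoint `T`-paths linking every
terminal. -/
def IsPerfectLinkage (Ps : Set G.Path) : Prop :=
  G.IsTPathSystem Ps ∧ ∀ t ∈ G.T, ∀ e ∈ G.edgeCut {t}, ∃ P ∈ Ps, e ∈ P.edges

/-- In the two-terminal setting: a system of pairwise edge-disjoint `st`-paths
covering `δ(s)` (a linkage of `s`). -/
def IsStLinkage (s t : V) (Ps : Set G.Path) : Prop :=
  G.EdgeDisjoint Ps ∧ (∀ P ∈ Ps, G.IsABPath {s} {t} P) ∧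
    ∀ e ∈ G.edgeCut {s}, ∃ P ∈ Ps, e ∈ P.edges

/-- `s` is linked (two-terminal setting). -/
def StLinked (s t : V) : Prop := ∃ Ps : Set G.Path, G.IsStLinkage s t Ps

/-- `λ_G(A,B)`: the maximal number of pairwise edge-disjoint `AB`-paths. -/
noncomputable def lambda (A B : Set V) : ℕ :=
  sSup {n : ℕ | ∃ Ps : Set G.Path, G.EdgeDisjoint Ps ∧ (∀ P ∈ Ps, G.IsABPath A B P) ∧
    Ps.Finite ∧ Ps.ncard = n}

/-- The grapht obtained by deleting all edges outside `F`. -/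
def restrict (F : Set E) : Grapht V F where
  I e := G.I e.1
  loopless e := G.loopless e.1
  T := G.T
  T_nontrivial := G.T_nontrivial

/-- The map sending every vertex of a contracted set `X t` (`t ∈ T`) to `t`. -/
noncomputable def contractMap (X : V → Set V) : V → V := fun v =>
  letI := Classical.dec (∃ u ∈ G.T, v ∈ X u)
  if h : ∃ u ∈ G.T, v ∈ X u then h.choose else v

/-- The contraction `G/ℱ` of the family `ℱ = {X t : t ∈ T}`: each `X t` is contracted
to `t` and the arising loops are deleted. -/
noncomputable def contract (X : V → Set V) :
    Grapht V {e : E // ¬ ((G.I e).map (G.contractMap X)).IsDiag} where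
  I e := (G.I e.1).map (G.contractMap X)
  loopless e := e.2
  T := G.T
  T_nontrivial := G.T_nontrivial

end Grapht

universe w

namespace LC
open Classical

structure MG (V : Type u) (E : Type v) where
  I : E → Sym2 V
  S : Set E

@[ext] structure Dart (V : Type u) (E : Type v) where
  s : V
  e : E
  t : V

variable {V : Type u} {E : Type v}

def Dart.rev (d : Dart V E) : Dart V E := ⟨d.t, d.e, d.s⟩
@[simp] lemma Dart.rev_s (d : Dart V E) : d.rev.s = d.t := rfl
@[simp] lemma Dart.rev_t (d : Dart V E) : d.rev.t = d.s := rfl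
@[simp] lemma Dart.rev_e (d : Dart V E) : d.rev.e = d.e := rfl
@[simp] lemma Dart.rev_rev (d : Dart V E) : d.rev.rev = d := rfl

/-- the dart is an edge of the graph -/
def MG.ok (G : MG V E) (d : Dart V E) : Prop := d.e ∈ G.S ∧ G.I d.e = s(d.s, d.t)

lemma MG.ok.rev {G : MG V E} {d : Dart V E} (h : G.ok d) : G.ok d.rev :=
  ⟨h.1, by simpa [Sym2.eq_swap] using h.2⟩

lemma ok_same {G : MG V E} {d d' : Dart V E} (h : G.ok d) (h' : G.ok d') (he : d.e = d'.e) :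
    d' = d ∨ d' = d.rev := by
  have h1 := h.2; have h2 := h'.2
  rw [he, h2, Sym2.eq_iff] at h1
  rcases d with ⟨a, e, b⟩; rcases d' with ⟨a', e', b'⟩
  simp only [Dart.rev, Dart.mk.injEq] at *
  grind

/-- chain of darts -/
def Ch : V → List (Dart V E) → V → Prop
  | x, [], y => x = y
  | x, d :: l, y => d.s = x ∧ Ch d.t l y

@[simp] lemma Ch_nil {x y : V} : Ch (E := E) x [] y ↔ x = y := Iff.rfl
@[simp] lemma Ch_cons {x y : V} {d : Dart V E} {l} : Ch x (d :: l) y ↔ d.s = x ∧ Ch d.t l y := Iff.rfl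

lemma Ch_append {x y : V} {l m : List (Dart V E)} :
    Ch x (l ++ m) y ↔ ∃ z, Ch x l z ∧ Ch z m y := by
  induction l generalizing x with
  | nil => simp
  | cons d l ih => simp [ih, and_assoc]

lemma Ch.append {x y z : V} {l m : List (Dart V E)} (h : Ch x l y) (h' : Ch y m z) :
    Ch x (l ++ m) z := Ch_append.2 ⟨y, h, h'⟩

lemma Ch.unique {x y z : V} {l : List (Dart V E)} (h : Ch x l y) (h' : Ch x l z) : y = z := by
  induction l generalizing x with
  | nil => simp at *; rw [← h, h']
  | cons d l ih => exact ih h.2 h'.2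

lemma Ch.append_iff {x y z : V} {l m : List (Dart V E)} (h : Ch x l y) :
    Ch x (l ++ m) z ↔ Ch y m z := by
  rw [Ch_append]
  exact ⟨fun ⟨w, h1, h2⟩ => by rwa [h.unique h1], fun h2 => ⟨y, h, h2⟩⟩

def revL (l : List (Dart V E)) : List (Dart V E) := (l.map Dart.rev).reverse

@[simp] lemma revL_nil : revL ([] : List (Dart V E)) = [] := rfl
@[simp] lemma revL_cons (d : Dart V E) (l) : revL (d :: l) = revL l ++ [d.rev] := by simp [revL]
@[simp] lemma mem_revL {d : Dart V E} {l} : d ∈ revL l ↔ d.rev ∈ l := by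
  simp only [revL, List.mem_reverse, List.mem_map]
  exact ⟨fun ⟨a, h, h'⟩ => by rw [← h']; simpa, fun h => ⟨_, h, rfl⟩⟩

lemma Ch.rev {x y : V} {l : List (Dart V E)} (h : Ch x l y) : Ch y (revL l) x := by
  induction l generalizing x with
  | nil => simp at *; exact h.symm
  | cons d l ih => rw [revL_cons]; exact (ih h.2).append (by simp [h.1])

def edges (l : List (Dart V E)) : List E := l.map Dart.e

@[simp] lemma edges_nil : edges ([] : List (Dart V E)) = [] := rfl
@[simp] lemma edges_cons (d : Dart V E) (l) : edges (d :: l) = d.e :: edges l := rfl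
@[simp] lemma edges_append (l m : List (Dart V E)) : edges (l ++ m) = edges l ++ edges m := by
  simp [edges]
lemma mem_edges {e : E} {l : List (Dart V E)} : e ∈ edges l ↔ ∃ d ∈ l, d.e = e := by simp [edges]
lemma mem_edges_of {d : Dart V E} {l : List (Dart V E)} (h : d ∈ l) : d.e ∈ edges l :=
  mem_edges.2 ⟨d, h, rfl⟩
@[simp] lemma mem_edges_revL {e : E} {l : List (Dart V E)} : e ∈ edges (revL l) ↔ e ∈ edges l := by
  simp only [mem_edges, mem_revL]
  exact ⟨fun ⟨d, h, h'⟩ => ⟨_, h, h'⟩, fun ⟨d, h, h'⟩ => ⟨d.rev, by simpa, h'⟩⟩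
lemma edges_sub {l m : List (Dart V E)} (h : l ⊆ m) : edges l ⊆ edges m := List.map_subset _ h
lemma edges_revL_nodup {l : List (Dart V E)} (h : (edges l).Nodup) : (edges (revL l)).Nodup := by
  simp only [revL, edges, List.map_reverse, List.nodup_reverse, List.map_map] at *
  exact h

lemma nodup_of_edges {l : List (Dart V E)} (h : (edges l).Nodup) : l.Nodup := List.Nodup.of_map _ h
lemma dart_eq_of_edge {l : List (Dart V E)} (h : (edges l).Nodup) {d d' : Dart V E} (hd : d ∈ l)
    (hd' : d' ∈ l) (he : d.e = d'.e) : d = d' := List.inj_on_of_nodup_map h hd hd' he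

lemma Ch.mem_split {x y : V} {l : List (Dart V E)} (h : Ch x l y) {d} (hd : d ∈ l) :
    ∃ l1 l2, l = l1 ++ d :: l2 ∧ Ch x l1 d.s ∧ Ch d.t l2 y := by
  obtain ⟨l1, l2, rfl⟩ := List.append_of_mem hd
  obtain ⟨z, h1, h2⟩ := Ch_append.1 h
  exact ⟨l1, l2, rfl, by rw [h2.1]; exact h1, h2.2⟩

/-- first exit -/
lemma Ch.exit {x y : V} {l : List (Dart V E)} (h : Ch x l y) {X : Set V} (hx : x ∈ X) (hy : y ∉ X) :
    ∃ l1 d l2, l = l1 ++ d :: l2 ∧ Ch x l1 d.s ∧ Ch d.t l2 y ∧ d.s ∈ X ∧ d.t ∉ X ∧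
      ∀ d' ∈ l1, d'.s ∈ X ∧ d'.t ∈ X := by
  induction l generalizing x with
  | nil => simp at h; grind
  | cons d l ih =>
    obtain ⟨rfl, h2⟩ := h
    by_cases ht : d.t ∈ X
    · obtain ⟨l1, d', l2, rfl, h3, h4, h5, h6, h7⟩ := ih h2 ht
      exact ⟨d :: l1, d', l2, rfl, ⟨rfl, h3⟩, h4, h5, h6, by simpa using ⟨⟨hx, ht⟩, h7⟩⟩
    · exact ⟨[], d, l, rfl, by simp, h2, hx, ht, by simp⟩

/-- last entrance: last position before which in X, after which never in X -/
lemma Ch.last_exit {x y : V} {l : List (Dart V E)} (h : Ch x l y) {X : Set V}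
    (hx : x ∈ X ∨ ∃ d ∈ l, d.t ∈ X) :
    ∃ l1 l2 z, l = l1 ++ l2 ∧ Ch x l1 z ∧ Ch z l2 y ∧ z ∈ X ∧ ∀ d ∈ l2, d.t ∉ X := by
  induction l generalizing x with
  | nil => simp at h hx; exact ⟨[], [], x, by simp [h, h ▸ hx]⟩
  | cons d l ih =>
    obtain ⟨rfl, h2⟩ := h
    by_cases hh : d.t ∈ X ∨ ∃ d' ∈ l, d'.t ∈ X
    · obtain ⟨l1, l2, z, rfl, h3, h4⟩ := ih h2 hh
      exact ⟨d :: l1, l2, z, rfl, ⟨rfl, h3⟩, h4⟩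
    · have hx' : d.s ∈ X := by simp at hx hh; grind
      exact ⟨[], d :: l, d.s, rfl, by simp, ⟨rfl, h2⟩, hx', by simp at hh ⊢; exact hh⟩

/-- shorten a chain to a vertex-simple one -/
lemma Ch.shorten {x y : V} {l : List (Dart V E)} (h : Ch x l y) :
    ∃ l', Ch x l' y ∧ l' ⊆ l ∧ (x :: l'.map Dart.t).Nodup := by
  induction hn : l.length using Nat.strong_induction_on generalizing l x with
  | _ n ih =>
    obtain ⟨l1, l2, z, rfl, h3, h4, h5, h6⟩ := h.last_exit (X := {x}) (Or.inl rfl)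
    simp only [Set.mem_singleton_iff] at h5 h6
    subst h5
    cases l2 with
    | nil => exact ⟨[], by simpa using h4, by simp, by simp⟩
    | cons d l2 =>
      obtain ⟨l', h7, h8, h9⟩ := ih l2.length (by simp at hn; omega) h4.2 rfl
      refine ⟨d :: l', ⟨h4.1, h7⟩, ?_, ?_⟩
      · intro a ha
        simp only [List.mem_cons, List.mem_append] at ha ⊢
        rcases ha with ha | ha
        · simp [ha]
        · right; right; exact h8 ha
      · rw [List.map_cons, List.nodup_cons]
        refine ⟨?_, h9⟩
        simp only [List.mem_cons, List.mem_map, not_or, not_exists, not_and]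
        exact ⟨fun h => h6 d (by simp) h.symm, fun a ha => h6 a (by simp [h8 ha])⟩

lemma Ch.mem_verts_s {x y : V} {l : List (Dart V E)} (h : Ch x l y) {d} (hd : d ∈ l) :
    d.s ∈ x :: l.map Dart.t := by
  induction l generalizing x with
  | nil => simp at hd
  | cons a l ih =>
    rcases List.mem_cons.1 hd with rfl | h'
    · simp [h.1]
    · have := ih h.2 h'
      simp only [List.map_cons, List.mem_cons] at *; tauto

lemma Ch.end_mem {x y : V} {l : List (Dart V E)} (h : Ch x l y) : y ∈ x :: l.map Dart.t := by
  induction l generalizing x with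
  | nil => simp at *; exact h.symm
  | cons a l ih =>
    have := ih h.2
    simp only [List.map_cons, List.mem_cons] at *; tauto

lemma Ch.edges_nodup {G : MG V E} {x y : V} {l : List (Dart V E)} (h : Ch x l y)
    (hok : ∀ d ∈ l, G.ok d) (hn : (x :: l.map Dart.t).Nodup) : (edges l).Nodup := by
  induction l generalizing x with
  | nil => simp
  | cons a l ih =>
    rw [List.map_cons, List.nodup_cons] at hn
    rw [edges_cons, List.nodup_cons]
    refine ⟨fun hm => ?_, ih h.2 (fun d hd => hok d (by simp [hd])) hn.2⟩
    obtain ⟨d, hd, hde⟩ := mem_edges.1 hm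
    have h1 := h.2.mem_verts_s hd
    have h2 : d.t ∈ a.t :: l.map Dart.t := by simp; right; exact ⟨d, hd, rfl⟩
    rcases ok_same (hok a (by simp)) (hok d (by simp [hd])) hde.symm with rfl | rfl
    · exact hn.1 (h.1 ▸ h1)
    · exact hn.1 (h.1 ▸ h2)

/-- edge cut -/
def MG.cut (G : MG V E) (X : Set V) : Set E := {e | ∃ d, G.ok d ∧ d.e = e ∧ d.s ∈ X ∧ d.t ∉ X}

lemma MG.ok.mem_cut {G : MG V E} {d : Dart V E} (h : G.ok d) {X : Set V} :
    d.e ∈ G.cut X ↔ (d.s ∈ X ∧ d.t ∉ X) ∨ (d.s ∉ X ∧ d.t ∈ X) := by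
  constructor
  · rintro ⟨d', h1, h2, h3, h4⟩
    rcases ok_same h h1 h2.symm with rfl | rfl
    · exact Or.inl ⟨h3, h4⟩
    · exact Or.inr ⟨h4, h3⟩
  · rintro (⟨h1, h2⟩ | ⟨h1, h2⟩)
    · exact ⟨d, h, rfl, h1, h2⟩
    · exact ⟨d.rev, h.rev, rfl, h2, h1⟩

lemma MG.cut_sub (G : MG V E) (X : Set V) : G.cut X ⊆ G.S := by
  rintro e ⟨d, h1, rfl, _⟩; exact h1.1

lemma MG.cut_compl (G : MG V E) (X : Set V) : G.cut Xᶜ = G.cut X := by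
  ext e; constructor
  · rintro ⟨d, h1, rfl, h2, h3⟩; exact ⟨d.rev, h1.rev, rfl, by simpa using h3, h2⟩
  · rintro ⟨d, h1, rfl, h2, h3⟩; exact ⟨d.rev, h1.rev, rfl, h3, by simpa using h2⟩

def MG.del (G : MG V E) (F : Set E) : MG V E := ⟨G.I, G.S \ F⟩
@[simp] lemma del_I (G : MG V E) (F) : (G.del F).I = G.I := rfl
@[simp] lemma del_S (G : MG V E) (F) : (G.del F).S = G.S \ F := rfl
lemma ok_del {G : MG V E} {F : Set E} {d : Dart V E} : (G.del F).ok d ↔ G.ok d ∧ d.e ∉ F := by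
  simp [MG.ok, MG.del]; tauto
lemma cut_del {G : MG V E} {F : Set E} {X : Set V} : (G.del F).cut X = G.cut X \ F := by
  ext e; constructor
  · rintro ⟨d, h1, rfl, h2⟩; rw [ok_del] at h1; exact ⟨⟨d, h1.1, rfl, h2⟩, h1.2⟩
  · rintro ⟨⟨d, h1, rfl, h2⟩, h3⟩; exact ⟨d, ok_del.2 ⟨h1, h3⟩, rfl, h2⟩
lemma del_del {G : MG V E} {F F' : Set E} : (G.del F).del F' = G.del (F ∪ F') := by
  simp [MG.del, Set.sdiff_sdiff]
@[simp] lemma del_empty {G : MG V E} : G.del ∅ = G := by simp [MG.del]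

/-- walks leaving X starting in A -/
def IsSW (G : MG V E) (A X : Set V) (l : List (Dart V E)) : Prop :=
  (∀ d ∈ l, G.ok d ∧ d.s ∈ X ∧ d.t ∉ A) ∧ ∃ x ∈ A, ∃ y ∉ X, Ch x l y

def used (W : Set (List (Dart V E))) : Set E := {e | ∃ l ∈ W, e ∈ edges l}

structure Sys (G : MG V E) (A X : Set V) (W : Set (List (Dart V E))) : Prop where
  sw : ∀ l ∈ W, IsSW G A X l
  nodup : ∀ l ∈ W, (edges l).Nodup
  disj : ∀ l ∈ W, ∀ l' ∈ W, ∀ e, e ∈ edges l → e ∈ edges l' → l = l'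

lemma IsSW.cons {G : MG V E} {A X : Set V} {l} (h : IsSW G A X l) (hAX : A ⊆ X) :
    ∃ d l', l = d :: l' ∧ d.s ∈ A ∧ ∀ d' ∈ l', d'.s ∉ A := by
  obtain ⟨h1, x, hx, y, hy, hc⟩ := h
  cases l with
  | nil => simp at hc; subst hc; exact absurd (hAX hx) hy
  | cons d l =>
    refine ⟨d, l, rfl, by rw [hc.1]; exact hx, fun d' hd' => ?_⟩
    have := hc.2.mem_verts_s hd'
    simp only [List.mem_cons, List.mem_map] at this
    rcases this with h | ⟨a, ha, h⟩
    · rw [h]; exact (h1 d (by simp)).2.2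
    · rw [← h]; exact (h1 a (by simp [ha])).2.2

lemma IsSW.snoc {G : MG V E} {A X : Set V} {l} (h : IsSW G A X l) (hAX : A ⊆ X) :
    ∃ d l', l = l' ++ [d] ∧ d.t ∉ X ∧ ∀ d' ∈ l', d'.t ∈ X := by
  obtain ⟨h1, x, hx, y, hy, hc⟩ := h
  obtain ⟨l1, d, l2, rfl, h3, h4, h5, h6, h7⟩ := hc.exit (hAX hx) hy
  cases l2 with
  | nil => exact ⟨d, l1, rfl, h6, fun d' hd' => (h7 d' hd').2⟩
  | cons a l2 => exact absurd ((h1 a (by simp)).2.1) (by rw [h4.1]; exact h6)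

lemma IsSW.first_mem {G G' : MG V E} {A X X' : Set V} {l l'} (h : IsSW G A X l) (h' : IsSW G' A X' l')
    (hAX : A ⊆ X) (hAX' : A ⊆ X') (hs : l' ⊆ l) {d} (hd : d ∈ l) (hA : d.s ∈ A) : d ∈ l' := by
  obtain ⟨d1, m, rfl, h1, h2⟩ := h.cons hAX
  obtain ⟨d2, m', rfl, h3, h4⟩ := h'.cons hAX'
  have e1 : d = d1 := by
    rcases List.mem_cons.1 hd with h | h
    · exact h
    · exact absurd hA (h2 d h)
  have e2 : d2 = d1 := by
    rcases List.mem_cons.1 (hs (List.mem_cons_self)) with h | h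
    · exact h
    · exact absurd h3 (h2 d2 h)
  simp [e1, e2]

lemma IsSW.last_mem {G G' : MG V E} {A A' X : Set V} {l l'} (h : IsSW G A X l) (h' : IsSW G' A' X l')
    (hAX : A ⊆ X) (hAX' : A' ⊆ X) (hs : l' ⊆ l) {d} (hd : d ∈ l) (hA : d.t ∉ X) : d ∈ l' := by
  obtain ⟨d1, m, rfl, h1, h2⟩ := h.snoc hAX
  obtain ⟨d2, m', rfl, h3, h4⟩ := h'.snoc hAX'
  have e1 : d = d1 := by
    rcases List.mem_append.1 hd with h | h
    · exact absurd (h2 d h) hA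
    · simpa using h
  have e2 : d2 = d1 := by
    rcases List.mem_append.1 (hs (a := d2) (by simp)) with h | h
    · exact absurd (h2 d2 h) h3
    · simpa using h
  simp [e1, e2]

/-- in a S-walk, edge of cut A is the dart starting in A -/
lemma IsSW.dartA {G : MG V E} {A X : Set V} {l} (h : IsSW G A X l) {e} (he : e ∈ edges l)
    (hc : e ∈ G.cut A) : ∃ d ∈ l, d.e = e ∧ d.s ∈ A := by
  obtain ⟨d, hd, rfl⟩ := mem_edges.1 he
  have := (h.1 d hd).1.mem_cut.1 hc
  have := (h.1 d hd).2.2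
  exact ⟨d, hd, rfl, by tauto⟩
lemma IsSW.dartX {G : MG V E} {A X : Set V} {l} (h : IsSW G A X l) {e} (he : e ∈ edges l)
    (hc : e ∈ G.cut X) : ∃ d ∈ l, d.e = e ∧ d.t ∉ X := by
  obtain ⟨d, hd, rfl⟩ := mem_edges.1 he
  have := (h.1 d hd).1.mem_cut.1 hc
  have := (h.1 d hd).2.1
  exact ⟨d, hd, rfl, by tauto⟩
lemma IsSW.edgeA {G : MG V E} {A X : Set V} {l} (h : IsSW G A X l) {d} (hd : d ∈ l)
    (hA : d.s ∈ A) : d.e ∈ G.cut A := (h.1 d hd).1.mem_cut.2 (Or.inl ⟨hA, (h.1 d hd).2.2⟩)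
lemma IsSW.edgeX {G : MG V E} {A X : Set V} {l} (h : IsSW G A X l) {d} (hd : d ∈ l)
    (hA : d.t ∉ X) : d.e ∈ G.cut X := (h.1 d hd).1.mem_cut.2 (Or.inl ⟨(h.1 d hd).2.1, hA⟩)

lemma IsSW.mono {G G' : MG V E} {A X : Set V} {l} (h : IsSW G A X l)
    (hG : ∀ d ∈ l, G.ok d → G'.ok d) : IsSW G' A X l :=
  ⟨fun d hd => ⟨hG d hd (h.1 d hd).1, (h.1 d hd).2⟩, h.2⟩

lemma isSW_del {G : MG V E} {F : Set E} {A X : Set V} {l} :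
    IsSW (G.del F) A X l ↔ IsSW G A X l ∧ ∀ e ∈ edges l, e ∉ F := by
  constructor
  · intro h
    refine ⟨h.mono (fun d _ hd => (ok_del.1 hd).1), fun e he => ?_⟩
    obtain ⟨d, hd, rfl⟩ := mem_edges.1 he
    exact (ok_del.1 (h.1 d hd).1).2
  · rintro ⟨h, h'⟩
    exact h.mono (fun d hd hok => ok_del.2 ⟨hok, h' _ (mem_edges_of hd)⟩)

lemma Sys.of_del {G : MG V E} {F : Set E} {A X : Set V} {W} (h : Sys (G.del F) A X W) : Sys G A X W :=
  ⟨fun l hl => (isSW_del.1 (h.sw l hl)).1, h.nodup, h.disj⟩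
lemma Sys.to_del {G : MG V E} {F : Set E} {A X : Set V} {W} (h : Sys G A X W)
    (hF : ∀ e ∈ used W, e ∉ F) : Sys (G.del F) A X W :=
  ⟨fun l hl => isSW_del.2 ⟨h.sw l hl, fun e he => hF e ⟨l, hl, he⟩⟩, h.nodup, h.disj⟩
lemma Sys.used_del {G : MG V E} {F : Set E} {A X : Set V} {W} (h : Sys (G.del F) A X W) :
    ∀ e ∈ used W, e ∉ F := by
  rintro e ⟨l, hl, he⟩; exact (isSW_del.1 (h.sw l hl)).2 e he
lemma Sys.mono {G G' : MG V E} {A X : Set V} {W} (h : Sys G A X W)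
    (hG : ∀ l ∈ W, ∀ d ∈ l, G.ok d → G'.ok d) : Sys G' A X W :=
  ⟨fun l hl => (h.sw l hl).mono (hG l hl), h.nodup, h.disj⟩
lemma Sys.sub {G : MG V E} {A X : Set V} {W W'} (h : Sys G A X W) (hs : W' ⊆ W) : Sys G A X W' :=
  ⟨fun l hl => h.sw l (hs hl), fun l hl => h.nodup l (hs hl),
    fun l hl l' hl' => h.disj l (hs hl) l' (hs hl')⟩
lemma Sys.used_sub {G : MG V E} {A X : Set V} {W} (h : Sys G A X W) : used W ⊆ G.S := by
  rintro e ⟨l, hl, he⟩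
  obtain ⟨d, hd, rfl⟩ := mem_edges.1 he
  exact ((h.sw l hl).1 d hd).1.1

lemma used_mono {W W' : Set (List (Dart V E))} (h : W ⊆ W') : used W ⊆ used W' :=
  fun _ ⟨l, hl, he⟩ => ⟨l, h hl, he⟩

lemma IsSW.shorten {G : MG V E} {A X : Set V} {l} (h : IsSW G A X l) :
    ∃ l', IsSW G A X l' ∧ l' ⊆ l ∧ (edges l').Nodup := by
  obtain ⟨h1, x, hx, y, hy, hc⟩ := h
  obtain ⟨l', h2, h3, h4⟩ := hc.shorten
  exact ⟨l', ⟨fun d hd => h1 d (h3 hd), x, hx, y, hy, h2⟩, h3,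
    h2.edges_nodup (fun d hd => (h1 d (h3 hd)).1) h4⟩

/-- build a system from an edge-disjoint indexed family -/
lemma mkSys {ι : Type*} {G : MG V E} {A X : Set V} (hAX : A ⊆ X) (f : ι → List (Dart V E))
    (hf : ∀ i, IsSW G A X (f i))
    (hd : ∀ i j e, e ∈ edges (f i) → e ∈ edges (f j) → i = j) :
    ∃ W, Sys G A X W ∧ (∀ e, (∃ i, e ∈ edges (f i)) → e ∈ G.cut A → e ∈ used W) ∧
      (∀ e, (∃ i, e ∈ edges (f i)) → e ∈ G.cut X → e ∈ used W) ∧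
      (∀ l ∈ W, ∃ i, l ⊆ f i) := by
  choose g h1 h2 h3 using fun i => (hf i).shorten
  refine ⟨Set.range g, ⟨?_, ?_, ?_⟩, ?_, ?_, ?_⟩
  · rintro _ ⟨i, rfl⟩; exact h1 i
  · rintro _ ⟨i, rfl⟩; exact h3 i
  · rintro _ ⟨i, rfl⟩ _ ⟨j, rfl⟩ e he he'
    rw [hd i j e (edges_sub (h2 i) he) (edges_sub (h2 j) he')]
  · rintro e ⟨i, he⟩ hc
    obtain ⟨d, hd, rfl, hs⟩ := (hf i).dartA he hc
    exact ⟨_, ⟨i, rfl⟩, mem_edges_of ((hf i).first_mem (h1 i) hAX hAX (h2 i) hd hs)⟩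
  · rintro e ⟨i, he⟩ hc
    obtain ⟨d, hd, rfl, hs⟩ := (hf i).dartX he hc
    exact ⟨_, ⟨i, rfl⟩, mem_edges_of ((hf i).last_mem (h1 i) hAX hAX (h2 i) hd hs)⟩
  · rintro _ ⟨i, rfl⟩; exact ⟨i, h2 i⟩

/-- truncation to X -/
noncomputable def trunc (X : Set V) : List (Dart V E) → List (Dart V E)
  | [] => []
  | d :: l => if d.t ∈ X then d :: trunc X l else [d]

lemma trunc_eq {X : Set V} {l1 l2 : List (Dart V E)} {d} (h1 : ∀ d' ∈ l1, d'.t ∈ X) (hd : d.t ∉ X) :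
    trunc X (l1 ++ d :: l2) = l1 ++ [d] := by
  induction l1 with
  | nil => simp [trunc, hd]
  | cons a l ih =>
    simp only [List.cons_append, trunc]
    rw [if_pos (h1 a (by simp)), ih (fun d' hd' => h1 d' (by simp [hd']))]

lemma trunc_initial {X : Set V} (l : List (Dart V E)) : trunc X l <+: l := by
  induction l with
  | nil => simp [trunc]
  | cons a l ih =>
    simp only [trunc]; split_ifs
    · simpa [List.cons_prefix_cons] using ih
    · simp [List.cons_prefix_cons]

lemma trunc_sub {X : Set V} (l : List (Dart V E)) : trunc X l ⊆ l := (trunc_initial l).subset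

lemma IsSW.trunc {G : MG V E} {A X Y : Set V} {l} (h : IsSW G A Y l) (hAX : A ⊆ X) (hXY : X ⊆ Y) :
    IsSW G A X (trunc X l) := by
  obtain ⟨h1, x, hx, y, hy, hc⟩ := h
  obtain ⟨l1, d, l2, rfl, h3, h4, h5, h6, h7⟩ := hc.exit (hAX hx) (fun h => hy (hXY h))
  rw [trunc_eq (fun d hd => (h7 d hd).2) h6]
  refine ⟨fun d' hd' => ?_, x, hx, d.t, h6, h3.append (by simp)⟩
  rw [List.mem_append, List.mem_singleton] at hd'
  rcases hd' with hd' | rfl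
  · exact ⟨(h1 d' (by simp [hd'])).1, (h7 d' hd').1, (h1 d' (by simp [hd'])).2.2⟩
  · exact ⟨(h1 d' (by simp)).1, h5, (h1 d' (by simp)).2.2⟩

lemma Sys.trunc {G : MG V E} {A X Y : Set V} {W} (h : Sys G A Y W) (hAX : A ⊆ X) (hXY : X ⊆ Y) :
    Sys G A X (trunc X '' W) ∧ (∀ e ∈ used W, e ∈ G.cut A → e ∈ used (LC.trunc X '' W)) := by
  refine ⟨⟨?_, ?_, ?_⟩, ?_⟩
  · rintro _ ⟨l, hl, rfl⟩; exact (h.sw l hl).trunc hAX hXY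
  · rintro _ ⟨l, hl, rfl⟩
    exact (h.nodup l hl).sublist ((trunc_initial l).sublist.map _)
  · rintro _ ⟨l, hl, rfl⟩ _ ⟨l', hl', rfl⟩ e he he'
    rw [h.disj l hl l' hl' e (edges_sub (trunc_sub l) he) (edges_sub (trunc_sub l') he')]
  · rintro e ⟨l, hl, he⟩ hc
    obtain ⟨d, hd, rfl, hs⟩ := (h.sw l hl).dartA he hc
    exact ⟨_, ⟨l, hl, rfl⟩, mem_edges_of ((h.sw l hl).first_mem ((h.sw l hl).trunc hAX hXY)
      (hAX.trans hXY) hAX (trunc_sub l) hd hs)⟩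

lemma used_trunc {X : Set V} {W : Set (List (Dart V E))} : used (trunc X '' W) ⊆ used W := by
  rintro e ⟨_, ⟨l, hl, rfl⟩, he⟩; exact ⟨l, hl, edges_sub (trunc_sub l) he⟩

def FarFull (G : MG V E) (X : Set V) (W : Set (List (Dart V E))) : Prop := G.cut X ⊆ used W

def Wave (G : MG V E) (A Y X : Set V) (W : Set (List (Dart V E))) : Prop :=
  A ⊆ X ∧ X ⊆ Y ∧ Sys G A X W ∧ G.cut X ⊆ used W

def Linked (G : MG V E) (A Y : Set V) : Prop := ∃ W, Sys G A Y W ∧ G.cut A ⊆ used W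

def UnH (G : MG V E) (A Y : Set V) : Prop := ∀ X W, Wave G A Y X W → G.cut A ⊆ used W

def Loose (G : MG V E) (A Y : Set V) : Prop :=
  ∀ X W, Wave G A Y X W → ∀ d, G.ok d → d.s ∈ A → d.t ∉ A → d.t ∉ X

def Eul (G : MG V E) (N : Set V) : Prop :=
  ∀ X ⊆ N, (G.cut X).Finite → Even (G.cut X).ncard

/-- a system restricted: edges shared between dart and list have the direction -/
lemma Sys.dart {G : MG V E} {A X : Set V} {W} (h : Sys G A X W) {d} (hd : G.ok d)
    (hu : d.e ∈ used W) : ∃ l ∈ W, d ∈ l ∨ d.rev ∈ l := by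
  obtain ⟨l, hl, he⟩ := hu
  obtain ⟨d', hd', he'⟩ := mem_edges.1 he
  rcases ok_same hd ((h.sw l hl).1 d' hd').1 he'.symm with rfl | rfl
  · exact ⟨l, hl, Or.inl hd'⟩
  · exact ⟨l, hl, Or.inr hd'⟩

end LC

namespace LC
open Classical
variable {V : Type u} {E : Type v}

lemma Ch.firstA {x y : V} {l : List (Dart V E)} {A : Set V} (hc : Ch x l y) (hx : x ∈ A) (hy : y ∉ A)
    (ht : ∀ d ∈ l, d.t ∉ A) : ∃ d l', l = d :: l' ∧ d.s ∈ A ∧ ∀ d' ∈ l', d'.s ∉ A := by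
  cases l with
  | nil => simp at hc; subst hc; exact absurd hx hy
  | cons d l =>
    refine ⟨d, l, rfl, by rw [hc.1]; exact hx, fun d' hd' => ?_⟩
    have := hc.2.mem_verts_s hd'
    simp only [List.mem_cons, List.mem_map] at this
    rcases this with h | ⟨a, ha, h⟩
    · rw [h]; exact ht d (by simp)
    · rw [← h]; exact ht a (by simp [ha])

lemma Ch.t_mem {x y : V} {l : List (Dart V E)} {X : Set V} (hc : Ch x l y) (hs : ∀ d ∈ l, d.s ∈ X)
    (hy : y ∈ X) : ∀ d ∈ l, d.t ∈ X := by
  induction l generalizing x with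
  | nil => simp
  | cons a l ih =>
    have h := ih hc.2 (fun d hd => hs d (by simp [hd]))
    intro d hd
    rcases List.mem_cons.1 hd with rfl | hd
    · cases l with
      | nil => have := hc.2; simp at this; rw [this]; exact hy
      | cons b l => have := hc.2.1; rw [← this]; exact hs b (by simp)
    · exact h d hd

lemma Ch.s_mem {x y : V} {l : List (Dart V E)} {X : Set V} (hc : Ch x l y) (hs : ∀ d ∈ l, d.t ∈ X)
    (hx : x ∈ X) : ∀ d ∈ l, d.s ∈ X := by
  intro d hd
  have := hc.mem_verts_s hd
  simp only [List.mem_cons, List.mem_map] at this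
  rcases this with h | ⟨a, ha, h⟩
  · rw [h]; exact hx
  · rw [← h]; exact hs a ha

/-- composition of systems -/
lemma Sys.comp {G : MG V E} {A X Y : Set V} (hAX : A ⊆ X) (hXY : X ⊆ Y) {W Q} (hW : Sys G A X W)
    (hQ : Sys G X Y Q) : ∃ U, Sys G A Y U ∧ used U ⊆ used W ∪ used Q ∧
      ((∀ e ∈ G.cut X, e ∈ used W → e ∈ used Q) → ∀ e ∈ G.cut A, e ∈ used W → e ∈ used U) ∧
      ((∀ e ∈ G.cut X, e ∈ used Q → e ∈ used W) → ∀ e ∈ G.cut Y, e ∈ used Q → e ∈ used U) := by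
  let ι := {p : List (Dart V E) × List (Dart V E) // p.1 ∈ W ∧ p.2 ∈ Q ∧
    ∃ l' m' d, p.1 = l' ++ [d] ∧ p.2 = d :: m'}
  have key : ∀ l ∈ W, ∀ m ∈ Q, ∀ e ∈ G.cut X, e ∈ edges l → e ∈ edges m →
      ∃ l' m' d, l = l' ++ [d] ∧ m = d :: m' := by
    intro l hl m hm e he hel hem
    obtain ⟨d, hd, rfl, ht⟩ := (hW.sw l hl).dartX hel he
    obtain ⟨d', hd', hde, hs⟩ := (hQ.sw m hm).dartA hem he
    have : d' = d := by
      rcases ok_same ((hW.sw l hl).1 d hd).1 ((hQ.sw m hm).1 d' hd').1 hde.symm with h | h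
      · exact h
      · rw [h] at hs; exact absurd hs ht
    subst this
    obtain ⟨d1, l', rfl, h1, h2⟩ := (hW.sw l hl).snoc hAX
    obtain ⟨d2, m', rfl, h3, h4⟩ := (hQ.sw m hm).cons hXY
    have e1 : d' = d1 := by
      rcases List.mem_append.1 hd with h | h
      · exact absurd (h2 d' h) ht
      · simpa using h
    have e2 : d' = d2 := by
      rcases List.mem_cons.1 hd' with h | h
      · exact h
      · exact absurd hs (h4 d' h)
    exact ⟨l', m', d', by rw [e1], by rw [e2]⟩
  let f : ι → List (Dart V E) := fun p => p.1.1 ++ p.1.2.tail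
  have tl : ∀ m ∈ Q, ∀ d ∈ m.tail, d.s ∉ X ∧ d.t ∉ X ∧ d.s ∈ Y ∧ G.ok d := by
    intro m hm d hd
    obtain ⟨d2, m', rfl, h3, h4⟩ := (hQ.sw m hm).cons hXY
    have := (hQ.sw _ hm).1 d (by simp at hd; simp [hd])
    exact ⟨h4 d (by simpa using hd), this.2.2, this.2.1, this.1⟩
  have hf : ∀ i, IsSW G A Y (f i) := by
    rintro ⟨⟨l, m⟩, hl, hm, l', m', d, h1, h2⟩
    simp only at hl hm h1 h2
    have hl1 := hW.sw l hl
    have hm1 := hQ.sw m hm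
    refine ⟨fun d' hd' => ?_, ?_⟩
    · rcases List.mem_append.1 hd' with h | h
      · exact ⟨(hl1.1 d' h).1, hXY (hl1.1 d' h).2.1, (hl1.1 d' h).2.2⟩
      · obtain ⟨a1, a2, a3, a4⟩ := tl m hm d' h
        exact ⟨a4, a3, fun h => a2 (hAX h)⟩
    · obtain ⟨_, x, hx, y, hy, hc⟩ := hl1
      obtain ⟨_, x', hx', y', hy', hc'⟩ := hm1
      refine ⟨x, hx, y', hy', ?_⟩
      simp only [f]
      rw [h1] at hc; rw [h2] at hc'
      rw [h1, h2]
      obtain ⟨z, c1, c2⟩ := Ch_append.1 hc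
      exact (c1.append (m := [d]) ⟨c2.1, rfl⟩).append hc'.2
  have cross : ∀ l ∈ W, ∀ m ∈ Q, ∀ e ∈ edges l, e ∈ edges m.tail → False := by
    intro l hl m hm e he he'
    obtain ⟨d, hd, rfl⟩ := mem_edges.1 he
    obtain ⟨d', hd', hde⟩ := mem_edges.1 he'
    obtain ⟨a1, a2, a3, a4⟩ := tl m hm d' hd'
    have b := (hW.sw l hl).1 d hd
    rcases ok_same b.1 a4 hde.symm with rfl | rfl
    · exact a1 b.2.1
    · exact a2 b.2.1
  have hdj : ∀ i j e, e ∈ edges (f i) → e ∈ edges (f j) → i = j := by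
    rintro ⟨⟨l, m⟩, hl, hm, l1, m1, d, h1, h2⟩ ⟨⟨l', m'⟩, hl', hm', l1', m1', d', h1', h2'⟩ e he he'
    change l ∈ W at hl; change m ∈ Q at hm; change l' ∈ W at hl'; change m' ∈ Q at hm'
    change l = _ at h1; change m = _ at h2; change l' = _ at h1'; change m' = _ at h2'
    simp only [f, edges_append, List.mem_append] at he he'
    rcases he with he | he
    · rcases he' with he' | he'
      · have := hW.disj l hl l' hl' e he he'
        subst this
        have : d = d' := by
          have := h1.symm.trans h1'
          exact (List.append_inj' this rfl).2 |> fun h => by simpa using h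
        subst this
        have := hQ.disj m hm m' hm' d.e (by rw [h2]; simp) (by rw [h2']; simp)
        subst this; rfl
      · exact (cross l hl m' hm' e he he').elim
    · rcases he' with he' | he'
      · exact (cross l' hl' m hm e he' he).elim
      · have := hQ.disj m hm m' hm' e (edges_sub (List.tail_subset _) he) (edges_sub (List.tail_subset _) he')
        subst this
        have : d = d' := by
          have := h2.symm.trans h2'
          simp at this; exact this.1
        subst this
        have := hW.disj l hl l' hl' d.e (by rw [h1]; simp) (by rw [h1']; simp)
        subst this; rfl
  obtain ⟨U, hU, hU1, hU2, hU3⟩ := mkSys (hAX.trans hXY) f hf hdj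
  refine ⟨U, hU, ?_, ?_, ?_⟩
  · rintro e ⟨l, hl, he⟩
    obtain ⟨⟨⟨a, b⟩, ha, hb, _⟩, hi⟩ := hU3 l hl
    have := edges_sub hi he
    simp only [f, edges_append, List.mem_append] at this
    rcases this with h | h
    · exact Or.inl ⟨a, ha, h⟩
    · exact Or.inr ⟨b, hb, edges_sub (List.tail_subset _) h⟩
  · rintro h e he ⟨l, hl, hel⟩
    refine hU1 e ?_ he
    obtain ⟨d, l', hl', h1, h2⟩ := (hW.sw l hl).snoc hAX
    have hdl : d ∈ l := by rw [hl']; simp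
    obtain ⟨m, hm, hem⟩ := h d.e ((hW.sw l hl).edgeX hdl h1) ⟨l, hl, mem_edges_of hdl⟩
    refine ⟨⟨⟨l, m⟩, hl, hm, key l hl m hm _ ((hW.sw l hl).edgeX hdl h1) (mem_edges_of hdl) hem⟩, ?_⟩
    simp only [f, edges_append, List.mem_append]; exact Or.inl hel
  · rintro h e he ⟨m, hm, hem⟩
    refine hU2 e ?_ he
    obtain ⟨d, m', hm', h1, h2⟩ := (hQ.sw m hm).cons hXY
    have hdm : d ∈ m := by rw [hm']; simp
    obtain ⟨l, hl, hel⟩ := h d.e ((hQ.sw m hm).edgeA hdm h1) ⟨m, hm, mem_edges_of hdm⟩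
    have hk := key l hl m hm _ ((hQ.sw m hm).edgeA hdm h1) hel (mem_edges_of hdm)
    refine ⟨⟨⟨l, m⟩, hl, hm, hk⟩, ?_⟩
    obtain ⟨l1, m1, d1, h3, h4⟩ := hk
    simp only [f, edges_append, List.mem_append]
    rw [h4] at hem ⊢; rw [h3]
    simp only [edges_cons, List.mem_cons] at hem
    rcases hem with rfl | hem
    · left; simp
    · right; simpa using hem

/-- partial walk from A inside X to v -/
def PW (G : MG V E) (A X : Set V) (p : List (Dart V E)) (v : V) : Prop :=
  (∀ d ∈ p, G.ok d ∧ d.s ∈ X ∧ d.t ∈ X ∧ d.t ∉ A) ∧ v ∉ A ∧ ∃ x ∈ A, Ch x p v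

/-- residual darts -/
def RD (G : MG V E) (A X : Set V) (W : Set (List (Dart V E))) (d : Dart V E) : Prop :=
  G.ok d ∧ (d.s ∈ X ∧ d.s ∉ A) ∧ (d.t ∈ X ∧ d.t ∉ A) ∧ (d.e ∉ used W ∨ ∃ l ∈ W, d.rev ∈ l)

lemma PW.initial_cutA {G : MG V E} {A X : Set V} {p1 p2 : List (Dart V E)} {v w : V}
    (h : PW G A X (p1 ++ p2) v) (h1 : PW G A X p1 w) {e} (he : e ∈ G.cut A) :
    e ∈ edges (p1 ++ p2) ↔ e ∈ edges p1 := by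
  constructor
  · intro hm
    obtain ⟨d, hd, rfl⟩ := mem_edges.1 hm
    have hs : d.s ∈ A := by
      have := (h.1 d hd).1.mem_cut.1 he; have := (h.1 d hd).2.2.2; tauto
    obtain ⟨hall, hv, x, hx, hc⟩ := h
    obtain ⟨_, hw, x', hx', hc'⟩ := h1
    cases p1 with
    | nil => simp at hc'; rw [hc'] at hx'; exact absurd hx' hw
    | cons a p1 =>
      obtain ⟨a', l', h3, h4, h5⟩ := hc.firstA hx hv (fun d hd => (hall d hd).2.2.2)
      simp only [List.cons_append, List.cons.injEq] at h3
      simp only [List.cons_append, List.mem_cons] at hd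
      rcases hd with rfl | hd
      · simp
      · rw [h3.2] at hd; exact absurd hs (h5 d hd)
  · intro h; simp [h]

lemma fact1_aux {G : MG V E} {A X : Set V} (hAX : A ⊆ X) (n : ℕ) : ∀ W p u c v, Sys G A X W →
    PW G A X p u → (edges p).Nodup → (∀ e ∈ edges p, e ∉ used W) → Ch u c v →
    (∀ d ∈ c, RD G A X W d) → c.length ≤ n →
    ∃ W' p', Sys G A X W' ∧ PW G A X p' v ∧ (edges p').Nodup ∧ (∀ e ∈ edges p', e ∉ used W') ∧
      (∀ e ∈ G.cut A, (e ∈ used W' ∨ e ∈ edges p') ↔ (e ∈ used W ∨ e ∈ edges p)) ∧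
      (∀ e ∈ G.cut X, e ∈ used W' ↔ e ∈ used W) := by
  induction n with
  | zero =>
    intro W p u c v hW hp hn hd hc hr hl
    have : c = [] := by simpa using hl
    subst this
    simp at hc; subst hc
    exact ⟨W, p, hW, hp, hn, hd, by simp, by simp⟩
  | succ n ih =>
    intro W p0 u0 c0 v hW hp0 hn0 hd0 hc0 hr0 hl0
    -- truncate
    obtain ⟨p, u, c, hp, hpre, hc, hcs, hcp⟩ : ∃ p u c, PW G A X p u ∧ p <+: p0 ∧ Ch u c v ∧
        c <:+ c0 ∧ ∀ d ∈ c, ∀ d' ∈ p, d.t ≠ d'.t := by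
      obtain ⟨hp1, hu, x, hx, hpc⟩ := hp0
      have hu0 : ∃ d ∈ p0, d.t = u0 := by
        have := hpc.end_mem
        simp only [List.mem_cons, List.mem_map] at this
        rcases this with h | h
        · rw [h] at hu; exact absurd hx hu
        · exact h
      obtain ⟨c1, c2, z, rfl, h1, h2, h3, h4⟩ := hc0.last_exit (X := {z | ∃ d ∈ p0, d.t = z}) (Or.inl hu0)
      obtain ⟨d, hd, rfl⟩ := h3
      obtain ⟨p1, p2, rfl, h5, h6⟩ := hpc.mem_split hd
      refine ⟨p1 ++ [d], d.t, c2, ⟨?_, (hp1 d hd).2.2.2, x, hx, h5.append (by simp)⟩, ?_, h2, ?_, ?_⟩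
      · intro d' hd'; exact hp1 d' (by simp at hd' ⊢; tauto)
      · simp
      · simp
      · intro a ha b hb h
        exact h4 a ha ⟨b, by simp at hb ⊢; tauto, h.symm⟩
    have hn : (edges p).Nodup := hn0.sublist (hpre.sublist.map _)
    have hd : ∀ e ∈ edges p, e ∉ used W := fun e he => hd0 e (edges_sub hpre.subset he)
    have hr : ∀ d ∈ c, RD G A X W d := fun d hd => hr0 d (hcs.subset hd)
    have hl : c.length ≤ n + 1 := hcs.length_le.trans hl0
    obtain ⟨p2, rfl⟩ := hpre
    have hcA : ∀ e ∈ G.cut A, e ∈ edges (p ++ p2) ↔ e ∈ edges p := fun e he => hp0.initial_cutA hp he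
    suffices h : ∃ W' p', Sys G A X W' ∧ PW G A X p' v ∧ (edges p').Nodup ∧ (∀ e ∈ edges p', e ∉ used W') ∧
      (∀ e ∈ G.cut A, (e ∈ used W' ∨ e ∈ edges p') ↔ (e ∈ used W ∨ e ∈ edges p)) ∧
      (∀ e ∈ G.cut X, e ∈ used W' ↔ e ∈ used W) by
      obtain ⟨W', p', a1, a2, a3, a4, a5, a6⟩ := h
      exact ⟨W', p', a1, a2, a3, a4, fun e he => by rw [a5 e he, hcA e he], a6⟩
    clear hcA hd0 hn0 hp0 hc0 hr0 hl0 hcs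
    cases c with
    | nil =>
      simp at hc; subst hc
      exact ⟨W, p, hW, hp, hn, hd, by simp, by simp⟩
    | cons d c =>
      obtain ⟨rfl, hc2⟩ := hc
      have hrd := hr d (by simp)
      have notp : ∀ d' ∈ d :: c, d'.e ∉ edges p := by
        intro d' hd' hm
        obtain ⟨b, hb, hbe⟩ := mem_edges.1 hm
        obtain ⟨h1, h2, x, hx, hch⟩ := hp
        rcases ok_same (hr d' hd').1 (h1 b hb).1 hbe.symm with rfl | rfl
        · exact hcp b hd' b hb rfl
        · have := hch.mem_verts_s hb
          simp only [List.mem_cons, List.mem_map] at this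
          rcases this with h | ⟨a, ha, h⟩
          · simp at h; rw [← h] at hx; exact (hr d' hd').2.2.1.2 hx
          · exact hcp d' hd' a ha (by simpa using h.symm)
      by_cases hu : d.e ∈ used W
      · -- reversal
        have hrev : ∃ l ∈ W, d.rev ∈ l := by
          rcases hrd.2.2.2 with h | h
          · exact absurd hu h
          · exact h
        obtain ⟨Q, hQ, hdQ⟩ := hrev
        have hQsw := hW.sw Q hQ
        obtain ⟨_, x, hx, y, hy, hQc⟩ := hQsw
        obtain ⟨Q1, Q2, hQe, hc1, hc3⟩ := hQc.mem_split hdQ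
        simp only [Dart.rev_s, Dart.rev_t] at hc1 hc3
        have hQn := hW.nodup Q hQ
        rw [hQe, edges_append, edges_cons, List.nodup_append] at hQn
        simp only [Dart.rev_e, List.nodup_cons, List.mem_cons] at hQn
        obtain ⟨n1, ⟨n2, n3⟩, n4⟩ := hQn
        have hQ1 : ∀ d' ∈ Q1, d' ∈ Q := fun d' h => by rw [hQe]; simp [h]
        have hQ2 : ∀ d' ∈ Q2, d' ∈ Q := fun d' h => by rw [hQe]; simp [h]
        have eQ1 : ∀ e ∈ edges Q1, e ∈ edges Q := edges_sub hQ1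
        have eQ2 : ∀ e ∈ edges Q2, e ∈ edges Q := edges_sub hQ2
        have eQ : ∀ e, e ∈ edges Q ↔ e ∈ edges Q1 ∨ e = d.e ∨ e ∈ edges Q2 := by
          intro e; rw [hQe]; simp
        obtain ⟨hp1, hp2, xp, hxp, hpc⟩ := hp
        set W1 : Set (List (Dart V E)) := (W \ {Q}) ∪ {p ++ Q2} with hW1
        have hpQ2 : ∀ l ∈ W, l ≠ Q → ∀ e, e ∈ edges l → e ∈ edges (p ++ Q2) → False := by
          intro l hl hlQ e he he'
          simp only [edges_append, List.mem_append] at he'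
          rcases he' with h | h
          · exact hd e h ⟨l, hl, he⟩
          · exact hlQ (hW.disj l hl Q hQ e he (eQ2 e h))
        have hW1s : Sys G A X W1 := by
          refine ⟨?_, ?_, ?_⟩
          · rintro l (⟨hl, _⟩ | rfl)
            · exact hW.sw l hl
            · refine ⟨?_, xp, hxp, y, hy, hpc.append hc3⟩
              intro b hb
              rcases List.mem_append.1 hb with h | h
              · exact ⟨(hp1 b h).1, (hp1 b h).2.1, (hp1 b h).2.2.2⟩
              · exact (hW.sw Q hQ).1 b (hQ2 b h)
          · rintro l (⟨hl, _⟩ | rfl)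
            · exact hW.nodup l hl
            · rw [edges_append, List.nodup_append]
              refine ⟨hn, n3, fun a ha b hb hab => ?_⟩
              subst hab
              exact hd a ha ⟨Q, hQ, eQ2 a hb⟩
          · rintro l (⟨hl, hlQ⟩ | rfl) l' (⟨hl', hlQ'⟩ | rfl) e he he'
            · exact hW.disj l hl l' hl' e he he'
            · exact (hpQ2 l hl hlQ e he he').elim
            · exact (hpQ2 l' hl' hlQ' e he' he).elim
            · rfl
        have hus : ∀ e, e ∈ used W1 ↔ (∃ l ∈ W, l ≠ Q ∧ e ∈ edges l) ∨ e ∈ edges p ∨ e ∈ edges Q2 := by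
          intro e
          constructor
          · rintro ⟨l, (⟨hl, hlQ⟩ | rfl), he⟩
            · exact Or.inl ⟨l, hl, hlQ, he⟩
            · simp only [edges_append, List.mem_append] at he; exact Or.inr he
          · rintro (⟨l, hl, hlQ, he⟩ | h)
            · exact ⟨l, Or.inl ⟨hl, hlQ⟩, he⟩
            · exact ⟨_, Or.inr rfl, by simpa using h⟩
        have husW : ∀ e, e ∈ used W ↔ (∃ l ∈ W, l ≠ Q ∧ e ∈ edges l) ∨ e ∈ edges Q := by
          intro e
          constructor
          · rintro ⟨l, hl, he⟩
            by_cases h : l = Q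
            · subst h; exact Or.inr he
            · exact Or.inl ⟨l, hl, h, he⟩
          · rintro (⟨l, hl, _, he⟩ | h)
            · exact ⟨l, hl, he⟩
            · exact ⟨Q, hQ, h⟩
        have hdA : d.e ∉ G.cut A := by rw [hrd.1.mem_cut]; have := hrd.2; tauto
        have hdX : d.e ∉ G.cut X := by rw [hrd.1.mem_cut]; have := hrd.2; tauto
        have hPW1 : PW G A X Q1 d.t := by
          refine ⟨fun b hb => ?_, hrd.2.2.1.2, x, hx, hc1⟩
          have hb' := (hW.sw Q hQ).1 b (hQ1 b hb)
          exact ⟨hb'.1, hb'.2.1, hc1.t_mem (fun d' hd' => ((hW.sw Q hQ).1 d' (hQ1 d' hd')).2.1)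
            hrd.2.2.1.1 b hb, hb'.2.2⟩
        have hQ1u : ∀ e ∈ edges Q1, e ∉ used W1 := by
          intro e he hu
          rw [hus] at hu
          rcases hu with ⟨l, hl, hlQ, hel⟩ | h | h
          · exact hlQ (hW.disj l hl Q hQ e hel (eQ1 e he))
          · exact hd e h ⟨Q, hQ, eQ1 e he⟩
          · exact n4 e he e (Or.inr h) rfl
        obtain ⟨W', p', a1, a2, a3, a4, a5, a6⟩ := ih W1 Q1 d.t c v hW1s hPW1 n1 hQ1u hc2 (by
          intro d' hd'
          have h0 := hr d' (by simp [hd'])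
          refine ⟨h0.1, h0.2.1, h0.2.2.1, ?_⟩
          by_cases hx : d'.e ∈ used W1
          swap
          · exact Or.inl hx
          right
          rw [hus] at hx
          rcases hx with ⟨l, hl, hlQ, he⟩ | h | h
          · rcases h0.2.2.2 with h | ⟨l', hl', hr'⟩
            · exact absurd ⟨l, hl, he⟩ h
            · have : l' = l := hW.disj l' hl' l hl d'.e (mem_edges_of (d := d'.rev) hr') he
              subst this
              exact ⟨l', Or.inl ⟨hl, hlQ⟩, hr'⟩
          · exact absurd h (notp d' (by simp [hd']))
          · rcases h0.2.2.2 with h' | ⟨l', hl', hr'⟩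
            · exact absurd ⟨Q, hQ, eQ2 _ h⟩ h'
            · have : l' = Q := hW.disj l' hl' Q hQ d'.e (mem_edges_of (d := d'.rev) hr') (eQ2 _ h)
              subst this
              obtain ⟨b, hb, hbe⟩ := mem_edges.1 h
              have : b = d'.rev := dart_eq_of_edge (hW.nodup _ hl') (hQ2 b hb) hr' hbe
              subst this
              exact ⟨_, Or.inr rfl, by simp [hb]⟩) (by simp at hl; omega)
        refine ⟨W', p', a1, a2, a3, a4, fun e he => ?_, fun e he => ?_⟩
        · rw [a5 e he, hus, husW, eQ]
          have : e ≠ d.e := fun h => hdA (h ▸ he)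
          generalize (∃ l ∈ W, l ≠ Q ∧ e ∈ edges l) = P
          clear * - this; tauto
        · rw [a6 e he, hus, husW, eQ]
          have h1 : e ≠ d.e := fun h => hdX (h ▸ he)
          have h2 : e ∉ edges p := by
            intro h
            obtain ⟨b, hb, rfl⟩ := mem_edges.1 h
            have := (hp1 b hb).1.mem_cut.1 he
            have := hp1 b hb; tauto
          have h3 : e ∉ edges Q1 := by
            intro h
            obtain ⟨b, hb, rfl⟩ := mem_edges.1 h
            have := (hPW1.1 b hb).1.mem_cut.1 he
            have := hPW1.1 b hb; tauto
          generalize (∃ l ∈ W, l ≠ Q ∧ e ∈ edges l) = P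
          clear * - h1 h2 h3; tauto
      · -- forward
        obtain ⟨hp1, hp2, xp, hxp, hpc⟩ := hp
        have hPW1 : PW G A X (p ++ [d]) d.t := by
          refine ⟨fun b hb => ?_, hrd.2.2.1.2, xp, hxp, hpc.append (by simp)⟩
          rcases List.mem_append.1 hb with h | h
          · exact hp1 b h
          · simp at h; subst h; exact ⟨hrd.1, hrd.2.1.1, hrd.2.2.1.1, hrd.2.2.1.2⟩
        obtain ⟨W', p', a1, a2, a3, a4, a5, a6⟩ := ih W (p ++ [d]) d.t c v hW hPW1
          (by
            rw [edges_append, List.nodup_append]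
            refine ⟨hn, by simp, fun a ha b hb hab => ?_⟩
            simp at hb; subst hab; subst hb; exact notp d (by simp) ha)
          (by
            intro e he
            simp only [edges_append, List.mem_append, edges_cons, edges_nil, List.mem_singleton] at he
            rcases he with h | rfl
            · exact hd e h
            · exact hu) hc2 (fun d' hd' => hr d' (by simp [hd'])) (by simp at hl; omega)
        refine ⟨W', p', a1, a2, a3, a4, fun e he => ?_, a6⟩
        rw [a5 e he, hPW1.initial_cutA ⟨hp1, hp2, xp, hxp, hpc⟩ he]

/-- vertices residually reachable from a missing start -/
def Reach (G : MG V E) (A X : Set V) (W : Set (List (Dart V E))) : Set V :=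
  {v | ∃ d c, G.ok d ∧ d.s ∈ A ∧ d.t ∈ X ∧ d.t ∉ A ∧ d.e ∉ used W ∧ Ch d.t c v ∧ ∀ b ∈ c, RD G A X W b}

lemma reach_sub {G : MG V E} {A X : Set V} {W} {v} (h : v ∈ Reach G A X W) : v ∈ X ∧ v ∉ A := by
  obtain ⟨d, c, h1, h2, h3, h4, h5, h6, h7⟩ := h
  have := h6.end_mem
  simp only [List.mem_cons, List.mem_map] at this
  rcases this with rfl | ⟨a, ha, rfl⟩
  · exact ⟨h3, h4⟩
  · exact (h7 a ha).2.2.1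

lemma reach_step {G : MG V E} {A X : Set V} {W} {b} (h : b.s ∈ Reach G A X W) (hb : RD G A X W b) :
    b.t ∈ Reach G A X W := by
  obtain ⟨d, c, h1, h2, h3, h4, h5, h6, h7⟩ := h
  refine ⟨d, c ++ [b], h1, h2, h3, h4, h5, h6.append (by simp), fun a ha => ?_⟩
  rcases List.mem_append.1 ha with h | h
  · exact h7 a h
  · simp at h; subst h; exact hb

lemma fact1 {G : MG V E} {A X : Set V} (hAX : A ⊆ X) {W} (hW : Sys G A X W) {v}
    (hv : v ∈ Reach G A X W) : ∃ W' p' a, Sys G A X W' ∧ PW G A X p' v ∧ (edges p').Nodup ∧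
      (∀ e ∈ edges p', e ∉ used W') ∧ a ∈ G.cut A ∧ a ∉ used W ∧
      (∀ e ∈ G.cut A, (e ∈ used W' ∨ e ∈ edges p') ↔ (e ∈ used W ∨ e = a)) ∧
      (∀ e ∈ G.cut X, e ∈ used W' ↔ e ∈ used W) := by
  obtain ⟨d, c, h1, h2, h3, h4, h5, h6, h7⟩ := hv
  obtain ⟨W', p', a1, a2, a3, a4, a5, a6⟩ := fact1_aux hAX c.length W [d] d.t c v hW
    ⟨by simpa using ⟨h1, hAX h2, h3, h4⟩, h4, d.s, h2, by simp⟩ (by simp) (by simpa using h5) h6 h7 le_rfl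
  exact ⟨W', p', d.e, a1, a2, a3, a4, h1.mem_cut.2 (Or.inl ⟨h2, h4⟩), h5, by simpa using a5, a6⟩

/-- the reach region is a wave -/
lemma fact2 {G : MG V E} {A X : Set V} (hAX : A ⊆ X) {W} (hW : Sys G A X W)
    (hfull : ∀ d, G.ok d → d.s ∈ A ∪ Reach G A X W → d.t ∉ X → d.e ∈ used W) :
    Sys G A (A ∪ Reach G A X W) (trunc (A ∪ Reach G A X W) '' W) ∧
    G.cut (A ∪ Reach G A X W) ⊆ used (trunc (A ∪ Reach G A X W) '' W) ∧
    (∀ e ∈ G.cut A, e ∈ used (trunc (A ∪ Reach G A X W) '' W) ↔ e ∈ used W) := by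
  set R := A ∪ Reach G A X W with hR
  have hAR : A ⊆ R := Set.subset_union_left
  have hRX : R ⊆ X := Set.union_subset hAX (fun v hv => (reach_sub hv).1)
  obtain ⟨h1, h2⟩ := hW.trunc hAR hRX
  have back : ∀ l ∈ W, ∀ d ∈ l, d.t ∈ R → d.s ∈ R := by
    intro l hl d hd ht
    have hsw := (hW.sw l hl).1 d hd
    rcases ht with h | h
    · exact absurd h hsw.2.2
    · by_cases hs : d.s ∈ A
      · exact Or.inl hs
      · right
        exact reach_step (b := d.rev) h ⟨hsw.1.rev, ⟨(reach_sub h).1, hsw.2.2⟩, ⟨hsw.2.1, hs⟩, Or.inr ⟨l, hl, by simpa⟩⟩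
  have backall : ∀ (l1 : List (Dart V E)) (x z : V), Ch x l1 z → (∃ l ∈ W, l1 ⊆ l) → z ∈ R →
      ∀ d ∈ l1, d.t ∈ R := by
    intro l1
    induction l1 using List.reverseRecOn with
    | nil => simp
    | append_singleton l1 b ih =>
      rintro x z hc ⟨l, hl, hs⟩ hz d hd
      obtain ⟨w, c1, c2⟩ := Ch_append.1 hc
      simp at c2
      have hb : b.t ∈ R := by rw [c2.2]; exact hz
      rcases List.mem_append.1 hd with h | h
      · refine ih x w c1 ⟨l, hl, fun a ha => hs (by simp [ha])⟩ ?_ d h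
        rw [← c2.1]; exact back l hl b (hs (by simp)) hb
      · simp at h; rw [h]; exact hb
  have usedtr : ∀ l ∈ W, ∀ d ∈ l, d.s ∈ R → d.t ∉ R → d.e ∈ used (trunc R '' W) := by
    intro l hl d hd hs ht
    obtain ⟨_, x, hx, y, hy, hc⟩ := hW.sw l hl
    obtain ⟨l1, l2, hle, c1, c2⟩ := hc.mem_split hd
    refine ⟨_, ⟨l, hl, rfl⟩, ?_⟩
    rw [hle, trunc_eq (backall l1 x _ c1 ⟨l, hl, by rw [hle]; simp⟩ hs) ht]
    simp
  refine ⟨h1, ?_, fun e he => ⟨fun h => used_trunc h, fun h => h2 e h he⟩⟩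
  rintro e ⟨d, hd, rfl, hs, ht⟩
  by_cases htX : d.t ∈ X
  swap
  · have hu := hfull d hd hs htX
    obtain ⟨l, hl, h | h⟩ := hW.dart hd hu
    · exact usedtr l hl d h hs ht
    · exact absurd ((hW.sw l hl).1 _ h).2.1 htX
  have htA : d.t ∉ A := fun h => ht (hAR h)
  by_cases hu : d.e ∈ used W
  · obtain ⟨l, hl, h | h⟩ := hW.dart hd hu
    · exact usedtr l hl d h hs ht
    · have hsA := ((hW.sw l hl).1 _ h).2.2
      simp at hsA
      rcases hs with hs | hs
      · exact absurd hs hsA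
      · exact absurd (Or.inr (reach_step hs ⟨hd, (reach_sub hs), ⟨htX, htA⟩, Or.inr ⟨l, hl, h⟩⟩)) ht
  · rcases hs with hs | hs
    · exact absurd (Or.inr ⟨d, [], hd, hs, htX, htA, hu, by simp, by simp⟩) ht
    · exact absurd (Or.inr (reach_step hs ⟨hd, (reach_sub hs), ⟨htX, htA⟩, Or.inl hu⟩)) ht

/-- augmentation -/
lemma augment {G : MG V E} {A X : Set V} (hAX : A ⊆ X) {W} (hW : Sys G A X W) {d}
    (hd : G.ok d) (hs : d.s ∈ A ∪ Reach G A X W) (ht : d.t ∉ X) (hu : d.e ∉ used W) :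
    ∃ W' a, Sys G A X W' ∧ a ∈ G.cut A ∧ a ∉ used W ∧
      (∀ e ∈ G.cut A, e ∈ used W' ↔ (e ∈ used W ∨ e = a)) ∧
      (∀ e ∈ G.cut X, e ∈ used W' ↔ (e ∈ used W ∨ e = d.e)) := by
  have add : ∀ W1 q, Sys G A X W1 → IsSW G A X q → (edges q).Nodup → (∀ e ∈ edges q, e ∉ used W1) →
      Sys G A X (W1 ∪ {q}) ∧ ∀ e, e ∈ used (W1 ∪ {q}) ↔ e ∈ used W1 ∨ e ∈ edges q := by
    intro W1 q h1 h2 h3 h4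
    refine ⟨⟨?_, ?_, ?_⟩, fun e => ⟨?_, ?_⟩⟩
    · rintro l (hl | rfl); exacts [h1.sw l hl, h2]
    · rintro l (hl | rfl); exacts [h1.nodup l hl, h3]
    · rintro l (hl | rfl) l' (hl' | rfl) e he he'
      · exact h1.disj l hl l' hl' e he he'
      · exact absurd ⟨l, hl, he⟩ (h4 e he')
      · exact absurd ⟨l', hl', he'⟩ (h4 e he)
      · rfl
    · rintro ⟨l, (hl | rfl), he⟩
      exacts [Or.inl ⟨l, hl, he⟩, Or.inr he]
    · rintro (⟨l, hl, he⟩ | he)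
      exacts [⟨l, Or.inl hl, he⟩, ⟨q, Or.inr rfl, he⟩]
  rcases hs with hs | hs
  · have htA : d.t ∉ A := fun h => ht (hAX h)
    obtain ⟨b1, b2⟩ := add W [d] hW ⟨by simpa using ⟨hd, hAX hs, htA⟩, d.s, hs, d.t, ht, by simp⟩ (by simp)
      (by simpa using hu)
    exact ⟨_, d.e, b1, hd.mem_cut.2 (Or.inl ⟨hs, htA⟩), hu, fun e _ => by rw [b2]; simp, fun e _ => by rw [b2]; simp⟩
  · obtain ⟨W', p, a, a1, a2, a3, a4, a5, a6, a7, a8⟩ := fact1 hAX hW hs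
    have hsX := reach_sub hs
    have hdX : d.e ∈ G.cut X := hd.mem_cut.2 (Or.inl ⟨hsX.1, ht⟩)
    have hpX : ∀ e ∈ G.cut X, e ∉ edges p := by
      intro e he h
      obtain ⟨b, hb, rfl⟩ := mem_edges.1 h
      have := (a2.1 b hb).1.mem_cut.1 he
      have := a2.1 b hb; tauto
    have hdA : d.e ∉ G.cut A := by
      rw [hd.mem_cut]; have : d.t ∉ A := fun h => ht (hAX h)
      tauto
    have htA : d.t ∉ A := fun h => ht (hAX h)
    obtain ⟨b1, b2⟩ := add W' (p ++ [d]) a1 (by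
        obtain ⟨c1, c2, x, hx, c3⟩ := a2
        refine ⟨fun b hb => ?_, x, hx, d.t, ht, c3.append (by simp)⟩
        rcases List.mem_append.1 hb with h | h
        · exact ⟨(c1 b h).1, (c1 b h).2.1, (c1 b h).2.2.2⟩
        · simp at h; subst h; exact ⟨hd, hsX.1, htA⟩)
      (by
        rw [edges_append, List.nodup_append]
        refine ⟨a3, by simp, fun a ha b hb hab => ?_⟩
        simp at hb; subst hab; subst hb; exact hpX _ hdX ha)
      (by
        intro e he
        simp only [edges_append, List.mem_append, edges_cons, edges_nil, List.mem_singleton] at he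
        rcases he with h | rfl
        · exact a4 e h
        · rw [a8 _ hdX]; exact hu)
    refine ⟨_, a, b1, a5, a6, fun e he => ?_, fun e he => ?_⟩
    · rw [b2, ← a7 e he]; simp
      have : e ≠ d.e := fun h => hdA (h ▸ he)
      tauto
    · rw [b2, a8 e he]; simp
      have := hpX e he
      tauto

end LC

namespace LC
open Classical
variable {V : Type u} {E : Type v}

lemma Sys.add {G : MG V E} {A X : Set V} {W1 q} (h1 : Sys G A X W1) (h2 : IsSW G A X q)
    (h3 : (edges q).Nodup) (h4 : ∀ e ∈ edges q, e ∉ used W1) :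
      Sys G A X (W1 ∪ {q}) ∧ ∀ e, e ∈ used (W1 ∪ {q}) ↔ e ∈ used W1 ∨ e ∈ edges q := by
  refine ⟨⟨?_, ?_, ?_⟩, fun e => ⟨?_, ?_⟩⟩
  · rintro l (hl | rfl); exacts [h1.sw l hl, h2]
  · rintro l (hl | rfl); exacts [h1.nodup l hl, h3]
  · rintro l (hl | rfl) l' (hl' | rfl) e he he'
    · exact h1.disj l hl l' hl' e he he'
    · exact absurd ⟨l, hl, he⟩ (h4 e he')
    · exact absurd ⟨l', hl', he'⟩ (h4 e he)
    · rfl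
  · rintro ⟨l, (hl | rfl), he⟩
    exacts [Or.inl ⟨l, hl, he⟩, Or.inr he]
  · rintro (⟨l, hl, he⟩ | he)
    exacts [⟨l, Or.inl hl, he⟩, ⟨q, Or.inr rfl, he⟩]

lemma par1 {G : MG V E} {S : Set V} {l : List (Dart V E)} {x y : V} (hc : Ch x l y)
    (hok : ∀ d ∈ l, G.ok d) :
    Even (l.countP (fun d => decide (d.e ∈ G.cut S))) ↔ (x ∈ S ↔ y ∈ S) := by
  induction l generalizing x with
  | nil => simp at hc; simp [hc]
  | cons a l ih =>
    have h1 := ih hc.2 (fun d hd => hok d (by simp [hd]))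
    have h2 := (hok a (by simp)).mem_cut (X := S)
    rw [hc.1] at h2
    by_cases h : a.e ∈ G.cut S
    · rw [List.countP_cons_of_pos (by simpa using h), Nat.even_add_one, h1]
      have := h2.1 h; tauto
    · rw [List.countP_cons_of_neg (by simpa using h), h1]
      have := mt h2.2 h; tauto

lemma par2 {l : List (Dart V E)} (hn : (edges l).Nodup) (F : Set E) :
    ({e | e ∈ edges l ∧ e ∈ F}).ncard = l.countP (fun d => decide (d.e ∈ F)) ∧
      ({e | e ∈ edges l ∧ e ∈ F}).Finite := by
  have hfin : ({e | e ∈ edges l ∧ e ∈ F}).Finite :=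
    (List.finite_toSet (edges l)).subset (fun e he => he.1)
  refine ⟨?_, hfin⟩
  induction l with
  | nil => simp
  | cons a l ih =>
    simp only [edges_cons, List.nodup_cons] at hn
    have hf : ({e | e ∈ edges l ∧ e ∈ F}).Finite :=
      (List.finite_toSet (edges l)).subset (fun e he => he.1)
    by_cases h : a.e ∈ F
    · rw [List.countP_cons_of_pos (by simpa using h), ← ih hn.2 hf]
      have : {e | e ∈ edges (a :: l) ∧ e ∈ F} = insert a.e {e | e ∈ edges l ∧ e ∈ F} := by
        ext e; simp only [edges_cons, List.mem_cons, Set.mem_setOf_eq, Set.mem_insert_iff]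
        constructor
        · rintro ⟨rfl | h1, h2⟩ <;> tauto
        · rintro (rfl | h1) <;> tauto
      rw [this, Set.ncard_insert_of_notMem (fun hh => hn.1 hh.1) hf]
    · rw [List.countP_cons_of_neg (by simpa using h), ← ih hn.2 hf]
      congr 1
      ext e; simp only [edges_cons, List.mem_cons, Set.mem_setOf_eq]
      constructor
      · rintro ⟨rfl | h1, h2⟩ <;> tauto
      · rintro ⟨h1, h2⟩; tauto

lemma par3 {Q : Set (List (Dart V E))} (hQ : Q.Finite) {F : Set E}
    (hd : ∀ l ∈ Q, ∀ l' ∈ Q, ∀ e, e ∈ edges l → e ∈ edges l' → l = l')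
    (hev : ∀ l ∈ Q, Even ({e | e ∈ edges l ∧ e ∈ F}).ncard) :
    ({e | e ∈ used Q ∧ e ∈ F}).Finite ∧ Even ({e | e ∈ used Q ∧ e ∈ F}).ncard := by
  induction Q, hQ using Set.Finite.induction_on with
  | empty => simp [used]
  | @insert l Q hl hf ih =>
    obtain ⟨h1, h2⟩ := ih (fun l hl l' hl' => hd l (by simp [hl]) l' (by simp [hl']))
      (fun l hl => hev l (by simp [hl]))
    have hfin : ({e | e ∈ edges l ∧ e ∈ F}).Finite :=
      (List.finite_toSet (edges l)).subset (fun e he => he.1)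
    have : {e | e ∈ used (insert l Q) ∧ e ∈ F} = {e | e ∈ edges l ∧ e ∈ F} ∪ {e | e ∈ used Q ∧ e ∈ F} := by
      ext e; simp [used]; tauto
    rw [this]
    refine ⟨hfin.union h1, ?_⟩
    rw [Set.ncard_union_eq ?_ hfin h1]
    · exact (hev l (by simp)).add h2
    · rw [Set.disjoint_left]
      rintro e ⟨ha, _⟩ ⟨⟨l', hl', hb⟩, _⟩
      have := hd l (by simp) l' (by simp [hl']) e ha hb
      subst this; exact hl hl'

lemma parityL {G : MG V E} {A Y : Set V} (hAY : A ⊆ Y) {Q} (hQ : Sys G A Y Q) (hfull : G.cut A ⊆ used Q)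
    {w : V} (hwY : w ∈ Y) (hwA : w ∉ A)
    (hpar : ∀ X ⊆ Y \ A, (G.cut X).Finite → (Even (G.cut X).ncard ↔ w ∉ X)) :
    ∃ p y, Ch w p y ∧ y ∉ Y ∧ (∀ d ∈ p, G.ok d ∧ d.s ∈ Y ∧ d.s ∉ A ∧ d.t ∉ A) ∧ (edges p).Nodup ∧
      Linked (G.del {e | e ∈ edges p}) A Y := by
  let HD : Dart V E → Prop := fun d => G.ok d ∧ d.e ∉ used Q ∧ (d.s ∈ Y ∧ d.s ∉ A) ∧ (d.t ∈ Y ∧ d.t ∉ A)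
  by_cases hsucc : ∃ c d, Ch w c d.s ∧ (∀ b ∈ c, HD b) ∧ G.ok d ∧ d.e ∉ used Q ∧ d.t ∉ Y
  · obtain ⟨c, d, h1, h2, h3, h4, h5⟩ := hsucc
    have hc : Ch w (c ++ [d]) d.t := h1.append (by simp)
    obtain ⟨p, hp1, hp2, hp3⟩ := hc.shorten
    have hds : d.s ∈ Y ∧ d.s ∉ A := by
      have := h1.end_mem
      simp only [List.mem_cons, List.mem_map] at this
      rcases this with h | ⟨a, ha, h⟩
      · rw [h]; exact ⟨hwY, hwA⟩
      · rw [← h]; exact (h2 a ha).2.2.2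
    have hall : ∀ b ∈ c ++ [d], G.ok b ∧ (b.s ∈ Y ∧ b.s ∉ A ∧ b.t ∉ A) ∧ b.e ∉ used Q := by
      intro b hb
      rcases List.mem_append.1 hb with h | h
      · have := h2 b h; exact ⟨this.1, ⟨this.2.2.1.1, this.2.2.1.2, this.2.2.2.2⟩, this.2.1⟩
      · simp at h; subst h; exact ⟨h3, ⟨hds.1, hds.2, fun h => h5 (hAY h)⟩, h4⟩
    refine ⟨p, d.t, hp1, h5, fun b hb => ⟨(hall b (hp2 hb)).1, (hall b (hp2 hb)).2.1⟩,
      hp1.edges_nodup (fun b hb => (hall b (hp2 hb)).1) hp3, Q, hQ.to_del ?_, ?_⟩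
    · intro e he hep
      obtain ⟨b, hb, rfl⟩ := mem_edges.1 hep
      exact (hall b (hp2 hb)).2.2 he
    · rw [cut_del]; exact Set.sdiff_subset.trans hfull
  -- infinite trail
  let Valid : List (Dart V E) → V → Prop := fun R v =>
    Ch w R v ∧ (∀ d ∈ R, HD d) ∧ (edges R).Nodup ∧ v ∈ Y ∧ v ∉ A
  have step : ∀ R v (B : List (List (Dart V E))), Valid R v → ∃ r c q h t, Ch v r c ∧ Valid (R ++ r) c ∧
      q ∈ Q ∧ q ∉ B ∧ q = h ++ t ∧ (∃ x ∈ A, Ch x h c) ∧ (∃ y ∉ Y, Ch c t y) := by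
    rintro R v B ⟨hR1, hR2, hR3, hvY, hvA⟩
    let S : Set V := {z | ∃ c, Ch v c z ∧ ∀ d ∈ c, HD d ∧ d.e ∉ edges R}
    have hSN : S ⊆ Y \ A := by
      rintro z ⟨c, h1, h2⟩
      have := h1.end_mem
      simp only [List.mem_cons, List.mem_map] at this
      rcases this with h | ⟨a, ha, h⟩
      · rw [h]; exact ⟨hvY, hvA⟩
      · rw [← h]; exact (h2 a ha).1.2.2.2
    have hvS : v ∈ S := ⟨[], by simp, by simp⟩
    let T : Set (List (Dart V E)) := {q ∈ Q | ∃ e ∈ edges q, e ∈ G.cut S}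
    have hinf : T.Infinite := by
      intro hT
      have hcut : G.cut S = {e | e ∈ edges R ∧ e ∈ G.cut S} ∪ {e | e ∈ used T ∧ e ∈ G.cut S} := by
        ext e
        constructor
        · intro he
          obtain ⟨d, h1, rfl, h2, h3⟩ := he
          have he : d.e ∈ G.cut S := ⟨d, h1, rfl, h2, h3⟩
          by_cases heR : d.e ∈ edges R
          · exact Or.inl ⟨heR, he⟩
          by_cases heQ : d.e ∈ used Q
          · obtain ⟨q, hq, hqe⟩ := heQ
            exact Or.inr ⟨⟨q, ⟨hq, d.e, hqe, he⟩, hqe⟩, he⟩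
          exfalso
          have hdA : d.t ∉ A := fun h => heQ (hfull (h1.mem_cut.2 (Or.inr ⟨(hSN h2).2, h⟩)))
          obtain ⟨c, hc1, hc2⟩ := h2
          by_cases hdY : d.t ∈ Y
          · refine h3 ⟨c ++ [d], hc1.append (by simp), fun b hb => ?_⟩
            rcases List.mem_append.1 hb with h | h
            · exact hc2 b h
            · simp at h; subst h
              have := hSN ⟨c, hc1, hc2⟩
              exact ⟨⟨h1, heQ, ⟨this.1, this.2⟩, ⟨hdY, hdA⟩⟩, heR⟩
          · refine hsucc ⟨R ++ c, d, hR1.append hc1, fun b hb => ?_, h1, heQ, hdY⟩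
            rcases List.mem_append.1 hb with h | h
            · exact hR2 b h
            · exact (hc2 b h).1
        · rintro (⟨_, h⟩ | ⟨_, h⟩) <;> exact h
      obtain ⟨f1, f2⟩ := par2 hR3 (G.cut S)
      obtain ⟨g1, g2⟩ := par3 (F := G.cut S) hT (fun l hl l' hl' => hQ.disj l hl.1 l' hl'.1) (by
        rintro l ⟨hl, _⟩
        rw [(par2 (hQ.nodup l hl) (G.cut S)).1]
        obtain ⟨h1, x, hx, y, hy, hc⟩ := hQ.sw l hl
        rw [par1 hc (fun d hd => (h1 d hd).1)]
        have a1 : x ∉ S := fun h => (hSN h).2 hx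
        have a2 : y ∉ S := fun h => hy (hSN h).1
        tauto)
      have hdis : Disjoint {e | e ∈ edges R ∧ e ∈ G.cut S} {e | e ∈ used T ∧ e ∈ G.cut S} := by
        rw [Set.disjoint_left]
        rintro e ⟨h1, _⟩ ⟨⟨q, hq, hqe⟩, _⟩
        obtain ⟨d, hd, rfl⟩ := mem_edges.1 h1
        exact (hR2 d hd).2.1 ⟨q, hq.1, hqe⟩
      have hfin : (G.cut S).Finite := by rw [hcut]; exact f2.union g1
      have hh := hpar S hSN hfin
      rw [hcut, Set.ncard_union_eq hdis f2 g1, Nat.even_add, f1, par1 hR1 (fun d hd => (hR2 d hd).1)] at hh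
      tauto
    obtain ⟨q, ⟨hqQ, e, hqe, hqc⟩, hqB⟩ := hinf.exists_notMem_finset B.toFinset
    simp only [List.mem_toFinset] at hqB
    obtain ⟨hq1, x, hx, y, hy, hqch⟩ := hQ.sw q hqQ
    obtain ⟨d, hd, rfl⟩ := mem_edges.1 hqe
    obtain ⟨h, t, hht, ch1, ch2⟩ := hqch.mem_split hd
    obtain ⟨c, hcS, h', t', e1, e2, e3⟩ : ∃ c ∈ S, ∃ h' t', q = h' ++ t' ∧ Ch x h' c ∧ Ch c t' y := by
      rcases (hq1 d hd).1.mem_cut.1 hqc with h0 | h0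
      · exact ⟨d.s, h0.1, h, d :: t, hht, ch1, rfl, ch2⟩
      · exact ⟨d.t, h0.2, h ++ [d], t, by simp [hht], ch1.append (by simp), ch2⟩
    have hcN := hSN hcS
    obtain ⟨r0, hr1, hr2⟩ := hcS
    obtain ⟨r, s1, s2, s3⟩ := hr1.shorten
    have hrn : (edges r).Nodup := s1.edges_nodup (fun b hb => (hr2 b (s2 hb)).1.1) s3
    refine ⟨r, c, q, h', t', s1, ⟨hR1.append s1, ?_, ?_, hcN.1, hcN.2⟩, hqQ, hqB, e1, ⟨x, hx, e2⟩, ⟨y, hy, e3⟩⟩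
    · intro b hb
      rcases List.mem_append.1 hb with h | h
      · exact hR2 b h
      · exact (hr2 b (s2 h)).1
    · rw [edges_append, List.nodup_append]
      refine ⟨hR3, hrn, fun a ha b hb hab => ?_⟩
      subst hab
      obtain ⟨b', hb', rfl⟩ := mem_edges.1 hb
      exact (hr2 b' (s2 hb')).2 ha
  let σ := {s : List (Dart V E) × V × List (List (Dart V E)) // Valid s.1 s.2.1}
  choose r c q h t a1 a2 a3 a4 a5 a6 a7 using fun s : σ => step s.1.1 s.1.2.1 s.1.2.2 s.2
  obtain ⟨sq, sq0, sq1, sq2, sq3⟩ : ∃ sq : ℕ → σ, (sq 0).1.2.1 = w ∧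
      (∀ n, (sq (n+1)).1.1 = (sq n).1.1 ++ r (sq n)) ∧ (∀ n, (sq (n+1)).1.2.1 = c (sq n)) ∧
      (∀ n, (sq (n+1)).1.2.2 = q (sq n) :: (sq n).1.2.2) :=
    ⟨fun n => Nat.rec ⟨([], w, []), ⟨by simp, by simp, by simp, hwY, hwA⟩⟩
      (fun _ s => ⟨(s.1.1 ++ r s, c s, q s :: s.1.2.2), a2 s⟩) n, rfl, fun _ => rfl, fun _ => rfl, fun _ => rfl⟩
  have memR : ∀ m n, m < n → r (sq m) ⊆ (sq n).1.1 := by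
    intro m n hmn
    induction n with
    | zero => omega
    | succ n ih =>
      rw [sq1]
      rcases Nat.lt_succ_iff_lt_or_eq.1 hmn with h | rfl
      · exact List.Subset.trans (ih h) (List.subset_append_left _ _)
      · exact List.subset_append_right _ _
  have memB : ∀ m n, m < n → q (sq m) ∈ (sq n).1.2.2 := by
    intro m n hmn
    induction n with
    | zero => omega
    | succ n ih =>
      rw [sq3]
      rcases Nat.lt_succ_iff_lt_or_eq.1 hmn with h | rfl
      · exact List.mem_cons_of_mem _ (ih h)
      · simp
  have qinj : ∀ m n, q (sq m) = q (sq n) → m = n := by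
    intro m n hmn
    rcases lt_trichotomy m n with h | h | h
    · exact absurd (hmn ▸ memB m n h) (a4 (sq n))
    · exact h
    · exact absurd (hmn.symm ▸ memB n m h) (a4 (sq m))
  have rHD : ∀ n, ∀ d ∈ r (sq n), HD d := fun n d hd => (a2 (sq n)).2.1 d (by simp [hd])
  have rdis' : ∀ m n e, m < n → e ∈ edges (r (sq m)) → e ∈ edges (r (sq n)) → False := by
    intro m n e hmn h1 h2
    have := (a2 (sq n)).2.2.1
    rw [edges_append, List.nodup_append] at this
    exact this.2.2 e (edges_sub (memR m n hmn) h1) e h2 rfl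
  have rdis : ∀ m n e, e ∈ edges (r (sq m)) → e ∈ edges (r (sq n)) → m = n := by
    intro m n e h1 h2
    rcases lt_trichotomy m n with h | h | h
    · exact (rdis' m n e h h1 h2).elim
    · exact h
    · exact (rdis' n m e h h2 h1).elim
  have rnd : ∀ n, (edges (r (sq n))).Nodup := by
    intro n
    have := (a2 (sq n)).2.2.1
    rw [edges_append, List.nodup_append] at this
    exact this.2.1
  have rQ : ∀ n e, e ∈ edges (r (sq n)) → e ∉ used Q := by
    intro n e he
    obtain ⟨d, hd, rfl⟩ := mem_edges.1 he
    exact (rHD n d hd).2.1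
  have cN : ∀ n, c (sq n) ∈ Y ∧ c (sq n) ∉ A := fun n => (a2 (sq n)).2.2.2
  have hq : ∀ n e, e ∈ edges (h (sq n)) → e ∈ edges (q (sq n)) := fun n e he => by
    rw [a5]; simp [he]
  have tq : ∀ n e, e ∈ edges (t (sq n)) → e ∈ edges (q (sq n)) := fun n e he => by
    rw [a5]; simp [he]
  have qd : ∀ m n e, e ∈ edges (q (sq m)) → e ∈ edges (q (sq n)) → m = n := fun m n e h1 h2 =>
    qinj m n (hQ.disj _ (a3 _) _ (a3 _) e h1 h2)
  have htd : ∀ n e, e ∈ edges (h (sq n)) → e ∈ edges (t (sq n)) → False := by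
    intro n e h1 h2
    have := hQ.nodup _ (a3 (sq n))
    rw [a5, edges_append, List.nodup_append] at this
    exact this.2.2 e h1 e h2 rfl
  let f : {l // l ∈ Q ∧ ∀ n, l ≠ q (sq n)} ⊕ ℕ → List (Dart V E) := fun i =>
    match i with
    | Sum.inl l => l.1
    | Sum.inr n => h (sq n) ++ r (sq (n+1)) ++ t (sq (n+1))
  have hsw : ∀ n, (∀ d ∈ h (sq n), G.ok d ∧ d.s ∈ Y ∧ d.t ∉ A) ∧ (∀ d ∈ t (sq n), G.ok d ∧ d.s ∈ Y ∧ d.t ∉ A) := by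
    intro n
    have := (hQ.sw _ (a3 (sq n))).1
    rw [a5] at this
    exact ⟨fun d hd => this d (by simp [hd]), fun d hd => this d (by simp [hd])⟩
  have fsw : ∀ i, IsSW G A Y (f i) := by
    rintro (l | n)
    · exact hQ.sw l.1 l.2.1
    · obtain ⟨x, hx, hxc⟩ := a6 (sq n)
      obtain ⟨y, hy, hyc⟩ := a7 (sq (n+1))
      refine ⟨fun d hd => ?_, x, hx, y, hy, (hxc.append (by have := a1 (sq (n+1)); rwa [sq2] at this)).append hyc⟩
      simp only [f, List.mem_append] at hd
      rcases hd with (hd | hd) | hd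
      · exact (hsw n).1 d hd
      · have := rHD _ d hd; exact ⟨this.1, this.2.2.1.1, this.2.2.2.2⟩
      · exact (hsw _).2 d hd
  have fd : ∀ i j e, e ∈ edges (f i) → e ∈ edges (f j) → i = j := by
    have LN : ∀ (l : {l // l ∈ Q ∧ ∀ n, l ≠ q (sq n)}) n e, e ∈ edges l.1 →
        e ∈ edges (h (sq n) ++ r (sq (n+1)) ++ t (sq (n+1))) → False := by
      intro l n e h1 h2
      simp only [edges_append, List.mem_append] at h2
      rcases h2 with (h2 | h2) | h2
      · exact l.2.2 _ (hQ.disj _ l.2.1 _ (a3 _) e h1 (hq _ _ h2))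
      · exact rQ _ _ h2 ⟨_, l.2.1, h1⟩
      · exact l.2.2 _ (hQ.disj _ l.2.1 _ (a3 _) e h1 (tq _ _ h2))
    rintro (l | m) (l' | n) e h1 h2
    · have := hQ.disj _ l.2.1 _ l'.2.1 e h1 h2
      rw [Subtype.ext this]
    · exact (LN l n e h1 h2).elim
    · exact (LN l' m e h2 h1).elim
    · simp only [f, edges_append, List.mem_append] at h1 h2
      congr 1
      rcases h1 with (h1 | h1) | h1 <;> rcases h2 with (h2 | h2) | h2
      · exact qd m n e (hq _ _ h1) (hq _ _ h2)
      · exact absurd ⟨_, a3 _, hq _ _ h1⟩ (rQ _ _ h2)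
      · have := qd m (n+1) e (hq _ _ h1) (tq _ _ h2)
        rw [this] at h1; exact (htd _ _ h1 h2).elim
      · exact absurd ⟨_, a3 _, hq _ _ h2⟩ (rQ _ _ h1)
      · have := rdis _ _ e h1 h2; omega
      · exact absurd ⟨_, a3 _, tq _ _ h2⟩ (rQ _ _ h1)
      · have := qd (m+1) n e (tq _ _ h1) (hq _ _ h2)
        rw [← this] at h2; exact (htd _ _ h2 h1).elim
      · exact absurd ⟨_, a3 _, tq _ _ h1⟩ (rQ _ _ h2)
      · have := qd (m+1) (n+1) e (tq _ _ h1) (tq _ _ h2); omega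
  obtain ⟨U, hU, hU1, _, hU3⟩ := mkSys hAY f fsw fd
  obtain ⟨y, hy, hyc⟩ := a7 (sq 0)
  have tA : ∀ n, ∀ d ∈ t (sq n), d.s ∉ A := by
    intro n d hd
    obtain ⟨y, hy, hyc⟩ := a7 (sq n)
    exact hyc.s_mem (X := Aᶜ) (fun d hd => ((hsw n).2 d hd).2.2) (cN n).2 d hd
  refine ⟨r (sq 0) ++ t (sq 0), y, Ch.append (by have := a1 (sq 0); rwa [sq0] at this) hyc, hy, ?_, ?_, U, hU.to_del ?_, ?_⟩
  · intro d hd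
    rcases List.mem_append.1 hd with hd | hd
    · have := rHD _ d hd; exact ⟨this.1, this.2.2.1.1, this.2.2.1.2, this.2.2.2.2⟩
    · have := (hsw _).2 d hd; exact ⟨this.1, this.2.1, tA _ d hd, this.2.2⟩
  · rw [edges_append, List.nodup_append]
    refine ⟨rnd 0, ?_, fun a ha b hb hab => ?_⟩
    · have := hQ.nodup _ (a3 (sq 0))
      rw [a5, edges_append, List.nodup_append] at this
      exact this.2.1
    · subst hab; exact rQ _ _ ha ⟨_, a3 _, tq _ _ hb⟩
  · rintro e ⟨l, hl, hle⟩ hep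
    obtain ⟨i, hi⟩ := hU3 l hl
    have hei := edges_sub hi hle
    simp only [Set.mem_setOf_eq, edges_append, List.mem_append] at hep
    rcases i with l' | n
    · have hei : e ∈ edges l'.1 := hei
      rcases hep with hp | hp
      · exact rQ _ _ hp ⟨_, l'.2.1, hei⟩
      · exact l'.2.2 _ (hQ.disj _ l'.2.1 _ (a3 _) e hei (tq _ _ hp))
    · simp only [f, edges_append, List.mem_append] at hei
      rcases hep with hp | hp <;> rcases hei with (h2 | h2) | h2
      · exact absurd ⟨_, a3 _, hq _ _ h2⟩ (rQ _ _ hp)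
      · have := rdis _ _ e hp h2; omega
      · exact absurd ⟨_, a3 _, tq _ _ h2⟩ (rQ _ _ hp)
      · have := qd 0 n e (tq _ _ hp) (hq _ _ h2)
        rw [← this] at h2; exact htd _ _ h2 hp
      · exact absurd ⟨_, a3 _, tq _ _ hp⟩ (rQ _ _ h2)
      · have := qd 0 (n+1) e (tq _ _ hp) (tq _ _ h2); omega
  · rw [cut_del]
    rintro e ⟨he, hep⟩
    refine hU1 e ?_ he
    obtain ⟨l, hl, hle⟩ := hfull he
    by_cases hn : ∃ n, l = q (sq n)
    · obtain ⟨n, rfl⟩ := hn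
      refine ⟨Sum.inr n, ?_⟩
      obtain ⟨d, hd, rfl, hdA⟩ := (hQ.sw _ hl).dartA hle he
      rw [a5] at hd
      rcases List.mem_append.1 hd with hd | hd
      · exact mem_edges_of (by simp only [f]; simp [hd])
      · exact absurd hdA (tA _ d hd)
    · push_neg at hn
      exact ⟨Sum.inl ⟨l, hl, hn⟩, hle⟩

/-- a walk from a start edge inside -/
lemma claimP {G : MG V E} {A Y : Set V} (hAY : A ⊆ Y) (hE : Eul G (Y \ A)) {W} (hW : Sys G A Y W)
    {a : E} (hfull : ∀ e ∈ G.cut A, e ≠ a → e ∈ used W) : Linked G A Y := by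
  by_cases ha : a ∈ G.cut A ∧ a ∉ used W
  swap
  · refine ⟨W, hW, fun e he => ?_⟩
    by_cases h : e = a
    · subst h; tauto
    · exact hfull e he h
  obtain ⟨⟨d, h1, rfl, h2, h3⟩, h4⟩ := ha
  by_cases hY : d.t ∈ Y
  swap
  · obtain ⟨b1, b2⟩ := hW.add (q := [d]) ⟨by simpa using ⟨h1, hAY h2, h3⟩, d.s, h2, d.t, hY, by simp⟩ (by simp)
      (by simpa using h4)
    refine ⟨_, b1, fun e he => ?_⟩
    rw [b2]
    by_cases h : e = d.e
    · simp [h]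
    · exact Or.inl (hfull e he h)
  have hW' : Sys (G.del {d.e}) A Y W := hW.to_del (by rintro e he rfl; exact h4 he)
  obtain ⟨p, y, p1, p2, p3, p4, U, hU, hUf⟩ := parityL hAY hW' (by
    rw [cut_del]; rintro e ⟨he, hne⟩; exact hfull e he hne) hY h3 (by
    intro X hX hf
    rw [cut_del] at hf ⊢
    have hf' : (G.cut X).Finite := Set.Finite.of_sdiff hf (Set.finite_singleton _)
    have hev := hE X hX hf'
    have hsX : d.s ∉ X := fun h => (hX h).2 h2
    by_cases hdX : d.t ∈ X
    · have hm : d.e ∈ G.cut X := h1.mem_cut.2 (Or.inr ⟨hsX, hdX⟩)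
      have := Set.ncard_diff_singleton_add_one hm hf'
      rw [← this, Nat.even_add_one] at hev
      tauto
    · have hm : d.e ∉ G.cut X := by rw [h1.mem_cut]; tauto
      rw [Set.sdiff_singleton_eq_self hm]; tauto)
  have hUd := hU.used_del
  obtain ⟨b1, b2⟩ := hU.of_del.of_del.add (q := d :: p) ⟨by
      intro b hb
      rcases List.mem_cons.1 hb with rfl | hb
      · exact ⟨h1, hAY h2, h3⟩
      · have := p3 b hb; exact ⟨(ok_del.1 this.1).1, this.2.1, this.2.2.2⟩, d.s, h2, y, p2, rfl, p1⟩ (by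
      rw [edges_cons, List.nodup_cons]
      refine ⟨fun hm => ?_, p4⟩
      obtain ⟨b, hb, hbe⟩ := mem_edges.1 hm
      exact (ok_del.1 (p3 b hb).1).2 hbe) (by
      intro e he heU
      simp only [edges_cons, List.mem_cons] at he
      rcases he with rfl | he
      · exact hU.of_del.used_del _ heU rfl
      · exact hUd e heU he)
  refine ⟨_, b1, fun e he => ?_⟩
  rw [b2]
  by_cases h5 : e ∈ edges (d :: p)
  · exact Or.inr h5
  · left; apply hUf; rw [cut_del, cut_del]
    simp only [edges_cons, List.mem_cons, not_or] at h5
    exact ⟨⟨he, h5.1⟩, h5.2⟩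

end LC

namespace LC
open Classical
variable {V : Type u} {E : Type v}

/-- `g` comes before `h` on a common walk -/
def Bf (L : Set (List (Dart V E))) (g h : E) : Prop :=
  ∃ l ∈ L, g ∈ edges l ∧ h ∈ edges l ∧ (edges l).idxOf g < (edges l).idxOf h

inductive Rj (L W : Set (List (Dart V E))) : E → Prop
  | mk (g h : E) : g ∈ used L → Bf W g h → h ∈ used L → h ∈ used W →
      (∀ g', g' ∈ used L → g' ∈ used W → Bf L g' h → Rj L W g') → Rj L W g

def Pp (L W : Set (List (Dart V E))) (h : E) : Prop :=
  h ∈ used L ∧ h ∈ used W ∧ ∀ g', g' ∈ used L → g' ∈ used W → Bf L g' h → Rj L W g'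

def Mt (L W : Set (List (Dart V E))) (h : E) : Prop := Pp L W h ∧ ¬ Rj L W h

lemma Rj.pp {L W : Set (List (Dart V E))} {g} (h : Rj L W g) : ∃ h, Bf W g h ∧ Pp L W h := by
  cases h with
  | mk g h h1 h2 h3 h4 h5 => exact ⟨h, h2, h3, h4, h5⟩

lemma bf_tri {W : Set (List (Dart V E))} {l} (hl : l ∈ W) {g h : E}
    (hg : g ∈ edges l) (hh : h ∈ edges l) : Bf W g h ∨ g = h ∨ Bf W h g := by
  rcases lt_trichotomy ((edges l).idxOf g) ((edges l).idxOf h) with h1 | h1 | h1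
  · exact Or.inl ⟨l, hl, hg, hh, h1⟩
  · exact Or.inr (Or.inl ((List.idxOf_inj hg).1 h1))
  · exact Or.inr (Or.inr ⟨l, hl, hh, hg, h1⟩)

lemma Sys.bf_trans {G : MG V E} {A X : Set V} {W} (hW : Sys G A X W) {g h k : E}
    (h1 : Bf W g h) (h2 : Bf W h k) : Bf W g k := by
  obtain ⟨l, hl, a, b, c⟩ := h1
  obtain ⟨l', hl', a', b', c'⟩ := h2
  obtain rfl := hW.disj l hl l' hl' h b a'
  exact ⟨l, hl, a, b', c.trans c'⟩

lemma idx_split {l1 l2 : List (Dart V E)} {d : Dart V E} (hn : (edges (l1 ++ d :: l2)).Nodup) :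
    (∀ e ∈ edges l1, (edges (l1 ++ d :: l2)).idxOf e < (edges (l1 ++ d :: l2)).idxOf d.e) ∧
    (∀ e ∈ edges l2, (edges (l1 ++ d :: l2)).idxOf d.e < (edges (l1 ++ d :: l2)).idxOf e) := by
  rw [edges_append, edges_cons] at *
  rw [List.nodup_append] at hn
  have h0 : d.e ∉ edges l1 := fun h => hn.2.2 _ h d.e (by simp) rfl
  have h3 : (edges l1 ++ d.e :: edges l2).idxOf d.e = (edges l1).length := by
    rw [List.idxOf_append_of_notMem h0]; simp
  rw [h3]
  constructor
  · intro e he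
    rw [List.idxOf_append_of_mem he]
    exact List.idxOf_lt_length_of_mem he
  · intro e he
    rw [List.idxOf_append_of_notMem (fun h => hn.2.2 _ h e (by simp [he]) rfl)]
    have : d.e ≠ e := by
      rintro rfl
      exact (List.nodup_cons.1 hn.2.1).1 he
    rw [List.idxOf_cons_ne _ this]; omega

lemma pym_walk {G : MG V E} {A X : Set V} (hAX : A ⊆ X) {L W} (hL : Sys G A X L) (hW : Sys G A X W)
    {h : E} (h1 : h ∈ used L) (h2 : h ∈ used W) : ∃ f, IsSW G A X f ∧
      (∀ e ∈ edges f, (e ∈ used L ∧ (Bf L e h ∨ e = h)) ∨ (e ∈ used W ∧ Bf W h e)) ∧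
      (∀ l ∈ L, h ∈ edges l → ∀ e ∈ edges l, e ∈ G.cut A → e ∈ edges f) ∧
      (∀ l ∈ W, h ∈ edges l → ∀ e ∈ edges l, e ∈ G.cut X → e ∈ edges f) := by
  obtain ⟨l, hl, hhl⟩ := h1
  obtain ⟨m, hm, hhm⟩ := h2
  obtain ⟨d, hd, rfl⟩ := mem_edges.1 hhl
  obtain ⟨d', hd', he⟩ := mem_edges.1 hhm
  have swl := hL.sw l hl
  have swm := hW.sw m hm
  obtain ⟨hl1, x, hx, y, hy, hcl⟩ := hL.sw l hl
  obtain ⟨hm1, x', hx', y', hy', hcm⟩ := hW.sw m hm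
  obtain ⟨l1, l2, rfl, c1, c2⟩ := hcl.mem_split hd
  obtain ⟨m1, m2, rfl, k1, k2⟩ := hcm.mem_split hd'
  have il := idx_split (hL.nodup _ hl)
  have im := idx_split (hW.nodup _ hm)
  rw [he] at im
  have hs := ok_same (hl1 d hd).1 (hm1 d' hd').1 he.symm
  obtain ⟨l0, hl0, hc0, hpre⟩ : ∃ l0, (∀ a ∈ l0, a ∈ l1 ∨ a = d) ∧ Ch x l0 d'.t ∧
      l1 ⊆ l0 ∧ (d.s ∈ A → d ∈ l0) ∧ (d'.t ∉ X → d' ∈ l0) := by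
    rcases hs with rfl | rfl
    · exact ⟨l1 ++ [d'], by simp, c1.append (by simp), by simp, by simp, by simp⟩
    · refine ⟨l1, fun a ha => Or.inl ha, c1, by simp, fun h => ?_, fun h => ?_⟩
      · exact absurd h (hm1 _ hd').2.2
      · exact absurd (hl1 d hd).2.1 h
  have swf : IsSW G A X (l0 ++ m2) := by
    refine ⟨fun a ha => ?_, x, hx, y', hy', hc0.append k2⟩
    rcases List.mem_append.1 ha with ha | ha
    · rcases hl0 a ha with h | rfl
      · exact hl1 a (by simp [h])
      · exact hl1 a (by simp)
    · exact hm1 a (by simp [ha])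
  refine ⟨l0 ++ m2, swf, ?_, ?_, ?_⟩
  · intro e he'
    rw [edges_append, List.mem_append] at he'
    rcases he' with he' | he'
    · left
      obtain ⟨a, ha, rfl⟩ := mem_edges.1 he'
      rcases hl0 a ha with ha | rfl
      · have : a.e ∈ edges (l1 ++ d :: l2) := mem_edges_of (by simp [ha])
        exact ⟨⟨_, hl, this⟩, Or.inl ⟨_, hl, this, hhl, il.1 _ (mem_edges_of ha)⟩⟩
      · exact ⟨⟨_, hl, hhl⟩, Or.inr rfl⟩
    · right
      have : e ∈ edges (m1 ++ d' :: m2) := by simp [he']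
      exact ⟨⟨_, hm, this⟩, _, hm, hhm, this, im.2 _ he'⟩
  · intro l' hl' hh e he' hc
    obtain rfl := hL.disj _ hl _ hl' d.e hhl hh
    obtain ⟨a, ha, rfl, has⟩ := swl.dartA he' hc
    apply mem_edges_of
    obtain ⟨d1, mm, hmm, h1, h2⟩ := swl.cons hAX
    have hal : a ∈ l1 ∨ a = d := by
      rcases l1 with _ | ⟨b, l1⟩
      · simp at hmm
        obtain ⟨rfl, rfl⟩ := hmm
        simp at ha
        rcases ha with h | h
        · exact Or.inr h
        · exact absurd has (h2 a h)
      · simp at hmm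
        obtain ⟨rfl, rfl⟩ := hmm
        simp at ha ⊢
        rcases ha with h | h
        · exact Or.inl (Or.inl h)
        · exact absurd has (h2 a (by simpa using h))
    rcases hal with h | rfl
    · simp [hpre.1 h]
    · simp [hpre.2.1 has]
  · intro l' hl' hh e he' hc
    obtain rfl := hW.disj _ hm _ hl' d.e hhm hh
    obtain ⟨a, ha, rfl, hat⟩ := swm.dartX he' hc
    apply mem_edges_of
    rcases List.mem_append.1 ha with h | h
    · exfalso
      have hch : Ch x' m1 d'.s := k1
      exact hat (hch.t_mem (X := X) (fun b hb => (hm1 b (by simp [hb])).2.1) (hm1 d' hd').2.1 a h)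
    · rcases List.mem_cons.1 h with rfl | h
      · simp [hpre.2.2 hat]
      · simp [h]

lemma pym {G : MG V E} {A X : Set V} (hAX : A ⊆ X) {L W} (hL : Sys G A X L) (hW : Sys G A X W)
    (hLf : G.cut A ⊆ used L) (hWf : G.cut X ⊆ used W) :
    ∃ U, Sys G A X U ∧ G.cut A ⊆ used U ∧ G.cut X ⊆ used U := by
  choose! f f1 f2 f3 f4 using fun (h : E) (h1 : h ∈ used L ∧ h ∈ used W) => pym_walk hAX hL hW h1.1 h1.2
  let ι := {h // Mt L W h} ⊕ {l // l ∈ L ∧ ∀ h ∈ edges l, ¬ Mt L W h} ⊕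
    {m // m ∈ W ∧ ∀ h ∈ edges m, ¬ Mt L W h}
  let F : ι → List (Dart V E) := fun i => match i with
    | Sum.inl h => f h.1
    | Sum.inr (Sum.inl l) => l.1
    | Sum.inr (Sum.inr m) => m.1
  -- uniqueness of matches
  have mL : ∀ l ∈ L, ∀ h h', h ∈ edges l → h' ∈ edges l → Mt L W h → Mt L W h' → h = h' := by
    intro l hl h h' h1 h2 m m'
    rcases bf_tri hl h1 h2 with h3 | h3 | h3
    · exact absurd (m'.1.2.2 h m.1.1 m.1.2.1 h3) m.2
    · exact h3
    · exact absurd (m.1.2.2 h' m'.1.1 m'.1.2.1 h3) m'.2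
  have rjW : ∀ g h, Bf W g h → g ∈ used L → Pp L W h → Rj L W g := by
    intro g h hb hg hp
    exact Rj.mk g h hg hb hp.1 hp.2.1 hp.2.2
  have mW : ∀ l ∈ W, ∀ h h', h ∈ edges l → h' ∈ edges l → Mt L W h → Mt L W h' → h = h' := by
    intro l hl h h' h1 h2 m m'
    rcases bf_tri hl h1 h2 with h3 | h3 | h3
    · exact absurd (rjW _ _ h3 m.1.1 m'.1) m.2
    · exact h3
    · exact absurd (rjW _ _ h3 m'.1.1 m.1) m'.2
  have exW : ∀ m ∈ W, ∀ h ∈ edges m, Pp L W h → ∃ h' ∈ edges m, Mt L W h' := by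
    intro m hm h hh hp
    obtain ⟨h', hh', hmax⟩ := Finset.exists_max_image
      ((edges m).toFinset.filter (fun x => Pp L W x)) (fun x => (edges m).idxOf x)
      ⟨h, by simp [hh, hp]⟩
    simp only [Finset.mem_filter, List.mem_toFinset] at hh' hmax
    refine ⟨h', hh'.1, hh'.2, fun hr => ?_⟩
    obtain ⟨k, ⟨m', hm', a, b, c⟩, hk⟩ := hr.pp
    obtain rfl := hW.disj _ hm _ hm' h' hh'.1 a
    have := hmax k ⟨b, hk⟩
    omega
  -- an L-walk without match is fully rejected
  have exL : ∀ l ∈ L, (∀ h ∈ edges l, ¬ Mt L W h) → ∀ g ∈ edges l, g ∈ used W → Rj L W g := by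
    intro l hl hno g hg hgW
    by_contra hcon
    obtain ⟨h', hh', hmin⟩ := Finset.exists_min_image
      ((edges l).toFinset.filter (fun x => x ∈ used W ∧ ¬ Rj L W x)) (fun x => (edges l).idxOf x)
      ⟨g, by simp [hg, hgW, hcon]⟩
    simp only [Finset.mem_filter, List.mem_toFinset] at hh' hmin
    refine hno h' hh'.1 ⟨⟨⟨l, hl, hh'.1⟩, hh'.2.1, fun g' g1 g2 g3 => ?_⟩, hh'.2.2⟩
    by_contra hcon'
    obtain ⟨l', hl', a, b, c⟩ := g3
    obtain rfl := hL.disj _ hl _ hl' h' hh'.1 b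
    have := hmin g' ⟨a, g2, hcon'⟩
    omega
  -- characterise edges
  let QL : ι → E → Prop := fun i e => e ∈ used L ∧ (e ∈ used W → Rj L W e ∨ Mt L W e) ∧
    match i with
    | Sum.inl h => ∃ l ∈ L, e ∈ edges l ∧ h.1 ∈ edges l
    | Sum.inr (Sum.inl l) => e ∈ edges l.1
    | Sum.inr (Sum.inr m) => False
  let QW : ι → E → Prop := fun i e => e ∈ used W ∧ (e ∈ used L → ¬ Rj L W e ∧ ¬ Mt L W e) ∧
    match i with
    | Sum.inl h => ∃ l ∈ W, e ∈ edges l ∧ h.1 ∈ edges l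
    | Sum.inr (Sum.inl l) => False
    | Sum.inr (Sum.inr m) => e ∈ edges m.1
  have key : ∀ i e, e ∈ edges (F i) → QL i e ∨ QW i e := by
    rintro (h | l | m) e he
    · have hm := h.2
      rcases f2 h.1 ⟨hm.1.1, hm.1.2.1⟩ e he with ⟨h1, h2⟩ | ⟨h1, h2⟩
      · left
        refine ⟨h1, fun h3 => ?_, ?_⟩
        · rcases h2 with h2 | h2
          · exact Or.inl (hm.1.2.2 e h1 h3 h2)
          · exact Or.inr (h2 ▸ hm)
        · rcases h2 with ⟨l, hl, a, b, _⟩ | h2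
          · exact ⟨l, hl, a, b⟩
          · obtain ⟨l, hl, a⟩ := h1
            exact ⟨l, hl, a, h2 ▸ a⟩
      · right
        refine ⟨h1, fun h3 => ⟨fun h4 => ?_, fun h4 => ?_⟩, ?_⟩
        · obtain ⟨k, k1, k2⟩ := h4.pp
          exact hm.2 (rjW _ _ (hW.bf_trans h2 k1) hm.1.1 k2)
        · exact hm.2 (rjW _ _ h2 hm.1.1 h4.1)
        · obtain ⟨l, hl, a, b, _⟩ := h2
          exact ⟨l, hl, b, a⟩
    · left
      exact ⟨⟨_, l.2.1, he⟩, fun h => Or.inl (exL _ l.2.1 l.2.2 e he h), he⟩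
    · right
      refine ⟨⟨_, m.2.1, he⟩, fun h => ⟨fun h4 => ?_, m.2.2 e he⟩, he⟩
      obtain ⟨k, ⟨m', hm', a, b, c⟩, hk⟩ := h4.pp
      obtain heq := hW.disj _ m.2.1 _ hm' e he a
      obtain ⟨h', x1, x2⟩ := exW m.1 m.2.1 k (heq ▸ b) hk
      exact m.2.2 _ x1 x2
  have hdis : ∀ i j e, e ∈ edges (F i) → e ∈ edges (F j) → i = j := by
    intro i j e hi hj
    rcases key i e hi with a | a <;> rcases key j e hj with b | b
    · have a := a.2.2; have b := b.2.2
      rcases i with h | l | m <;> rcases j with h' | l' | m'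
      · obtain ⟨l, hl, x1, x2⟩ := a
        obtain ⟨l', hl', y1, y2⟩ := b
        obtain rfl := hL.disj _ hl _ hl' e x1 y1
        rw [Subtype.ext (mL l hl _ _ x2 y2 h.2 h'.2)]
      · obtain ⟨l, hl, x1, x2⟩ := a
        have := hL.disj _ hl _ l'.2.1 e x1 b
        exact absurd h.2 (l'.2.2 _ (this ▸ x2))
      · exact b.elim
      · obtain ⟨l', hl', x1, x2⟩ := b
        have := hL.disj _ hl' _ l.2.1 e x1 a
        exact absurd h'.2 (l.2.2 _ (this ▸ x2))
      · rw [Subtype.ext (hL.disj _ l.2.1 _ l'.2.1 e a b)]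
      · exact b.elim
      all_goals exact a.elim
    · have := a.2.1 b.1; have := b.2.1 a.1; tauto
    · have := b.2.1 a.1; have := a.2.1 b.1; tauto
    · have a := a.2.2; have b := b.2.2
      rcases i with h | l | m <;> rcases j with h' | l' | m'
      · obtain ⟨l, hl, x1, x2⟩ := a
        obtain ⟨l', hl', y1, y2⟩ := b
        obtain rfl := hW.disj _ hl _ hl' e x1 y1
        rw [Subtype.ext (mW l hl _ _ x2 y2 h.2 h'.2)]
      · exact b.elim
      · obtain ⟨l, hl, x1, x2⟩ := a
        have := hW.disj _ hl _ m'.2.1 e x1 b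
        exact absurd h.2 (m'.2.2 _ (this ▸ x2))
      · exact a.elim
      · exact a.elim
      · exact a.elim
      · obtain ⟨l', hl', x1, x2⟩ := b
        have := hW.disj _ hl' _ m.2.1 e x1 a
        exact absurd h'.2 (m.2.2 _ (this ▸ x2))
      · exact b.elim
      · rw [Subtype.ext (hW.disj _ m.2.1 _ m'.2.1 e a b)]
  have hsw : ∀ i, IsSW G A X (F i) := by
    rintro (h | l | m)
    · exact f1 _ ⟨h.2.1.1, h.2.1.2.1⟩
    · exact hL.sw _ l.2.1
    · exact hW.sw _ m.2.1
  obtain ⟨U, hU, hUA, hUX, -⟩ := mkSys hAX F hsw hdis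
  refine ⟨U, hU, fun e he => hUA e ?_ he, fun e he => hUX e ?_ he⟩
  · obtain ⟨l, hl, hel⟩ := hLf he
    by_cases hm : ∀ h ∈ edges l, ¬ Mt L W h
    · exact ⟨Sum.inr (Sum.inl ⟨l, hl, hm⟩), hel⟩
    · push Not at hm
      obtain ⟨h, h1, h2⟩ := hm
      exact ⟨Sum.inl ⟨h, h2⟩, f3 h ⟨h2.1.1, h2.1.2.1⟩ l hl h1 e hel he⟩
  · obtain ⟨l, hl, hel⟩ := hWf he
    by_cases hm : ∀ h ∈ edges l, ¬ Mt L W h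
    · exact ⟨Sum.inr (Sum.inr ⟨l, hl, hm⟩), hel⟩
    · push Not at hm
      obtain ⟨h, h1, h2⟩ := hm
      exact ⟨Sum.inl ⟨h, h2⟩, f4 h ⟨h2.1.1, h2.1.2.1⟩ l hl h1 e hel he⟩

end LC

namespace LC
open Classical
variable {V : Type u} {E : Type v}

lemma Loose.unH {G : MG V E} {A Y : Set V} (h : Loose G A Y) : UnH G A Y := by
  intro X W hW e he
  obtain ⟨d, hd, rfl, hs, ht⟩ := he
  exact hW.2.2.2 (hd.mem_cut.2 (Or.inl ⟨hW.1 hs, h X W hW d hd hs ht⟩))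

lemma wave_ext {G : MG V E} {A X X' : Set V} (hAX : A ⊆ X) (hXX : X ⊆ X') {W Q} (hW : Sys G A X W)
    (hQ : Sys G X X' Q) (hWf : G.cut X ⊆ used W) (hQf : G.cut X' ⊆ used Q) :
    ∃ U, Sys G A X' U ∧ G.cut X' ⊆ used U ∧ (∀ l ∈ W, (∃ d ∈ l, d.t ∉ X') → l ∈ U) ∧
      (G.cut X ⊆ used Q → used W ⊆ used U) := by
  -- edges of W and tails of Q are different
  have key : ∀ l ∈ W, ∀ a q, a :: q ∈ Q → ∀ e ∈ edges l, e ∉ edges q := by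
    intro l hl a q hq e he he'
    obtain ⟨d, hd, rfl⟩ := mem_edges.1 he
    obtain ⟨d', hd', hde⟩ := mem_edges.1 he'
    have h1 := (hW.sw l hl).1 d hd
    have h2 := (hQ.sw _ hq).1 d' (by simp [hd'])
    obtain ⟨b, q', hb, h3, h4⟩ := (hQ.sw _ hq).cons hXX
    simp only [List.cons.injEq] at hb
    obtain ⟨rfl, rfl⟩ := hb
    have h5 := h4 d' hd'
    rcases ok_same h1.1 h2.1 hde.symm with h | h
    · rw [h] at h5; exact h5 h1.2.1
    · rw [h] at h2; exact h2.2.2 h1.2.1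
  have keyQ : ∀ a q, a :: q ∈ Q → a.s ∈ X ∧ a.t ∉ X ∧ G.ok a := by
    intro a q hq
    obtain ⟨b, q', hb, h3, h4⟩ := (hQ.sw _ hq).cons hXX
    simp only [List.cons.injEq] at hb
    obtain ⟨rfl, rfl⟩ := hb
    have := (hQ.sw _ hq).1 a (by simp)
    exact ⟨h3, this.2.2, this.1⟩
  have keyW : ∀ a, G.ok a → a.s ∈ X → a.t ∉ X → ∃ l1, l1 ++ [a] ∈ W := by
    intro a ha h1 h2
    obtain ⟨l, hl, he⟩ := hWf (ha.mem_cut.2 (Or.inl ⟨h1, h2⟩))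
    obtain ⟨d, hd, hde⟩ := mem_edges.1 he
    have h3 := (hW.sw l hl).1 d hd
    obtain ⟨b, l1, rfl, h4, h5⟩ := (hW.sw l hl).snoc hAX
    rcases ok_same ha h3.1 hde.symm with rfl | rfl
    · rcases List.mem_append.1 hd with h | h
      · exact absurd (h5 d h) h2
      · simp only [List.mem_singleton] at h; exact ⟨l1, h ▸ hl⟩
    · exact absurd h3.2.1 h2
  let U : Set (List (Dart V E)) := {u | ∃ l1 a q, l1 ++ [a] ∈ W ∧ a :: q ∈ Q ∧ u = l1 ++ a :: q}
  have hU : Sys G A X' U := by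
    refine ⟨?_, ?_, ?_⟩
    · rintro _ ⟨l1, a, q, h1, h2, rfl⟩
      obtain ⟨w1, x, hx, y, hy, hc⟩ := hW.sw _ h1
      obtain ⟨q1, x', hx', y', hy', hc'⟩ := hQ.sw _ h2
      obtain ⟨z, hz1, hz2⟩ := Ch_append.1 hc
      refine ⟨fun d hd => ?_, x, hx, y', hy', ?_⟩
      · rcases List.mem_append.1 hd with h | h
        · have := w1 d (by simp [h])
          exact ⟨this.1, hXX this.2.1, this.2.2⟩
        · have := q1 d h
          exact ⟨this.1, this.2.1, fun h => this.2.2 (hAX h)⟩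
      · exact hz1.append ⟨hz2.1, hc'.2⟩
    · rintro _ ⟨l1, a, q, h1, h2, rfl⟩
      have n1 := hW.nodup _ h1
      have n2 := hQ.nodup _ h2
      have k := key _ h1 a q h2
      simp only [edges_append, edges_cons, edges_nil, List.nodup_append, List.nodup_cons] at *
      refine ⟨n1.1, n2, ?_⟩
      intro e he f hf hef
      subst hef
      rcases List.mem_cons.1 hf with rfl | h
      · exact n1.2.2 _ he a.e (by simp) rfl
      · exact k e (by simp [he]) h
    · rintro _ ⟨l1, a, q, h1, h2, rfl⟩ _ ⟨l1', a', q', h1', h2', rfl⟩ e he he'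
      have k := key _ h1 a' q' h2' e
      have k' := key _ h1' a q h2 e
      have hx : ∀ (l1 : List (Dart V E)) a q, e ∈ edges (l1 ++ a :: q) ↔
        e ∈ edges (l1 ++ [a]) ∨ e ∈ edges q := by intro l1 a q; simp [or_assoc]
      rw [hx] at he he'
      have hfin : l1 ++ [a] = l1' ++ [a'] → l1 ++ a :: q = l1' ++ a' :: q' := by
        intro heq
        obtain ⟨rfl, h⟩ := List.append_inj' heq rfl
        simp only [List.cons.injEq, and_true] at h
        subst h
        rw [hQ.disj _ h2 _ h2' a.e (by simp) (by simp)]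
      rcases he with he | he <;> rcases he' with he' | he'
      · exact hfin (hW.disj _ h1 _ h1' e he he')
      · exact absurd he' (k he)
      · exact absurd he (k' he')
      · have := hQ.disj _ h2 _ h2' e (by simp [he]) (by simp [he'])
        simp only [List.cons.injEq] at this
        obtain ⟨rfl, rfl⟩ := this
        exact hfin (hW.disj _ h1 _ h1' a.e (by simp) (by simp))
  refine ⟨U, hU, ?_, ?_, ?_⟩
  · intro e he
    obtain ⟨q0, hq0, heq⟩ := hQf he
    obtain ⟨a, q, rfl, -⟩ := (hQ.sw _ hq0).cons hXX
    obtain ⟨k1, k2, k3⟩ := keyQ a q hq0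
    obtain ⟨l1, hl1⟩ := keyW a k3 k1 k2
    exact ⟨_, ⟨l1, a, q, hl1, hq0, rfl⟩, by simp [edges_append]; right; simpa using heq⟩
  · rintro l hl ⟨d, hd, hdt⟩
    obtain ⟨b, l1, rfl, h4, h5⟩ := (hW.sw l hl).snoc hAX
    have hb : d = b := by
      rcases List.mem_append.1 hd with h | h
      · exact absurd (hXX (h5 d h)) hdt
      · simpa using h
    subst hb
    have hok := (hW.sw _ hl).1 d hd
    obtain ⟨q0, hq0, heq⟩ := hQf (hok.1.mem_cut.2 (Or.inl ⟨hXX hok.2.1, hdt⟩))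
    obtain ⟨a, q, rfl, ha, hq⟩ := (hQ.sw _ hq0).cons hXX
    obtain ⟨c, hc, hce⟩ := mem_edges.1 heq
    have hcok := (hQ.sw _ hq0).1 c hc
    have hcd : c = d := by
      rcases ok_same hok.1 hcok.1 hce.symm with h | h
      · exact h
      · rw [h] at hcok; exact absurd hcok.2.1 hdt
    subst hcd
    have hca : c = a := by
      rcases List.mem_cons.1 hc with h | h
      · exact h
      · exact absurd hok.2.1 (hq c h)
    subst hca
    refine ⟨l1, c, q, hl, hq0, ?_⟩
    cases q with
    | nil => rfl
    | cons b q =>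
      obtain ⟨q1, x', hx', y', hy', hc'⟩ := hQ.sw _ hq0
      have := (q1 b (by simp)).2.1
      rw [hc'.2.1] at this
      exact absurd this hdt
  · rintro hn e ⟨l, hl, he⟩
    obtain ⟨b, l1, rfl, h4, h5⟩ := (hW.sw l hl).snoc hAX
    have hok := (hW.sw _ hl).1 b (by simp)
    have hcut := hok.1.mem_cut.2 (Or.inl ⟨hok.2.1, h4⟩)
    obtain ⟨q0, hq0, heq⟩ := hn hcut
    obtain ⟨a, q, rfl, ha, hq⟩ := (hQ.sw _ hq0).cons hXX
    obtain ⟨c, hc, hce, hcs⟩ := (hQ.sw _ hq0).dartA heq hcut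
    have hcok := (hQ.sw _ hq0).1 c hc
    have hcd : c = b := by
      rcases ok_same hok.1 hcok.1 hce.symm with h | h
      · exact h
      · rw [h] at hcs; exact absurd hcs h4
    subst hcd
    have hca : c = a := by
      rcases List.mem_cons.1 hc with h | h
      · exact h
      · exact absurd hok.2.1 (hq c h)
    subst hca
    refine ⟨_, ⟨l1, c, q, hl, hq0, rfl⟩, ?_⟩
    simp only [edges_append, edges_cons, edges_nil, List.mem_append, List.mem_cons] at he ⊢
    simp at he; tauto

structure FamP (G : MG V E) {ι : Type*} (A : ι → Set V) (N : Set V) (X : ι → Set V)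
    (W : ι → Set (List (Dart V E))) : Prop where
  sub : ∀ j, A j ⊆ X j
  sup : ∀ j, X j ⊆ N ∪ A j
  disj : ∀ i j, i ≠ j → Disjoint (X i) (X j)
  sys : ∀ j, Sys G (A j) (X j) (W j)
  far : ∀ j, G.cut (X j) ⊆ used (W j)

lemma fam {ι : Type*} (G : MG V E) (A : ι → Set V) (N : Set V)
    (hA : ∀ i j, i ≠ j → Disjoint (A i) (A j)) :
    ∃ X W, FamP G A N X W ∧ ∀ j, Loose G (X j) ((N \ ⋃ i, X i) ∪ X j) := by
  let α := {p : (ι → Set V) × (ι → Set (List (Dart V E))) // FamP G A N p.1 p.2}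
  let r : α → α → Prop := fun p q => (∀ j, p.1.1 j ⊆ q.1.1 j) ∧
    ∀ j, ∀ l ∈ p.1.2 j, (∃ d ∈ l, d.t ∉ q.1.1 j) → l ∈ q.1.2 j
  have h0 : FamP G A N A (fun j => {l | ∃ d, G.ok d ∧ d.s ∈ A j ∧ d.t ∉ A j ∧ l = [d]}) := by
    refine ⟨fun j => le_rfl, fun j => Set.subset_union_right, hA, fun j => ⟨?_, ?_, ?_⟩, fun j => ?_⟩
    · rintro _ ⟨d, h1, h2, h3, rfl⟩
      exact ⟨by simp; exact ⟨h1, h2, h3⟩, d.s, h2, d.t, h3, by simp⟩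
    · rintro _ ⟨d, h1, h2, h3, rfl⟩; simp
    · rintro _ ⟨d, h1, h2, h3, rfl⟩ _ ⟨d', h1', h2', h3', rfl⟩ e he he'
      simp at he he'
      rcases ok_same h1 h1' (by rw [← he, ← he']) with rfl | rfl
      · rfl
      · exact absurd h2' h3
    · rintro e ⟨d, h1, rfl, h2, h3⟩
      exact ⟨[d], ⟨d, h1, h2, h3, rfl⟩, by simp⟩
  obtain ⟨m, hm⟩ : ∃ m : α, ∀ a, r m a → r a m := by
    apply exists_maximal_of_chains_bounded
    · intro c hc
      by_cases hne : c.Nonempty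
      swap
      · exact ⟨⟨(A, _), h0⟩, fun a ha => absurd ⟨a, ha⟩ hne⟩
      have htot : ∀ p ∈ c, ∀ q ∈ c, r p q ∨ r q p := by
        intro p hp q hq
        by_cases h : p = q
        · subst h; left; exact ⟨fun j => le_rfl, fun j l hl _ => hl⟩
        · exact hc hp hq h
      let Xc : ι → Set V := fun j => ⋃ p ∈ c, p.1.1 j
      have hXc : ∀ p ∈ c, ∀ j, p.1.1 j ⊆ Xc j := fun p hp j => Set.subset_biUnion_of_mem (u := fun p : α => p.1.1 j) hp
      let Wc : ι → Set (List (Dart V E)) := fun j => {l | (∃ p ∈ c, l ∈ p.1.2 j) ∧ ∃ d ∈ l, d.t ∉ Xc j}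
      have hmove : ∀ p ∈ c, ∀ q ∈ c, ∀ j l l', l ∈ p.1.2 j → l' ∈ q.1.2 j → (∃ d ∈ l, d.t ∉ Xc j) →
          (∃ d ∈ l', d.t ∉ Xc j) → ∃ s ∈ c, l ∈ s.1.2 j ∧ l' ∈ s.1.2 j := by
        rintro p hp q hq j l l' hl hl' ⟨d, hd, hdt⟩ ⟨d', hd', hdt'⟩
        rcases htot p hp q hq with h | h
        · exact ⟨q, hq, h.2 j l hl ⟨d, hd, fun h => hdt (hXc q hq j h)⟩, hl'⟩
        · exact ⟨p, hp, hl, h.2 j l' hl' ⟨d', hd', fun h => hdt' (hXc p hp j h)⟩⟩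
      have hub : FamP G A N Xc Wc := by
        refine ⟨?_, ?_, ?_, fun j => ⟨?_, ?_, ?_⟩, ?_⟩
        · intro j
          obtain ⟨p, hp⟩ := hne
          exact (p.2.sub j).trans (hXc p hp j)
        · intro j
          exact Set.iUnion₂_subset (fun p _ => p.2.sup j)
        · intro i j hij
          rw [Set.disjoint_left]
          intro v hv hv'
          simp only [Xc, Set.mem_iUnion, exists_prop] at hv hv'
          obtain ⟨p, hp, h1⟩ := hv
          obtain ⟨q, hq, h2⟩ := hv'
          rcases htot p hp q hq with h | h
          · exact Set.disjoint_left.1 (q.2.disj i j hij) (h.1 i h1) h2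
          · exact Set.disjoint_left.1 (p.2.disj i j hij) h1 (h.1 j h2)
        · rintro l ⟨⟨p, hp, hl⟩, d, hd, hdt⟩
          obtain ⟨w1, x, hx, y, hy, hch⟩ := (p.2.sys j).sw l hl
          refine ⟨fun a ha => ⟨(w1 a ha).1, hXc p hp j (w1 a ha).2.1, (w1 a ha).2.2⟩, x, hx, y, ?_, hch⟩
          obtain ⟨b, l1, rfl, h4, h5⟩ := ((p.2.sys j).sw l hl).snoc (p.2.sub j)
          have hb : d = b := by
            rcases List.mem_append.1 hd with h | h
            · exact absurd (hXc p hp j (h5 d h)) hdt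
            · simpa using h
          subst hb
          obtain ⟨z, hz1, hz2⟩ := Ch_append.1 hch
          have : d.t = y := hz2.2
          rwa [← this]
        · rintro l ⟨⟨p, hp, hl⟩, _⟩; exact (p.2.sys j).nodup l hl
        · rintro l ⟨⟨p, hp, hl⟩, hx⟩ l' ⟨⟨p', hp', hl'⟩, hx'⟩ e he he'
          obtain ⟨s, hs, a, b⟩ := hmove p hp p' hp' j l l' hl hl' hx hx'
          exact (s.2.sys j).disj l a l' b e he he'
        · rintro j e ⟨d, hd, rfl, hs, ht⟩
          have hs' := hs
          simp only [Xc, Set.mem_iUnion, exists_prop] at hs'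
          obtain ⟨p, hp, h1⟩ := hs'
          have ht' : d.t ∉ p.1.1 j := fun h => ht (hXc p hp j h)
          have hcut := hd.mem_cut.2 (Or.inl ⟨h1, ht'⟩)
          obtain ⟨l, hl, hle⟩ := p.2.far j hcut
          obtain ⟨a, ha, hae, hat⟩ := ((p.2.sys j).sw l hl).dartX hle hcut
          have had : a = d := by
            rcases ok_same hd (((p.2.sys j).sw l hl).1 a ha).1 hae.symm with h | h
            · exact h
            · rw [h] at hat; exact absurd h1 hat
          exact ⟨l, ⟨⟨p, hp, hl⟩, d, had ▸ ha, ht⟩, hle⟩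
      exact ⟨⟨(Xc, Wc), hub⟩, fun p hp => ⟨fun j => hXc p hp j, fun j l hl hx => ⟨⟨p, hp, hl⟩, hx⟩⟩⟩
    · rintro a b c ⟨h1, h2⟩ ⟨h3, h4⟩
      refine ⟨fun j => (h1 j).trans (h3 j), fun j l hl ⟨d, hd, hdt⟩ => ?_⟩
      exact h4 j l (h2 j l hl ⟨d, hd, fun h => hdt (h3 j h)⟩) ⟨d, hd, hdt⟩
  refine ⟨m.1.1, m.1.2, m.2, fun j X' Q hQ d hd hds hdt hdX => ?_⟩
  obtain ⟨q1, q2, q3, q4⟩ := hQ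
  obtain ⟨U, u1, u2, u3, -⟩ := wave_ext (m.2.sub j) q1 (m.2.sys j) q3 (m.2.far j) q4
  have hN : FamP G A N (Function.update m.1.1 j X') (Function.update m.1.2 j U) := by
    refine ⟨?_, ?_, ?_, ?_, ?_⟩
    · intro i
      by_cases hi : i = j
      · subst hi; simpa using (m.2.sub i).trans q1
      · simpa [hi] using m.2.sub i
    · intro i
      by_cases hi : i = j
      · subst hi
        simp only [Function.update_self]
        refine q2.trans (Set.union_subset ?_ (m.2.sup i))
        exact Set.sdiff_subset.trans Set.subset_union_left
      · simpa [hi] using m.2.sup i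
    · have hX : ∀ k, k ≠ j → Disjoint X' (m.1.1 k) := by
        intro k hk
        rw [Set.disjoint_left]
        intro v hv hv'
        rcases q2 hv with h | h
        · exact h.2 (Set.mem_iUnion.2 ⟨k, hv'⟩)
        · exact Set.disjoint_left.1 (m.2.disj k j hk) hv' h
      intro i k hik
      by_cases hi : i = j
      · subst hi
        simpa [Ne.symm hik] using hX k (Ne.symm hik)
      · by_cases hk : k = j
        · subst hk; simpa [hi] using (hX i hi).symm
        · simpa [hi, hk] using m.2.disj i k hik
    · intro i
      by_cases hi : i = j
      · subst hi; simpa using u1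
      · simpa [hi] using m.2.sys i
    · intro i
      by_cases hi : i = j
      · subst hi; simpa using u2
      · simpa [hi] using m.2.far i
  have hr : r m ⟨(Function.update m.1.1 j X', Function.update m.1.2 j U), hN⟩ := by
    refine ⟨fun i => ?_, fun i l hl hx => ?_⟩
    · by_cases hi : i = j
      · subst hi; simpa using q1
      · simp [hi]
    · by_cases hi : i = j
      · subst hi
        simp only [Function.update_self] at hx ⊢
        exact u3 l hl hx
      · simpa [hi] using hl
  have := (hm _ hr).1 j
  simp only [Function.update_self] at this
  exact hdt (this hdX)

lemma famL {ι : Type*} (G : MG V E) (A : ι → Set V) (N : Set V)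
    (hA : ∀ i j, i ≠ j → Disjoint (A i) (A j)) (hL : ∀ j, Linked G (A j) (N ∪ A j)) :
    ∃ X W, FamP G A N X W ∧ (∀ j, G.cut (A j) ⊆ used (W j)) ∧
      ∀ j, Loose G (X j) ((N \ ⋃ i, X i) ∪ X j) := by
  obtain ⟨X, W, hF, hLo⟩ := fam G A N hA
  have : ∀ j, ∃ U, Sys G (A j) (X j) U ∧ G.cut (A j) ⊆ used U ∧ G.cut (X j) ⊆ used U := by
    intro j
    obtain ⟨L, hL1, hL2⟩ := hL j
    obtain ⟨t1, t2⟩ := hL1.trunc (hF.sub j) (hF.sup j)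
    exact pym (hF.sub j) t1 (hF.sys j) (fun e he => t2 e (hL2 he) he) (hF.far j)
  choose U u1 u2 u3 using this
  exact ⟨X, U, ⟨hF.sub, hF.sup, hF.disj, u1, u3⟩, u2, hLo⟩

end LC

namespace LC
open Classical
variable {V : Type u} {E : Type v}

lemma L1 {G : MG V E} {X Y : Set V} (hU : UnH G X Y) {g : Dart V E} (hg : G.ok g)
    (hgs : g.s ∉ X) (hgt : g.t ∉ X) (hn : ¬ UnH (G.del {g.e}) X Y) :
    ∃ X' W', Wave G X Y X' W' ∧ ((g.s ∈ X' ∧ g.t ∉ X') ∨ (g.s ∉ X' ∧ g.t ∈ X')) := by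
  simp only [UnH, not_forall] at hn
  obtain ⟨X', W, ⟨w1, w2, w3, w4⟩, hcut⟩ := hn
  rw [Set.not_subset] at hcut
  obtain ⟨a, ha, haW⟩ := hcut
  rw [cut_del] at ha w4
  have hgc : g.e ∈ G.cut X' := by
    by_contra hcon
    refine haW (hU X' W ⟨w1, w2, w3.of_del, fun e he => w4 ⟨he, ?_⟩⟩ ha.1)
    rintro rfl; exact hcon he
  refine ⟨X', ?_⟩
  have hor := hg.mem_cut.1 hgc
  obtain ⟨d, hd, hde, hds, hdt⟩ := hgc
  have hdu : d.e ∉ used W := fun h => w3.used_del _ h hde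
  by_cases hr : d.s ∈ X ∪ Reach G X X' W
  · obtain ⟨W', a', h1, h2, h3, h4, h5⟩ := augment w1 w3.of_del hd hr hdt hdu
    refine ⟨W', ⟨w1, w2, h1, fun e he => (h5 e he).2 ?_⟩, hor⟩
    by_cases h : e = g.e
    · right; rw [h, hde]
    · left; exact w4 ⟨he, h⟩
  · exfalso
    obtain ⟨h1, h2, h3⟩ := fact2 w1 w3.of_del (fun d' hd' hs' ht' => by
      refine w4 ⟨hd'.mem_cut.2 (Or.inl ⟨?_, ht'⟩), ?_⟩
      · rcases hs' with h | h
        · exact w1 h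
        · exact (reach_sub h).1
      · intro h
        rcases ok_same hd hd' (by rw [hde]; exact h.symm) with rfl | rfl
        · exact hr hs'
        · exact ht' hds)
    have hsub : X ∪ Reach G X X' W ⊆ X' := Set.union_subset w1 (fun v hv => (reach_sub hv).1)
    have := hU _ _ ⟨Set.subset_union_left, hsub.trans w2, h1, h2⟩ ha.1
    exact haW ((h3 a ha.1).1 this)

lemma UnH.wave {G : MG V E} {A X Y : Set V} {W} (hU : UnH G A Y) (hW : Wave G A Y X W) :
    UnH G X Y := by
  intro X' Q hQ e he
  obtain ⟨w1, w2, w3, w4⟩ := hW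
  obtain ⟨q1, q2, q3, q4⟩ := hQ
  by_contra hcon
  -- remove from W the walk ending in e
  obtain ⟨l, hl, hel⟩ := w4 he
  let W0 := W \ {l}
  have hW0 : Sys G A X W0 := w3.sub Set.sdiff_subset
  obtain ⟨Z, z1, z2, z3, z4⟩ := hW0.comp w1 q1 q3
  -- near full by UnH, but used edges near: first edge of l is missing
  obtain ⟨b, l1, hb, hb1, hb2⟩ := (w3.sw l hl).cons w1
  have hbe : b.e ∈ edges l := by rw [hb]; simp
  have hbc : b.e ∈ G.cut A := (w3.sw l hl).edgeA (by rw [hb]; simp) hb1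
  have hfar : ∀ e' ∈ G.cut X', e' ∈ used Z := by
    intro e' he'
    refine z4 ?_ e' he' (q4 he')
    intro e1 h1 h2
    obtain ⟨l', hl', hel'⟩ := w4 h1
    refine ⟨l', ⟨hl', ?_⟩, hel'⟩
    rintro rfl
    -- both e1 and e are far edges of l
    obtain ⟨c1, hc1, rfl, hc1'⟩ := (w3.sw l' hl).dartX hel' h1
    obtain ⟨c2, hc2, rfl, hc2'⟩ := (w3.sw l' hl).dartX hel he
    obtain ⟨c, m, hm, hm1, hm2⟩ := (w3.sw l' hl).snoc w1
    have aux : ∀ c' ∈ l', c'.t ∉ X → c' = c := by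
      intro c' hc' ht
      rw [hm] at hc'
      rcases List.mem_append.1 hc' with h | h
      · exact absurd (hm2 _ h) ht
      · simpa using h
    rw [aux c1 hc1 hc1', ← aux c2 hc2 hc2'] at h2
    exact hcon h2
  have := hU X' Z ⟨w1.trans q1, q2, z1, hfar⟩ hbc
  rcases z2 this with ⟨l', hl', h⟩ | ⟨q, hq, h⟩
  · exact hl'.2 (w3.disj _ hl'.1 _ hl _ h hbe)
  · obtain ⟨c, hc, hce⟩ := mem_edges.1 h
    have h1 := (q3.sw q hq).1 c hc
    obtain ⟨a, q', rfl, ha, hq'⟩ := (q3.sw q hq).cons q1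
    have hbok := (w3.sw l hl).1 b (by rw [hb]; simp)
    rcases ok_same hbok.1 h1.1 hce.symm with hcb | hcb
    · -- c = b, so b.e is the far edge of l too
      subst hcb
      have hcX : c.e ∈ G.cut X := h1.1.mem_cut.2 (Or.inl ⟨w1 hb1, h1.2.2⟩)
      obtain ⟨c2, hc2, rfl, hc2'⟩ := (w3.sw l hl).dartX hel he
      obtain ⟨c', m, hm, hm1, hm2⟩ := (w3.sw l hl).snoc w1
      have aux : ∀ x ∈ l, x.t ∉ X → x = c' := by
        intro x hx ht
        rw [hm] at hx
        rcases List.mem_append.1 hx with h | h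
        · exact absurd (hm2 _ h) ht
        · simpa using h
      have e1 := aux c (by rw [hb]; simp) h1.2.2
      have e2 := aux c2 hc2 hc2'
      exact hcon ⟨_, hq, by rw [e2, ← e1]; exact h⟩
    · rw [hcb] at h1
      exact h1.2.2 (w1 hb1)

lemma UnH.del_in {G : MG V E} {X Y : Set V} {F : Set E} (hU : UnH G X Y)
    (hF : ∀ d, G.ok d → d.e ∈ F → d.s ∈ X ∧ d.t ∈ X) : UnH (G.del F) X Y := by
  intro X' W ⟨w1, w2, w3, w4⟩ e he
  rw [cut_del] at he
  refine hU X' W ⟨w1, w2, w3.of_del, fun e he => w4 ?_⟩ he.1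
  rw [cut_del]
  refine ⟨he, fun h => ?_⟩
  obtain ⟨d, hd, rfl, hs, ht⟩ := he
  exact ht (w1 (hF d hd h).2)

lemma UnH.del_start {G : MG V E} {X Y : Set V} {b : Dart V E} (hU : UnH G X Y) (hXY : X ⊆ Y)
    (hb : G.ok b) (hbs : b.s ∈ X) (hbt : b.t ∉ X) : UnH (G.del {b.e}) X Y := by
  intro X' W ⟨w1, w2, w3, w4⟩ a ha
  rw [cut_del] at ha w4
  by_cases h : b.t ∈ X'
  · refine hU X' W ⟨w1, w2, w3.of_del, fun e he => w4 ⟨he, ?_⟩⟩ ha.1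
    rintro rfl
    have := hb.mem_cut.1 he
    have := w1 hbs
    tauto
  · have h1 : IsSW G X X' [b] := ⟨by simp; exact ⟨hb, w1 hbs, hbt⟩, b.s, hbs, b.t, h, by simp⟩
    obtain ⟨s1, s2⟩ := w3.of_del.add h1 (by simp) (by
      simp; intro h; exact w3.used_del _ h rfl)
    have := hU X' _ ⟨w1, w2, s1, fun e he => (s2 e).2 ?_⟩ ha.1
    · rcases (s2 a).1 this with h | h
      · exact h
      · simp at h; exact absurd h ha.2
    · by_cases h : e = b.e
      · right; simp [h]
      · left; exact w4 ⟨he, h⟩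

/-- state of the tree construction -/
structure TSt (G : MG V E) (A Y : Set V) (b : Dart V E) (F : Set E) (R X : Set V)
    (W : Set (List (Dart V E))) : Prop where
  AX : A ⊆ X
  XY : X ⊆ Y
  sys : Sys (G.del F) A X W
  far : (G.del F).cut X ⊆ used W
  near : (G.del F).cut A ⊆ used W
  unh : UnH (G.del F) X Y
  bF : b.e ∈ F
  FA : ∀ d, G.ok d → d.e ∈ F → d.e = b.e ∨ (d.s ∉ A ∧ d.t ∉ A)
  RY : ∀ r ∈ R, r ∈ Y ∧ r ∉ A
  FR : ∀ d, G.ok d → d.e ∈ F → d.t ∈ R ∪ A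
  bR : b.t ∈ R
  tree : ∀ r ∈ R, ∃ p, Ch b.t p r ∧ ∀ d ∈ p, G.ok d ∧ d.e ∈ F ∧ d.s ∈ R ∧ d.t ∈ R

def TreeOK (G : MG V E) (A Y : Set V) (b : Dart V E) : Prop :=
  ∃ F X W P, A ⊆ X ∧ X ⊆ Y ∧ Sys (G.del F) A X W ∧ (G.del F).cut X ⊆ used W ∧
    (G.del F).cut A ⊆ used W ∧ UnH (G.del F) X Y ∧ b.e ∈ F ∧
    (∀ d, G.ok d → d.e ∈ F → d.e = b.e ∨ (d.s ∉ A ∧ d.t ∉ A)) ∧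
    IsSW G A Y (b :: P) ∧ ∀ d ∈ P, d.e ∈ F

lemma TSt.step {G : MG V E} {A Y : Set V} {b : Dart V E} {F : Set E} {R X : Set V}
    {W : Set (List (Dart V E))} (hb : G.ok b) (hbs : b.s ∈ A) (hbt : b.t ∉ A) (hAY : A ⊆ Y)
    (h : TSt G A Y b F R X W) (hno : ¬ TreeOK G A Y b) {g : Dart V E} (hg : G.ok g) :
    ∃ F' R' X' W', TSt G A Y b F' R' X' W' ∧ F ⊆ F' ∧ R ⊆ R' ∧ X ⊆ X' ∧
      (∀ l ∈ W, (∃ d ∈ l, d.t ∉ X') → l ∈ W') ∧ (g.s ∈ R → g.t ∈ R' ∨ g.s ∈ X' ∨ g.t ∈ X') := by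
  by_cases htriv : g.s ∈ R → g.t ∈ R ∨ g.s ∈ X ∨ g.t ∈ X
  · exact ⟨F, R, X, W, h, le_rfl, le_rfl, le_rfl, fun l hl _ => hl, htriv⟩
  push Not at htriv
  obtain ⟨gR, gtR, gsX, gtX⟩ := htriv
  have gF : g.e ∉ F := fun hF => by
    rcases h.FR g hg hF with h1 | h1
    · exact gtR h1
    · exact gtX (h.AX h1)
  have hgok : (G.del F).ok g := ok_del.2 ⟨hg, gF⟩
  by_cases hUg : UnH (G.del (F ∪ {g.e})) X Y
  · have hun : g.e ∉ used W := by
      intro hu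
      obtain ⟨l, hl, hdl⟩ := h.sys.dart hgok hu
      rcases hdl with h1 | h1
      · exact gsX ((h.sys.sw l hl).1 _ h1).2.1
      · exact gtX ((h.sys.sw l hl).1 _ h1).2.1
    have hsys : Sys (G.del (F ∪ {g.e})) A X W := by
      rw [← del_del]
      refine h.sys.to_del fun e he hge => ?_
      rw [Set.mem_singleton_iff] at hge; subst hge; exact hun he
    have hsub : ∀ Z, (G.del (F ∪ {g.e})).cut Z ⊆ (G.del F).cut Z := by
      intro Z; rw [cut_del, cut_del]
      exact fun e he => ⟨he.1, fun h => he.2 (Or.inl h)⟩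
    have hFA : ∀ d, G.ok d → d.e ∈ F ∪ {g.e} → d.e = b.e ∨ (d.s ∉ A ∧ d.t ∉ A) := by
      rintro d hd (h1 | h1)
      · exact h.FA d hd h1
      · right
        have a1 := fun h' => gsX (h.AX h')
        have a2 := fun h' => gtX (h.AX h')
        rcases ok_same hg hd (Eq.symm h1) with rfl | rfl
        · exact ⟨a1, a2⟩
        · exact ⟨a2, a1⟩
    obtain ⟨p, hp, hp2⟩ := h.tree g.s gR
    by_cases hY : g.t ∈ Y
    · refine ⟨F ∪ {g.e}, R ∪ {g.t}, X, W, ⟨h.AX, h.XY, hsys, (hsub X).trans h.far,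
        (hsub A).trans h.near, hUg, Or.inl h.bF, hFA, ?_, ?_, Or.inl h.bR, ?_⟩,
        Set.subset_union_left, Set.subset_union_left, le_rfl, fun l hl _ => hl, fun _ => Or.inl (Or.inr rfl)⟩
      · rintro r (h1 | rfl)
        · exact h.RY r h1
        · exact ⟨hY, fun h' => gtX (h.AX h')⟩
      · rintro d hd (h1 | h1)
        · rcases h.FR d hd h1 with h2 | h2
          · exact Or.inl (Or.inl h2)
          · exact Or.inr h2
        · rcases ok_same hg hd (Eq.symm h1) with rfl | rfl
          · exact Or.inl (Or.inr rfl)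
          · exact Or.inl (Or.inl gR)
      · rintro r (h1 | h1)
        · obtain ⟨p, q1, q2⟩ := h.tree r h1
          exact ⟨p, q1, fun d hd => ⟨(q2 d hd).1, Or.inl (q2 d hd).2.1, Or.inl (q2 d hd).2.2.1,
            Or.inl (q2 d hd).2.2.2⟩⟩
        · rw [Set.mem_singleton_iff] at h1; subst h1
          refine ⟨p ++ [g], hp.append (by simp), fun d hd => ?_⟩
          rcases List.mem_append.1 hd with h1 | h1
          · exact ⟨(hp2 d h1).1, Or.inl (hp2 d h1).2.1, Or.inl (hp2 d h1).2.2.1,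
            Or.inl (hp2 d h1).2.2.2⟩
          · rw [List.mem_singleton] at h1; subst h1
            exact ⟨hg, Or.inr rfl, Or.inl gR, Or.inr rfl⟩
    · exfalso
      refine hno ⟨F ∪ {g.e}, X, W, p ++ [g], h.AX, h.XY, hsys, (hsub X).trans h.far,
        (hsub A).trans h.near, hUg, Or.inl h.bF, hFA, ⟨fun d hd => ?_, b.s, hbs, g.t, hY, ?_⟩, ?_⟩
      · rcases List.mem_cons.1 hd with rfl | hd
        · exact ⟨hb, hAY hbs, hbt⟩
        rcases List.mem_append.1 hd with h1 | h1
        · exact ⟨(hp2 d h1).1, (h.RY _ (hp2 d h1).2.2.1).1, (h.RY _ (hp2 d h1).2.2.2).2⟩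
        · rw [List.mem_singleton] at h1; subst h1
          exact ⟨hg, (h.RY _ gR).1, fun h' => gtX (h.AX h')⟩
      · exact ⟨rfl, hp.append (by simp)⟩
      · intro d hd
        rcases List.mem_append.1 hd with h1 | h1
        · exact Or.inl (hp2 d h1).2.1
        · rw [List.mem_singleton] at h1; subst h1; exact Or.inr rfl
  · rw [← del_del] at hUg
    obtain ⟨X', Q, hQ, hex⟩ := L1 h.unh hgok gsX gtX hUg
    have hQ0 := hQ
    obtain ⟨q1, q2, q3, q4⟩ := hQ
    have hQn := h.unh X' Q hQ0
    obtain ⟨U, u1, u2, u3, u4⟩ := wave_ext h.AX q1 h.sys q3 h.far q4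
    refine ⟨F, R, X', U, ⟨h.AX.trans q1, q2, u1, u2, h.near.trans (u4 hQn), h.unh.wave hQ0, h.bF, h.FA,
      h.RY, h.FR, h.bR, h.tree⟩, le_rfl, le_rfl, q1, u3, fun _ => Or.inr (by tauto)⟩

lemma countable_darts {G : MG V E} (hS : G.S.Countable) : {d | G.ok d}.Countable := by
  have : {d | G.ok d} ⊆ ⋃ e ∈ G.S, {d | G.ok d ∧ d.e = e} := by
    intro d hd
    simp only [Set.mem_iUnion, Set.mem_setOf_eq, exists_prop]
    exact ⟨d.e, hd.1, hd, rfl⟩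
  refine Set.Countable.mono this (hS.biUnion fun e _ => Set.Finite.countable ?_)
  by_cases h : ∃ d, G.ok d ∧ d.e = e
  · obtain ⟨d, hd, rfl⟩ := h
    refine (Set.toFinite {d, d.rev}).subset ?_
    rintro d' ⟨h1, h2⟩
    exact ok_same hd h1 h2.symm
  · convert Set.finite_empty
    ext d; simp; intro h1 h2; exact h ⟨d, h1, h2⟩

lemma tree {G : MG V E} (hS : G.S.Countable) {A Y : Set V} (hAY : A ⊆ Y) (hU : UnH G A Y)
    {b : Dart V E} (hb : G.ok b) (hbs : b.s ∈ A) (hbt : b.t ∉ A) : TreeOK G A Y b := by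
  by_contra hno
  -- trivial system
  let W0 : Set (List (Dart V E)) := {l | ∃ d, (G.del {b.e}).ok d ∧ d.s ∈ A ∧ d.t ∉ A ∧ l = [d]}
  have hW0 : Sys (G.del {b.e}) A A W0 := by
    refine ⟨?_, ?_, ?_⟩
    · rintro _ ⟨d, h1, h2, h3, rfl⟩
      exact ⟨by simp; exact ⟨h1, h2, h3⟩, d.s, h2, d.t, h3, by simp⟩
    · rintro _ ⟨d, h1, h2, h3, rfl⟩; simp
    · rintro _ ⟨d, h1, h2, h3, rfl⟩ _ ⟨d', h1', h2', h3', rfl⟩ e he he'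
      simp at he he'
      rcases ok_same h1 h1' (by rw [← he, ← he']) with rfl | rfl
      · rfl
      · exact absurd h2' h3
  have hW0f : (G.del {b.e}).cut A ⊆ used W0 := by
    rintro e ⟨d, h1, rfl, h2, h3⟩
    exact ⟨[d], ⟨d, h1, h2, h3, rfl⟩, by simp⟩
  have hU0 := hU.del_start hAY hb hbs hbt
  have hbY : b.t ∈ Y := by
    by_contra hbY
    refine hno ⟨{b.e}, A, W0, [], le_rfl, hAY, hW0, hW0f, hW0f, hU0, rfl, fun d _ h => Or.inl h, ?_, by simp⟩
    exact ⟨by simp; exact ⟨hb, hAY hbs, hbt⟩, b.s, hbs, b.t, hbY, by simp⟩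
  have h0 : TSt G A Y b {b.e} {b.t} A W0 := by
    refine ⟨le_rfl, hAY, hW0, hW0f, hW0f, hU0, rfl, fun d _ h => Or.inl h, ?_, ?_, rfl, ?_⟩
    · rintro r rfl; exact ⟨hbY, hbt⟩
    · rintro d hd h
      rcases ok_same hb hd (Eq.symm h) with rfl | rfl
      · exact Or.inl rfl
      · exact Or.inr hbs
    · rintro r rfl; exact ⟨[], by simp, by simp⟩
  obtain ⟨en, hen⟩ := (countable_darts hS).exists_eq_range ⟨b, hb⟩
  have hen1 : ∀ n, G.ok (en n) := fun n => by
    have : en n ∈ {d | G.ok d} := by rw [hen]; exact ⟨n, rfl⟩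
    exact this
  let α := {p : Set E × Set V × Set V × Set (List (Dart V E)) // TSt G A Y b p.1 p.2.1 p.2.2.1 p.2.2.2}
  have hstep : ∀ (p : α) (n : ℕ), ∃ q : α, p.1.1 ⊆ q.1.1 ∧ p.1.2.1 ⊆ q.1.2.1 ∧ p.1.2.2.1 ⊆ q.1.2.2.1 ∧
      (∀ l ∈ p.1.2.2.2, (∃ d ∈ l, d.t ∉ q.1.2.2.1) → l ∈ q.1.2.2.2) ∧
      ((en n).s ∈ p.1.2.1 → (en n).t ∈ q.1.2.1 ∨ (en n).s ∈ q.1.2.2.1 ∨ (en n).t ∈ q.1.2.2.1) := by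
    intro p n
    obtain ⟨F', R', X', W', h1, h2⟩ := p.2.step hb hbs hbt hAY hno (hen1 n)
    exact ⟨⟨(F', R', X', W'), h1⟩, h2⟩
  choose nx hnx using hstep
  obtain ⟨sq, sq0, sqs⟩ : ∃ sq : ℕ → α, sq 0 = ⟨({b.e}, {b.t}, A, W0), h0⟩ ∧
      ∀ n, sq (n+1) = nx (sq n) (Nat.unpair n).1 :=
    ⟨fun n => Nat.rec ⟨({b.e}, {b.t}, A, W0), h0⟩ (fun n p => nx p (Nat.unpair n).1) n, rfl, fun n => rfl⟩
  obtain ⟨F, hF⟩ : ∃ F : ℕ → Set E, ∀ n, F n = (sq n).1.1 := ⟨_, fun _ => rfl⟩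
  obtain ⟨R, hR⟩ : ∃ F : ℕ → Set V, ∀ n, F n = (sq n).1.2.1 := ⟨_, fun _ => rfl⟩
  obtain ⟨X, hX⟩ : ∃ F : ℕ → Set V, ∀ n, F n = (sq n).1.2.2.1 := ⟨_, fun _ => rfl⟩
  obtain ⟨W, hW⟩ : ∃ F : ℕ → Set (List (Dart V E)), ∀ n, F n = (sq n).1.2.2.2 := ⟨_, fun _ => rfl⟩
  have hst : ∀ n, TSt G A Y b (F n) (R n) (X n) (W n) := by
    intro n; rw [hF, hR, hX, hW]; exact (sq n).2
  have hs : ∀ n, F n ⊆ F (n+1) ∧ R n ⊆ R (n+1) ∧ X n ⊆ X (n+1) ∧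
      (∀ l ∈ W n, (∃ d ∈ l, d.t ∉ X (n+1)) → l ∈ W (n+1)) ∧
      ((en (Nat.unpair n).1).s ∈ R n → (en (Nat.unpair n).1).t ∈ R (n+1) ∨
        (en (Nat.unpair n).1).s ∈ X (n+1) ∨ (en (Nat.unpair n).1).t ∈ X (n+1)) := by
    intro n
    simp only [hF, hR, hX, hW, sqs]
    exact hnx _ _
  clear hF hR hX hW sqs sq0 hnx
  have mR : Monotone R := monotone_nat_of_le_succ fun n => (hs n).2.1
  have mX : Monotone X := monotone_nat_of_le_succ fun n => (hs n).2.2.1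
  have mW : ∀ n m, n ≤ m → ∀ l ∈ W n, (∃ d ∈ l, d.t ∉ X m) → l ∈ W m := by
    intro n m hnm
    induction m, hnm using Nat.le_induction with
    | base => intro l hl _; exact hl
    | succ m hm ih =>
      rintro l hl ⟨d, hd, hdt⟩
      exact (hs m).2.2.2.1 l (ih l hl ⟨d, hd, fun h => hdt ((hs m).2.2.1 h)⟩) ⟨d, hd, hdt⟩
  let Z : Set V := (⋃ n, X n) ∪ ⋃ n, R n
  have hXZ : ∀ n, X n ⊆ Z := fun n v hv => Or.inl (Set.mem_iUnion.2 ⟨n, hv⟩)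
  have hRZ : ∀ n, R n ⊆ Z := fun n v hv => Or.inr (Set.mem_iUnion.2 ⟨n, hv⟩)
  let U : Set (List (Dart V E)) := {l | (∃ n, l ∈ W n) ∧ ∃ d ∈ l, d.t ∉ Z}
  have hmove : ∀ l ∈ U, ∀ l' ∈ U, ∃ n, l ∈ W n ∧ l' ∈ W n := by
    rintro l ⟨⟨n, hn⟩, d, hd, hdt⟩ l' ⟨⟨n', hn'⟩, d', hd', hdt'⟩
    refine ⟨max n n', mW n _ (le_max_left _ _) l hn ⟨d, hd, fun h => hdt (hXZ _ h)⟩,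
      mW n' _ (le_max_right _ _) l' hn' ⟨d', hd', fun h => hdt' (hXZ _ h)⟩⟩
  have hUsys : Sys G A Z U := by
    refine ⟨?_, ?_, ?_⟩
    · rintro l ⟨⟨n, hn⟩, d, hd, hdt⟩
      have hsw := (hst n).sys.of_del.sw l hn
      obtain ⟨c, m, rfl, hm1, hm2⟩ := hsw.snoc (hst n).AX
      obtain ⟨w1, x, hx, y, hy, hc⟩ := hsw
      refine ⟨fun a ha => ⟨(w1 a ha).1, hXZ n (w1 a ha).2.1, (w1 a ha).2.2⟩, x, hx, y, ?_, hc⟩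
      have : d = c := by
        rcases List.mem_append.1 hd with h | h
        · exact absurd (hXZ n (hm2 d h)) hdt
        · simpa using h
      obtain ⟨z, _, hz⟩ := Ch_append.1 hc
      have hz2 : c.t = y := hz.2
      rwa [← hz2, ← this]
    · rintro l ⟨⟨n, hn⟩, _⟩; exact (hst n).sys.nodup l hn
    · intro l hl l' hl' e he he'
      obtain ⟨n, h1, h2⟩ := hmove l hl l' hl'
      exact (hst n).sys.disj l h1 l' h2 e he he'
  have hAZ : A ⊆ Z := (hst 0).AX.trans (hXZ 0)
  have hfar : G.cut Z ⊆ used U := by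
    rintro e ⟨d, hd, rfl, hds, hdt⟩
    have hdF : ∀ n, d.e ∉ F n := by
      intro n h
      rcases (hst n).FR d hd h with h | h
      · exact hdt (hRZ n h)
      · exact hdt (hAZ h)
    have hdX : d.s ∈ ⋃ n, X n := by
      rcases hds with h | h
      · exact h
      · obtain ⟨n, hn⟩ := Set.mem_iUnion.1 h
        have : d ∈ {d | G.ok d} := hd
        rw [hen] at this
        obtain ⟨k, rfl⟩ := this
        have := (hs (Nat.pair k n)).2.2.2.2
        rw [Nat.unpair_pair] at this
        rcases this (mR (Nat.right_le_pair k n) hn) with h | h | h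
        · exact absurd (hRZ _ h) hdt
        · exact Set.mem_iUnion.2 ⟨_, h⟩
        · exact absurd (hXZ _ h) hdt
    obtain ⟨n, hn⟩ := Set.mem_iUnion.1 hdX
    have hdok : (G.del (F n)).ok d := ok_del.2 ⟨hd, hdF n⟩
    have hcut := hdok.mem_cut.2 (Or.inl ⟨hn, fun h => hdt (hXZ n h)⟩)
    obtain ⟨l, hl, he⟩ := (hst n).far hcut
    obtain ⟨a, ha, hae, hat⟩ := ((hst n).sys.sw l hl).dartX he hcut
    have had : a = d := by
      rcases ok_same hdok (((hst n).sys.sw l hl).1 a ha).1 hae.symm with h | h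
      · exact h
      · rw [h] at hat; exact absurd hn hat
    exact ⟨l, ⟨⟨n, hl⟩, d, had ▸ ha, hdt⟩, he⟩
  have hZY : Z ⊆ Y := by
    rintro v (h | h)
    · obtain ⟨n, hn⟩ := Set.mem_iUnion.1 h; exact (hst n).XY hn
    · obtain ⟨n, hn⟩ := Set.mem_iUnion.1 h; exact ((hst n).RY v hn).1
  obtain ⟨l, ⟨⟨n, hn⟩, _⟩, hl⟩ := hU Z U ⟨hAZ, hZY, hUsys, hfar⟩ (hb.mem_cut.2 (Or.inl ⟨hbs, hbt⟩))
  exact (hst n).sys.used_del _ ⟨l, hn, hl⟩ (hst n).bF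


def Good (G : MG V E) (A Y : Set V) : Prop := ∃ X W, A ⊆ X ∧ X ⊆ Y ∧ Sys G A X W ∧
  G.cut X ⊆ used W ∧ G.cut A ⊆ used W ∧ UnH G X Y

lemma Good.step {G : MG V E} (hS : G.S.Countable) {A Y : Set V} (hG : Good G A Y)
    {e : E} (he : e ∈ G.cut A) : ∃ D P, IsSW G A Y P ∧ e ∈ edges P ∧ (∀ f ∈ edges P, f ∈ D) ∧
      Good (G.del D) A Y ∧ ∀ f ∈ G.cut A, f ∈ D → f = e := by
  obtain ⟨X, W, hAX, hXY, hW, hfar, hnear, hU⟩ := hG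
  obtain ⟨l, hl, hel⟩ := hnear he
  obtain ⟨b, l1, rfl, hbt, hl1⟩ := (hW.sw l hl).snoc hAX
  have hb := (hW.sw _ hl).1 b (by simp)
  obtain ⟨F, X', Q, P, h1, h2, h3, h4, h5, h6, h7, h8, h9, h10⟩ := tree hS hXY hU hb.1 hb.2.1 hbt
  have hAY := hAX.trans hXY
  -- edges of l1 lie inside X
  have hin : ∀ d ∈ l1, G.ok d ∧ d.s ∈ X ∧ d.t ∈ X := fun d hd =>
    ⟨((hW.sw _ hl).1 d (by simp [hd])).1, ((hW.sw _ hl).1 d (by simp [hd])).2.1, hl1 d hd⟩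
  have hin' : ∀ d, G.ok d → d.e ∈ edges l1 → d.s ∈ X ∧ d.t ∈ X := by
    intro d hd hde
    obtain ⟨d', hd', he'⟩ := mem_edges.1 hde
    obtain ⟨o1, o2, o3⟩ := hin d' hd'
    rcases ok_same o1 hd he' with rfl | rfl
    · exact ⟨o2, o3⟩
    · exact ⟨o3, o2⟩
  have hnd := hW.nodup _ hl
  -- start edges in D
  have hfirst : ∀ f ∈ G.cut A, f ∈ edges (l1 ++ [b]) → f = e := by
    intro f hf hfl
    obtain ⟨d1, q1, rfl, q2⟩ := (hW.sw _ hl).dartA hfl hf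
    obtain ⟨d2, q3, rfl, q4⟩ := (hW.sw _ hl).dartA hel he
    obtain ⟨c, m, hm, hm1, hm2⟩ := (hW.sw _ hl).cons hAX
    have aux : ∀ x ∈ l1 ++ [b], x.s ∈ A → x = c := by
      intro x hx hxA
      rw [hm] at hx
      rcases List.mem_cons.1 hx with h | h
      · exact h
      · exact absurd hxA (hm2 _ h)
    rw [aux d1 q1 q2, aux d2 q3 q4]
  refine ⟨F ∪ {f | f ∈ edges l1}, l1 ++ b :: P, ?_, ?_, ?_, ?_, ?_⟩
  · obtain ⟨w1, x, hx, y, hy, hc⟩ := hW.sw _ hl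
    obtain ⟨q1, x', hx', y', hy', hc'⟩ := h9
    obtain ⟨z, hz1, hz2⟩ := Ch_append.1 hc
    refine ⟨fun d hd => ?_, x, hx, y', hy', hz1.append ⟨hz2.1, hc'.2⟩⟩
    rcases List.mem_append.1 hd with h | h
    · have := w1 d (by simp [h])
      exact ⟨this.1, hXY this.2.1, this.2.2⟩
    · exact ⟨(q1 d h).1, (q1 d h).2.1, fun h' => (q1 d h).2.2 (hAX h')⟩
  · simp only [edges_append, edges_cons, edges_nil, List.mem_append, List.mem_cons] at hel ⊢
    simp at hel; tauto
  · intro f hf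
    simp only [edges_append, edges_cons, List.mem_append, List.mem_cons] at hf
    rcases hf with h | rfl | h
    · exact Or.inr h
    · exact Or.inl h7
    · obtain ⟨d, hd, rfl⟩ := mem_edges.1 h
      exact Or.inl (h10 d hd)
  · -- composition
    have hW0 : Sys (G.del (F ∪ {f | f ∈ edges l1})) A X (W \ {l1 ++ [b]}) := by
      refine (hW.sub Set.sdiff_subset).to_del ?_
      rintro f ⟨m, hm, hfm⟩ (h | h)
      · obtain ⟨d, hd, rfl⟩ := mem_edges.1 hfm
        have hd' := (hW.sw _ hm.1).1 d hd
        rcases h8 d hd'.1 h with h | h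
        · exact hm.2 (hW.disj _ hm.1 _ hl b.e (h ▸ hfm) (by simp))
        · exact h.1 hd'.2.1
      · exact hm.2 (hW.disj _ hm.1 _ hl f hfm (by simp only [edges_append, List.mem_append]; exact Or.inl h))
    have hQ0 : Sys (G.del (F ∪ {f | f ∈ edges l1})) X X' Q := by
      rw [← del_del]
      refine h3.to_del ?_
      rintro f ⟨m, hm, hfm⟩ h
      obtain ⟨d, hd, rfl⟩ := mem_edges.1 hfm
      have hd' := (h3.sw _ hm).1 d hd
      exact hd'.2.2 (hin' d (ok_del.1 hd'.1).1 h).2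
    obtain ⟨Z, z1, z2, z3, z4⟩ := hW0.comp hAX h1 hQ0
    have hcut : ∀ S, (G.del (F ∪ {f | f ∈ edges l1})).cut S ⊆ (G.del F).cut S := by
      intro S; rw [cut_del, cut_del]; exact fun f hf => ⟨hf.1, fun h => hf.2 (Or.inl h)⟩
    refine ⟨X', Z, hAX.trans h1, h2, z1, ?_, ?_, ?_⟩
    · intro f hf
      refine z4 ?_ f hf (h4 (hcut _ hf))
      intro f1 hf1 _
      have hf1' := (cut_del ▸ hf1)
      obtain ⟨m, hm, hfm⟩ := hfar hf1'.1
      refine ⟨m, ⟨hm, ?_⟩, hfm⟩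
      rintro rfl
      simp only [edges_append, List.mem_append, edges_cons, edges_nil, List.mem_singleton] at hfm
      rcases hfm with h | h
      · exact hf1'.2 (Or.inr h)
      · rw [h] at hf1'; exact hf1'.2 (Or.inl h7)
    · intro f hf
      have hf' := (cut_del ▸ hf)
      refine z3 ?_ f hf ?_
      · intro f1 hf1 _
        exact h5 (hcut _ hf1)
      · obtain ⟨m, hm, hfm⟩ := hnear hf'.1
        refine ⟨m, ⟨hm, ?_⟩, hfm⟩
        rintro rfl
        simp only [edges_append, List.mem_append, edges_cons, edges_nil, List.mem_singleton] at hfm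
        rcases hfm with h | h
        · exact hf'.2 (Or.inr h)
        · rw [h] at hf'; exact hf'.2 (Or.inl h7)
    · rw [← del_del]
      refine h6.del_in ?_
      intro d hd hde
      have := hin' d (ok_del.1 hd).1 hde
      exact ⟨h1 this.1, h1 this.2⟩
  · rintro f hf (h | h)
    · obtain ⟨d, hd, rfl, hs, ht⟩ := hf
      rcases h8 d hd h with h' | h'
      · refine hfirst d.e (hd.mem_cut.2 (Or.inl ⟨hs, ht⟩)) (by rw [h']; simp)
      · exact absurd (hAX hs) h'.1
    · refine hfirst f hf ?_
      simp only [edges_append, List.mem_append]; exact Or.inl h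

lemma B_omega {G : MG V E} (hS : G.S.Countable) {A Y : Set V} (hAY : A ⊆ Y) (hU : UnH G A Y) :
    Linked G A Y := by
  by_cases hne : (G.cut A).Nonempty
  swap
  · refine ⟨∅, ⟨by simp, by simp, by simp⟩, ?_⟩
    rw [Set.not_nonempty_iff_eq_empty.1 hne]; simp
  obtain ⟨en, hen⟩ := (hS.mono (G.cut_sub A)).exists_eq_range hne
  have h0 : Good (G.del ∅) A Y := by
    rw [del_empty]
    refine ⟨A, {l | ∃ d, G.ok d ∧ d.s ∈ A ∧ d.t ∉ A ∧ l = [d]}, le_rfl, hAY, ⟨?_, ?_, ?_⟩, ?_, ?_, hU⟩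
    · rintro _ ⟨d, h1, h2, h3, rfl⟩
      exact ⟨by simp; exact ⟨h1, h2, h3⟩, d.s, h2, d.t, h3, by simp⟩
    · rintro _ ⟨d, h1, h2, h3, rfl⟩; simp
    · rintro _ ⟨d, h1, h2, h3, rfl⟩ _ ⟨d', h1', h2', h3', rfl⟩ e he he'
      simp at he he'
      rcases ok_same h1 h1' (by rw [← he, ← he']) with rfl | rfl
      · rfl
      · exact absurd h2' h3
    all_goals
      rintro e ⟨d, h1, rfl, h2, h3⟩
      exact ⟨[d], ⟨d, h1, h2, h3, rfl⟩, by simp⟩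
  let α := {D : Set E // Good (G.del D) A Y}
  have hstep : ∀ (p : α) (n : ℕ), ∃ q : α, p.1 ⊆ q.1 ∧ (en n ∈ p.1 ∨ ∃ P, IsSW (G.del p.1) A Y P ∧
      en n ∈ edges P ∧ (∀ f ∈ edges P, f ∈ q.1)) ∧ ∀ f ∈ G.cut A, f ∈ q.1 → f ∈ p.1 ∨ f = en n := by
    intro p n
    by_cases hD : en n ∈ p.1
    · exact ⟨p, le_rfl, Or.inl hD, fun f _ h => Or.inl h⟩
    · have hc : en n ∈ (G.del p.1).cut A := by
        rw [cut_del]; refine ⟨?_, hD⟩; rw [hen]; exact ⟨n, rfl⟩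
      obtain ⟨D, P, h1, h2, h3, h4, h5⟩ := Good.step (hS.mono Set.sdiff_subset) p.2 hc
      refine ⟨⟨p.1 ∪ D, by rw [← del_del]; exact h4⟩, Set.subset_union_left, Or.inr ⟨P, h1, h2,
        fun f hf => Or.inr (h3 f hf)⟩, ?_⟩
      rintro f hf (h | h)
      · exact Or.inl h
      · by_cases hf' : f ∈ p.1
        · exact Or.inl hf'
        · right; refine h5 f ?_ h; rw [cut_del]; exact ⟨hf, hf'⟩
  choose nx hnx using hstep
  obtain ⟨sq, sq0, sqs⟩ : ∃ sq : ℕ → α, sq 0 = ⟨∅, h0⟩ ∧ ∀ n, sq (n+1) = nx (sq n) n :=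
    ⟨fun n => Nat.rec ⟨∅, h0⟩ (fun n p => nx p n) n, rfl, fun n => rfl⟩
  obtain ⟨D, hD⟩ : ∃ D : ℕ → Set E, ∀ n, D n = (sq n).1 := ⟨_, fun _ => rfl⟩
  have hs : ∀ n, D n ⊆ D (n+1) ∧ (en n ∈ D n ∨ ∃ P, IsSW (G.del (D n)) A Y P ∧
      en n ∈ edges P ∧ (∀ f ∈ edges P, f ∈ D (n+1))) ∧ ∀ f ∈ G.cut A, f ∈ D (n+1) → f ∈ D n ∨ f = en n := by
    intro n; simp only [hD, sqs]; exact hnx _ _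
  have hD0 : D 0 = ∅ := by rw [hD, sq0]
  clear hD sqs sq0 hnx
  have mD : Monotone D := monotone_nat_of_le_succ fun n => (hs n).1
  have hch : ∀ n : {n // en n ∉ D n}, ∃ P, IsSW (G.del (D n)) A Y P ∧
      en n ∈ edges P ∧ (∀ f ∈ edges P, f ∈ D (n+1)) := fun n => ((hs n).2.1).resolve_left n.2
  choose P p1 p2 p3 using hch
  obtain ⟨U, u1, u2, -⟩ := mkSys hAY P (fun n => (isSW_del.1 (p1 n)).1) (by
    intro i j e hi hj
    have key : ∀ i j, e ∈ edges (P i) → e ∈ edges (P j) → ¬ i.1 < j.1 := by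
      intro i j hi hj hij
      exact (isSW_del.1 (p1 j)).2 e hj (mD hij (p3 i e hi))
    have := key i j hi hj; have := key j i hj hi
    apply Subtype.ext; omega)
  refine ⟨U, u1, fun e he => u2 e ?_ he⟩
  have he' := he
  rw [hen] at he'
  obtain ⟨n, rfl⟩ := he'
  have hex : ∀ m, en n ∈ D m → ∃ i, en n ∈ edges (P i) := by
    intro m
    induction m with
    | zero => intro h; rw [hD0] at h; exact h.elim
    | succ m ih =>
      intro h
      by_cases h1 : en n ∈ D m
      · exact ih h1
      · have h2 : en n = en m := ((hs m).2.2 _ he h).resolve_left h1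
        rw [h2] at h1 ⊢
        exact ⟨⟨m, h1⟩, p2 ⟨m, h1⟩⟩
  by_cases h1 : en n ∈ D n
  · exact hex n h1
  · exact ⟨⟨n, h1⟩, p2 ⟨n, h1⟩⟩

end LC

namespace LC
open Classical
variable {V : Type u} {E : Type v}

def BH (V : Type u) {E : Type v} (S0 : Set E) : Prop := ∀ H : MG V E, H.S ⊆ S0 → ∀ A Y : Set V, A ⊆ Y →
  Eul H (Y \ A) → Loose H A Y → Linked H A Y

lemma cut_congr {G H : MG V E} (h : ∀ d, G.ok d ↔ H.ok d) (X : Set V) : G.cut X = H.cut X := by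
  ext e; simp only [MG.cut, h]
lemma Sys.congr {G H : MG V E} (h : ∀ d, G.ok d ↔ H.ok d) {A X : Set V} {W} (hW : Sys G A X W) :
    Sys H A X W := hW.mono fun _ _ d _ hd => (h d).1 hd
lemma Linked.congr {G H : MG V E} (h : ∀ d, G.ok d ↔ H.ok d) {A X : Set V} (hW : Linked G A X) :
    Linked H A X := by
  obtain ⟨W, h1, h2⟩ := hW
  exact ⟨W, h1.congr h, by rw [← cut_congr h]; exact h2⟩
lemma Eul.congr {G H : MG V E} (h : ∀ d, G.ok d ↔ H.ok d) {N : Set V} (hW : Eul G N) :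
    Eul H N := by
  intro X hX; rw [← cut_congr h]; exact hW X hX

noncomputable def MG.split (G : MG V E) (e f : E) (u w : V) : MG V E :=
  ⟨fun x => if x = e then s(u, w) else G.I x, G.S \ {f}⟩

lemma ok_split {G : MG V E} {e f : E} {u w : V} (he : e ∈ G.S) (hef : e ≠ f)
    {d : Dart V E} : (G.split e f u w).ok d ↔ (d.e ≠ e ∧ d.e ≠ f ∧ G.ok d) ∨
      (d = ⟨u, e, w⟩ ∨ d = ⟨w, e, u⟩) := by
  rcases d with ⟨s, g, t⟩
  simp only [MG.ok, MG.split, Set.mem_diff, Set.mem_singleton_iff, Dart.mk.injEq]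
  by_cases h : g = e
  · subst h
    simp only [if_true, Sym2.eq_iff]
    simp [he, hef]
    grind
  · simp [h]; tauto

lemma replLast {G1 G : MG V E} {A X : Set V} (hAX : A ⊆ X) {W} (hW : Sys G1 A X W) {e f : E} {w u : V}
    {r : List (Dart V E)} (hu : u ∉ X)
    (hok : ∀ d, G1.ok d → d.s ∈ X → d.e ≠ e → G.ok d ∧ d.e ≠ f)
    (he1 : ∀ d, G1.ok d → d.e = e → d = ⟨w, e, u⟩ ∨ d = ⟨u, e, w⟩) (hr : ∃ y ∉ X, Ch w r y)
    (hr2 : ∀ d ∈ r, G.ok d ∧ d.s ∈ X ∧ d.t ∉ A ∧ (d.e = e ∨ d.e = f)) :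
    ∃ W', Sys G A X W' ∧ used W' ⊆ used W ∪ {e, f} ∧ ∀ e', e' ∈ G.cut X ∨ e' ∈ G.cut A →
      ((e' ∈ used W ∧ e' ≠ e) ∨ (e ∈ used W ∧ e' ∈ edges r)) → e' ∈ used W' := by
  let F : W → List (Dart V E) := fun l => if e ∈ edges l.1 then l.1.dropLast ++ r else l.1
  have key : ∀ l ∈ W, e ∈ edges l → ∃ m, l = m ++ [⟨w, e, u⟩] ∧ e ∉ edges m := by
    intro l hl hel
    obtain ⟨b, m, rfl, hb, hm⟩ := (hW.sw l hl).snoc hAX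
    have hnd := hW.nodup _ hl
    obtain ⟨d, hd, hde⟩ := mem_edges.1 hel
    have hd' := (hW.sw _ hl).1 d hd
    have hdd : d = ⟨w, e, u⟩ := by
      rcases he1 d hd'.1 hde with h | h
      · exact h
      · rw [h] at hd'; exact absurd hd'.2.1 hu
    have hdb : d = b := by
      rcases List.mem_append.1 hd with h | h
      · have := hm d h; rw [hdd] at this; exact absurd this hu
      · simpa using h
    refine ⟨m, by rw [← hdb, hdd], fun h => ?_⟩
    rw [edges_append, List.nodup_append] at hnd
    exact hnd.2.2 e h b.e (by simp) (by rw [← hdb]; exact hde.symm)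
  have hF1 : ∀ l m, (hl : l ∈ W) → l = m ++ [⟨w, e, u⟩] → F ⟨l, hl⟩ = m ++ r := by
    intro l m hl h
    have : e ∈ edges l := by rw [h]; simp
    simp only [F, this, if_true]; rw [h]; simp
  have hF2 : ∀ l, (hl : l ∈ W) → e ∉ edges l → F ⟨l, hl⟩ = l := by
    intro l hl h; simp [F, h]
  have hokl : ∀ l ∈ W, ∀ d ∈ l, d.e ≠ e → G.ok d ∧ d.s ∈ X ∧ d.t ∉ A ∧ d.e ≠ f := by
    intro l hl d hd hde
    have := (hW.sw l hl).1 d hd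
    have h2 := hok d this.1 this.2.1 hde
    exact ⟨h2.1, this.2.1, this.2.2, h2.2⟩
  have hsw : ∀ i, IsSW G A X (F i) := by
    rintro ⟨l, hl⟩
    obtain ⟨w1, x, hx, y, hy, hc⟩ := hW.sw l hl
    by_cases hel : e ∈ edges l
    · obtain ⟨m, rfl, hm⟩ := key l hl hel
      rw [hF1 _ m hl rfl]
      obtain ⟨y', hy', hc'⟩ := hr
      obtain ⟨z, hz1, hz2⟩ := Ch_append.1 hc
      have : w = z := hz2.1
      subst this
      refine ⟨fun d hd => ?_, x, hx, y', hy', hz1.append hc'⟩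
      rcases List.mem_append.1 hd with h | h
      · have := hokl _ hl d (by simp [h]) (fun h' => hm (h' ▸ mem_edges_of h))
        exact ⟨this.1, this.2.1, this.2.2.1⟩
      · exact ⟨(hr2 d h).1, (hr2 d h).2.1, (hr2 d h).2.2.1⟩
    · rw [hF2 l hl hel]
      refine ⟨fun d hd => ?_, x, hx, y, hy, hc⟩
      have := hokl _ hl d hd (fun h' => hel (h' ▸ mem_edges_of hd))
      exact ⟨this.1, this.2.1, this.2.2.1⟩
  have hnf : ∀ l ∈ W, f ∈ edges l → f = e := by
    intro l hl h
    by_contra hfe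
    obtain ⟨d, hd, hde⟩ := mem_edges.1 h
    exact (hokl l hl d hd (by rw [hde]; exact hfe)).2.2.2 hde
  have hedge : ∀ i e', e' ∈ edges (F i) → (e' ∈ edges i.1 ∧ e' ≠ e) ∨ ((e' = e ∨ e' = f) ∧ e ∈ edges i.1) := by
    rintro ⟨l, hl⟩ e' he'
    by_cases hel : e ∈ edges l
    · obtain ⟨m, rfl, hm⟩ := key l hl hel
      rw [hF1 _ m hl rfl, edges_append, List.mem_append] at he'
      rcases he' with h | h
      · left; exact ⟨by simp [h], fun h' => hm (h' ▸ h)⟩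
      · right
        obtain ⟨d, hd, rfl⟩ := mem_edges.1 h
        exact ⟨(hr2 d hd).2.2.2, hel⟩
    · rw [hF2 l hl hel] at he'
      exact Or.inl ⟨he', fun h => hel (h ▸ he')⟩
  obtain ⟨U, u1, u2, u3, u4⟩ := mkSys hAX F hsw (by
    intro i j e' hi hj
    apply Subtype.ext
    rcases hedge i e' hi with ⟨a, a'⟩ | ⟨a, a'⟩ <;> rcases hedge j e' hj with ⟨b, b'⟩ | ⟨b, b'⟩
    · exact hW.disj _ i.2 _ j.2 e' a b
    · rcases b with b | b
      · exact absurd b a'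
      · subst b; exact absurd (hnf _ i.2 a) a'
    · rcases a with a | a
      · exact absurd a b'
      · subst a; exact absurd (hnf _ j.2 b) b'
    · exact hW.disj _ i.2 _ j.2 e a' b')
  refine ⟨U, u1, ?_, ?_⟩
  · rintro e' ⟨l, hl, hel⟩
    obtain ⟨i, hi⟩ := u4 l hl
    rcases hedge i e' (edges_sub hi hel) with ⟨a, a'⟩ | ⟨a, a'⟩
    · exact Or.inl ⟨_, i.2, a⟩
    · exact Or.inr a
  · intro e' hc hor
    have hex : ∃ i, e' ∈ edges (F i) := by
      rcases hor with ⟨⟨l, hl, hel⟩, hne⟩ | ⟨⟨l, hl, hel⟩, h2⟩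
      · refine ⟨⟨l, hl⟩, ?_⟩
        by_cases h : e ∈ edges l
        · obtain ⟨m, rfl, hm⟩ := key l hl h
          rw [hF1 _ m hl rfl]
          simp at hel ⊢; tauto
        · rw [hF2 l hl h]; exact hel
      · refine ⟨⟨l, hl⟩, ?_⟩
        obtain ⟨m, rfl, hm⟩ := key l hl hel
        rw [hF1 _ m hl rfl]; simp [h2]
    rcases hc with hc | hc
    · exact u3 e' hex hc
    · exact u2 e' hex hc

section split
variable {G : MG V E} {e f : E} {u v w : V}

lemma cut_split (he : G.ok ⟨u, e, v⟩) (hf : G.ok ⟨v, f, w⟩) (hef : e ≠ f) {X : Set V} {g : E} :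
    g ∈ (G.split e f u w).cut X ↔ (g ≠ e ∧ g ≠ f ∧ g ∈ G.cut X) ∨
      (g = e ∧ ((u ∈ X ∧ w ∉ X) ∨ (w ∈ X ∧ u ∉ X))) := by
  constructor
  · rintro ⟨d, hd, rfl, hs, ht⟩
    rcases (ok_split he.1 hef).1 hd with h | h | h
    · exact Or.inl ⟨h.1, h.2.1, d, h.2.2, rfl, hs, ht⟩
    · right; subst h; exact ⟨rfl, Or.inl ⟨hs, ht⟩⟩
    · right; subst h; exact ⟨rfl, Or.inr ⟨hs, ht⟩⟩
  · rintro (⟨h1, h2, d, hd, rfl, hs, ht⟩ | ⟨rfl, h | h⟩)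
    · exact ⟨d, (ok_split he.1 hef).2 (Or.inl ⟨h1, h2, hd⟩), rfl, hs, ht⟩
    · exact ⟨⟨u, g, w⟩, (ok_split he.1 hef).2 (Or.inr (Or.inl rfl)), rfl, h.1, h.2⟩
    · exact ⟨⟨w, g, u⟩, (ok_split he.1 hef).2 (Or.inr (Or.inr rfl)), rfl, h.1, h.2⟩

lemma cut_e (he : G.ok ⟨u, e, v⟩) {X : Set V} : e ∈ G.cut X ↔ (u ∈ X ∧ v ∉ X) ∨ (u ∉ X ∧ v ∈ X) :=
  he.mem_cut

lemma Eul.split (he : G.ok ⟨u, e, v⟩) (hf : G.ok ⟨v, f, w⟩) (hef : e ≠ f) {N : Set V} (hu : u ∉ N)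
    (hE : Eul G N) : Eul (G.split e f u w) N := by
  intro X hX hfin
  have huX : u ∉ X := fun h => hu (hX h)
  have ce := cut_e he (X := X)
  have cf := cut_e hf (X := X)
  have cs := fun g => cut_split he hf hef (X := X) (g := g)
  by_cases hv : v ∈ X <;> by_cases hw : w ∈ X
  · have : (G.split e f u w).cut X = G.cut X := by
      ext g; rw [cs]
      by_cases h1 : g = e
      · subst h1; simp [ce, huX, hv, hw]
      · by_cases h2 : g = f
        · subst h2; simp [cf, h1, hv, hw]
        · simp [h1, h2]
    rw [this] at hfin ⊢; exact hE X hX hfin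
  · have h1 : G.cut X = (G.split e f u w).cut X ∪ {e, f} := by
      ext g; rw [Set.mem_union, cs]
      by_cases h1 : g = e
      · subst h1; simp [ce, huX, hv]
      · by_cases h2 : g = f
        · subst h2; simp [cf, hv, hw]
        · simp [h1, h2]
    have h2 : Disjoint ((G.split e f u w).cut X) {e, f} := by
      rw [Set.disjoint_left]
      intro g hg hg'
      rw [cs] at hg
      rcases hg' with rfl | hg'
      · simp [huX, hw] at hg
      · rw [Set.mem_singleton_iff] at hg'; subst hg'; simp [Ne.symm hef] at hg
    have h3 := hE X hX (by rw [h1]; exact hfin.union (by simp))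
    rw [h1, Set.ncard_union_eq h2 hfin (by simp), Set.ncard_pair hef] at h3
    simpa [Nat.even_add] using h3
  · have hinj : (G.split e f u w).cut X = (fun g => if g = f then e else g) '' G.cut X := by
      ext g; rw [cs, Set.mem_image]
      constructor
      · rintro (⟨h1, h2, h3⟩ | ⟨h1, h2⟩)
        · exact ⟨g, h3, by simp [h2]⟩
        · exact ⟨f, cf.2 (by tauto), by simp [h1]⟩
      · rintro ⟨g', h1, h2⟩
        by_cases h : g' = f
        · subst h; simp at h2; right; exact ⟨h2.symm, Or.inr ⟨hw, huX⟩⟩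
        · simp [h] at h2; subst h2
          have : g' ≠ e := by rintro rfl; rw [ce] at h1; tauto
          exact Or.inl ⟨this, h, h1⟩
    have hio : Set.InjOn (fun g => if g = f then e else g) (G.cut X) := by
      have hne : e ∉ G.cut X := by rw [ce]; tauto
      intro a ha b hb hab
      have : a ≠ e := fun h => hne (h ▸ ha)
      have : b ≠ e := fun h => hne (h ▸ hb)
      simp only at hab
      split_ifs at hab <;> grind
    rw [hinj] at hfin ⊢
    rw [Set.ncard_image_of_injOn hio]
    exact hE X hX ((Set.finite_image_iff hio).1 hfin)
  · have : (G.split e f u w).cut X = G.cut X := by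
      ext g; rw [cs]
      by_cases h1 : g = e
      · subst h1; simp [ce, huX, hv, hw]
      · by_cases h2 : g = f
        · subst h2; simp [cf, h1, hv, hw]
        · simp [h1, h2]
    rw [this] at hfin ⊢; exact hE X hX hfin

lemma Linked.split_triv (he : G.ok ⟨u, e, v⟩) (hf : G.ok ⟨v, f, w⟩) (hef : e ≠ f) {A Y : Set V}
    (hAY : A ⊆ Y) (hu : u ∉ Y) (hv : v ∉ Y) (hL : Linked G A Y) : Linked (G.split e f u w) A Y := by
  obtain ⟨Q, h1, h2⟩ := hL
  have huA : u ∉ A := fun h => hu (hAY h)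
  have hvA : v ∉ A := fun h => hv (hAY h)
  have heY : ∀ d, G.ok d → d.s ∈ Y → d.e ≠ e := by
    intro d hd hs hde
    rcases ok_same he hd hde.symm with rfl | rfl
    · exact hu hs
    · exact hv hs
  by_cases hw : w ∈ Y
  · obtain ⟨W', w1, w2, w3⟩ := replLast (G := G.split e f u w) hAY h1 (e := f) (f := e) (w := w) (u := v)
      (r := [⟨w, e, u⟩]) hv
      (fun d hd hs hde => ⟨(ok_split he.1 hef).2 (Or.inl ⟨heY d hd hs, hde, hd⟩), heY d hd hs⟩)
      (fun d hd hde => (ok_same hf.rev hd hde.symm)) ⟨u, hu, by simp⟩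
      (by simp; exact ⟨(ok_split he.1 hef).2 (Or.inr (Or.inr rfl)), hw, huA⟩)
    refine ⟨W', w1, fun g hg => w3 g (Or.inr hg) ?_⟩
    rcases (cut_split he hf hef).1 hg with ⟨a, b, c⟩ | ⟨a, b⟩
    · exact Or.inl ⟨h2 c, b⟩
    · right
      have : w ∈ A := by tauto
      exact ⟨h2 ((cut_e hf).2 (Or.inr ⟨hvA, this⟩)), by simp [a]⟩
  · have hfY : ∀ d, G.ok d → d.s ∈ Y → d.e ≠ f := by
      intro d hd hs hde
      rcases ok_same hf hd hde.symm with rfl | rfl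
      · exact hv hs
      · exact hw hs
    refine ⟨Q, ⟨fun l hl => ⟨fun d hd => ⟨(ok_split he.1 hef).2 (Or.inl ?_), ((h1.sw l hl).1 d hd).2⟩,
      (h1.sw l hl).2⟩, h1.nodup, h1.disj⟩, ?_⟩
    · have := (h1.sw l hl).1 d hd
      exact ⟨heY d this.1 this.2.1, hfY d this.1 this.2.1, this.1⟩
    · intro g hg
      rcases (cut_split he hf hef).1 hg with ⟨a, b, c⟩ | ⟨a, b⟩
      · exact h2 c
      · have : w ∉ A := fun h => hw (hAY h)
        tauto

lemma fam1 (G : MG V E) {A Y : Set V} (hAY : A ⊆ Y) : ∃ X W, Wave G A Y X W ∧ Loose G X Y := by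
  obtain ⟨X, W, h1, h2⟩ := fam (ι := Unit) G (fun _ => A) (Y \ A) (fun i j h => absurd rfl h)
  have hX : X () ⊆ Y := (h1.sup ()).trans (Set.union_subset Set.sdiff_subset hAY)
  refine ⟨X (), W (), ⟨h1.sub (), hX, h1.sys (), h1.far ()⟩, ?_⟩
  convert h2 () using 1
  ext y
  have := @hX y
  have := h1.sub () (a := y)
  have h3 : (∀ x : Unit, y ∉ X x) ↔ y ∉ X () := ⟨fun h => h (), fun h _ => h⟩
  simp [h3]
  tauto

lemma Linked.split (he : G.ok ⟨u, e, v⟩) (hf : G.ok ⟨v, f, w⟩) (hef : e ≠ f) {A Y : Set V}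
    (hAY : A ⊆ Y) (hu : u ∉ Y) (hv : v ∈ Y) (hvA : v ∉ A) (hE : Eul G (Y \ A)) (hLo : Loose G A Y)
    (hBH : BH V G.S) : Linked (G.split e f u w) A Y := by
  have huA : u ∉ A := fun h => hu (hAY h)
  have hE1 : Eul (G.split e f u w) (Y \ A) := hE.split he hf hef (fun h => hu h.1)
  obtain ⟨X, W, ⟨w1, w2, w3, w4⟩, hlo⟩ := fam1 (G.split e f u w) hAY
  have huX : u ∉ X := fun h => hu (w2 h)
  obtain ⟨Q, q1, q2⟩ := hBH (G.split e f u w) Set.sdiff_subset X Y w2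
    (fun Z hZ => hE1 Z (hZ.trans (Set.sdiff_subset_sdiff_right w1))) hlo
  obtain ⟨U, u1, u2, u3, -⟩ := w3.comp w1 w2 q1
  have hgoal : (∃ a, ∀ g ∈ (G.split e f u w).cut A, g ≠ a → g ∈ used W) → Linked (G.split e f u w) A Y := by
    rintro ⟨a, ha⟩
    refine claimP hAY hE1 u1 (a := a) (fun g hg hga => u3 (fun g' hg' _ => q2 hg') g hg (ha g hg hga))
  have cs := fun Z g => cut_split he hf hef (X := Z) (g := g)
  have hok1 : ∀ d, (G.split e f u w).ok d → d.e ≠ e → G.ok d ∧ d.e ≠ f := by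
    intro d hd hde
    rcases (ok_split he.1 hef).1 hd with h | h | h
    · exact ⟨h.2.2, h.2.1⟩
    · subst h; exact absurd rfl hde
    · subst h; exact absurd rfl hde
  have hUnH := hLo.unH
  by_cases hw : w ∈ X
  · -- the walk through e is rerouted
    have heW : e ∈ used W := w4 ((cs X e).2 (Or.inr ⟨rfl, Or.inr ⟨hw, huX⟩⟩))
    obtain ⟨r, hr, hr2, hr3⟩ : ∃ r : List (Dart V E), (∃ y ∉ X, Ch w r y) ∧
        (∀ d ∈ r, G.ok d ∧ d.s ∈ X ∧ d.t ∉ A ∧ (d.e = e ∨ d.e = f)) ∧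
        ∀ g ∈ G.cut X, (g = e ∨ g = f) → g ∈ edges r := by
      by_cases hvX : v ∈ X
      · refine ⟨[⟨w, f, v⟩, ⟨v, e, u⟩], ⟨u, huX, by simp⟩, ?_, ?_⟩
        · simp only [List.mem_cons, List.not_mem_nil, or_false]
          rintro d (rfl | rfl)
          · exact ⟨hf.rev, hw, hvA, Or.inr rfl⟩
          · exact ⟨he.rev, hvX, huA, Or.inl rfl⟩
        · rintro g hg (rfl | rfl) <;> simp
      · refine ⟨[⟨w, f, v⟩], ⟨v, hvX, by simp⟩, ?_, ?_⟩
        · simp only [List.mem_singleton]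
          rintro d rfl
          exact ⟨hf.rev, hw, hvA, Or.inr rfl⟩
        · rintro g hg (rfl | rfl)
          · rw [cut_e he] at hg; tauto
          · simp
    obtain ⟨W', x1, x2, x3⟩ := replLast (G := G) w1 w3 (e := e) (f := f) (w := w) (u := u) huX
      (fun d hd _ hde => hok1 d hd hde) (fun d hd hde => by
        rcases (ok_split he.1 hef).1 hd with h | h | h
        · exact absurd hde h.1
        · exact Or.inr h
        · exact Or.inl h) hr hr2
    have hfull := hUnH X W' ⟨w1, w2, x1, fun g hg => x3 g (Or.inl hg) ?_⟩
    · refine hgoal ⟨e, fun g hg hge => ?_⟩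
      rcases (cs A g).1 hg with ⟨a, b, c⟩ | ⟨a, b⟩
      · rcases x2 (hfull c) with h | h | h
        · exact h
        · exact absurd h a
        · exact absurd h b
      · exact absurd a hge
    · by_cases h : g = e ∨ g = f
      · exact Or.inr ⟨heW, hr3 g hg h⟩
      · push Not at h
        exact Or.inl ⟨w4 ((cs X g).2 (Or.inl ⟨h.1, h.2, hg⟩)), h.1⟩
  · have hwA : w ∉ A := fun h => hw (w1 h)
    have heX : ∀ d, (G.split e f u w).ok d → d.s ∈ X → d.e ≠ e := by
      intro d hd hs hde
      rcases (ok_split he.1 hef).1 hd with h | h | h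
      · exact h.1 hde
      · subst h; exact huX hs
      · subst h; exact hw hs
    have hWG : Sys G A X W := ⟨fun l hl => ⟨fun d hd => ⟨(hok1 d ((w3.sw l hl).1 d hd).1
      (heX d ((w3.sw l hl).1 d hd).1 ((w3.sw l hl).1 d hd).2.1)).1, ((w3.sw l hl).1 d hd).2⟩,
      (w3.sw l hl).2⟩, w3.nodup, w3.disj⟩
    have hused : ∀ g ∈ used W, g ≠ e ∧ g ≠ f := by
      rintro g ⟨l, hl, hg⟩
      obtain ⟨d, hd, rfl⟩ := mem_edges.1 hg
      have h0 := (w3.sw l hl).1 d hd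
      have h1 := heX d h0.1 h0.2.1
      exact ⟨h1, (hok1 d h0.1 h1).2⟩
    have hcA : ∀ g, g ∈ (G.split e f u w).cut A → g ∈ G.cut A := by
      intro g hg
      rcases (cs A g).1 hg with ⟨a, b, c⟩ | ⟨a, b⟩
      · exact c
      · tauto
    have hfar : ∀ g ∈ G.cut X, g ≠ e → g ≠ f → g ∈ used W := fun g hg h1 h2 =>
      w4 ((cs X g).2 (Or.inl ⟨h1, h2, hg⟩))
    by_cases hvX : v ∈ X
    · -- use reachability
      have hmis : ∀ W' : Set (List (Dart V E)), Sys G A X W' → (∀ d, G.ok d → d.s ∈ A ∪ Reach G A X W' →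
          d.t ∉ X → d.e ∈ used W') → G.cut A ⊆ used W' := by
        intro W' hW' hfull g hg
        obtain ⟨f1, f2, f3⟩ := fact2 w1 hW' hfull
        have := hUnH _ _ ⟨Set.subset_union_left, (Set.union_subset w1
          (fun v hv => (reach_sub hv).1)).trans w2, f1, f2⟩ hg
        exact (f3 g hg).1 this
      have hsX : ∀ W' v', v' ∈ A ∪ Reach G A X W' → v' ∈ X := by
        rintro W' v' (h | h)
        · exact w1 h
        · exact (reach_sub h).1
      by_cases hr : v ∈ A ∪ Reach G A X W
      · obtain ⟨W1, a, a1, a2, a3, a4, a5⟩ := augment w1 hWG (d := ⟨v, e, u⟩) he.rev hr huX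
          (fun h => (hused _ h).1 rfl)
        have hfu : f ∉ used W1 := by
          intro h
          rcases (a5 f ((cut_e hf).2 (Or.inl ⟨hvX, hw⟩))).1 h with h | h
          · exact (hused _ h).2 rfl
          · exact hef h.symm
        by_cases hr1 : v ∈ A ∪ Reach G A X W1
        · obtain ⟨W2, b, b1, b2, b3, b4, b5⟩ := augment w1 a1 (d := ⟨v, f, w⟩) hf hr1 hw hfu
          have hwave : Wave G A Y X W2 := by
            refine ⟨w1, w2, b1, fun g hg => (b5 g hg).2 ?_⟩
            by_cases h1 : g = f
            · exact Or.inr h1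
            · left
              refine (a5 g hg).2 ?_
              by_cases h2 : g = e
              · exact Or.inr h2
              · exact Or.inl (hfar g hg h2 h1)
          refine hgoal ⟨e, fun g hg hge => ?_⟩
          rcases (cs A g).1 hg with ⟨a, b, c⟩ | ⟨a, b⟩
          · obtain ⟨d, hd, rfl, hs, ht⟩ := c
            exact hfar d.e (hd.mem_cut.2 (Or.inl ⟨w1 hs, hLo X W2 hwave d hd hs ht⟩)) a b
          · exact absurd a hge
        · have hfull := hmis W1 a1 (by
            intro d hd hs ht
            have hc := hd.mem_cut.2 (Or.inl ⟨hsX _ _ hs, ht⟩)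
            refine (a5 d.e hc).2 ?_
            by_cases h1 : d.e = e
            · exact Or.inr h1
            · left
              refine hfar d.e hc h1 ?_
              intro h2
              rcases ok_same hf hd h2.symm with rfl | rfl
              · exact hr1 hs
              · exact ht hvX)
          refine hgoal ⟨a, fun g hg hga => ?_⟩
          rcases (a4 g (hcA g hg)).1 (hfull (hcA g hg)) with h | h
          · exact h
          · exact absurd h hga
      · have hfull := hmis W hWG (by
          intro d hd hs ht
          have hc := hd.mem_cut.2 (Or.inl ⟨hsX _ _ hs, ht⟩)
          refine hfar d.e hc ?_ ?_
          · intro h2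
            rcases ok_same he hd h2.symm with rfl | rfl
            · exact ht hvX
            · exact hr hs
          · intro h2
            rcases ok_same hf hd h2.symm with rfl | rfl
            · exact hr hs
            · exact ht hvX)
        exact hgoal ⟨e, fun g hg _ => hfull (hcA g hg)⟩
    · have hwave : Wave G A Y X W := by
        refine ⟨w1, w2, hWG, fun g hg => hfar g hg ?_ ?_⟩
        · rintro rfl; rw [cut_e he] at hg; tauto
        · rintro rfl; rw [cut_e hf] at hg; tauto
      exact hgoal ⟨e, fun g hg _ => hUnH X W hwave (hcA g hg)⟩

end split
end LC

namespace LC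
open Classical
variable {V : Type u} {E : Type v}

lemma Ext {H : MG V E} {B Y' Y : Set V} (hB : B ⊆ Y') (hY : Y' ⊆ Y) {Q} (hQ : Sys H B Y' Q)
    (r : Dart V E → List (Dart V E))
    (h1 : ∀ l ∈ Q, ∀ d ∈ l, d.t ∉ Y' → d.t ∈ Y → (∃ y ∉ Y, Ch d.t (r d) y) ∧
      ∀ g ∈ r d, H.ok g ∧ g.s ∈ Y ∧ g.t ∉ B ∧ g.e ∉ used Q)
    (h2 : ∀ l ∈ Q, ∀ l' ∈ Q, ∀ d ∈ l, ∀ d' ∈ l', d.t ∉ Y' → d.t ∈ Y → d'.t ∉ Y' → d'.t ∈ Y →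
      ∀ g, g ∈ edges (r d) → g ∈ edges (r d') → d.e = d'.e) :
    ∃ U, Sys H B Y U ∧ ∀ e ∈ H.cut B, e ∈ used Q → e ∈ used U := by
  have key : ∀ l : Q, ∃ f, IsSW H B Y f ∧ l.1 ⊆ f ∧ ∀ g ∈ edges f, g ∈ edges l.1 ∨
      ∃ d ∈ l.1, d.t ∉ Y' ∧ d.t ∈ Y ∧ g ∈ edges (r d) := by
    rintro ⟨l, hl⟩
    obtain ⟨d, l', rfl, hd, hl'⟩ := (hQ.sw l hl).snoc hB
    obtain ⟨a1, x, hx, y, hy, hc⟩ := hQ.sw _ hl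
    obtain ⟨z, hz1, hz2⟩ := Ch_append.1 hc
    have hyd : d.t = y := by simpa using hz2.2
    by_cases hdY : d.t ∈ Y
    · obtain ⟨⟨y', hy', hc'⟩, b⟩ := h1 _ hl d (by simp) hd hdY
      refine ⟨(l' ++ [d]) ++ r d, ⟨?_, x, hx, y', hy', hc.append (hyd ▸ hc')⟩, by simp, ?_⟩
      · intro g hg
        rcases List.mem_append.1 hg with h | h
        · exact ⟨(a1 g h).1, hY (a1 g h).2.1, (a1 g h).2.2⟩
        · exact ⟨(b g h).1, (b g h).2.1, (b g h).2.2.1⟩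
      · intro g hg
        rw [edges_append, List.mem_append] at hg
        rcases hg with h | h
        · exact Or.inl h
        · exact Or.inr ⟨d, by simp, hd, hdY, h⟩
    · refine ⟨l' ++ [d], ⟨fun g h => ⟨(a1 g h).1, hY (a1 g h).2.1, (a1 g h).2.2⟩, x, hx, y, hyd ▸ hdY, hc⟩,
        List.Subset.refl _, fun g hg => Or.inl hg⟩
  choose f f1 f2 f3 using key
  have hnu : ∀ l ∈ Q, ∀ d ∈ l, d.t ∉ Y' → d.t ∈ Y → ∀ g ∈ edges (r d), g ∉ used Q := by
    intro l hl d hd a b g hg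
    obtain ⟨g', hg', rfl⟩ := mem_edges.1 hg
    exact ((h1 l hl d hd a b).2 g' hg').2.2.2
  obtain ⟨U, u1, u2, -, -⟩ := mkSys (hB.trans hY) f f1 (by
    intro i j e hi hj
    apply Subtype.ext
    rcases f3 i e hi with a | ⟨d, a1, a2, a3, a4⟩ <;> rcases f3 j e hj with b | ⟨d', b1, b2, b3, b4⟩
    · exact hQ.disj _ i.2 _ j.2 e a b
    · exact absurd ⟨_, i.2, a⟩ (hnu _ j.2 d' b1 b2 b3 e b4)
    · exact absurd ⟨_, j.2, b⟩ (hnu _ i.2 d a1 a2 a3 e a4)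
    · have := h2 _ i.2 _ j.2 d a1 d' b1 a2 a3 b2 b3 e a4 b4
      exact hQ.disj _ i.2 _ j.2 d.e (mem_edges_of a1) (this ▸ mem_edges_of b1))
  exact ⟨U, u1, fun e he ⟨l, hl, hel⟩ => u2 e ⟨⟨l, hl⟩, edges_sub (f2 ⟨l, hl⟩) hel⟩ he⟩

section lift
variable {ι : Type*} {G : MG V E} {A X : ι → Set V} {N : Set V} {W : ι → Set (List (Dart V E))}

lemma FamP.cont (hF : FamP G A N X W) {i : ι} {d : Dart V E} (hd : G.ok d) (hs : d.s ∉ X i) (ht : d.t ∈ X i) :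
    ∃ m, m ++ [d.rev] ∈ W i := by
  obtain ⟨l, hl, hel⟩ := hF.far i (hd.mem_cut.2 (Or.inr ⟨hs, ht⟩))
  obtain ⟨b, m, rfl, hb, hm⟩ := (hF.sys i |>.sw l hl).snoc (hF.sub i)
  obtain ⟨d', hd', hde⟩ := mem_edges.1 hel
  have h0 := ((hF.sys i).sw _ hl).1 d' hd'
  have hdd : d' = d.rev := by
    rcases ok_same hd h0.1 hde.symm with h | h
    · subst h; exact absurd h0.2.1 hs
    · exact h
  have : d' = b := by
    rcases List.mem_append.1 hd' with h | h
    · have := hm d' h; rw [hdd] at this; exact absurd this hs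
    · simpa using h
  exact ⟨m, by rw [← hdd, this]; exact hl⟩

lemma FamP.seg (hF : FamP G A N X W) {i : ι} {m} {b : Dart V E} (h : m ++ [b] ∈ W i) (hb : b.t ∉ X i) :
    (∃ a ∈ A i, Ch a m b.s) ∧ ∀ g ∈ m, G.ok g ∧ g.s ∈ X i ∧ g.t ∈ X i ∧ g.t ∉ A i := by
  obtain ⟨a1, x, hx, y, hy, hc⟩ := (hF.sys i).sw _ h
  obtain ⟨z, hz1, hz2⟩ := Ch_append.1 hc
  have hz : b.s = z := hz2.1
  refine ⟨⟨x, hx, hz ▸ hz1⟩, fun g hg => ?_⟩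
  have h0 := a1 g (by simp [hg])
  obtain ⟨b', m', he, hb', hm'⟩ := ((hF.sys i).sw _ h).snoc (hF.sub i)
  obtain ⟨rfl, -⟩ := List.append_inj' he rfl
  exact ⟨h0.1, h0.2.1, hm' g hg, h0.2.2⟩

lemma FamP.lift (hF : FamP G A N X W) {F : Set E} {B Y' Y : Set V} (hB : B ⊆ Y') (hY : Y' ⊆ Y) {Q}
    (hQ : Sys (G.del F) B Y' Q)
    (hX : ∀ x ∈ Y, x ∉ Y' → ∃ i, x ∈ X i ∧ Disjoint (X i) Y' ∧ Disjoint (A i) Y ∧ X i \ A i ⊆ Y)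
    (hFm : ∀ i m b, m ++ [b] ∈ W i → b.t ∉ X i → b.e ∉ F → ∀ g ∈ m, g.e ∉ F) :
    ∃ U, Sys (G.del F) B Y U ∧ ∀ e ∈ (G.del F).cut B, e ∈ used Q → e ∈ used U := by
  have key : ∀ d : Dart V E, ∃ r, ∀ l ∈ Q, d ∈ l → d.t ∉ Y' → d.t ∈ Y → ∃ i m, r = revL m ∧ d.t ∈ X i ∧ d.s ∉ X i ∧
      Disjoint (X i) Y' ∧ Disjoint (A i) Y ∧ X i \ A i ⊆ Y ∧ m ++ [d.rev] ∈ W i := by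
    intro d
    by_cases h : ∃ l ∈ Q, d ∈ l ∧ d.t ∉ Y' ∧ d.t ∈ Y
    · obtain ⟨l, hl, h1, h2, h3⟩ := h
      obtain ⟨i, x1, x2, x3, x4⟩ := hX _ h3 h2
      have h0 := (hQ.sw l hl).1 d h1
      have hs : d.s ∉ X i := fun h => Set.disjoint_left.1 x2 h h0.2.1
      obtain ⟨m, hm⟩ := hF.cont (ok_del.1 h0.1).1 hs x1
      exact ⟨revL m, fun l' _ _ _ _ => ⟨i, m, rfl, x1, hs, x2, x3, x4, hm⟩⟩
    · exact ⟨[], fun l hl h1 h2 h3 => absurd ⟨l, hl, h1, h2, h3⟩ h⟩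
  choose r hr using key
  refine Ext hB hY hQ r ?_ ?_
  · intro l hl d hd h1 h2
    obtain ⟨i, m, e1, e2, e2', e3, e4, e5, e6⟩ := hr d l hl hd h1 h2
    obtain ⟨⟨a, ha, hc⟩, hs⟩ := hF.seg e6 e2'
    rw [e1]
    refine ⟨⟨a, fun h => Set.disjoint_left.1 e4 ha h, hc.rev⟩, fun g hg => ?_⟩
    have h0 := hs _ (mem_revL.1 hg)
    refine ⟨ok_del.2 ⟨h0.1.rev, ?_⟩, e5 ⟨h0.2.2.1, h0.2.2.2⟩, fun h => Set.disjoint_left.1 e3 h0.2.1 (hB h), ?_⟩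
    · exact hFm i m d.rev e6 e2' (ok_del.1 ((hQ.sw l hl).1 d hd).1).2 g.rev (mem_revL.1 hg)
    · rintro ⟨l', hl', hge⟩
      obtain ⟨g', hg', hge'⟩ := mem_edges.1 hge
      have h3 := (hQ.sw l' hl').1 g' hg'
      rcases ok_same h0.1.rev (ok_del.1 h3.1).1 hge'.symm with rfl | rfl
      · exact Set.disjoint_left.1 e3 h0.2.2.1 h3.2.1
      · exact Set.disjoint_left.1 e3 h0.2.1 h3.2.1
  · intro l hl l' hl' d hd d' hd' h1 h2 h1' h2' g hg hg'
    obtain ⟨i, m, e1, e2, e2', e3, e4, e5, e6⟩ := hr d l hl hd h1 h2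
    obtain ⟨i', m', f1, f2, f2', f3, f4, f5, f6⟩ := hr d' l' hl' hd' h1' h2'
    rw [e1, mem_edges_revL] at hg
    rw [f1, mem_edges_revL] at hg'
    obtain ⟨b, hb, rfl⟩ := mem_edges.1 hg
    obtain ⟨b', hb', hbe⟩ := mem_edges.1 hg'
    have s1 := (hF.seg e6 e2').2 b hb
    have s2 := (hF.seg f6 f2').2 b' hb'
    have hii : i = i' := by
      by_contra hne
      have := Set.disjoint_left.1 (hF.disj i i' hne)
      rcases ok_same s1.1 s2.1 hbe.symm with rfl | rfl
      · exact this s1.2.1 s2.2.1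
      · exact this s1.2.1 s2.2.2.1
    subst hii
    have := (hF.sys i).disj _ e6 _ f6 b.e (by simp [mem_edges_of hb]) (by simp [hg'])
    have h3 := (List.append_inj' this rfl).2
    simp only [List.cons.injEq, and_true] at h3
    have h4 := congrArg Dart.e h3
    exact h4

/-- deleting an edge joining two vertices outside N -/
lemma Linked.del_edge {A Y : Set V} (hAY : A ⊆ Y) {d : Dart V E} (hd : G.ok d) (hs : d.s ∉ Y)
    (ht : d.t ∈ Y → d.t ∈ A) (hL : Linked G A Y) : Linked (G.del {d.e}) A Y := by
  obtain ⟨Q, h1, h2⟩ := hL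
  have key : ∀ l ∈ Q, d.e ∈ edges l → l = [d.rev] := by
    intro l hl hel
    obtain ⟨g, hg, hge⟩ := mem_edges.1 hel
    have h0 := (h1.sw l hl).1 g hg
    have hgd : g = d.rev := by
      rcases ok_same hd h0.1 hge.symm with h | h
      · subst h; exact absurd h0.2.1 hs
      · exact h
    subst hgd
    have hA := ht h0.2.1
    obtain ⟨a, l', rfl, ha, hl'⟩ := (h1.sw l hl).cons hAY
    have hda : d.rev = a := by
      rcases List.mem_cons.1 hg with h | h
      · exact h
      · exact absurd hA (hl' _ h)
    subst hda
    obtain ⟨a1, x, hx, y, hy, hc⟩ := h1.sw _ hl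
    cases l' with
    | nil => rfl
    | cons b l'' =>
      have h3 := a1 b (by simp)
      have h4 : b.s = d.s := hc.2.1
      rw [h4] at h3
      exact absurd h3.2.1 hs
  refine ⟨{l ∈ Q | d.e ∉ edges l}, (h1.sub (fun l hl => hl.1)).to_del ?_, ?_⟩
  · rintro g ⟨l, hl, hg⟩ h
    exact hl.2 (by rw [Set.mem_singleton_iff] at h; exact h ▸ hg)
  · intro g hg
    rw [cut_del] at hg
    obtain ⟨l, hl, hgl⟩ := h2 hg.1
    refine ⟨l, ⟨hl, fun h => ?_⟩, hgl⟩
    have := key l hl h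
    subst this
    exact hg.2 (by simpa using hgl)

end lift

structure OS {ι : Type*} (G : MG V E) (A : ι → Set V) (N A0 Y0 : Set V) (x0 : V) : Prop where
  dA : ∀ i j, i ≠ j → Disjoint (A i) (A j)
  dN : ∀ j, Disjoint (A j) N
  eul : Eul G N
  lk : ∀ j, Linked G (A j) (N ∪ A j)
  bh : BH V G.S
  h0 : A0 ⊆ Y0
  d0A : ∀ j, Disjoint (A j) Y0
  d0N : Disjoint A0 N
  NY : N ⊆ Y0
  xN : x0 ∉ N
  xA : ∀ j, x0 ∉ A j

structure OSW {ι : Type*} (G : MG V E) (A : ι → Set V) (A0 Y0 : Set V) (x0 : V) (P : List (Dart V E)) (y : V) : Prop where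
  ch : Ch x0 P y
  ok : ∀ d ∈ P, G.ok d
  tA : ∀ d ∈ P, d.t ∉ A0
  sA : ∀ d ∈ P, ∀ j, d.s ∉ A j
  nd : (edges P).Nodup
  lk : Linked (G.del {e | e ∈ edges P}) A0 Y0

lemma Ch.getlast {x y : V} {l : List (Dart V E)} (h : Ch x l y) (hl : l ≠ []) : ∃ m d, l = m ++ [d] ∧ d.t = y ∧ Ch x m d.s := by
  refine ⟨l.dropLast, l.getLast hl, (List.dropLast_append_getLast hl).symm, ?_⟩
  have : Ch x (l.dropLast ++ [l.getLast hl]) y := by rw [List.dropLast_append_getLast hl]; exact h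
  obtain ⟨z, h1, h2⟩ := Ch_append.1 this
  have h3 : (l.getLast hl).s = z := h2.1
  exact ⟨h2.2, h3 ▸ h1⟩

/-- lifting a walk found for the relabelled problem -/
lemma oneLift {ι : Type*} {G : MG V E} {A X : ι → Set V} {N A0 Y0 : Set V} {x0 : V} {W}
    (hO : OS G A N A0 Y0 x0) (hF : FamP G A N X W) (hWA : ∀ j, G.cut (A j) ⊆ used (W j))
    {P : List (Dart V E)} {y : V} (hy : (y ∉ N ∧ ∀ j, y ∉ X j) ∨ ∃ j, y ∈ X j) (hne : P ≠ [])
    (hP : OSW G X A0 (Y0 \ ⋃ i, X i) x0 P y)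
    (hL : ∀ j, Linked (G.del {e | e ∈ edges P}) (X j) ((N \ ⋃ i, X i) ∪ X j)) :
    ∃ R y', OSW G A A0 Y0 x0 (P ++ R) y' ∧ (∀ d ∈ R, d.s ∈ N) ∧ ((y' = y ∧ ∀ j, y ∉ X j) ∨ ∃ j, y' ∈ A j) ∧
      ∀ j, Linked (G.del {e | e ∈ edges (P ++ R)}) (A j) (N ∪ A j) := by
  have hXY : ∀ i, X i \ A i ⊆ N := fun i x hx => (hF.sup i hx.1).resolve_right hx.2
  have hX0 : ∀ i, Disjoint (X i) A0 := fun i => by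
    rw [Set.disjoint_left]; intro x hx h
    rcases hF.sup i hx with h' | h'
    · exact Set.disjoint_left.1 hO.d0N h h'
    · exact Set.disjoint_left.1 (hO.d0A i) h' (hO.h0 h)
  have hXA : ∀ i j, i ≠ j → ∀ x ∈ X i, x ∉ A j := fun i j hij x hx h =>
    Set.disjoint_left.1 (hF.disj i j hij) hx (hF.sub j h)
  obtain ⟨p, d, hpd, hdy, hcp⟩ := hP.ch.getlast hne
  have hpX : ∀ g ∈ P, ∀ j, g.t ∈ X j → g = d := by
    intro g hg j hgj
    by_contra hgd
    rw [hpd, List.mem_append] at hg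
    have hg : g ∈ p := by rcases hg with h | h
                          · exact h
                          · simp at h; exact absurd h hgd
    obtain ⟨l1, l2, rfl⟩ := List.append_of_mem hg
    have hc := hP.ch
    rw [hpd] at hc
    simp only [List.append_assoc, List.cons_append] at hc
    obtain ⟨z, -, hz⟩ := Ch_append.1 hc
    have hz2 := hz.2
    cases l2 with
    | nil =>
      have : d.s = g.t := hz2.1
      exact hP.sA d (by rw [hpd]; simp) j (this ▸ hgj)
    | cons b l2 =>
      have : b.s = g.t := hz2.1
      exact hP.sA b (by rw [hpd]; simp) j (this ▸ hgj)
  -- the extension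
  obtain ⟨m, hm⟩ : ∃ m : List (Dart V E), (∃ y', Ch y (revL m) y' ∧ ((y' = y ∧ ∀ j, y ∉ X j) ∨ ∃ j, y' ∈ A j)) ∧
      ((m = [] ∧ ∀ j, d.t ∉ X j) ∨ ∃ i, m ++ [d.rev] ∈ W i ∧ d.t ∈ X i) := by
    rcases hy with ⟨h1, h2⟩ | ⟨j, hj⟩
    · exact ⟨[], ⟨y, by simp [revL], Or.inl ⟨rfl, h2⟩⟩, Or.inl ⟨rfl, fun j => hdy ▸ h2 j⟩⟩
    · have hds := hP.sA d (by rw [hpd]; simp) j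
      obtain ⟨m, hm⟩ := hF.cont (hP.ok d (by rw [hpd]; simp)) hds (hdy ▸ hj)
      obtain ⟨⟨a, ha, hc⟩, -⟩ := hF.seg hm hds
      have hc' : Ch a m y := hdy ▸ hc
      exact ⟨m, ⟨a, hc'.rev, Or.inr ⟨j, ha⟩⟩, Or.inr ⟨j, hm, hdy ▸ hj⟩⟩
  obtain ⟨⟨y', hcy, hy'⟩, hmW⟩ := hm
  have hms : ∀ g ∈ m, ∃ i, m ++ [d.rev] ∈ W i ∧ d.t ∈ X i ∧ G.ok g ∧ g.s ∈ X i ∧ g.t ∈ X i ∧ g.t ∉ A i := by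
    intro g hg
    rcases hmW with ⟨rfl, -⟩ | ⟨i, h1, h2⟩
    · simp at hg
    · exact ⟨i, h1, h2, (hF.seg h1 (hP.sA d (by rw [hpd]; simp) i)).2 g hg⟩
  have hFdef : {e | e ∈ edges (P ++ revL m)} = {e | e ∈ edges P} ∪ {e | e ∈ edges m} := by
    ext e; simp [mem_edges_revL]
  -- a dart ok with an edge of m lies inside some X i
  have hin : ∀ g, G.ok g → g.e ∈ edges m → ∃ i, m ++ [d.rev] ∈ W i ∧ d.t ∈ X i ∧ g.s ∈ X i ∧ g.t ∈ X i := by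
    intro g hg he
    obtain ⟨b, hb, hbe⟩ := mem_edges.1 he
    obtain ⟨i, h1, h2, h3, h4, h5, h6⟩ := hms b hb
    rcases ok_same h3 hg hbe with rfl | rfl
    · exact ⟨i, h1, h2, h4, h5⟩
    · exact ⟨i, h1, h2, h5, h4⟩
  -- transfer of systems
  have htr : ∀ B Y' Q, Sys (G.del {e | e ∈ edges P}) B Y' Q → (∀ i, Disjoint (X i) Y' ∨ X i ⊆ B) →
      Sys (G.del {e | e ∈ edges (P ++ revL m)}) B Y' Q := by
    intro B Y' Q hQ hBY
    refine hQ.of_del.to_del ?_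
    rintro e ⟨l, hl, he⟩ heF
    rw [hFdef] at heF
    obtain ⟨g, hg, rfl⟩ := mem_edges.1 he
    have h0 := (hQ.sw l hl).1 g hg
    have h1 := ok_del.1 h0.1
    rcases heF with h | h
    · exact h1.2 h
    · obtain ⟨i, -, -, h2, h3⟩ := hin g h1.1 h
      rcases hBY i with h' | h'
      · exact Set.disjoint_left.1 h' h2 h0.2.1
      · exact h0.2.2 (h' h3)
  have hWF : ∀ i l, l ∈ W i → ∀ e ∈ edges l, e ∈ {e | e ∈ edges (P ++ revL m)} → ∃ b, l = m ++ [b] ∧ b.e = d.e := by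
    intro i l hl e he heF
    obtain ⟨g, hg, rfl⟩ := mem_edges.1 he
    have h0 := ((hF.sys i).sw l hl).1 g hg
    rw [hFdef] at heF
    have hdi : d.t ∈ X i ∧ (g.e = d.e ∨ g.e ∈ edges m) := by
      rcases heF with h | h
      · obtain ⟨g', hg', hge'⟩ := mem_edges.1 h
        have hs := hP.sA g' hg' i
        have ht : g'.t ∈ X i := by
          rcases ok_same (hP.ok g' hg') h0.1 hge' with rfl | rfl
          · exact absurd h0.2.1 hs
          · exact h0.2.1
        have := hpX g' hg' i ht
        subst this
        exact ⟨ht, Or.inl hge'.symm⟩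
      · obtain ⟨i', h1, h2, h3, h4⟩ := hin g h0.1 h
        have : i = i' := by
          by_contra hne
          exact Set.disjoint_left.1 (hF.disj i i' hne) h0.2.1 h3
        subst this
        exact ⟨h2, Or.inr h⟩
    rcases hmW with ⟨-, h⟩ | ⟨i', h1, h2⟩
    · exact absurd hdi.1 (h i)
    · have : i = i' := by
        by_contra hne
        exact Set.disjoint_left.1 (hF.disj i i' hne) hdi.1 h2
      subst this
      refine ⟨d.rev, (hF.sys i).disj _ hl _ h1 g.e he ?_, rfl⟩
      rcases hdi.2 with h | h
      · rw [h]; simp [edges, Dart.rev]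
      · simp [h]
  have hFm : ∀ i m' b, m' ++ [b] ∈ W i → b.t ∉ X i → b.e ∉ {e | e ∈ edges (P ++ revL m)} →
      ∀ g ∈ m', g.e ∉ {e | e ∈ edges (P ++ revL m)} := by
    intro i m' b hm' hb hbe g hg hgF
    obtain ⟨b', h1, h2⟩ := hWF i _ hm' g.e (by simp [mem_edges_of hg]) hgF
    have h3 := (List.append_inj' h1 rfl).2
    simp only [List.cons.injEq, and_true] at h3
    subst h3
    apply hbe
    rw [hFdef]; left
    rw [h2, hpd]; simp
  have hmX : ∀ g ∈ revL m, ∃ i, g.s ∈ X i ∧ g.s ∉ A i ∧ g.t ∈ X i ∧ G.ok g := by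
    intro g hg
    obtain ⟨i, h1, h2, h3, h4, h5, h6⟩ := hms _ (mem_revL.1 hg)
    exact ⟨i, h5, h6, h4, h3.rev⟩
  refine ⟨revL m, y', ⟨hP.ch.append hcy, ?_, ?_, ?_, ?_, ?_⟩, ?_, hy', ?_⟩
  · intro g hg
    rcases List.mem_append.1 hg with h | h
    · exact hP.ok g h
    · obtain ⟨i, -, -, -, h⟩ := hmX g h; exact h
  · intro g hg
    rcases List.mem_append.1 hg with h | h
    · exact hP.tA g h
    · obtain ⟨i, -, -, h1, -⟩ := hmX g h
      exact fun h => Set.disjoint_left.1 (hX0 i) h1 h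
  · intro g hg j
    rcases List.mem_append.1 hg with h | h
    · exact fun h' => hP.sA g h j (hF.sub j h')
    · obtain ⟨i, h1, h2, h3, -⟩ := hmX g h
      by_cases hij : i = j
      · exact hij ▸ h2
      · exact hXA i j hij _ h1
  · rw [edges_append, List.nodup_append]
    refine ⟨hP.nd, edges_revL_nodup ?_, ?_⟩
    · rcases hmW with ⟨rfl, -⟩ | ⟨i, h1, -⟩
      · simp
      · have := (hF.sys i).nodup _ h1
        rw [edges_append, List.nodup_append] at this
        exact this.1
    · rintro e he _ he' rfl
      obtain ⟨g, hg, rfl⟩ := mem_edges.1 he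
      obtain ⟨i, -, -, h2, -⟩ := hin g (hP.ok g hg) (mem_edges_revL.1 he')
      exact hP.sA g hg i h2
  · obtain ⟨Q, q1, q2⟩ := hP.lk
    have q3 := htr _ _ _ q1 (fun i => Or.inl (by
      rw [Set.disjoint_left]; intro x hx h; exact h.2 (Set.mem_iUnion.2 ⟨i, hx⟩)))
    obtain ⟨U, u1, u2⟩ := hF.lift (B := A0) (Y' := Y0 \ ⋃ i, X i) (Y := Y0) (fun x hx => ⟨hO.h0 hx, fun h => by
      obtain ⟨i, hi⟩ := Set.mem_iUnion.1 h
      exact Set.disjoint_left.1 (hX0 i) hi hx⟩) Set.sdiff_subset q3 (by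
        intro x hx hx'
        have : x ∈ ⋃ i, X i := by by_contra h; exact hx' ⟨hx, h⟩
        obtain ⟨i, hi⟩ := Set.mem_iUnion.1 this
        refine ⟨i, hi, ?_, hO.d0A i, (hXY i).trans hO.NY⟩
        rw [Set.disjoint_left]; intro x hx h; exact h.2 (Set.mem_iUnion.2 ⟨i, hx⟩)) hFm
    refine ⟨U, u1, fun e he => u2 e he (q2 ?_)⟩
    rw [cut_del] at he ⊢
    exact ⟨he.1, fun h => he.2 (by rw [hFdef]; exact Or.inl h)⟩
  · intro g hg
    obtain ⟨i, h1, h2, -⟩ := hmX g hg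
    exact hXY i ⟨h1, h2⟩
  · intro j
    obtain ⟨Q, q1, q2⟩ := hL j
    have hdj : ∀ i, i ≠ j → Disjoint (X i) (N \ (⋃ i, X i) ∪ X j) := by
      intro i hij
      rw [Set.disjoint_left]; rintro x hx (h | h)
      · exact h.2 (Set.mem_iUnion.2 ⟨i, hx⟩)
      · exact Set.disjoint_left.1 (hF.disj i j hij) hx h
    have q3 := htr _ _ _ q1 (fun i => by
      by_cases hij : i = j
      · right; rw [hij]
      · exact Or.inl (hdj i hij))
    obtain ⟨U, u1, u2⟩ := hF.lift (B := X j) (Y' := N \ (⋃ i, X i) ∪ X j) (Y := N ∪ A j) Set.subset_union_right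
      (Set.union_subset (Set.sdiff_subset.trans Set.subset_union_left) (hF.sup j)) q3 (by
        intro x hx hx'
        have hxX : x ∉ X j := fun h => hx' (Or.inr h)
        have hxN : x ∈ N := hx.resolve_right (fun h => hxX (hF.sub j h))
        have : x ∈ ⋃ i, X i := by by_contra h; exact hx' (Or.inl ⟨hxN, h⟩)
        obtain ⟨i, hi⟩ := Set.mem_iUnion.1 this
        have hij : i ≠ j := fun h => hxX (h ▸ hi)
        refine ⟨i, hi, hdj i hij, ?_, (hXY i).trans Set.subset_union_left⟩
        rw [Set.disjoint_union_right]
        exact ⟨hO.dN i, hO.dA i j hij⟩) hFm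
    have hW' : Sys (G.del {e | e ∈ edges (P ++ revL m)}) (A j) (X j)
        {l ∈ W j | ∀ e ∈ edges l, e ∉ {e | e ∈ edges (P ++ revL m)}} :=
      ((hF.sys j).sub (fun l hl => hl.1)).to_del (by rintro e ⟨l, hl, he⟩; exact hl.2 e he)
    obtain ⟨R, r1, -, r3, -⟩ := hW'.comp (hF.sub j) (hF.sup j) u1
    refine ⟨R, r1, fun e he => r3 ?_ e he ?_⟩
    · intro e he _
      refine u2 e he (q2 ?_)
      rw [cut_del] at he ⊢
      exact ⟨he.1, fun h => he.2 (by rw [hFdef]; exact Or.inl h)⟩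
    · rw [cut_del] at he
      obtain ⟨l, hl, hel⟩ := hWA j he.1
      refine ⟨l, ⟨hl, fun g hg hgF => ?_⟩, hel⟩
      obtain ⟨b, rfl, hb⟩ := hWF j l hl g hg hgF
      apply he.2
      rw [edges_append, List.mem_append] at hel
      rw [hFdef]
      rcases hel with h | h
      · exact Or.inr h
      · left
        simp only [edges_cons, edges_nil, List.mem_singleton] at h
        rw [h, hb, hpd]; simp

end LC

namespace LC
open Classical
variable {V : Type u} {E : Type v}

lemma cutAt {U : Set V} {y : V} : ∀ {l : List (Dart V E)} {x : V}, l ≠ [] → x ∉ U → Ch x l y →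
    ∃ l1 l2 z, l = l1 ++ l2 ∧ l1 ≠ [] ∧ Ch x l1 z ∧ (∀ d ∈ l1, d.s ∉ U) ∧ (z ∈ U ∨ (l2 = [] ∧ z = y ∧ y ∉ U))
  | [], _, h, _, _ => absurd rfl h
  | d :: l, x, _, hx, hc => by
    have hs : d.s = x := hc.1
    by_cases hd : d.t ∈ U
    · exact ⟨[d], l, d.t, rfl, by simp, by simp [hs], by simp [hs, hx], Or.inl hd⟩
    · cases l with
      | nil =>
        have : d.t = y := hc.2
        exact ⟨[d], [], y, rfl, by simp, by simp [hs, this], by simp [hs, hx], Or.inr ⟨rfl, rfl, this ▸ hd⟩⟩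
      | cons b l' =>
        obtain ⟨l1, l2, z, h1, h2, h3, h4, h5⟩ := cutAt (l := b :: l') (x := d.t) (by simp) hd hc.2
        refine ⟨d :: l1, l2, z, by rw [h1]; rfl, by simp, by simp [hs, h3], ?_, h5⟩
        intro g hg
        rcases List.mem_cons.1 hg with rfl | h
        · rw [hs]; exact hx
        · exact h4 g h

lemma Ch.tail_s {x y : V} {d : Dart V E} {l : List (Dart V E)} (h : Ch x (d :: l) y) {g} (hg : g ∈ l) :
    ∃ g' ∈ d :: l, g'.t = g.s := by
  obtain ⟨l1, l2, rfl⟩ := List.append_of_mem hg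
  have h2 := h.2
  obtain ⟨z, h3, h4⟩ := Ch_append.1 h2
  have h5 : g.s = z := h4.1
  by_cases hl : l1 = []
  · subst hl
    exact ⟨d, by simp, by rw [h5]; exact h3⟩
  · obtain ⟨m, b, rfl, hb, -⟩ := h3.getlast hl
    exact ⟨b, by simp, by rw [hb, h5]⟩

lemma Linked.pre {G : MG V E} {A0 Y0 Y0' : Set V} {P1 P2 : List (Dart V E)} {x y : V} (hne : P1 ≠ []) (hc : Ch x (P1 ++ P2) y)
    (hok : ∀ d ∈ P1 ++ P2, G.ok d) (ht : ∀ d ∈ P1 ++ P2, d.t ∉ A0) (h0 : A0 ⊆ Y0') (hY : Y0' ⊆ Y0)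
    (h : Linked (G.del {e | e ∈ edges (P1 ++ P2)}) A0 Y0) : Linked (G.del {e | e ∈ edges P1}) A0 Y0' := by
  obtain ⟨W, w1, w2⟩ := h
  have w3 : Sys (G.del {e | e ∈ edges P1}) A0 Y0 W := w1.of_del.to_del (fun e he h => w1.used_del e he (by
    simp only [Set.mem_setOf_eq] at h ⊢; simp [h]))
  obtain ⟨t1, t2⟩ := w3.trunc h0 hY
  refine ⟨_, t1, fun e he => t2 e (w2 ?_) he⟩
  rw [cut_del] at he ⊢
  refine ⟨he.1, fun h => ?_⟩
  simp only [Set.mem_setOf_eq, edges_append, List.mem_append] at h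
  rcases h with h | h
  · exact he.2 h
  · obtain ⟨d, P1', rfl⟩ := List.exists_cons_of_ne_nil hne
    obtain ⟨g, hg, rfl⟩ := mem_edges.1 h
    obtain ⟨g', hg', hgt⟩ := hc.tail_s (g := g) (by simp [hg])
    have h1 := ht g' hg'
    have h2 := ht g (by simp [hg])
    have he := he.1
    rw [(hok g (by simp [hg])).mem_cut] at he
    rw [hgt] at h1
    tauto

lemma Eul.mono {G : MG V E} {N N' : Set V} (h : Eul G N) (hs : N' ⊆ N) : Eul G N' :=
  fun X hX => h X (hX.trans hs)

lemma BH.mono {S S' : Set E} (h : BH V S) (hs : S' ⊆ S) : BH V S' :=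
  fun H hH => h H (hH.trans hs)

lemma oneStep {ι : Type*} {x0 : V} : ∀ (n : ℕ) (G : MG V E) (A : ι → Set V) (N A0 Y0 : Set V) (d0 : Dart V E)
    (P0 : List (Dart V E)) (y : V), P0.length = n → OS G A N A0 Y0 x0 → OSW G A A0 Y0 x0 (d0 :: P0) y →
    (x0 :: (d0 :: P0).map Dart.t).Nodup → y ∉ N →
    ∃ R y', OSW G A A0 Y0 x0 (d0 :: R) y' ∧ (∀ d ∈ d0 :: R, d.s ∈ N ∨ ∃ d' ∈ d0 :: P0, d'.s = d.s) ∧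
      (y' = y ∨ ∃ j, y' ∈ A j) ∧ ∀ j, Linked (G.del {e | e ∈ edges (d0 :: R)}) (A j) (N ∪ A j) := by
  intro n
  induction n using Nat.strong_induction_on with
  | _ n ih =>
    intro G A N A0 Y0 d0 P0 y hn hO hP hnd hyN
    obtain ⟨X, W, hF, hWA, hlo⟩ := famL G A N hO.dA hO.lk
    have hxX : x0 ∉ ⋃ i, X i := by
      intro h; obtain ⟨i, hi⟩ := Set.mem_iUnion.1 h
      rcases hF.sup i hi with h | h
      · exact hO.xN h
      · exact hO.xA i h
    obtain ⟨P1, P2, y1, hP12, hne, hc1, hs1, hy1⟩ := cutAt (by simp) hxX hP.ch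
    obtain ⟨d, P01, rfl⟩ := List.exists_cons_of_ne_nil hne
    obtain ⟨rfl, rfl⟩ : d0 = d ∧ P0 = P01 ++ P2 := by simpa using hP12
    have hX0 : ∀ i, Disjoint (X i) A0 := fun i => by
      rw [Set.disjoint_left]; intro x hx h
      rcases hF.sup i hx with h' | h'
      · exact Set.disjoint_left.1 hO.d0N h h'
      · exact Set.disjoint_left.1 (hO.d0A i) h' (hO.h0 h)
    have hA0 : A0 ⊆ Y0 \ ⋃ i, X i := fun x hx => ⟨hO.h0 hx, fun h => by
      obtain ⟨i, hi⟩ := Set.mem_iUnion.1 h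
      exact Set.disjoint_left.1 (hX0 i) hi hx⟩
    have hW1 : OSW G X A0 (Y0 \ ⋃ i, X i) x0 (d0 :: P01) y1 := by
      refine ⟨hc1, fun d hd => hP.ok d (by simp at hd ⊢; tauto), fun d hd => hP.tA d (by simp at hd ⊢; tauto),
        fun d hd j h => hs1 d hd (Set.mem_iUnion.2 ⟨j, h⟩), ?_, ?_⟩
      · have := hP.nd
        rw [← List.cons_append, edges_append, List.nodup_append] at this
        exact this.1
      · exact Linked.pre (P2 := P2) (by simp) hP.ch hP.ok hP.tA hA0 Set.sdiff_subset hP.lk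
    have hO1 : OS G X (N \ ⋃ i, X i) A0 (Y0 \ ⋃ i, X i) x0 := by
      have hj : ∀ j, ∀ x ∈ X j, x ∈ ⋃ i, X i := fun j x hx => Set.mem_iUnion.2 ⟨j, hx⟩
      refine ⟨hF.disj, ?_, hO.eul.mono Set.sdiff_subset, ?_, hO.bh, hA0, ?_, ?_, ?_, ?_, ?_⟩
      · intro j; rw [Set.disjoint_left]; exact fun x hx h => h.2 (hj j x hx)
      · intro j
        refine hO.bh G (Set.Subset.refl _) _ _ Set.subset_union_right ?_ (hlo j)
        refine hO.eul.mono ?_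
        rintro x ⟨h | h, h'⟩
        · exact h.1
        · exact absurd h h'
      · intro j; rw [Set.disjoint_left]; exact fun x hx h => h.2 (hj j x hx)
      · exact hO.d0N.mono_right Set.sdiff_subset
      · exact Set.sdiff_subset_sdiff_left hO.NY
      · exact fun h => hO.xN h.1
      · exact fun j h => hxX (hj j _ h)
    have hy1' : (y1 ∉ N ∧ ∀ j, y1 ∉ X j) ∨ ∃ j, y1 ∈ X j := by
      rcases hy1 with h | ⟨-, rfl, h⟩
      · exact Or.inr (Set.mem_iUnion.1 h)
      · exact Or.inl ⟨hyN, fun j hj => h (Set.mem_iUnion.2 ⟨j, hj⟩)⟩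
    have hy1N : y1 ∉ N \ ⋃ i, X i := by
      rcases hy1' with h | ⟨j, h⟩
      · exact fun h' => h.1 h'.1
      · exact fun h' => h'.2 (Set.mem_iUnion.2 ⟨j, h⟩)
    suffices hmain : ∃ R y', OSW G X A0 (Y0 \ ⋃ i, X i) x0 (d0 :: R) y' ∧
        (∀ d ∈ d0 :: R, d.s ∈ N \ (⋃ i, X i) ∨ ∃ d' ∈ d0 :: P01, d'.s = d.s) ∧ (y' = y1 ∨ ∃ j, y' ∈ X j) ∧
        ∀ j, Linked (G.del {e | e ∈ edges (d0 :: R)}) (X j) ((N \ ⋃ i, X i) ∪ X j) by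
      obtain ⟨R, y', r1, r2, r3, r4⟩ := hmain
      obtain ⟨R', y'', s1, s2, s3, s4⟩ := oneLift hO hF hWA (y := y') (by
        rcases r3 with rfl | h
        · exact hy1'
        · exact Or.inr h) (by simp) r1 r4
      refine ⟨R ++ R', y'', s1, ?_, ?_, s4⟩
      · intro d hd
        rw [← List.cons_append] at hd
        rcases List.mem_append.1 hd with h | h
        · rcases r2 d h with h' | ⟨d', h1, h2⟩
          · exact Or.inl h'.1
          · exact Or.inr ⟨d', by simp at h1 ⊢; tauto, h2⟩
        · exact Or.inl (s2 d h)
      · rcases s3 with ⟨rfl, hX⟩ | h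
        · rcases r3 with rfl | ⟨j, hj⟩
          · rcases hy1 with h | ⟨-, rfl, h⟩
            · obtain ⟨j, hj⟩ := Set.mem_iUnion.1 h
              exact absurd hj (hX j)
            · exact Or.inl rfl
          · exact absurd hj (hX j)
        · exact Or.inr h
    have hnd1 : (x0 :: (d0 :: P01).map Dart.t).Nodup := by
      refine List.Nodup.sublist ?_ hnd
      simp
    cases P01 with
    | nil =>
      refine ⟨[], y1, hW1, fun d hd => Or.inr ⟨d, hd, rfl⟩, Or.inl rfl, fun j => ?_⟩
      have hs : d0.s = x0 := hc1.1
      have ht : d0.t = y1 := hc1.2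
      have := (hO1.lk j).del_edge Set.subset_union_right (hW1.ok d0 (by simp)) (by
        rw [hs]; rintro (h | h)
        · exact hO1.xN h
        · exact hO1.xA j h) (by
        rw [ht]; rintro (h | h)
        · exact absurd h hy1N
        · exact h)
      have h2 : ({e | e ∈ edges [d0]} : Set E) = {d0.e} := by ext e; simp
      rw [h2]; exact this
    | cons f0 P02 =>
      obtain ⟨x', e, v⟩ := d0
      obtain ⟨v', f, w⟩ := f0
      obtain rfl : x' = x0 := hc1.1
      obtain rfl : v' = v := hc1.2.1
      have he : G.ok ⟨x', e, v'⟩ := hW1.ok _ (by simp)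
      have hf : G.ok ⟨v', f, w⟩ := hW1.ok _ (by simp)
      have hnde := hW1.nd
      simp only [edges_cons, List.nodup_cons, List.mem_cons, not_or] at hnde
      obtain ⟨⟨hef, heP⟩, hfP, hPP⟩ := hnde
      have hw : w ≠ x' := by
        simp at hnd1; tauto
      have hvX : v' ∉ ⋃ i, X i := hs1 ⟨v', f, w⟩ (by simp)
      have hoks := fun g => ok_split (G := G) (u := x') (w := w) he.1 hef (d := g)
      have hO2 : OS (G.split e f x' w) X (N \ ⋃ i, X i) A0 (Y0 \ ⋃ i, X i) x' := by
        refine ⟨hO1.dA, hO1.dN, hO1.eul.split he hf hef hO1.xN, fun j => ?_, hO1.bh.mono Set.sdiff_subset,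
          hO1.h0, hO1.d0A, hO1.d0N, hO1.NY, hO1.xN, hO1.xA⟩
        have hu : x' ∉ (N \ ⋃ i, X i) ∪ X j := by
          rintro (h | h)
          · exact hO1.xN h
          · exact hO1.xA j h
        have hvj : v' ∉ X j := fun h => hvX (Set.mem_iUnion.2 ⟨j, h⟩)
        by_cases hv : v' ∈ N \ ⋃ i, X i
        · refine Linked.split he hf hef Set.subset_union_right hu (Or.inl hv) hvj ?_ (hlo j) hO1.bh
          refine hO1.eul.mono ?_
          rintro x ⟨h | h, h'⟩
          · exact h
          · exact absurd h h'
        · exact Linked.split_triv he hf hef Set.subset_union_right hu (by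
            rintro (h | h)
            · exact hv h
            · exact hvj h) (hO1.lk j)
      have hcongr : ∀ R : List (Dart V E), ∀ g, ((G.split e f x' w).del {a | a ∈ edges (⟨x', e, w⟩ :: R)}).ok g ↔
          (G.del {a | a ∈ edges (⟨x', e, v'⟩ :: ⟨v', f, w⟩ :: R)}).ok g := by
        intro R g
        rw [ok_del, ok_del, hoks]
        simp only [Set.mem_setOf_eq, edges_cons, List.mem_cons, not_or]
        constructor
        · rintro ⟨h | h, h2, h3⟩
          · exact ⟨h.2.2, h.1, h.2.1, h3⟩
          · rcases h with rfl | rfl <;> exact absurd rfl h2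
        · rintro ⟨h1, h2, h3, h4⟩
          exact ⟨Or.inl ⟨h2, h3, h1⟩, h2, h4⟩
      have hW2 : OSW (G.split e f x' w) X A0 (Y0 \ ⋃ i, X i) x' (⟨x', e, w⟩ :: P02) y1 := by
        refine ⟨⟨rfl, hc1.2.2⟩, ?_, ?_, ?_, ?_, ?_⟩
        · intro g hg
          rcases List.mem_cons.1 hg with rfl | h
          · exact (hoks _).2 (Or.inr (Or.inl rfl))
          · refine (hoks _).2 (Or.inl ⟨fun h' => heP (mem_edges.2 ⟨g, h, h'⟩), fun h' => hfP (h' ▸ mem_edges_of h),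
              hW1.ok g (by simp [h])⟩)
        · intro g hg
          rcases List.mem_cons.1 hg with rfl | h
          · exact hW1.tA ⟨v', f, w⟩ (by simp)
          · exact hW1.tA g (by simp [h])
        · intro g hg
          rcases List.mem_cons.1 hg with rfl | h
          · exact hO1.xA
          · exact hW1.sA g (by simp [h])
        · simp only [edges_cons, List.nodup_cons]; exact ⟨heP, hPP⟩
        · exact hW1.lk.congr (fun g => (hcongr P02 g).symm)
      obtain ⟨R, y', r1, r2, r3, r4⟩ := ih P02.length (by rw [← hn]; simp) (G.split e f x' w) X (N \ ⋃ i, X i)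
        A0 (Y0 \ ⋃ i, X i) ⟨x', e, w⟩ P02 y1 rfl hO2 hW2 (by
          refine List.Nodup.sublist ?_ hnd1
          simp) hy1N
      have hnd2 := r1.nd
      simp only [edges_cons, List.nodup_cons] at hnd2
      have hRok : ∀ g ∈ R, g.e ≠ f ∧ G.ok g := by
        intro g hg
        rcases (hoks g).1 (r1.ok g (by simp [hg])) with h | h
        · exact ⟨h.2.1, h.2.2⟩
        · have : g.e ∈ edges R := mem_edges_of hg
          rcases h with rfl | rfl <;> exact absurd this hnd2.1
      refine ⟨⟨v', f, w⟩ :: R, y', ⟨⟨rfl, rfl, r1.ch.2⟩, ?_, ?_, ?_, ?_, ?_⟩, ?_, r3, ?_⟩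
      · intro g hg
        simp only [List.mem_cons] at hg
        rcases hg with rfl | rfl | h
        · exact he
        · exact hf
        · exact (hRok g h).2
      · intro g hg
        simp only [List.mem_cons] at hg
        rcases hg with rfl | rfl | h
        · exact hW1.tA _ (by simp)
        · exact hW1.tA _ (by simp)
        · exact r1.tA g (by simp [h])
      · intro g hg
        simp only [List.mem_cons] at hg
        rcases hg with rfl | rfl | h
        · exact hW1.sA _ (by simp)
        · exact hW1.sA _ (by simp)
        · exact r1.sA g (by simp [h])
      · simp only [edges_cons, List.nodup_cons, List.mem_cons, not_or]
        refine ⟨⟨hef, hnd2.1⟩, fun h => ?_, hnd2.2⟩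
        obtain ⟨g, hg, hge⟩ := mem_edges.1 h
        exact (hRok g hg).1 hge
      · exact r1.lk.congr (hcongr R)
      · intro g hg
        simp only [List.mem_cons] at hg
        rcases hg with rfl | rfl | h
        · exact Or.inr ⟨_, List.mem_cons_self, rfl⟩
        · exact Or.inr ⟨⟨v', f, w⟩, by simp, rfl⟩
        · rcases r2 g (by simp [h]) with h' | ⟨g', hg', hs'⟩
          · exact Or.inl h'
          · rcases List.mem_cons.1 hg' with rfl | h''
            · exact Or.inr ⟨_, List.mem_cons_self, hs'⟩
            · exact Or.inr ⟨g', by simp [h''], hs'⟩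
      · intro j
        exact (r4 j).congr (hcongr R)

lemma Eul.del_trail {G : MG V E} {N : Set V} (hE : Eul G N) {x y : V} {l : List (Dart V E)} (hc : Ch x l y)
    (hok : ∀ d ∈ l, G.ok d) (hnd : (edges l).Nodup) (hx : x ∉ N) (hy : y ∉ N) :
    Eul (G.del {e | e ∈ edges l}) N := by
  intro X hX hfin
  rw [cut_del] at hfin ⊢
  obtain ⟨p1, p2⟩ := par2 hnd (G.cut X)
  have p3 := (par1 (S := X) hc hok).2 (by
    have : x ∉ X := fun h => hx (hX h)
    have : y ∉ X := fun h => hy (hX h)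
    tauto)
  have hsplit : G.cut X = (G.cut X \ {e | e ∈ edges l}) ∪ {e | e ∈ edges l ∧ e ∈ G.cut X} := by
    ext e; simp; tauto
  have hdis : Disjoint (G.cut X \ {e | e ∈ edges l}) {e | e ∈ edges l ∧ e ∈ G.cut X} := by
    rw [Set.disjoint_left]; rintro e ⟨-, h⟩ ⟨h', -⟩; exact h h'
  have h1 := hE X hX (by rw [hsplit]; exact hfin.union p2)
  rw [hsplit, Set.ncard_union_eq hdis hfin p2, p1, Nat.even_add] at h1
  exact h1.2 p3

structure PS {ι : Type*} (G : MG V E) (A : ι → Set V) (N : Set V) (P : Set (List (Dart V E))) : Prop where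
  sw : ∀ l ∈ P, ∃ i, IsSW G (A i) (N ∪ A i) l
  nodup : ∀ l ∈ P, (edges l).Nodup
  disj : ∀ l ∈ P, ∀ l' ∈ P, ∀ e, e ∈ edges l → e ∈ edges l' → l = l'
  cov : ∀ i, G.cut (A i) ⊆ used P

lemma BH_omega {S0 : Set E} (hS : S0.Countable) : BH V S0 := by
  intro H hH A Y hAY _ hlo
  exact B_omega (hS.mono hH) hAY hlo.unH

/-- remove one walk starting with a prescribed edge -/
lemma stepT {ι : Type*} {G : MG V E} {A : ι → Set V} {N : Set V} (dA : ∀ i j, i ≠ j → Disjoint (A i) (A j))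
    (dN : ∀ j, Disjoint (A j) N) (hE : Eul G N) (hL : ∀ j, Linked G (A j) (N ∪ A j)) (hB : BH V G.S)
    {t : ι} {e : E} (he : e ∈ G.cut (A t)) :
    ∃ l, IsSW G (A t) (N ∪ A t) l ∧ (edges l).Nodup ∧ e ∈ edges l ∧ Eul (G.del {e | e ∈ edges l}) N ∧
      ∀ j, Linked (G.del {e | e ∈ edges l}) (A j) (N ∪ A j) := by
  obtain ⟨W, w1, w2⟩ := hL t
  obtain ⟨l, hl, hel⟩ := w2 he
  have hlw := w1.sw l hl
  obtain ⟨d, hd, rfl, hds⟩ := hlw.dartA hel he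
  have hAY : A t ⊆ N ∪ A t := Set.subset_union_right
  obtain ⟨l1, x0, hx0, y, hy, hc⟩ := id hlw
  obtain ⟨l', c1, c2, c3⟩ := hc.shorten
  have hlw' : IsSW G (A t) (N ∪ A t) l' := ⟨fun g hg => l1 g (c2 hg), x0, hx0, y, hy, c1⟩
  have hdl' : d ∈ l' := hlw.first_mem hlw' hAY hAY c2 hd hds
  obtain ⟨d0, P0, rfl, hd0, hP0⟩ := hlw'.cons hAY
  have hdd : d = d0 := by
    rcases List.mem_cons.1 hdl' with h | h
    · exact h
    · exact absurd hds (hP0 d h)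
  subst hdd
  have hxs : d.s = x0 := c1.1
  have hxN : x0 ∉ N := fun h => Set.disjoint_left.1 (dN t) hx0 h
  have hO : OS G (fun j : {j // j ≠ t} => A j.1) N (A t) (N ∪ A t) x0 := by
    refine ⟨fun i j hij => dA _ _ (fun h => hij (Subtype.ext h)), fun j => dN _, hE, fun j => hL _, hB, hAY, fun j => ?_,
      dN t, Set.subset_union_left, hxN, fun j h => Set.disjoint_left.1 (dA _ _ j.2) h hx0⟩
    rw [Set.disjoint_union_right]
    exact ⟨dN _, dA _ _ j.2⟩
  have hW : OSW G (fun j : {j // j ≠ t} => A j.1) (A t) (N ∪ A t) x0 (d :: P0) y := by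
    refine ⟨c1, fun g hg => (hlw'.1 g hg).1, fun g hg => (hlw'.1 g hg).2.2, fun g hg j h => ?_, ?_, ?_⟩
    · exact Set.disjoint_left.1 (hO.d0A j) h (hlw'.1 g hg).2.1
    · exact c1.edges_nodup (fun g hg => (hlw'.1 g hg).1) c3
    · refine ⟨W \ {l}, (w1.sub Set.sdiff_subset).to_del ?_, ?_⟩
      · rintro e ⟨k, hk, hek⟩ h
        exact hk.2 (w1.disj _ hk.1 _ hl e hek (edges_sub c2 h))
      · intro e he
        rw [cut_del] at he
        obtain ⟨k, hk, hek⟩ := w2 he.1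
        refine ⟨k, ⟨hk, fun h => he.2 ?_⟩, hek⟩
        rw [Set.mem_singleton_iff] at h
        subst h
        obtain ⟨g, hg, rfl, hgs⟩ := hlw.dartA hek he.1
        exact mem_edges_of (hlw.first_mem hlw' hAY hAY c2 hg hgs)
  obtain ⟨R, y', r1, r2, r3, r4⟩ := oneStep P0.length G _ N (A t) (N ∪ A t) d P0 y rfl hO hW c3 (fun h => hy (Or.inl h))
  have hy' : y' ∉ N ∪ A t := by
    rcases r3 with rfl | ⟨j, hj⟩
    · exact hy
    · exact fun h => Set.disjoint_left.1 (hO.d0A j) hj h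
  refine ⟨d :: R, ⟨fun g hg => ⟨r1.ok g hg, ?_, r1.tA g hg⟩, x0, hx0, y', hy', r1.ch⟩, r1.nd, by simp,
    hE.del_trail r1.ch r1.ok r1.nd hxN (fun h => hy' (Or.inl h)), fun j => ?_⟩
  · rcases r2 g hg with h | ⟨g', h1, h2⟩
    · exact Or.inl h
    · rw [← h2]; exact (hlw'.1 g' h1).2.1
  · by_cases hj : j = t
    · subst hj; exact r1.lk
    · exact r4 ⟨j, hj⟩

lemma C_omega {ι : Type*} {G : MG V E} {A : ι → Set V} {N : Set V} (hS : G.S.Countable)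
    (dA : ∀ i j, i ≠ j → Disjoint (A i) (A j))
    (dN : ∀ j, Disjoint (A j) N) (hE : Eul G N) (hL : ∀ j, Linked G (A j) (N ∪ A j)) :
    ∃ P, PS G A N P := by
  let Inv : Set E → Prop := fun F => Eul (G.del F) N ∧ ∀ j, Linked (G.del F) (A j) (N ∪ A j)
  have step : ∀ (e : E) (F : {F // Inv F}), ∃ q : {F // Inv F} × Set (List (Dart V E)),
      q.1.1 = F.1 ∪ used q.2 ∧ (∀ l ∈ q.2, ∃ i, IsSW (G.del F) (A i) (N ∪ A i) l) ∧ (∀ l ∈ q.2, (edges l).Nodup) ∧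
      (∀ l ∈ q.2, ∀ l' ∈ q.2, l = l') ∧ ∀ t, e ∈ G.cut (A t) → e ∈ q.1.1 := by
    rintro e ⟨F, hF⟩
    by_cases h : ∃ t, e ∈ (G.del F).cut (A t)
    · obtain ⟨t, ht⟩ := h
      obtain ⟨l, l1, l2, l3, l4, l5⟩ := stepT dA dN hF.1 hF.2 (BH_omega (hS.mono Set.sdiff_subset)) ht
      rw [del_del] at l4
      simp_rw [del_del] at l5
      have hu : used {l} = {e | e ∈ edges l} := by ext e; simp [used]
      refine ⟨(⟨F ∪ {e | e ∈ edges l}, l4, l5⟩, {l}), by rw [hu], ?_, ?_, ?_, fun t _ => Or.inr l3⟩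
      · intro k hk; rw [show k = l from hk]; exact ⟨t, l1⟩
      · intro k hk; rw [show k = l from hk]; exact l2
      · intro k hk k' hk'; rw [show k = l from hk, show k' = l from hk']
    · refine ⟨(⟨F, hF⟩, ∅), by simp [used], by simp, by simp, by simp, fun t ht => ?_⟩
      by_contra h'
      exact h ⟨t, by rw [cut_del]; exact ⟨ht, h'⟩⟩
  choose q q1 q2 q3 q4 q5 using step
  rcases Set.eq_empty_or_nonempty G.S with hem | hne
  · refine ⟨∅, by simp, by simp, by simp, fun i e he => ?_⟩
    have := G.cut_sub _ he
    rw [hem] at this; exact absurd this (by simp)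
  obtain ⟨en, hen⟩ := hS.exists_eq_range hne
  obtain ⟨sq, s0, s1⟩ : ∃ sq : ℕ → {F // Inv F}, sq 0 = ⟨∅, by simpa [Inv] using ⟨hE, hL⟩⟩ ∧
      ∀ n, sq (n + 1) = (q (en n) (sq n)).1 :=
    ⟨fun n => Nat.rec ⟨∅, by simpa [Inv] using ⟨hE, hL⟩⟩ (fun n F => (q (en n) F).1) n, rfl, fun n => rfl⟩
  have hsucc : ∀ n, (sq (n + 1)).1 = (sq n).1 ∪ used (q (en n) (sq n)).2 := by
    intro n; rw [s1]; exact q1 _ _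
  have hmono : Monotone fun n => (sq n).1 := by
    refine monotone_nat_of_le_succ (fun n => ?_)
    rw [hsucc]; exact Set.subset_union_left
  have hlt : ∀ n m, n < m → ∀ l ∈ (q (en n) (sq n)).2, ∀ l' ∈ (q (en m) (sq m)).2, ∀ e, e ∈ edges l → e ∉ edges l' := by
    intro n m hnm l hl l' hl' e he he'
    obtain ⟨i, hi⟩ := q2 _ _ l' hl'
    have := (isSW_del.1 hi).2 e he'
    apply this
    apply hmono (Nat.succ_le_of_lt hnm)
    change e ∈ (sq (n + 1)).1
    rw [hsucc]
    exact Or.inr ⟨l, hl, he⟩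
  have hcov : ∀ n, ∀ e ∈ (sq n).1, ∃ m, e ∈ used (q (en m) (sq m)).2 := by
    intro n
    induction n with
    | zero => intro e he; rw [s0] at he; exact absurd he (by simp)
    | succ n ih =>
      intro e he
      rw [hsucc] at he
      rcases he with h | h
      · exact ih e h
      · exact ⟨n, h⟩
  refine ⟨{l | ∃ n, l ∈ (q (en n) (sq n)).2}, ?_, ?_, ?_, ?_⟩
  · rintro l ⟨n, hl⟩
    obtain ⟨i, hi⟩ := q2 _ _ l hl
    exact ⟨i, (isSW_del.1 hi).1⟩
  · rintro l ⟨n, hl⟩; exact q3 _ _ l hl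
  · rintro l ⟨n, hl⟩ l' ⟨m, hl'⟩ e he he'
    rcases lt_trichotomy n m with h | rfl | h
    · exact absurd he' (hlt n m h l hl l' hl' e he)
    · exact q4 _ _ l hl l' hl'
    · exact absurd he (hlt m n h l' hl' l hl e he')
  · intro i e he
    have : e ∈ Set.range en := hen ▸ G.cut_sub _ he
    obtain ⟨n, rfl⟩ := this
    have h1 := q5 (en n) (sq n) i he
    rw [← s1] at h1
    obtain ⟨m, l, hl, hel⟩ := hcov _ _ h1
    exact ⟨l, ⟨m, hl⟩, hel⟩

end LC

namespace LC
open Classical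
variable {V : Type u} {E : Type v}

lemma mkPS {ι κ : Type*} {G : MG V E} {A : ι → Set V} {N : Set V}
    (dA : ∀ i j, i ≠ j → Disjoint (A i) (A j)) (dN : ∀ j, Disjoint (A j) N) (f : κ → List (Dart V E))
    (hf : ∀ k, ∃ i, IsSW G (A i) (N ∪ A i) (f k))
    (hd : ∀ i j e, e ∈ edges (f i) → e ∈ edges (f j) → i = j)
    (hcov : ∀ i, ∀ e ∈ G.cut (A i), ∃ k, e ∈ edges (f k)) : ∃ P, PS G A N P := by
  choose s hs using hf
  choose g h1 h2 h3 using fun k => (hs k).shorten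
  have hAY : ∀ i, A i ⊆ N ∪ A i := fun i => Set.subset_union_right
  refine ⟨Set.range g, ?_, ?_, ?_, ?_⟩
  · rintro _ ⟨k, rfl⟩; exact ⟨s k, h1 k⟩
  · rintro _ ⟨i, rfl⟩; exact h3 i
  · rintro _ ⟨i, rfl⟩ _ ⟨j, rfl⟩ e he he'
    rw [hd i j e (edges_sub (h2 i) he) (edges_sub (h2 j) he')]
  · intro i e he
    obtain ⟨k, hk⟩ := hcov i e he
    by_cases hi : i = s k
    · subst hi
      obtain ⟨d, hd, rfl, hs'⟩ := (hs k).dartA hk he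
      exact ⟨_, ⟨k, rfl⟩, mem_edges_of ((hs k).first_mem (h1 k) (hAY _) (hAY _) (h2 k) hd hs')⟩
    · obtain ⟨d, hd, rfl⟩ := mem_edges.1 hk
      have h0 := (hs k).1 d hd
      have hs' : d.s ∉ A i := by
        intro h
        rcases h0.2.1 with h' | h'
        · exact Set.disjoint_left.1 (dN i) h h'
        · exact Set.disjoint_left.1 (dA _ _ hi) h h'
      have ht : d.t ∈ A i := by
        rw [h0.1.mem_cut] at he; tauto
      have ht' : d.t ∉ N ∪ A (s k) := by
        rintro (h' | h')
        · exact Set.disjoint_left.1 (dN i) ht h'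
        · exact h0.2.2 h'
      exact ⟨_, ⟨k, rfl⟩, mem_edges_of ((hs k).last_mem (h1 k) (hAY _) (hAY _) (h2 k) hd ht')⟩

lemma C_of_M {ι : Type*} {G : MG V E} {A : ι → Set V} {N : Set V}
    (dA : ∀ i j, i ≠ j → Disjoint (A i) (A j)) (dN : ∀ j, Disjoint (A j) N) (hE : Eul G N)
    (hL : ∀ j, Linked G (A j) (N ∪ A j))
    (hM : ∀ (X : ι → Set V) (N' : Set V), (∀ i j, i ≠ j → Disjoint (X i) (X j)) → (∀ j, Disjoint (X j) N') → Eul G N' →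
      (∀ j, Loose G (X j) (N' ∪ X j)) → ∃ P, PS G X N' P) : ∃ P, PS G A N P := by
  obtain ⟨X, W, hF, hWA, hlo⟩ := famL G A N dA hL
  have hXU : ∀ i, ∀ x ∈ X i, x ∈ ⋃ i, X i := fun i x hx => Set.mem_iUnion.2 ⟨i, hx⟩
  obtain ⟨P, hP⟩ := hM X (N \ ⋃ i, X i) hF.disj (fun j => by
    rw [Set.disjoint_left]; exact fun x hx h => h.2 (hXU j x hx)) (hE.mono Set.sdiff_subset) hlo
  have hXN : ∀ i, ∀ x ∈ X i, x ∉ A i → x ∈ N := fun i x hx h => (hF.sup i hx).resolve_right h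
  have hXA : ∀ i j, i ≠ j → ∀ x ∈ X i, x ∉ A j := fun i j hij x hx h =>
    Set.disjoint_left.1 (hF.disj i j hij) hx (hF.sub j h)
  -- extension of each walk
  have key : ∀ l : P, ∃ m1 m2 : List (Dart V E), (∃ i, IsSW G (A i) (N ∪ A i) (m1 ++ l.1 ++ m2)) ∧
      (∀ g ∈ m1 ++ m2, G.ok g ∧ ∃ j m b, m ++ [b] ∈ W j ∧ b.t ∉ X j ∧ g.e ∈ edges m ∧ b.e ∈ edges l.1 ∧ g.s ∈ X j ∧ g.t ∈ X j) ∧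
      (∀ j m b, m ++ [b] ∈ W j → b.t ∉ X j → b.e ∈ edges l.1 → edges m ⊆ edges (m1 ++ m2)) := by
    rintro ⟨l, hl⟩
    obtain ⟨i, hi⟩ := hP.sw l hl
    obtain ⟨d, l', rfl, hds, hl'⟩ := hi.cons Set.subset_union_right
    obtain ⟨hi1, x, hx, y, hy, hc⟩ := hi
    have hxd : d.s = x := hc.1
    have h0 := hi1 d (by simp)
    obtain ⟨m1, hm1⟩ := hF.cont (d := d.rev) h0.1.rev h0.2.2 hds
    rw [Dart.rev_rev] at hm1
    obtain ⟨⟨a, ha, hca⟩, hseg1⟩ := hF.seg hm1 h0.2.2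
    rw [hxd] at hca
    -- starting part
    have hstart : ∀ g ∈ m1, G.ok g ∧ ∃ j m b, m ++ [b] ∈ W j ∧ b.t ∉ X j ∧ g.e ∈ edges m ∧ b.e ∈ edges (d :: l') ∧
        g.s ∈ X j ∧ g.t ∈ X j := fun g hg =>
      ⟨(hseg1 g hg).1, i, m1, d, hm1, h0.2.2, mem_edges_of hg, by simp, (hseg1 g hg).2.1, (hseg1 g hg).2.2.1⟩
    have hsame : ∀ j m b m' b', m ++ [b] ∈ W j → m' ++ [b'] ∈ W j → b.e = b'.e → m = m' := by
      intro j m b m' b' h h' hb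
      exact (List.append_inj' ((hF.sys j).disj _ h _ h' b.e (by simp) (by simp [hb])) rfl).1
    -- classification
    have hclass : ∀ j m b, m ++ [b] ∈ W j → b.t ∉ X j → b.e ∈ edges (d :: l') → edges m ⊆ edges m1 ∨
        (y ∈ X j ∧ ∃ g ∈ d :: l', g.e = b.e ∧ g.t ∈ X j) := by
      intro j m b hm hb hbe
      obtain ⟨g, hg, hge⟩ := mem_edges.1 hbe
      have hg0 := hi1 g hg
      have hb0 := ((hF.sys j).sw _ hm).1 b (by simp)
      by_cases hij : i = j
      · subst hij
        left
        have hgb : g = b := by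
          rcases ok_same hb0.1 hg0.1 hge.symm with h | h
          · exact h
          · subst h; exact absurd hb0.2.1 hg0.2.2
        subst hgb
        have : g = d := by
          rcases List.mem_cons.1 hg with h | h
          · exact h
          · exact absurd hb0.2.1 (hl' g h)
        subst this
        rw [hsame i m g m1 g hm hm1 rfl]
        exact List.Subset.refl _
      · right
        have hgs : g.s ∉ X j := by
          intro h
          rcases hg0.2.1 with h' | h'
          · exact h'.2 (hXU j _ h)
          · exact Set.disjoint_left.1 (hF.disj i j hij) h' h
        have hgt : g.t ∈ X j := by
          rcases ok_same hb0.1 hg0.1 hge.symm with h | h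
          · subst h; exact absurd hb0.2.1 hgs
          · subst h; exact hb0.2.1
        refine ⟨?_, g, hg, hge, hgt⟩
        obtain ⟨l1, l2, hl12⟩ := List.append_of_mem hg
        have hc2 := hc
        rw [hl12] at hc2
        obtain ⟨z, -, hz⟩ := Ch_append.1 hc2
        cases l2 with
        | nil =>
          have hz' : g.t = y := hz.2
          rw [← hz']; exact hgt
        | cons b' l2 =>
          exfalso
          have hb's : b'.s = g.t := hz.2.1
          have hb' := hi1 b' (by rw [hl12]; simp)
          rw [hb's] at hb'
          rcases hb'.2.1 with h' | h'
          · exact h'.2 (hXU j _ hgt)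
          · exact Set.disjoint_left.1 (hF.disj i j hij) h' hgt
    have hN'N : ∀ x ∈ N \ (⋃ i, X i) ∪ X i, x ∈ N ∪ A i := by
      rintro x (h | h)
      · exact Or.inl h.1
      · exact hF.sup i h
    have hm1g : ∀ g ∈ m1, G.ok g ∧ g.s ∈ N ∪ A i ∧ g.t ∉ A i := fun g hg =>
      ⟨(hseg1 g hg).1, hF.sup i (hseg1 g hg).2.1, (hseg1 g hg).2.2.2⟩
    have hlg : ∀ g ∈ d :: l', G.ok g ∧ g.s ∈ N ∪ A i ∧ g.t ∉ A i := fun g hg =>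
      ⟨(hi1 g hg).1, hN'N _ (hi1 g hg).2.1, fun h => (hi1 g hg).2.2 (hF.sub i h)⟩
    by_cases hyX : ∃ j, y ∈ X j
    · obtain ⟨j, hj⟩ := hyX
      have hij : i ≠ j := fun h => hy (Or.inr (h ▸ hj))
      obtain ⟨p, b, hpb, hby, hcp⟩ := hc.getlast (by simp)
      have hb0 := hi1 b (by rw [hpb]; simp)
      have hbs : b.s ∉ X j := by
        intro h
        rcases hb0.2.1 with h' | h'
        · exact h'.2 (hXU j _ h)
        · exact Set.disjoint_left.1 (hF.disj i j hij) h' h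
      obtain ⟨m2, hm2⟩ := hF.cont hb0.1 hbs (hby ▸ hj)
      obtain ⟨⟨a2, ha2, hca2⟩, hseg2⟩ := hF.seg hm2 hbs
      have hca2' : Ch a2 m2 y := hby ▸ hca2
      refine ⟨m1, revL m2, ⟨i, ?_, a, ha, a2, ?_, (hca.append hc).append hca2'.rev⟩, ?_, ?_⟩
      · intro g hg
        rcases List.mem_append.1 hg with h | h
        · rcases List.mem_append.1 h with h | h
          · exact hm1g g h
          · exact hlg g h
        · have h3 := hseg2 _ (mem_revL.1 h)
          exact ⟨h3.1.rev, Or.inl (hXN j _ h3.2.2.1 h3.2.2.2), hXA j i (Ne.symm hij) _ h3.2.1⟩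
      · rintro (h | h)
        · exact Set.disjoint_left.1 (dN j) ha2 h
        · exact Set.disjoint_left.1 (dA i j hij) h ha2
      · intro g hg
        rcases List.mem_append.1 hg with h | h
        · exact hstart g h
        · have h3 := hseg2 _ (mem_revL.1 h)
          refine ⟨h3.1.rev, j, m2, b.rev, hm2, hbs, ?_, ?_, h3.2.2.1, h3.2.1⟩
          · exact mem_edges.2 ⟨g.rev, mem_revL.1 h, rfl⟩
          · exact mem_edges.2 ⟨b, by show b ∈ d :: l'; rw [hpb]; simp, rfl⟩
      · intro j' m b' hm hb' hbe
        rcases hclass j' m b' hm hb' hbe with h | ⟨h1, g, hg, hge, hgt⟩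
        · exact List.Subset.trans h (by simp)
        · have hjj : j = j' := by
            by_contra hne
            exact Set.disjoint_left.1 (hF.disj j j' hne) hj h1
          subst hjj
          have hgb : g = b := by
            rw [hpb] at hg hc
            rcases List.mem_append.1 hg with h | h
            · exfalso
              obtain ⟨l1, l2, rfl⟩ := List.append_of_mem h
              have hc2 := hc
              simp only [List.append_assoc, List.cons_append] at hc2
              obtain ⟨z, -, hz⟩ := Ch_append.1 hc2
              have : ∃ b2 ∈ d :: l', b2.s = g.t := by
                cases l2 with
                | nil => exact ⟨b, by rw [hpb]; simp, hz.2.1⟩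
                | cons b2 l2 => exact ⟨b2, by rw [hpb]; simp, hz.2.1⟩
              obtain ⟨b2, hb2, hb2s⟩ := this
              have hb2' := hi1 b2 hb2
              rw [hb2s] at hb2'
              rcases hb2'.2.1 with h' | h'
              · exact h'.2 (hXU j _ hgt)
              · exact Set.disjoint_left.1 (hF.disj i j hij) h' hgt
            · simpa using h
          subst hgb
          rw [hsame j m b' m2 g.rev hm hm2 hge.symm]
          intro e he
          rw [edges_append, List.mem_append, mem_edges_revL]
          exact Or.inr he
    · push Not at hyX
      refine ⟨m1, [], ⟨i, ?_, a, ha, y, ?_, ?_⟩, ?_, ?_⟩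
      · intro g hg
        rw [List.append_nil] at hg
        rcases List.mem_append.1 hg with h | h
        · exact hm1g g h
        · exact hlg g h
      · rintro (h | h)
        · refine hy (Or.inl ⟨h, fun h' => ?_⟩)
          obtain ⟨j, hj⟩ := Set.mem_iUnion.1 h'
          exact hyX j hj
        · exact hyX i (hF.sub i h)
      · rw [List.append_nil]; exact hca.append hc
      · intro g hg
        rw [List.append_nil] at hg
        exact hstart g hg
      · intro j m b hm hb hbe
        rcases hclass j m b hm hb hbe with h | ⟨h, -⟩
        · simpa using h
        · exact absurd h (hyX j)
  choose m1 m2 k1 k2 k3 using key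
  -- darts of P are not inside X j
  have hout : ∀ l ∈ P, ∀ g, G.ok g → g.e ∈ edges l → ∀ j, g.s ∈ X j → g.t ∉ X j := by
    intro l hl g hg hge j hs ht
    obtain ⟨i, hi⟩ := hP.sw l hl
    obtain ⟨b, hb, hbe⟩ := mem_edges.1 hge
    have hb0 := hi.1 b hb
    have : b.s ∈ X j ∧ b.t ∈ X j := by
      rcases ok_same hg hb0.1 hbe.symm with rfl | rfl
      · exact ⟨hs, ht⟩
      · exact ⟨ht, hs⟩
    rcases hb0.2.1 with h' | h'
    · exact h'.2 (hXU j _ this.1)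
    · have hij : i = j := by
        by_contra hne
        exact Set.disjoint_left.1 (hF.disj i j hne) h' this.1
      subst hij
      exact hb0.2.2 this.2
  refine mkPS dA dN (fun l : P => m1 l ++ l.1 ++ m2 l) k1 ?_ ?_
  · intro l l' e he he'
    have hsplit : ∀ l : P, e ∈ edges (m1 l ++ l.1 ++ m2 l) → e ∈ edges l.1 ∨ ∃ g ∈ m1 l ++ m2 l, g.e = e := by
      intro l h
      simp only [edges_append, List.mem_append] at h
      rcases h with (h | h) | h
      · obtain ⟨g, hg, hge⟩ := mem_edges.1 h
        exact Or.inr ⟨g, by simp [hg], hge⟩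
      · exact Or.inl h
      · obtain ⟨g, hg, hge⟩ := mem_edges.1 h
        exact Or.inr ⟨g, by simp [hg], hge⟩
    apply Subtype.ext
    rcases hsplit l he with h | ⟨g, hg, hge⟩ <;> rcases hsplit l' he' with h' | ⟨g', hg', hge'⟩
    · exact hP.disj _ l.2 _ l'.2 e h h'
    · obtain ⟨a1, j, m, b, a2, a3, a4, a5, a6, a7⟩ := k2 l' g' hg'
      exact absurd a7 (hout _ l.2 g' a1 (hge' ▸ h) j a6)
    · obtain ⟨a1, j, m, b, a2, a3, a4, a5, a6, a7⟩ := k2 l g hg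
      exact absurd a7 (hout _ l'.2 g a1 (hge ▸ h') j a6)
    · obtain ⟨a1, j, m, b, a2, a3, a4, a5, a6, a7⟩ := k2 l g hg
      obtain ⟨b1, j', m', b', b2, b3, b4, b5, b6, b7⟩ := k2 l' g' hg'
      have hjj : j = j' := by
        by_contra hne
        have := Set.disjoint_left.1 (hF.disj j j' hne)
        rcases ok_same a1 b1 (hge.trans hge'.symm) with rfl | rfl
        · exact this a6 b6
        · exact this a6 b7
      subst hjj
      have := (hF.sys j).disj _ a2 _ b2 g.e (by simp [a4]) (by rw [hge, ← hge']; simp [b4])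
      have h3 := (List.append_inj' this rfl).2
      simp only [List.cons.injEq, and_true] at h3
      subst h3
      exact hP.disj _ l.2 _ l'.2 b.e a5 b5
  · intro i e he
    obtain ⟨l, hl, hel⟩ := hWA i he
    obtain ⟨b, m, rfl, hb, hm⟩ := ((hF.sys i).sw l hl).snoc (hF.sub i)
    have hb0 := ((hF.sys i).sw _ hl).1 b (by simp)
    obtain ⟨p, hp, hbp⟩ := hP.cov i (hb0.1.mem_cut.2 (Or.inl ⟨hb0.2.1, hb⟩))
    refine ⟨⟨p, hp⟩, ?_⟩
    have h3 := k3 ⟨p, hp⟩ i m b hl hb hbp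
    rw [edges_append, List.mem_append] at hel
    rcases hel with h | h
    · have := h3 h
      simp at this ⊢; tauto
    · simp only [edges_cons, edges_nil, List.mem_singleton] at h
      rw [h]; simp [hbp]

end LC

namespace LC
open Classical
variable {V : Type u} {E : Type v}

lemma Ch.stay_out {R : Set V} {y : V} : ∀ {l : List (Dart V E)} {z : V}, Ch z l y → z ∉ R →
    (∀ g ∈ l, g.t ∈ R → g.s ∈ R) → ∀ g ∈ l, g.s ∉ R ∧ g.t ∉ R
  | [], _, _, _, _ => by simp
  | d :: l, z, hc, hz, hR => by
    have hs : d.s ∉ R := by rw [hc.1]; exact hz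
    have ht : d.t ∉ R := fun h => hs (hR d (by simp) h)
    intro g hg
    rcases List.mem_cons.1 hg with rfl | h
    · exact ⟨hs, ht⟩
    · exact Ch.stay_out hc.2 ht (fun g hg => hR g (by simp [hg])) g h

lemma reach_back {G : MG V E} {A X : Set V} {W} (hW : Sys G A X W) {l} (hl : l ∈ W) {b} (hb : b ∈ l)
    (ht : b.t ∈ A ∪ Reach G A X W) : b.s ∈ A ∪ Reach G A X W := by
  have h0 := (hW.sw l hl).1 b hb
  have hr := ht.resolve_left h0.2.2
  by_cases hs : b.s ∈ A
  · exact Or.inl hs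
  · right
    exact reach_step (b := b.rev) hr ⟨h0.1.rev, reach_sub hr, ⟨h0.2.1, hs⟩, Or.inr ⟨l, hl, by rw [Dart.rev_rev]; exact hb⟩⟩

lemma reachTail {G : MG V E} {A X : Set V} (hAX : A ⊆ X) {W} (hW : Sys G A X W)
    (hc : G.cut (A ∪ Reach G A X W) ⊆ used W) :
    ∃ Wt, Sys G (A ∪ Reach G A X W) X Wt ∧ G.cut (A ∪ Reach G A X W) ⊆ used Wt := by
  set R := A ∪ Reach G A X W with hR
  have hRX : R ⊆ X := by
    rintro x (h | h)
    · exact hAX h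
    · exact (reach_sub h).1
  have key : ∀ e : G.cut R, ∃ l ∈ W, ∃ p b q, l = p ++ b :: q ∧ b.e = e.1 ∧ b.s ∈ R ∧ b.t ∉ R ∧
      (∀ g ∈ q, g.s ∉ R ∧ g.t ∉ R) ∧ IsSW G R X (b :: q) := by
    rintro ⟨e, he⟩
    obtain ⟨l, hl, hel⟩ := hc he
    obtain ⟨b, hb, rfl⟩ := mem_edges.1 hel
    have hsw := hW.sw l hl
    obtain ⟨h1, x, hx, y, hy, hch⟩ := id hsw
    have hb' : b.s ∈ R ∧ b.t ∉ R := by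
      rcases (h1 b hb).1.mem_cut.1 he with h | h
      · exact h
      · exact absurd (reach_back hW hl hb h.2) h.1
    obtain ⟨p, q, hpq, hc1, hc2⟩ := hch.mem_split hb
    have hq := hc2.stay_out hb'.2 (fun g hg => reach_back hW hl (by rw [hpq]; simp [hg]))
    refine ⟨l, hl, p, b, q, hpq, rfl, hb'.1, hb'.2, hq, ?_, b.s, hb'.1, y, hy, rfl, hc2⟩
    intro g hg
    have h2 := h1 g (by rw [hpq]; exact List.mem_append_right _ hg)
    refine ⟨h2.1, h2.2.1, ?_⟩
    rcases List.mem_cons.1 hg with rfl | h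
    · exact hb'.2
    · exact (hq g h).2
  choose l hl p b q k1 k2 k3 k4 k5 k6 using key
  obtain ⟨Wt, w1, w2, -⟩ := mkSys hRX (fun e : G.cut R => b e :: q e) k6 (by
    intro e f x hx hx'
    have hll : l e = l f := hW.disj _ (hl e) _ (hl f) x (by rw [k1 e, edges_append]; exact List.mem_append_right _ hx)
      (by rw [k1 f, edges_append]; exact List.mem_append_right _ hx')
    have hnd := hW.nodup _ (hl e)
    obtain ⟨g, hg, rfl⟩ := mem_edges.1 hx
    obtain ⟨g', hg', hgg⟩ := mem_edges.1 hx'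
    have h1 := k1 e
    have h2 := k1 f
    rw [hll] at h1
    rw [h1] at h2
    have hbb : b e = b f := by
      rcases List.append_eq_append_iff.1 h2 with ⟨a', ha, hb⟩ | ⟨c', ha, hb⟩
      · cases a' with
        | nil => simp at hb; exact hb.1
        | cons z a' =>
          simp only [List.cons_append, List.cons.injEq] at hb
          exact absurd (k3 f) (k5 e (b f) (by rw [hb.2]; simp)).1
      · cases c' with
        | nil => simp at hb; exact hb.1.symm
        | cons z c' =>
          simp only [List.cons_append, List.cons.injEq] at hb
          exact absurd (k3 e) (k5 f (b e) (by rw [hb.2]; simp)).1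
    apply Subtype.ext
    rw [← k2 e, ← k2 f, hbb])
  exact ⟨Wt, w1, fun e he => w2 e ⟨⟨e, he⟩, by simp [k2]⟩ he⟩

lemma exitL {ι : Type*} {H : MG V E} {A : ι → Set V} {N K Sg : Set V} {t : ι} {w : V}
    (dA : ∀ i j, i ≠ j → Disjoint (A i) (A j)) (dN : ∀ j, Disjoint (A j) N) (hE : Eul H N)
    (hlo : ∀ j, Loose H (A j) (N \ K ∪ A j)) (hB : BH V H.S) (hKN : K ⊆ N) (hSK : Sg ⊆ K)
    (hw : w ∈ K) (hwS : w ∉ Sg) (hinf : ∀ X ⊆ N, w ∈ X → ¬ (H.cut X).Finite) :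
    (∃ R y, Ch w R y ∧ (∀ d ∈ R, H.ok d ∧ d.s ∈ N ∧ d.t ∉ A t) ∧ (edges R).Nodup ∧ (y ∉ N ∨ y ∈ Sg) ∧
      Eul (H.del {e | e ∈ edges R}) (N \ K) ∧ ∀ j, Linked (H.del {e | e ∈ edges R}) (A j) (N \ K ∪ A j)) ∨
    ∃ X W p, Wave H (A t) (N \ Sg ∪ A t) X W ∧ PW H (A t) X p w ∧ (edges p).Nodup ∧ ∀ e ∈ edges p, e ∉ used W := by
  set Y := N \ Sg ∪ A t with hY
  have hAY : A t ⊆ Y := Set.subset_union_right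
  obtain ⟨X, W, ⟨hAX, hXY, hW, hWf⟩, hXl⟩ := fam1 H hAY
  set Rc := A t ∪ Reach H (A t) X W with hRc
  have hNA : ∀ j, ∀ x ∈ A j, x ∉ N := fun j x hx h => Set.disjoint_left.1 (dN j) hx h
  have hwN : w ∈ N := hKN hw
  have hwA : ∀ j, w ∉ A j := fun j h => hNA j w h hwN
  by_cases hwR : w ∈ Rc
  · right
    obtain ⟨W', p, a, f1, f2, f3, f4, -, -, -, f8⟩ := fact1 hAX hW (hwR.resolve_left (hwA t))
    exact ⟨X, W', p, ⟨hAX, hXY, f1, fun e he => (f8 e he).2 (hWf he)⟩, f2, f3, f4⟩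
  left
  have hRX : Rc ⊆ X := by
    rintro x (h | h)
    · exact hAX h
    · exact (reach_sub h).1
  have hfull : ∀ d, H.ok d → d.s ∈ Rc → d.t ∉ X → d.e ∈ used W := fun d hd hs ht =>
    hWf (hd.mem_cut.2 (Or.inl ⟨hRX hs, ht⟩))
  obtain ⟨f1, f2, -⟩ := fact2 hAX hW hfull
  obtain ⟨Wt, t1, t2⟩ := reachTail hAX hW (f2.trans used_trunc)
  have hYX : ∀ Z : Set V, A t ⊆ Z → Y \ Z ⊆ N := by
    rintro Z hZ x ⟨h | h, h'⟩
    · exact h.1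
    · exact absurd (hZ h) h'
  obtain ⟨Q, q1, q2⟩ := hB H subset_rfl X Y hXY (hE.mono (hYX X hAX)) hXl
  obtain ⟨U, u1, -, u2, -⟩ := t1.comp hRX hXY q1
  have hU : H.cut Rc ⊆ used U := fun e he => u2 (fun e he _ => q2 he) e he (t2 he)
  have hARc : A t ⊆ Rc := Set.subset_union_left
  obtain ⟨p, y, p1, p2, p3, p4, p5⟩ := parityL (hRX.trans hXY) u1 hU (w := w) (Or.inl ⟨hwN, hwS⟩) hwR (by
    intro X' hX' hfin
    have hX'N : X' ⊆ N := hX'.trans (hYX _ hARc)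
    refine ⟨fun _ h => hinf X' hX'N h hfin, fun _ => hE X' hX'N hfin⟩)
  -- shorten the walk
  obtain ⟨p', c1, c2, c3⟩ := p1.shorten
  obtain ⟨Q', s1, s2⟩ := p5
  have hpR : ∀ d ∈ p, H.ok d ∧ d.s ∈ Y ∧ d.s ∉ Rc ∧ d.t ∉ Rc := p3
  have hpcut : ∀ e ∈ edges p, ∀ d, H.ok d → d.e = e → d.s ∉ Rc ∧ d.t ∉ Rc := by
    intro e he d hd hde
    obtain ⟨g, hg, hge⟩ := mem_edges.1 he
    have h0 := hpR g hg
    rcases ok_same hd h0.1 (hde.trans hge.symm) with rfl | rfl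
    · exact h0.2.2
    · exact ⟨h0.2.2.2, h0.2.2.1⟩
  have hyN : y ∉ N ∨ y ∈ Sg := by
    by_contra h; push Not at h; exact p2 (Or.inl h)
  have hyK : y ∉ N \ K := by
    rintro ⟨h1, h2⟩
    rcases hyN with h | h
    · exact h h1
    · exact h2 (hSK h)
  set L := Sg ∪ K ∩ Rc with hL
  have hLK : L ⊆ K := Set.union_subset hSK Set.inter_subset_left
  set Y0 := N \ L ∪ A t with hY0
  have hY10 : N \ K ∪ A t ⊆ Y0 := Set.union_subset_union_left _ (Set.sdiff_subset_sdiff_right hLK)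
  have hY0Y : Y0 ⊆ Y := Set.union_subset_union_left _ (Set.sdiff_subset_sdiff_right Set.subset_union_left)
  have hlk : ∀ j, Linked H (A j) (N \ K ∪ A j) := fun j =>
    hB H subset_rfl _ _ Set.subset_union_right (hE.mono (by
      rintro x ⟨h | h, h'⟩
      · exact h.1
      · exact absurd h h')) (hlo j)
  -- protect t
  have hprot : Linked (H.del {e | e ∈ edges p'}) (A t) Y0 := by
    obtain ⟨L0, l1, l2⟩ := hlk t
    set X1 := (N \ K ∪ A t) ∩ Rc with hX1
    have hAX1 : A t ⊆ X1 := fun x hx => ⟨Or.inr hx, hARc hx⟩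
    obtain ⟨v1, v2⟩ := l1.trunc hAX1 (X := X1) Set.inter_subset_left
    have v3 : Sys (H.del {e | e ∈ edges p'}) (A t) X1 (trunc X1 '' L0) := by
      refine v1.to_del ?_
      rintro e ⟨l, hl, he⟩ hep
      obtain ⟨d, hd, rfl⟩ := mem_edges.1 he
      have h0 := (v1.sw l hl).1 d hd
      exact (hpcut _ (edges_sub c2 hep) d h0.1 rfl).1 h0.2.1.2
    have hX1Y0 : X1 ⊆ Y0 := Set.inter_subset_left.trans hY10
    set D := H.del {e | e ∈ edges p'} with hD
    have key : ∀ e : D.cut X1, ∃ f : List (Dart V E), IsSW D X1 Y0 f ∧ e.1 ∈ edges f ∧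
        ((∀ x ∈ edges f, x = e.1) ∨ (e.1 ∈ H.cut Rc ∧ f ∈ Q')) ∧ (∀ x ∈ edges f, x ∈ H.cut X1 → x = e.1) ∧
        (e.1 ∉ H.cut Rc → ∀ x ∈ edges f, x = e.1) := by
      rintro ⟨e, he⟩
      have he0 := he
      rw [hD, cut_del] at he0
      obtain ⟨d, hd, hde, hds, hdt⟩ : ∃ d, H.ok d ∧ d.e = e ∧ d.s ∈ X1 ∧ d.t ∉ X1 := by
        obtain ⟨d, h1, h2, h3, h4⟩ := he0.1
        exact ⟨d, h1, h2, h3, h4⟩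
      subst hde
      have hdD : D.ok d := ok_del.2 ⟨hd, he0.2⟩
      by_cases hr : d.t ∈ Rc
      · have hdK : d.t ∈ K ∧ d.t ∈ Rc := by
          refine ⟨?_, hr⟩
          by_contra hk
          apply hdt
          refine ⟨?_, hr⟩
          rcases hXY (hRX hr) with h | h
          · exact Or.inl ⟨h.1, hk⟩
          · exact Or.inr h
        refine ⟨[d], ⟨?_, d.s, hds, d.t, ?_, rfl, rfl⟩, by simp, Or.inl (by simp), by simp, by simp⟩
        · intro g hg
          rw [List.mem_singleton.1 hg]
          exact ⟨hdD, hX1Y0 hds, hdt⟩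
        · rintro (h | h)
          · exact h.2 (Or.inr hdK)
          · exact hNA t _ h (hKN hdK.1)
      · have hcut : d.e ∈ H.cut Rc := hd.mem_cut.2 (Or.inl ⟨hds.2, hr⟩)
        obtain ⟨q, hq, heq⟩ := s2 (show d.e ∈ (H.del {e | e ∈ edges p}).cut Rc by
          rw [cut_del]; exact ⟨hcut, fun h => (hpcut _ h d hd rfl).1 hds.2⟩)
        have hqs := s1.sw q hq
        obtain ⟨d', hd', hde', hs'⟩ := hqs.dartA heq (by rw [cut_del]; exact ⟨hcut, fun h => (hpcut _ h d hd rfl).1 hds.2⟩)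
        have hdd : d' = d := by
          rcases ok_same hd (ok_del.1 (hqs.1 d' hd').1).1 hde'.symm with h | h
          · exact h
          · subst h; exact absurd hs' hr
        subst hdd
        obtain ⟨d2, l2, hql, hd2, hl2⟩ := hqs.cons (hRX.trans hXY)
        have hdd : d' = d2 := by
          rw [hql] at hd'
          rcases List.mem_cons.1 hd' with h | h
          · exact h
          · exact absurd hs' (hl2 d' h)
        subst hdd
        obtain ⟨g1, x, hx, z, hz, hch⟩ := id hqs
        refine ⟨q, ⟨?_, d'.s, hds, z, fun h => hz (hY0Y h), ?_⟩, heq, Or.inr ⟨hcut, hq⟩, ?_, fun h => absurd hcut h⟩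
        · intro g hg
          have h0 := g1 g hg
          have h1 := ok_del.1 h0.1
          refine ⟨ok_del.2 ⟨h1.1, fun h => h1.2 (edges_sub c2 h)⟩, ?_, fun h => h0.2.2 h.2⟩
          by_cases hgR : g.s ∈ Rc
          · rw [hql] at hg
            rcases List.mem_cons.1 hg with rfl | h
            · exact hX1Y0 hds
            · exact absurd hgR (hl2 g h)
          · rcases h0.2.1 with h | h
            · exact Or.inl ⟨h.1, fun h' => h'.elim h.2 fun h' => hgR h'.2⟩
            · exact Or.inr h
        · rw [hql] at hch ⊢
          exact ⟨rfl, hch.2⟩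
        · intro x hx hxc
          obtain ⟨g, hg, rfl⟩ := mem_edges.1 hx
          have h0 := g1 g hg
          have : g.s ∈ X1 := by
            rcases (ok_del.1 h0.1).1.mem_cut.1 hxc with h | h
            · exact h.1
            · exact absurd h.2.2 h0.2.2
          rw [hql] at hg
          rcases List.mem_cons.1 hg with rfl | h
          · rfl
          · exact absurd this.2 (hl2 g h)
    choose f k1 k2 k3 k4 k5 using key
    obtain ⟨T, t1, t2, -⟩ := mkSys hX1Y0 f k1 (by
      intro e e' x hx hx'
      apply Subtype.ext
      have hcc : ∀ e : D.cut X1, e.1 ∈ H.cut X1 := fun e =>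
        (cut_del.subset e.2).1
      rcases k3 e with h | ⟨h1, h2⟩
      · rw [h x hx] at hx'
        exact k4 e' _ hx' (hcc e)
      · rcases k3 e' with h | ⟨h1', h2'⟩
        · rw [h x hx'] at hx
          exact (k4 e _ hx (hcc e')).symm
        · have := s1.disj _ h2 _ h2' x hx hx'
          have h3 := k2 e
          rw [this] at h3
          exact k4 e' _ h3 (hcc e))
    obtain ⟨U', a1, -, a2, -⟩ := v3.comp hAX1 hX1Y0 t1
    refine ⟨U', a1, fun e he => a2 (fun e he _ => t2 e ⟨⟨e, he⟩, k2 _⟩ he) e he ?_⟩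
    have he' := he
    rw [hD, cut_del] at he'
    exact v2 e (l2 he'.1) he'.1
  have hne : p' ≠ [] := by
    rintro rfl
    have : w = y := c1
    exact p2 (this ▸ Or.inl ⟨hwN, hwS⟩)
  obtain ⟨d0, P0, rfl⟩ := List.exists_cons_of_ne_nil hne
  have hO : OS H (fun j : {j // j ≠ t} => A j.1) (N \ K) (A t) Y0 w := by
    refine ⟨fun i j hij => dA _ _ (fun h => hij (Subtype.ext h)), fun j => (dN _).mono_right Set.sdiff_subset,
      hE.mono Set.sdiff_subset, fun j => hlk _, hB, Set.subset_union_right, fun j => ?_,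
      (dN t).mono_right Set.sdiff_subset, Set.subset_union_left.trans hY10, fun h => h.2 hw, fun j => hwA _⟩
    rw [hY0, Set.disjoint_union_right]
    exact ⟨(dN _).mono_right Set.sdiff_subset, dA _ _ j.2⟩
  have hpN : ∀ d ∈ p, d.s ∈ N := by
    intro d hd
    have h0 := hpR d hd
    exact hYX Rc hARc ⟨h0.2.1, h0.2.2.1⟩
  have hOW : OSW H (fun j : {j // j ≠ t} => A j.1) (A t) Y0 w (d0 :: P0) y := by
    refine ⟨c1, fun g hg => (hpR g (c2 hg)).1, fun g hg h => (hpR g (c2 hg)).2.2.2 (hARc h),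
      fun g hg j h => hNA _ _ h (hpN g (c2 hg)), c1.edges_nodup (fun g hg => (hpR g (c2 hg)).1) c3, hprot⟩
  obtain ⟨R, y', r1, r2, r3, r4⟩ := oneStep P0.length H _ _ (A t) Y0 d0 P0 y rfl hO hOW c3 hyK
  have hy' : y' ∉ N ∨ y' ∈ Sg := by
    rcases r3 with rfl | ⟨j, hj⟩
    · exact hyN
    · exact Or.inl (hNA _ _ hj)
  refine ⟨d0 :: R, y', r1.ch, fun d hd => ⟨r1.ok d hd, ?_, r1.tA d hd⟩, r1.nd, hy',
    (hE.mono Set.sdiff_subset).del_trail r1.ch r1.ok r1.nd (fun h => h.2 hw) ?_, fun j => ?_⟩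
  · rcases r2 d hd with h | ⟨d', h1, h2⟩
    · exact h.1
    · rw [← h2]; exact hpN d' (c2 h1)
  · rintro ⟨h1, h2⟩
    rcases hy' with h | h
    · exact h h1
    · exact h2 (hSK h)
  · by_cases hj : j = t
    · subst hj
      obtain ⟨Q3, z1, z2⟩ := r1.lk
      obtain ⟨z3, z4⟩ := z1.trunc (X := N \ K ∪ A j) Set.subset_union_right hY10
      exact ⟨_, z3, fun e he => z4 e (z2 he) he⟩
    · exact r4 ⟨j, hj⟩

end LC

namespace LC
open Classical
variable {V : Type u} {E : Type v}

def MG.piece {I : Type*} (G : MG V E) (st : E → I) (i : I) : MG V E := ⟨G.I, {e | e ∈ G.S ∧ st e = i}⟩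

lemma ok_piece {I : Type*} {G : MG V E} {st : E → I} {i : I} {d : Dart V E} :
    (G.piece st i).ok d ↔ G.ok d ∧ st d.e = i := by
  constructor
  · rintro ⟨⟨h1, h2⟩, h3⟩; exact ⟨⟨h1, h3⟩, h2⟩
  · rintro ⟨⟨h1, h3⟩, h2⟩; exact ⟨⟨h1, h2⟩, h3⟩

structure Dec {I : Type*} [LinearOrder I] (G : MG V E) (N : Set V) (st : E → I) (par : I → V × E) (K : Set V) : Prop where
  KN : K ⊆ N
  priv : ∀ d d', G.ok d → G.ok d' → d.s = d'.s → d.s ∈ N → d.s ∉ K → st d.e = st d'.e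
  inf : ∀ d, G.ok d → d.s ∈ K → ∀ X ⊆ N, d.s ∈ X → ¬ ((G.piece st (st d.e)).cut X).Finite
  book : ∀ d, G.ok d → d.s ∈ K → ∀ a ∈ G.S, st a ≤ st d.e → ∃ g : E → I,
    (∀ d1 d2, G.ok d1 → G.ok d2 → d1.s = d.s → d2.s = d.s → g d1.e = g d2.e → d1.e = d2.e) ∧
    ∀ d1, G.ok d1 → d1.s = d.s → par (g d1.e) = (d.s, a) ∧ st a < g d1.e ∧ ∃ d2, G.ok d2 ∧ d2.s = d.s ∧ st d2.e = g d1.e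

section
variable {I : Type*} [LinearOrder I] {G : MG V E} {N K : Set V} {st : E → I} {par : I → V × E}

lemma Dec.eul (hD : Dec G N st par K) (hE : Eul G N) (i : I) : Eul (G.piece st i) N := by
  intro X hX hfin
  set X' := {x | x ∈ X ∧ ∃ d, (G.piece st i).ok d ∧ d.s = x} with hX'
  have h1 : (G.piece st i).cut X = (G.piece st i).cut X' := by
    ext e
    constructor
    · rintro ⟨d, h1, h2, h3, h4⟩
      exact ⟨d, h1, h2, ⟨h3, d, h1, rfl⟩, fun h => h4 h.1⟩
    · rintro ⟨d, h1, h2, h3, h4⟩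
      exact ⟨d, h1, h2, h3.1, fun h => h4 ⟨h, d.rev, h1.rev, rfl⟩⟩
  have h2 : (G.piece st i).cut X' = G.cut X' := by
    ext e
    constructor
    · rintro ⟨d, h1, h2, h3, h4⟩
      exact ⟨d, (ok_piece.1 h1).1, h2, h3, h4⟩
    · rintro ⟨d, h1, h2, h3, h4⟩
      refine ⟨d, ok_piece.2 ⟨h1, ?_⟩, h2, h3, h4⟩
      obtain ⟨h3, d', h5, h6⟩ := h3
      have h5' := ok_piece.1 h5
      have hK : d.s ∉ K := by
        intro hK
        refine hD.inf d' h5'.1 (h6 ▸ hK) X hX (h6 ▸ h3) ?_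
        rw [h5'.2]; exact hfin
      rw [hD.priv d d' h1 h5'.1 h6.symm (hX h3) hK, h5'.2]
  rw [h1] at hfin ⊢
  rw [h2] at hfin ⊢
  exact hE X' (fun x hx => hX hx.1) hfin

lemma glueWave (hD : Dec G N st par K) {A U : Set V} (hU : U ⊆ K) (hAN : Disjoint A N) (X : I → Set V) (W : I → Set (List (Dart V E)))
    (hW : ∀ i, Wave (G.piece st i) A (N \ (K \ U) ∪ A) (X i) (W i)) (σ : V → E → I) (p : I → List (Dart V E))
    (hσ : ∀ d d', G.ok d → G.ok d' → d.s ∈ U → d'.s ∈ U → σ d.s d.e = σ d'.s d'.e → d.e = d'.e)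
    (hp : ∀ d, G.ok d → d.s ∈ U → PW (G.piece st (σ d.s d.e)) A (X (σ d.s d.e)) (p (σ d.s d.e)) d.s ∧
      ∀ e ∈ edges (p (σ d.s d.e)), e ∉ used (W (σ d.s d.e))) :
    ∃ X' W', Wave G A (N ∪ A) X' W' ∧ ∀ i, ∀ d, (G.piece st i).ok d → d.s ∈ X i → d.s ∈ X' := by
  set X' := A ∪ U ∪ {x | ∃ i, x ∈ X i ∧ ∃ d, (G.piece st i).ok d ∧ d.s = x} with hX'
  have htouch : ∀ i, ∀ d, (G.piece st i).ok d → d.s ∈ X i → d.s ∈ X' := fun i d hd hs => Or.inr ⟨i, hs, d, hd, rfl⟩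
  have htouch' : ∀ i, ∀ d, (G.piece st i).ok d → d.t ∈ X i → d.t ∈ X' := fun i d hd hs =>
    Or.inr ⟨i, hs, d.rev, hd.rev, rfl⟩
  have hAX' : A ⊆ X' := fun x hx => Or.inl (Or.inl hx)
  have hX'Y : X' ⊆ N ∪ A := by
    rintro x ((h | h) | ⟨i, h, -⟩)
    · exact Or.inr h
    · exact Or.inl (hD.KN (hU h))
    · rcases (hW i).2.1 h with h | h
      · exact Or.inl h.1
      · exact Or.inr h
  have hUA : ∀ x ∈ U, x ∉ A := fun x hx h => Set.disjoint_left.1 hAN h (hD.KN (hU hx))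
  have key : ∀ e : G.cut X', ∃ d f, G.ok d ∧ d.e = e.1 ∧ d.t ∉ X' ∧ d ∈ f ∧ IsSW G A X' f ∧
      ((f ∈ W (st d.e) ∧ d.s ∈ X (st d.e)) ∨ (d.s ∈ U ∧ d.s ∉ X (st d.e) ∧ f = p (σ d.s d.e) ++ [d])) := by
    rintro ⟨e, d, hd, rfl, hds, hdt⟩
    have hdp : (G.piece st (st d.e)).ok d := ok_piece.2 ⟨hd, rfl⟩
    by_cases hs : d.s ∈ X (st d.e)
    · have ht : d.t ∉ X (st d.e) := fun h => hdt (htouch' _ d hdp h)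
      obtain ⟨f, hf, hef⟩ := (hW (st d.e)).2.2.2 (hdp.mem_cut.2 (Or.inl ⟨hs, ht⟩))
      have hfs := (hW (st d.e)).2.2.1.sw f hf
      obtain ⟨b, hb, hbe, hbt⟩ := hfs.dartX hef (hdp.mem_cut.2 (Or.inl ⟨hs, ht⟩))
      have hbd : b = d := by
        rcases ok_same hd (ok_piece.1 (hfs.1 b hb).1).1 hbe.symm with h | h
        · exact h
        · subst h; exact absurd hs hbt
      subst hbd
      refine ⟨b, f, hd, rfl, hdt, hb, ⟨fun g hg => ?_, ?_⟩, Or.inl ⟨hf, hs⟩⟩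
      · have h0 := hfs.1 g hg
        exact ⟨(ok_piece.1 h0.1).1, htouch _ g h0.1 h0.2.1, h0.2.2⟩
      · obtain ⟨x, hx, y, hy, hc⟩ := hfs.2
        obtain ⟨l1, l2, hl, hc1, hc2⟩ := hc.mem_split hb
        refine ⟨x, hx, b.t, hdt, ?_⟩
        cases l2 with
        | nil => rw [hl]; exact hc1.append ⟨rfl, rfl⟩
        | cons b' l2 =>
          have h0 := (hfs.1 b' (by rw [hl]; simp)).2.1
          rw [hc2.1] at h0
          exact absurd h0 ht
    · have hsU : d.s ∈ U := by
        rcases hds with (h | h) | ⟨j, hj, d', hd', hdd⟩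
        · exact absurd ((hW (st d.e)).1 h) hs
        · exact h
        · by_contra hsU
          have hd'' := ok_piece.1 hd'
          rcases (hW j).2.1 hj with h | h
          · have := hD.priv d d' hd hd''.1 hdd.symm h.1 (fun hk => h.2 ⟨hk, hsU⟩)
            rw [this, hd''.2] at hs
            exact hs hj
          · exact hs ((hW (st d.e)).1 h)
      obtain ⟨⟨p1, p2, x, hx, hc⟩, -⟩ := hp d hd hsU
      refine ⟨d, _, hd, rfl, hdt, by simp, ⟨?_, x, hx, d.t, hdt, hc.append (show Ch d.s [d] d.t from ⟨rfl, rfl⟩)⟩, Or.inr ⟨hsU, hs, rfl⟩⟩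
      intro g hg
      rcases List.mem_append.1 hg with h | h
      · have h0 := p1 g h
        exact ⟨(ok_piece.1 h0.1).1, htouch _ g h0.1 h0.2.1, h0.2.2.2⟩
      · rw [List.mem_singleton.1 h]
        exact ⟨hd, hds, fun h => hdt (hAX' h)⟩
  choose d f k1 k2 k3 k4 k5 k6 using key
  -- edges of a supply walk
  have hpe : ∀ e : G.cut X', (d e).s ∈ U → ∀ x ∈ edges (p (σ (d e).s (d e).e)), st x = σ (d e).s (d e).e ∧
      ∀ g, G.ok g → g.e = x → g.s ∈ X (st x) ∧ g.t ∈ X (st x) := by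
    intro e he x hx
    obtain ⟨⟨p1, -⟩, -⟩ := hp (d e) (k1 e) he
    obtain ⟨b, hb, rfl⟩ := mem_edges.1 hx
    have h0 := p1 b hb
    have h1 := ok_piece.1 h0.1
    refine ⟨h1.2, fun g hg hgb => ?_⟩
    rw [h1.2]
    rcases ok_same h1.1 hg hgb.symm with rfl | rfl
    · exact ⟨h0.2.1, h0.2.2.1⟩
    · exact ⟨h0.2.2.1, h0.2.1⟩
  have hWe : ∀ i, ∀ l ∈ W i, ∀ x ∈ edges l, st x = i ∧ ∀ g, G.ok g → g.e = x → g.s ∈ X i ∨ g.t ∈ X i := by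
    intro i l hl x hx
    obtain ⟨b, hb, rfl⟩ := mem_edges.1 hx
    have h0 := ((hW i).2.2.1.sw l hl).1 b hb
    have h1 := ok_piece.1 h0.1
    refine ⟨h1.2, fun g hg hgb => ?_⟩
    rcases ok_same h1.1 hg hgb.symm with rfl | rfl
    · exact Or.inl h0.2.1
    · exact Or.inr h0.2.1
  have hdX : ∀ e, (d e).t ∉ X (st (d e).e) := fun e h => k3 e (htouch' _ _ (ok_piece.2 ⟨k1 e, rfl⟩) h)
  -- mixed case
  have hmix : ∀ e e' x, f e ∈ W (st (d e).e) → (d e').s ∈ U → (d e').s ∉ X (st (d e').e) → f e' = p (σ (d e').s (d e').e) ++ [d e'] →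
      x ∈ edges (f e) → x ∈ edges (f e') → False := by
    intro e e' x h1 h2 h3 h4 hx hx'
    rw [h4, edges_append, List.mem_append] at hx'
    have h5 := hWe _ _ h1 x hx
    rcases hx' with hx' | hx'
    · have h6 := hpe e' h2 x hx'
      refine (hp (d e') (k1 e') h2).2 x hx' ⟨f e, ?_, hx⟩
      rw [← h6.1, h5.1]; exact h1
    · simp at hx'
      subst hx'
      rcases h5.2 (d e') (k1 e') rfl with h | h
      · rw [← h5.1] at h; exact h3 h
      · rw [← h5.1] at h; exact hdX e' h
  obtain ⟨Wn, w1, -, w2, -⟩ := mkSys hAX' f k5 (by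
    intro e e' x hx hx'
    apply Subtype.ext
    rw [← k2 e, ← k2 e']
    rcases k6 e with ⟨h1, h2⟩ | ⟨h1, h2, h3⟩ <;> rcases k6 e' with ⟨h1', h2'⟩ | ⟨h1', h2', h3'⟩
    · have e1 := (hWe _ _ h1 x hx).1
      have e2 := (hWe _ _ h1' x hx').1
      rw [← e1] at h1 h2
      rw [← e2] at h1' h2'
      have hff := (hW (st x)).2.2.1.disj _ h1 _ h1' x hx hx'
      have hsw := (hW (st x)).2.2.1.sw _ h1
      obtain ⟨b, m, hm, hb1, hb2⟩ := hsw.snoc (hW (st x)).1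
      have hlast : ∀ g ∈ f e, g.t ∉ X (st x) → g = b := by
        intro g hg hgt
        rw [hm] at hg
        rcases List.mem_append.1 hg with h | h
        · exact absurd (hb2 g h) hgt
        · simpa using h
      have a1 := hlast (d e) (k4 e) (by have := hdX e; rw [← e1] at this; exact this)
      have a2 := hlast (d e') (by rw [hff]; exact k4 e') (by have := hdX e'; rw [← e2] at this; exact this)
      rw [a1, a2]
    · exact (hmix e e' x h1 h1' h2' h3' hx hx').elim
    · exact (hmix e' e x h1' h1 h2 h3 hx' hx).elim
    · rw [h3, edges_append, List.mem_append] at hx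
      rw [h3', edges_append, List.mem_append] at hx'
      rcases hx with hx | hx <;> rcases hx' with hx' | hx'
      · exact hσ _ _ (k1 e) (k1 e') h1 h1' ((hpe e h1 x hx).1.symm.trans (hpe e' h1' x hx').1)
      · simp at hx'
        subst hx'
        exact absurd ((hpe e h1 _ hx).2 (d e') (k1 e') rfl).1 h2'
      · simp at hx
        subst hx
        exact absurd ((hpe e' h1' _ hx').2 (d e) (k1 e) rfl).1 h2
      · simp at hx hx'
        rw [← hx, ← hx'])
  exact ⟨X', Wn, ⟨hAX', hX'Y, w1, fun e he => w2 e ⟨⟨e, he⟩, mem_edges.2 ⟨_, k4 _, k2 _⟩⟩ he⟩, htouch⟩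

lemma trivWave (H : MG V E) {A Y : Set V} (hAY : A ⊆ Y) : ∃ W, Wave H A Y A W := by
  have key : ∀ e : H.cut A, ∃ d, H.ok d ∧ d.e = e.1 ∧ d.s ∈ A ∧ d.t ∉ A := fun e => e.2
  choose d k1 k2 k3 k4 using key
  obtain ⟨W, w1, w2, -⟩ := mkSys (G := H) (subset_refl A) (fun e => [d e])
    (fun e => ⟨fun g hg => by rw [List.mem_singleton.1 hg]; exact ⟨k1 e, k3 e, k4 e⟩, (d e).s, k3 e, (d e).t, k4 e, rfl, rfl⟩)
    (fun e e' x hx hx' => by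
      simp at hx hx'
      apply Subtype.ext
      rw [← k2 e, ← k2 e', ← hx, ← hx'])
  exact ⟨W, subset_rfl, hAY, w1, fun e he => w2 e ⟨⟨e, he⟩, by simp [k2]⟩ he⟩

lemma Dec.loose (hD : Dec G N st par K) {A : Set V} (hAN : Disjoint A N) (hl : Loose G A (N ∪ A)) (i : I) :
    Loose (G.piece st i) A (N \ K ∪ A) := by
  intro X W hW d hd hs ht hX
  have hAY : A ⊆ N \ K ∪ A := Set.subset_union_right
  have key : ∀ j, ∃ X W, Wave (G.piece st j) A (N \ K ∪ A) X W ∧ (j = i → d.t ∈ X) := by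
    intro j
    by_cases hj : j = i
    · subst hj; exact ⟨X, W, hW, fun _ => hX⟩
    · obtain ⟨W', hW'⟩ := trivWave (G.piece st j) hAY
      exact ⟨A, W', hW', fun h => absurd h hj⟩
  choose X1 W1 k1 k2 using key
  obtain ⟨X', W', h1, h2⟩ := glueWave hD (U := ∅) (Set.empty_subset _) hAN X1 W1 (by simpa using k1) (fun _ _ => i) (fun _ => [])
    (by simp) (by simp)
  exact hl X' W' h1 d (ok_piece.1 hd).1 hs ht (h2 i d.rev hd.rev (k2 i rfl))

end

end LC

namespace LC
open Classical
variable {V : Type u} {E : Type v}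

noncomputable def Lset (P : Set V → V → Prop) (α : Ordinal.{u}) : Set V :=
  {w | P {x | ∃ β, ∃ _h : β < α, x ∈ Lset P β} w}
termination_by α
decreasing_by exact _h

lemma rankL (P : Set V → V → Prop) : ∃ (rk : V → Ordinal.{u}) (U : Set V),
    (∀ w ∈ U, P {x | x ∈ U ∧ rk x < rk w} w) ∧ ∀ w, w ∉ U → ¬ P U w := by
  have hL : ∀ α w, w ∈ Lset P α ↔ P {x | ∃ β, β < α ∧ x ∈ Lset P β} w := by
    intro α w
    rw [Lset]
    simp
  obtain ⟨L, hLd⟩ : ∃ L, L = Lset P := ⟨_, rfl⟩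
  rw [← hLd] at hL
  set rk : V → Ordinal.{u} := fun w => sInf {α | w ∈ L α} with hrk
  have hmem : ∀ w, (∃ α, w ∈ L α) → w ∈ L (rk w) := fun w h => csInf_mem (s := {α | w ∈ L α}) h
  have hle : ∀ w α, w ∈ L α → rk w ≤ α := fun w α h => csInf_le' (s := {α | w ∈ L α}) h
  refine ⟨rk, {w | ∃ α, w ∈ L α}, ?_, ?_⟩
  · intro w hw
    have h1 := (hL _ _).1 (hmem w hw)
    have h2 : {x | ∃ β, β < rk w ∧ x ∈ L β} = {x | x ∈ {w | ∃ α, w ∈ L α} ∧ rk x < rk w} := by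
      ext x
      constructor
      · rintro ⟨β, h1, h2⟩
        exact ⟨⟨β, h2⟩, (hle x β h2).trans_lt h1⟩
      · rintro ⟨h1, h2⟩
        exact ⟨rk x, h2, hmem x h1⟩
    rw [← h2]; exact h1
  · intro w hw hP
    apply hw
    refine ⟨Order.succ (⨆ x, rk x), (hL _ _).2 ?_⟩
    have h2 : {x | ∃ β, β < Order.succ (⨆ x, rk x) ∧ x ∈ L β} = {w | ∃ α, w ∈ L α} := by
      ext x
      constructor
      · rintro ⟨β, -, h2⟩
        exact ⟨β, h2⟩
      · intro h1
        exact ⟨rk x, Order.lt_succ_of_le (Ordinal.le_iSup rk x), hmem x h1⟩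
    rw [h2]; exact hP

def GoodR {ι : Type*} (H : MG V E) (A : ι → Set V) (N K Sg : Set V) (t : ι) (w : V) (R : List (Dart V E)) : Prop :=
  ∃ y, Ch w R y ∧ (∀ d ∈ R, H.ok d ∧ d.s ∈ N ∧ d.t ∉ A t) ∧ (edges R).Nodup ∧ (y ∉ N ∨ y ∈ Sg) ∧
    Eul (H.del {e | e ∈ edges R}) (N \ K) ∧ ∀ j, Linked (H.del {e | e ∈ edges R}) (A j) (N \ K ∪ A j)

section
variable {I : Type*} [LinearOrder I] {G : MG V E} {N K : Set V} {st : E → I} {par : I → V × E}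

lemma allExit {ι : Type*} (hD : Dec G N st par K) {A : ι → Set V} (dA : ∀ i j, i ≠ j → Disjoint (A i) (A j))
    (dN : ∀ j, Disjoint (A j) N) (hE : Eul G N) (hlo : ∀ j, Loose G (A j) (N ∪ A j))
    (hB : ∀ i, BH V (G.piece st i).S) (t : ι) {U : Set V} (hUK : U ⊆ K)
    (hU : ∀ w ∈ K, w ∉ U → ∃ a ∈ G.cut (A t), (∃ d, G.ok d ∧ d.s = w ∧ st a ≤ st d.e) ∧
      ∀ i R, par i = (w, a) → st a < i → ¬ GoodR (G.piece st i) A N K U t w R) : K ⊆ U := by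
  intro w0 hw0
  by_contra hwU0
  have key : ∀ w : (K \ U : Set V), ∃ a, ∃ g : E → I,
      (∀ d1 d2, G.ok d1 → G.ok d2 → d1.s = w → d2.s = w → g d1.e = g d2.e → d1.e = d2.e) ∧
      (∃ d, G.ok d ∧ d.s = w) ∧
      ∀ d1, G.ok d1 → d1.s = w → par (g d1.e) = (w.1, a) ∧ ∃ X W p, Wave (G.piece st (g d1.e)) (A t) (N \ U ∪ A t) X W ∧
        PW (G.piece st (g d1.e)) (A t) X p w ∧ (edges p).Nodup ∧ ∀ e ∈ edges p, e ∉ used W := by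
    rintro ⟨w, hwK, hwU⟩
    obtain ⟨a, ha, ⟨d, hd, rfl, hda⟩, hno⟩ := hU w hwK hwU
    obtain ⟨g, hg1, hg2⟩ := hD.book d hd hwK a (G.cut_sub _ ha) hda
    refine ⟨a, g, hg1, ⟨d, hd, rfl⟩, fun d1 hd1 hs1 => ?_⟩
    obtain ⟨h1, h2, d2, hd2, hs2, hst2⟩ := hg2 d1 hd1 hs1
    refine ⟨h1, ?_⟩
    rcases exitL (H := G.piece st (g d1.e)) (t := t) dA dN (hD.eul hE _) (fun j => hD.loose (dN j) (hlo j) _) (hB _) hD.KN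
      hUK hwK hwU (by
        intro X hX hwX
        have := hD.inf d2 hd2 (hs2 ▸ hwK) X hX (hs2 ▸ hwX)
        rwa [hst2] at this) with ⟨R, hR⟩ | h
    · exact absurd hR (hno _ R h1 h2)
    · exact h
  choose a g k1 k2 k3 using key
  have kU : K \ (K \ U) = U := by
    ext x; simp only [Set.mem_diff]; have := @hUK x; tauto
  have key2 : ∀ i, ∃ X W p, Wave (G.piece st i) (A t) (N \ U ∪ A t) X W ∧
      ∀ w : (K \ U : Set V), ∀ d1, G.ok d1 → d1.s = w → g w d1.e = i →
        PW (G.piece st i) (A t) X p w ∧ ∀ e ∈ edges p, e ∉ used W := by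
    intro i
    by_cases hi : ∃ w : (K \ U : Set V), ∃ d1, G.ok d1 ∧ d1.s = w ∧ g w d1.e = i
    · obtain ⟨w, d1, h1, h2, rfl⟩ := hi
      obtain ⟨hp, X, W, p, h3, h4, -, h5⟩ := k3 w d1 h1 h2
      refine ⟨X, W, p, h3, fun w' d' h1' h2' h3' => ?_⟩
      have := (k3 w' d' h1' h2').1
      rw [h3', hp] at this
      have : w = w' := Subtype.ext (Prod.ext_iff.1 this).1
      subst this
      exact ⟨h4, h5⟩
    · obtain ⟨W, hW⟩ := trivWave (G.piece st i) (A := A t) (Y := N \ U ∪ A t) Set.subset_union_right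
      exact ⟨A t, W, [], hW, fun w d1 h1 h2 h3 => absurd ⟨w, d1, h1, h2, h3⟩ hi⟩
  choose X W p m1 m2 using key2
  obtain ⟨X', W', h1, h2⟩ := glueWave hD (A := A t) (U := K \ U) Set.diff_subset (dN t) X W (by rw [kU]; exact m1)
    (fun w e => if h : w ∈ K \ U then g ⟨w, h⟩ e else st e) p
    (by
      intro d d' hd hd' hs hs' he
      rw [dif_pos hs, dif_pos hs'] at he
      have e1 := (k3 ⟨_, hs⟩ d hd rfl).1
      have e2 := (k3 ⟨_, hs'⟩ d' hd' rfl).1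
      rw [he, e2] at e1
      have e3 : d'.s = d.s := (Prod.ext_iff.1 e1).1
      have e4 : (⟨d'.s, hs'⟩ : (K \ U : Set V)) = ⟨d.s, hs⟩ := Subtype.ext e3
      rw [e4] at he
      exact k1 _ d d' hd hd' rfl e3 he)
    (by
      intro d hd hs
      rw [dif_pos hs]
      exact m2 _ ⟨_, hs⟩ d hd rfl rfl)
  obtain ⟨d, hd, hds⟩ := k2 ⟨w0, hw0, hwU0⟩
  obtain ⟨⟨p1, p2, x, hx, hc⟩, -⟩ := m2 _ ⟨w0, hw0, hwU0⟩ d hd hds rfl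
  revert p1 hc
  generalize p (g ⟨w0, hw0, hwU0⟩ d.e) = pl
  intro p1 hc
  cases pl with
  | nil =>
    simp only [Ch_nil] at hc
    exact p2 (hc ▸ hx)
  | cons b l =>
    have hb := p1 b (by simp)
    refine hlo t X' W' h1 b (ok_piece.1 hb.1).1 (by rw [hc.1]; exact hx) hb.2.2.2 (h2 _ b.rev hb.1.rev hb.2.2.1)

end

end LC

namespace LC
open Classical
variable {V : Type u} {E : Type v}

/-- a path fragment in piece j, starting in A t by the edge a and ending at z -/
def Frag {ι I : Type*} (G : MG V E) (A : ι → Set V) (N K : Set V) (st : E → I) (j : I) (s : List (Dart V E)) (t : ι)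
    (a : E) (z : V) : Prop :=
  (∃ d s', s = d :: s' ∧ d.e = a ∧ d.s ∈ A t ∧ Ch d.s s z) ∧
    (∀ d ∈ s, G.ok d ∧ st d.e = j ∧ d.s ∈ N ∪ A t ∧ d.t ∉ A t) ∧ (z ∉ N ∪ A t ∨ z ∈ K)

lemma Frag.unique {ι I : Type*} {G : MG V E} {A : ι → Set V} {N K : Set V} {st : E → I} {j j' : I} {s : List (Dart V E)}
    {t t' : ι} {a a' : E} {z z' : V} (h : Frag G A N K st j s t a z) (h' : Frag G A N K st j' s t' a' z') :
    a = a' ∧ z = z' := by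
  obtain ⟨⟨d, s1, rfl, rfl, h1, h2⟩, -⟩ := h
  obtain ⟨⟨d', s1', he, rfl, h1', h2'⟩, -⟩ := h'
  obtain ⟨rfl, rfl⟩ := List.cons.inj he
  exact ⟨rfl, h2.unique h2'⟩

lemma Frag.mem {ι I : Type*} {G : MG V E} {A : ι → Set V} {N K : Set V} {st : E → I} {j : I} {s : List (Dart V E)}
    {t : ι} {a : E} {z : V} (h : Frag G A N K st j s t a z) : a ∈ edges s ∧ st a = j := by
  obtain ⟨⟨d, s1, rfl, rfl, h1, h2⟩, h3, -⟩ := h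
  exact ⟨by simp, (h3 d (by simp)).2.1⟩

section
variable {I : Type*} [LinearOrder I] [WellFoundedLT I] {G : MG V E} {N K : Set V} {st : E → I} {par : I → V × E}

theorem M_of_Dec {ι : Type*} (hD : Dec G N st par K) {A : ι → Set V} (dA : ∀ i j, i ≠ j → Disjoint (A i) (A j))
    (dN : ∀ j, Disjoint (A j) N) (hE : Eul G N) (hlo : ∀ j, Loose G (A j) (N ∪ A j))
    (hB : ∀ i, BH V (G.piece st i).S)
    (hC : ∀ i, ∀ (H : MG V E) (N' : Set V), H.S ⊆ (G.piece st i).S → (∀ j, Disjoint (A j) N') → Eul H N' →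
      (∀ j, Linked H (A j) (N' ∪ A j)) → ∃ P, PS H A N' P) : ∃ P, PS G A N P := by
  have dNK : ∀ j, Disjoint (A j) (N \ K) := fun j => (dN j).mono_right Set.diff_subset
  -- ranks
  have key : ∀ t : ι, ∃ rk : V → Ordinal.{u}, ∀ w ∈ K, ∀ a ∈ G.cut (A t), (∃ d, G.ok d ∧ d.s = w ∧ st a ≤ st d.e) →
      ∃ i R, par i = (w, a) ∧ st a < i ∧ GoodR (G.piece st i) A N K {x | x ∈ K ∧ rk x < rk w} t w R := by
    intro t
    obtain ⟨rk, U, h1, h2⟩ := rankL (fun (Sg : Set V) w => w ∈ K ∧ ∀ a ∈ G.cut (A t), (∃ d, G.ok d ∧ d.s = w ∧ st a ≤ st d.e) →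
      ∃ i R, par i = (w, a) ∧ st a < i ∧ GoodR (G.piece st i) A N K Sg t w R)
    have hUK : U ⊆ K := fun w hw => (h1 w hw).1
    have hKU : K ⊆ U := by
      apply allExit hD dA dN hE hlo hB t hUK
      intro w hw hwU
      have := h2 w hwU
      push Not at this
      obtain ⟨a, ha, hd, hno⟩ := this hw
      exact ⟨a, ha, hd, fun i R h1 h2 => hno i R h1 h2⟩
    have : U = K := hUK.antisymm hKU
    subst this
    exact ⟨rk, fun w hw => (h1 w hw).2⟩
  choose rk hrk using key
  by_cases hne : Nonempty ι
  swap
  · refine ⟨∅, by simp, by simp, by simp, fun i => absurd ⟨i⟩ hne⟩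
  obtain ⟨τ, hτ⟩ : ∃ τ : E → ι, ∀ t, ∀ d, G.ok d → d.s ∈ A t → d.t ∈ N → τ d.e = t := by
    refine ⟨fun a => if h : ∃ t, ∃ d, G.ok d ∧ d.e = a ∧ d.s ∈ A t ∧ d.t ∈ N then h.choose else Classical.arbitrary ι, ?_⟩
    intro t d hd hs ht
    have h : ∃ t, ∃ d', G.ok d' ∧ d'.e = d.e ∧ d'.s ∈ A t ∧ d'.t ∈ N := ⟨t, d, hd, rfl, hs, ht⟩
    beta_reduce
    rw [dif_pos h]
    obtain ⟨d', h1, h2, h3, h4⟩ := h.choose_spec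
    by_contra hne
    rcases ok_same hd h1 h2.symm with h | h
    · rw [h] at h3; exact Set.disjoint_left.1 (dA _ _ hne) h3 hs
    · rw [h] at h3; exact Set.disjoint_left.1 (dN _) h3 ht
  -- pieces
  have key2 : ∀ i, ∃ R P, PS ((G.piece st i).del {e | e ∈ edges R}) A (N \ K) P ∧
      (R = [] ∨ ∃ y, (par i).1 ∈ K ∧ Ch (par i).1 R y ∧ ∀ d ∈ R, (G.piece st i).ok d ∧ d.s ∈ N) ∧
      ((par i).1 ∈ K → (∃ R', GoodR (G.piece st i) A N K {x | x ∈ K ∧ rk (τ (par i).2) x < rk (τ (par i).2) (par i).1}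
          (τ (par i).2) (par i).1 R') →
        GoodR (G.piece st i) A N K {x | x ∈ K ∧ rk (τ (par i).2) x < rk (τ (par i).2) (par i).1} (τ (par i).2) (par i).1 R) := by
    intro i
    by_cases h : (par i).1 ∈ K ∧ (∃ R', GoodR (G.piece st i) A N K {x | x ∈ K ∧ rk (τ (par i).2) x < rk (τ (par i).2) (par i).1}
          (τ (par i).2) (par i).1 R')
    · obtain ⟨hk, R, hR⟩ := h
      obtain ⟨y, r1, r2, r3, r4, r5, r6⟩ := id hR
      obtain ⟨P, hP⟩ := hC i ((G.piece st i).del {e | e ∈ edges R}) (N \ K) Set.diff_subset dNK r5 r6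
      exact ⟨R, P, hP, Or.inr ⟨y, hk, r1, fun d hd => ⟨(r2 d hd).1, (r2 d hd).2.1⟩⟩, fun _ _ => hR⟩
    · have hE' : Eul (G.piece st i) (N \ K) := (hD.eul hE i).mono Set.diff_subset
      obtain ⟨P, hP⟩ := hC i (G.piece st i) (N \ K) subset_rfl dNK hE' (fun j =>
        hB i _ subset_rfl _ _ Set.subset_union_right (hE'.mono (by
          rintro x ⟨h1 | h1, h2⟩
          · exact h1
          · exact absurd h1 h2)) (hD.loose (dN j) (hlo j) i))
      exact ⟨[], P, by simpa using hP, Or.inl rfl, fun h1 h2 => absurd ⟨h1, h2⟩ h⟩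
  choose R P hP hR hRG using key2
  have hRp : ∀ i, ∀ d ∈ R i, (G.piece st i).ok d ∧ d.s ∈ N := by
    intro i d hd
    rcases hR i with h | ⟨y, -, -, h⟩
    · rw [h] at hd; simp at hd
    · exact h d hd
  have hRst : ∀ i, ∀ e ∈ edges (R i), st e = i := by
    intro i e he
    obtain ⟨d, hd, rfl⟩ := mem_edges.1 he
    exact (ok_piece.1 (hRp i d hd).1).2
  -- orbits
  have korb : ∀ a z, ∃ is : List I, ∃ m y, (z ∈ K → (∃ d, G.ok d ∧ d.s = z ∧ st a ≤ st d.e) → a ∈ G.cut (A (τ a)) →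
      Ch z m y ∧ y ∉ N ∪ A (τ a) ∧ (∀ d ∈ m, G.ok d ∧ d.s ∈ N ∧ d.t ∉ A (τ a)) ∧ (∀ d ∈ m, ∃ i ∈ is, d.e ∈ edges (R i)) ∧
      ∀ i ∈ is, (par i).2 = a ∧ st a < i ∧ edges (R i) ⊆ edges m) := by
    intro a z
    by_cases hz : z ∈ K ∧ (∃ d, G.ok d ∧ d.s = z ∧ st a ≤ st d.e) ∧ a ∈ G.cut (A (τ a))
    swap
    · exact ⟨[], [], z, fun h1 h2 h3 => absurd ⟨h1, h2, h3⟩ hz⟩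
    obtain ⟨hzK, hzd, ha⟩ := hz
    induction hr : rk (τ a) z using WellFoundedLT.induction generalizing z with
    | _ r ih =>
    obtain ⟨i, R', hi, hai, hG'⟩ := hrk (τ a) z hzK a ha hzd
    have hpi1 : (par i).1 = z := by rw [hi]
    have hpi2 : (par i).2 = a := by rw [hi]
    have hG : GoodR (G.piece st i) A N K {x | x ∈ K ∧ rk (τ a) x < rk (τ a) z} (τ a) z (R i) := by
      have := hRG i
      rw [hpi1, hpi2] at this
      exact this hzK ⟨R', hG'⟩
    obtain ⟨y, r1, r2, r3, r4, -, -⟩ := hG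
    have r2' : ∀ d ∈ R i, G.ok d ∧ d.s ∈ N ∧ d.t ∉ A (τ a) := fun d hd => ⟨(ok_piece.1 (r2 d hd).1).1, (r2 d hd).2⟩
    have hzN := hD.KN hzK
    rcases r4 with hy | ⟨hyK, hyr⟩
    · refine ⟨[i], R i, y, fun _ _ _ => ⟨r1, ?_, r2', fun d hd => ⟨i, by simp, mem_edges_of hd⟩, ?_⟩⟩
      · rintro (h | h)
        · exact hy h
        · have := r1.end_mem
          rcases List.mem_cons.1 this with h' | h'
          · exact hy (h' ▸ hzN)
          · obtain ⟨b, hb, rfl⟩ := List.mem_map.1 h'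
            exact (r2 b hb).2.2 h
      · intro j hj
        rw [List.mem_singleton.1 hj]
        exact ⟨hpi2, hai, List.Subset.refl _⟩
    · have hyd : ∃ d, G.ok d ∧ d.s = y ∧ st a ≤ st d.e := by
        rcases List.mem_cons.1 r1.end_mem with h' | h'
        · rw [h'] at hyr; exact absurd hyr (lt_irrefl _)
        · obtain ⟨b, hb, rfl⟩ := List.mem_map.1 h'
          refine ⟨b.rev, (r2' b hb).1.rev, rfl, ?_⟩
          rw [Dart.rev_e, hRst i b.e (mem_edges_of hb)]
          exact hai.le
      obtain ⟨is, m, y', h⟩ := ih _ (hr ▸ hyr) y hyK hyd rfl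
      obtain ⟨m1, m2, m3, m4, m5⟩ := h hyK hyd ha
      refine ⟨i :: is, R i ++ m, y', fun _ _ _ => ⟨r1.append m1, m2, ?_, ?_, ?_⟩⟩
      · intro d hd
        rcases List.mem_append.1 hd with h | h
        · exact r2' d h
        · exact m3 d h
      · intro d hd
        rcases List.mem_append.1 hd with h | h
        · exact ⟨i, by simp, mem_edges_of h⟩
        · obtain ⟨j, hj, hje⟩ := m4 d h
          exact ⟨j, by simp [hj], hje⟩
      · intro j hj
        rw [edges_append]
        rcases List.mem_cons.1 hj with rfl | h
        · exact ⟨hpi2, hai, List.subset_append_left _ _⟩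
        · exact ⟨(m5 j h).1, (m5 j h).2.1, List.Subset.trans (m5 j h).2.2 (List.subset_append_right _ _)⟩
  choose is m y horb using korb
  -- fragments ending in K have an orbit
  have hfo : ∀ j s t a z, Frag G A N K st j s t a z → z ∈ K → τ a = t ∧ Ch z (m a z) (y a z) ∧ y a z ∉ N ∪ A t ∧
      (∀ d ∈ m a z, G.ok d ∧ d.s ∈ N ∧ d.t ∉ A t) ∧ (∀ d ∈ m a z, ∃ i ∈ is a z, d.e ∈ edges (R i)) ∧
      ∀ i ∈ is a z, (par i).2 = a ∧ st a < i ∧ edges (R i) ⊆ edges (m a z) := by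
    intro j s t a z hF hz
    obtain ⟨⟨d, s', rfl, rfl, h1, h2⟩, h3, h4⟩ := hF
    have hdt : d.t ∈ N := by
      cases s' with
      | nil =>
        have : d.t = z := h2.2
        rw [this]; exact hD.KN hz
      | cons b s' =>
        have hb : b.s = d.t := h2.2.1
        rcases (h3 b (by simp)).2.2.1 with h | h
        · exact hb ▸ h
        · exact absurd (hb ▸ h) (h3 d (by simp)).2.2.2
    have hd := h3 d (by simp)
    have ht : τ d.e = t := hτ t d hd.1 h1 hdt
    have hlast : ∃ d', G.ok d' ∧ d'.s = z ∧ st d.e ≤ st d'.e := by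
      rcases List.mem_cons.1 h2.end_mem with h' | h'
      · exact absurd (h'.symm ▸ h1 : z ∈ A t) (fun hh => Set.disjoint_left.1 (dN t) hh (hD.KN hz))
      · obtain ⟨b, hb, rfl⟩ := List.mem_map.1 h'
        refine ⟨b.rev, (h3 b hb).1.rev, rfl, ?_⟩
        rw [Dart.rev_e, (h3 b hb).2.1, hd.2.1]
    have := horb d.e z hz hlast (by rw [ht]; exact hd.1.mem_cut.2 (Or.inl ⟨h1, hd.2.2.2⟩))
    rw [ht] at this
    exact ⟨ht, this⟩
  obtain ⟨us, hus⟩ : ∃ us : I → Prop, ∀ i, us i ↔ ∃ j, j < i ∧ ∃ s t a z, Frag G A N K st j s t a z ∧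
      (s ∈ P j ∨ (s = revL (R j) ∧ ¬ us j)) ∧ z ∈ K ∧ i ∈ is a z := by
    refine ⟨(wellFounded_lt (α := I)).fix (fun i rec => ∃ j, ∃ h : j < i, ∃ s t a z, Frag G A N K st j s t a z ∧
      (s ∈ P j ∨ (s = revL (R j) ∧ ¬ rec j h)) ∧ z ∈ K ∧ i ∈ is a z), fun i => ?_⟩
    rw [WellFounded.fix_eq]
    simp only [exists_prop]
  -- keys
  let κ := {k : I × List (Dart V E) // (∃ t a z, Frag G A N K st k.1 k.2 t a z) ∧ (k.2 ∈ P k.1 ∨ (k.2 = revL (R k.1) ∧ ¬ us k.1))}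
  have kd : ∀ k : κ, ∃ t a z, Frag G A N K st k.1.1 k.1.2 t a z := fun k => k.2.1
  choose kt ka kz hF using kd
  have hPe : ∀ i, ∀ l ∈ P i, ∀ e ∈ edges l, e ∉ edges (R i) ∧ st e = i := by
    intro i l hl e he
    obtain ⟨t, ht⟩ := (hP i).sw l hl
    obtain ⟨d, hd, rfl⟩ := mem_edges.1 he
    have := (ht.1 d hd).1
    exact ⟨(ok_del.1 this).2, (ok_piece.1 (ok_del.1 this).1).2⟩
  have hPF : ∀ i, ∀ l ∈ P i, ∃ t a z, Frag G A N K st i l t a z := by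
    intro i l hl
    obtain ⟨t, ht⟩ := (hP i).sw l hl
    obtain ⟨d, l', rfl, hd1, hd2⟩ := ht.cons Set.subset_union_right
    obtain ⟨h1, x, hx, y, hy, hc⟩ := ht
    refine ⟨t, d.e, y, ⟨d, l', rfl, rfl, hd1, ?_⟩, ?_, ?_⟩
    · rw [hc.1]; exact hc
    · intro b hb
      have hb' := h1 b hb
      have hb2 := ok_piece.1 (ok_del.1 hb'.1).1
      exact ⟨hb2.1, hb2.2, hb'.2.1.imp (fun h => h.1) id, hb'.2.2⟩
    · by_cases hyK : y ∈ K
      · exact Or.inr hyK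
      · refine Or.inl ?_
        rintro (h | h)
        · exact hy (Or.inl ⟨h, hyK⟩)
        · exact hy (Or.inr h)
  -- the paths
  let f : κ → List (Dart V E) := fun k => if kz k ∈ K then k.1.2 ++ m (ka k) (kz k) else k.1.2
  have hfs : ∀ k : κ, ∀ e ∈ edges k.1.2, e ∈ edges (f k) := by
    intro k e he
    by_cases h : kz k ∈ K
    · simp only [f, if_pos h, edges_append, List.mem_append]; exact Or.inl he
    · simp only [f, if_neg h]; exact he
  have hfe : ∀ k : κ, ∀ e ∈ edges (f k), e ∈ edges k.1.2 ∨ (kz k ∈ K ∧ ∃ i ∈ is (ka k) (kz k), e ∈ edges (R i)) := by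
    intro k e he
    by_cases h : kz k ∈ K
    · simp only [f, if_pos h, edges_append, List.mem_append] at he
      refine he.imp id (fun he => ⟨h, ?_⟩)
      obtain ⟨d, hd, rfl⟩ := mem_edges.1 he
      exact (hfo _ _ _ _ _ (hF k) h).2.2.2.2.1 d hd
    · simp only [f, if_neg h] at he; exact Or.inl he
  have hkst : ∀ k : κ, ∀ e ∈ edges k.1.2, st e = k.1.1 := by
    intro k e he
    obtain ⟨d, hd, rfl⟩ := mem_edges.1 he
    exact ((hF k).2.1 d hd).2.1
  have hkus : ∀ k : κ, kz k ∈ K → ∀ i ∈ is (ka k) (kz k), us i := by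
    intro k hk i hi
    have h0 := (hfo _ _ _ _ _ (hF k) hk).2.2.2.2.2 i hi
    refine (hus i).2 ⟨k.1.1, ?_, k.1.2, _, _, _, hF k, k.2.2, hk, hi⟩
    rw [← (hF k).mem.2]; exact h0.2.1
  -- case A
  have cA : ∀ k k' : κ, ∀ e, e ∈ edges k.1.2 → e ∈ edges k'.1.2 → k = k' := by
    rintro ⟨⟨j, s⟩, h1, h2⟩ ⟨⟨j', s'⟩, h1', h2'⟩ e he he'
    have hj := hkst ⟨⟨j, s⟩, h1, h2⟩ e he
    have hj' := hkst ⟨⟨j', s'⟩, h1', h2'⟩ e he'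
    simp only at hj hj' h2 h2' he he'
    subst hj'
    subst hj
    have : s = s' := by
      rcases h2 with h2 | ⟨rfl, h2⟩ <;> rcases h2' with h2' | ⟨rfl, h2'⟩
      · exact (hP _).disj _ h2 _ h2' e he he'
      · exact absurd (mem_edges_revL.1 he') (hPe _ _ h2 e he).1
      · exact absurd (mem_edges_revL.1 he) (hPe _ _ h2' e he').1
      · rfl
    subst this
    rfl
  -- case B
  have cB : ∀ k k' : κ, ∀ e, e ∈ edges k.1.2 → kz k' ∈ K → ∀ i ∈ is (ka k') (kz k'), e ∈ edges (R i) → False := by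
    intro k k' e he hk' i hi hei
    have hij : i = k.1.1 := (hRst i e hei).symm.trans (hkst k e he)
    have hu := hkus k' hk' i hi
    rw [hij] at hei hu
    rcases k.2.2 with h | h
    · exact (hPe _ _ h e he).1 hei
    · exact h.2 hu
  refine mkPS dA dN f ?_ ?_ ?_
  · intro k
    refine ⟨kt k, ?_⟩
    obtain ⟨⟨d, s', h1, h2, h3, h4⟩, h5, h6⟩ := id (hF k)
    have h5' : ∀ d ∈ k.1.2, G.ok d ∧ d.s ∈ N ∪ A (kt k) ∧ d.t ∉ A (kt k) := fun b hb =>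
      ⟨(h5 b hb).1, (h5 b hb).2.2⟩
    by_cases h : kz k ∈ K
    · obtain ⟨-, o1, o2, o3, -⟩ := hfo _ _ _ _ _ (hF k) h
      simp only [f, if_pos h]
      refine ⟨fun b hb => ?_, d.s, h3, _, o2, h4.append o1⟩
      rcases List.mem_append.1 hb with hb | hb
      · exact h5' b hb
      · exact ⟨(o3 b hb).1, Or.inl (o3 b hb).2.1, (o3 b hb).2.2⟩
    · simp only [f, if_neg h]
      exact ⟨h5', d.s, h3, _, h6.resolve_right h, h4⟩
  · intro k k' e he he'
    rcases hfe k e he with h | ⟨h1, i, hi, h2⟩ <;> rcases hfe k' e he' with h' | ⟨h1', i', hi', h2'⟩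
    · exact cA k k' e h h'
    · exact (cB k k' e h h1' i' hi' h2').elim
    · exact (cB k' k e h' h1 i hi h2).elim
    · have hii : i = i' := (hRst i e h2).symm.trans (hRst i' e h2')
      subst hii
      have e1 := ((hfo _ _ _ _ _ (hF k) h1).2.2.2.2.2 i hi).1
      have e2 := ((hfo _ _ _ _ _ (hF k') h1').2.2.2.2.2 i hi').1
      have e3 : ka k = ka k' := e1.symm.trans e2
      exact cA k k' (ka k) (hF k).mem.1 (e3 ▸ (hF k').mem.1)
  · rintro t e ⟨d, hd, rfl, hds, hdt⟩
    set i := st d.e with hi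
    have hdp : (G.piece st i).ok d := ok_piece.2 ⟨hd, rfl⟩
    by_cases hRe : d.e ∈ edges (R i)
    · by_cases hu : us i
      · obtain ⟨j, hji, s, t', a, z, hFr, hs, hz, hiz⟩ := (hus i).1 hu
        let k : κ := ⟨(j, s), ⟨t', a, z, hFr⟩, hs⟩
        obtain ⟨e1, e2⟩ := (hF k).unique hFr
        refine ⟨k, ?_⟩
        have hz' : kz k ∈ K := e2 ▸ hz
        simp only [f, if_pos hz', edges_append, List.mem_append]
        right
        exact ((hfo _ _ _ _ _ (hF k) hz').2.2.2.2.2 i (by rw [e1, e2]; exact hiz)).2.2 hRe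
      · rcases hR i with h0 | ⟨y', hK, hc, -⟩
        · rw [h0] at hRe; simp at hRe
        obtain ⟨b, hb, hbe⟩ := mem_edges.1 hRe
        have hbN := (hRp i b hb).2
        have hbd : b = d.rev := by
          rcases ok_same hd (ok_piece.1 (hRp i b hb).1).1 hbe.symm with h | h
          · rw [h] at hbN; exact absurd hbN (fun hh => Set.disjoint_left.1 (dN t) hds hh)
          · exact h
        obtain ⟨l1, l2, hl, hc1, hc2⟩ := hc.mem_split hb
        have hl2 : l2 = [] := by
          cases l2 with
          | nil => rfl
          | cons c l2 =>
            have hcN := (hRp i c (by rw [hl]; simp)).2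
            rw [hc2.1, hbd] at hcN
            exact absurd hcN (fun hh => Set.disjoint_left.1 (dN t) hds hh)
        subst hl2
        have hbt : b.t ∈ A t := by rw [hbd]; exact hds
        have hrev : revL (R i) = d :: revL l1 := by
          rw [hl, hbd]; simp [revL]
        have hend : y' = d.s := by
          have : b.t = y' := hc2
          rw [← this, hbd]; rfl
        let k : κ := ⟨(i, revL (R i)), ⟨t, d.e, (par i).1, ⟨d, revL l1, hrev, rfl, hds, hend ▸ hc.rev⟩, by
          intro c hc'
          have hc'' := mem_revL.1 hc'
          have h0 := hRp i _ hc''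
          have h1 := ok_piece.1 h0.1
          refine ⟨by simpa using h1.1.rev, h1.2, ?_, fun hh => Set.disjoint_left.1 (dN t) hh h0.2⟩
          rw [hrev] at hc'
          rcases List.mem_cons.1 hc' with rfl | h
          · exact Or.inr hds
          · have hcl := mem_revL.1 h
            left
            have h2 := hc1.mem_verts_s hcl
            obtain ⟨q1, q2, hq, hq1, hq2⟩ := hc1.mem_split hcl
            cases q2 with
            | nil => have : c.s = b.s := hq2
                     rw [this]; exact hbN
            | cons g q2 =>
              have h3 := (hRp i g (by rw [hl, hq]; simp)).2
              have h4 : g.s = c.s := hq2.1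
              rw [← h4]; exact h3, Or.inr hK⟩, Or.inr ⟨rfl, hu⟩⟩
        exact ⟨k, hfs k _ (mem_edges_revL.2 hRe)⟩
    · have hcut : d.e ∈ ((G.piece st i).del {e | e ∈ edges (R i)}).cut (A t) :=
        ⟨d, ok_del.2 ⟨hdp, hRe⟩, rfl, hds, hdt⟩
      obtain ⟨l, hl, hel⟩ := (hP i).cov t hcut
      exact ⟨⟨(i, l), hPF i l hl, Or.inl hl⟩, hfs _ _ hel⟩

end

end LC

namespace LC
open Classical Cardinal
variable {V : Type u} {E : Type v}

/-- ends of edges -/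
noncomputable def en (G : MG V E) (h : E × Bool) : V := if h.2 then (Quot.out (G.I h.1)).1 else (Quot.out (G.I h.1)).2

lemma en_I (G : MG V E) (e : E) (b : Bool) : G.I e = s(en G (e, b), en G (e, !b)) := by
  have h : s((Quot.out (G.I e)).1, (Quot.out (G.I e)).2) = G.I e := Quot.out_eq (G.I e)
  cases b
  · simp only [en]; rw [Sym2.eq_swap]; simpa using h.symm
  · simp only [en]; simpa using h.symm

lemma en_ok (G : MG V E) {e : E} (he : e ∈ G.S) (b : Bool) : G.ok ⟨en G (e, b), e, en G (e, !b)⟩ := ⟨he, en_I G e b⟩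

lemma ok_en {G : MG V E} {d : Dart V E} (hd : G.ok d) : ∃ b, d.s = en G (d.e, b) ∧ d.t = en G (d.e, !b) := by
  rcases ok_same hd (en_ok G hd.1 true) rfl with h | h
  · exact ⟨true, by rw [← congrArg Dart.s h], by rw [← congrArg Dart.t h]⟩
  · exact ⟨false, (congrArg Dart.t h).symm, (congrArg Dart.s h).symm⟩

/-- reachability of a target set avoiding C -/
def To (G : MG V E) (C : Set E) (x : V) (Y : Set V) : Prop :=
  ∃ l, ∃ y ∈ Y, Ch x l y ∧ ∀ d ∈ l, G.ok d ∧ d.e ∉ C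

lemma To.mono {G : MG V E} {C C' : Set E} {x : V} {Y : Set V} (h : To G C x Y) (hC : ∀ e ∈ G.S, e ∈ C' → e ∈ C) : To G C' x Y := by
  obtain ⟨l, y, hy, h1, h2⟩ := h
  exact ⟨l, y, hy, h1, fun d hd => ⟨(h2 d hd).1, fun h => (h2 d hd).2 (hC _ (h2 d hd).1.1 h)⟩⟩

def Vt (G : MG V E) (F : Set E) (x : V) : Prop := ∃ d, G.ok d ∧ d.s = x ∧ d.e ∈ F
lemma Vt.mono {G : MG V E} {F F' : Set E} {x} (h : Vt G F x) (hF : F ⊆ F') : Vt G F' x := by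
  obtain ⟨d, h1, h2, h3⟩ := h; exact ⟨d, h1, h2, hF h3⟩
def Tg (G : MG V E) (Z : Set V) (F : Set E) (Y : Set V) : Prop := Y = Z ∨ ∃ y, Vt G F y ∧ Y = {y}
lemma Tg.mono {G : MG V E} {Z : Set V} {F F' : Set E} {Y} (h : Tg G Z F Y) (hF : F ⊆ F') : Tg G Z F' Y :=
  h.imp id (fun ⟨y, h1, h2⟩ => ⟨y, h1.mono hF, h2⟩)

lemma Vt_fin (G : MG V E) (l : List E) : {x | Vt G {e | e ∈ l} x}.Finite := by
  refine Set.Finite.subset (s := (en G) '' {h | h.1 ∈ l}) (Set.Finite.image _ ?_) ?_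
  · refine Set.Finite.subset (s := {e | e ∈ l} ×ˢ Set.univ) ((List.finite_toSet l).prod Set.finite_univ) ?_
    rintro h hh
    exact ⟨hh, trivial⟩
  · rintro x ⟨d, h1, rfl, h2⟩
    obtain ⟨b, hb, -⟩ := ok_en h1
    exact ⟨(d.e, b), h2, hb.symm⟩

lemma Tg_fin (G : MG V E) (Z : Set V) (l : List E) : {Y | Tg G Z {e | e ∈ l} Y}.Finite := by
  refine Set.Finite.subset (s := insert Z ((fun y => {y}) '' {x | Vt G {e | e ∈ l} x})) (((Vt_fin G l).image _).insert _) ?_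
  rintro Y (h | ⟨y, h1, h2⟩)
  · exact Or.inl h
  · exact Or.inr ⟨y, h1, h2.symm⟩

lemma card_finUnion {α : Type*} {μ : Cardinal.{v}} (hμ : ℵ₀ ≤ μ) {s : Set α} (hs : s.Finite) (f : α → Set E)
    (hf : ∀ x ∈ s, #(f x) ≤ μ) : #(⋃ x ∈ s, f x : Set E) ≤ μ := by
  induction s, hs using Set.Finite.induction_on with
  | empty => simp
  | insert _ _ ih =>
    rw [Set.biUnion_insert]
    refine (mk_union_le _ _).trans (add_le_of_le hμ (hf _ (by simp)) (ih (fun x hx => hf x (by simp [hx]))))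

lemma card_natUnion {μ : Cardinal.{v}} (hμ : ℵ₀ ≤ μ) (f : ℕ → Set E) (hf : ∀ n, #(f n) ≤ μ) : #(⋃ n, f n : Set E) ≤ μ := by
  have h := mk_iUnion_le_lift f
  have h2 : (⨆ i, #(f i)) ≤ μ := ciSup_le' hf
  simp only [mk_nat, lift_aleph0, lift_uzero] at h
  exact h.trans ((mul_le_mul' hμ h2).trans (mul_eq_self hμ).le)

lemma closeE {Op : List E → Set E} {μ : Cardinal.{v}} (hμ : ℵ₀ ≤ μ) (hOp : ∀ l, #(Op l) ≤ μ) {B S : Set E} (hB : #B ≤ μ)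
    (hBS : B ⊆ S) (hOS : ∀ l, Op l ⊆ S) :
    ∃ C, B ⊆ C ∧ C ⊆ S ∧ #C ≤ μ ∧ ∀ l, (∀ e ∈ l, e ∈ C) → Op l ⊆ C := by
  let T : Set E → Set E := fun X => X ∪ ⋃ l : List X, Op (l.map Subtype.val)
  have hT : ∀ X : Set E, #X ≤ μ → #(T X) ≤ μ := by
    intro X hX
    refine (mk_union_le _ _).trans (add_le_of_le hμ hX ?_)
    refine (mk_iUnion_le _).trans ?_
    have h1 : #(List X) ≤ μ := (mk_list_le_max _).trans (max_le hμ hX)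
    exact (mul_le_mul' h1 (ciSup_le' (fun l => hOp _))).trans (mul_eq_self hμ).le
  let Q : ℕ → Set E := fun n => T^[n] B
  have hQs : ∀ n, Q (n + 1) = T (Q n) := fun n => Function.iterate_succ_apply' T n B
  have hQm : Monotone Q := monotone_nat_of_le_succ (fun n => by rw [hQs]; exact Set.subset_union_left)
  have hQc : ∀ n, #(Q n) ≤ μ := by
    intro n
    induction n with
    | zero => exact hB
    | succ n ih => rw [hQs]; exact hT _ ih
  refine ⟨⋃ n, Q n, Set.subset_iUnion Q 0, ?_, card_natUnion hμ Q hQc, ?_⟩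
  · refine Set.iUnion_subset (fun n => ?_)
    induction n with
    | zero => exact hBS
    | succ n ih =>
      rw [hQs]
      exact Set.union_subset ih (Set.iUnion_subset (fun l => hOS _))
  · intro l hl
    have : ∃ n, ∀ e ∈ l, e ∈ Q n := by
      induction l with
      | nil => exact ⟨0, by simp⟩
      | cons a l ih =>
        obtain ⟨n, hn⟩ := ih (fun e he => hl e (by simp [he]))
        obtain ⟨m, hm⟩ := Set.mem_iUnion.1 (hl a (by simp))
        refine ⟨max m n, ?_⟩
        intro e he
        rcases List.mem_cons.1 he with rfl | he
        · exact hQm (le_max_left _ _) hm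
        · exact hQm (le_max_right _ _) (hn e he)
    obtain ⟨n, hn⟩ := this
    refine Set.Subset.trans ?_ (Set.subset_iUnion Q (n + 1))
    rw [hQs]
    refine Set.Subset.trans ?_ Set.subset_union_right
    have h1 : Op l = Op ((l.attach.map (fun e => (⟨e.1, hn _ e.2⟩ : Q n))).map Subtype.val) := by
      congr 1
      simp [List.map_map, Function.comp_def]
    rw [h1]
    exact Set.subset_iUnion (fun l : List (Q n) => Op (l.map Subtype.val)) _

lemma enumE (c : Set E) : ∃ f : E → Ordinal.{v}, (∀ e ∈ c, f e < (#c).ord) ∧ ∀ e ∈ c, ∀ e' ∈ c, f e = f e' → e = e' := by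
  obtain ⟨r, hr, h⟩ := Cardinal.ord_eq c
  refine ⟨fun e => if he : e ∈ c then Ordinal.typein r ⟨e, he⟩ else 0, ?_, ?_⟩
  · intro e he
    beta_reduce
    rw [dif_pos he, h]
    exact Ordinal.typein_lt_type r _
  · intro e he e' he' hee
    beta_reduce at hee
    rw [dif_pos he, dif_pos he'] at hee
    have := Ordinal.typein_injective r hee
    exact congrArg Subtype.val this

lemma card_below {c : Set E} {f : E → Ordinal.{v}} (hf : ∀ e ∈ c, ∀ e' ∈ c, f e = f e' → e = e') (o : Ordinal.{v}) :
    #{e | e ∈ c ∧ f e < o} ≤ o.card := by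
  have h : lift.{v+1} #{e | e ∈ c ∧ f e < o} ≤ lift.{v} #(Set.Iio o) := by
    refine lift_mk_le'.2 ⟨⟨fun e => ⟨f e.1, e.2.2⟩, fun e e' h => ?_⟩⟩
    exact Subtype.ext (hf _ e.2.1 _ e'.2.1 (congrArg Subtype.val h))
  rw [mk_Iio_ordinal] at h
  simp only [lift_lift] at h
  exact lift_le.1 (h.trans (by simp))

end LC

namespace LC
open Classical Cardinal
variable {V : Type u} {E : Type v}

noncomputable def Fseq (Cl : Ordinal.{v} → Set E → Set E) (γ : Ordinal.{v}) : Set E :=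
  {e | ∃ δ, ∃ _h : δ < γ, e ∈ Cl δ (Fseq Cl δ)}
termination_by γ
decreasing_by exact _h

/-- size bound of stage γ -/
noncomputable def sz (γ : Ordinal.{v}) : Cardinal.{v} := max γ.card ℵ₀

lemma sz_inf (γ : Ordinal.{v}) : ℵ₀ ≤ sz γ := le_max_right _ _
lemma sz_mono {γ δ : Ordinal.{v}} (h : γ ≤ δ) : sz γ ≤ sz δ := max_le_max_right _ (Ordinal.card_le_card h)
lemma sz_succ (γ : Ordinal.{v}) : sz (Order.succ γ) = sz γ := by
  apply le_antisymm
  · refine max_le ?_ (sz_inf γ)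
    rw [Ordinal.card_succ]
    exact add_le_of_le (sz_inf γ) (le_max_left _ _) (one_le_aleph0.trans (sz_inf γ))
  · exact sz_mono (Order.le_succ γ)

structure Filt (G : MG V E) (Z : Set V) (F : Ordinal.{v} → Set E) : Prop where
  cont : ∀ γ e, e ∈ F γ ↔ ∃ δ, δ < γ ∧ e ∈ F (Order.succ δ)
  sub : ∀ γ, F γ ⊆ G.S
  all : ∀ e ∈ G.S, ∃ δ, δ < (#G.S).ord ∧ e ∈ F (Order.succ δ)
  card : ∀ γ, #(F γ) ≤ sz γ
  star : ∀ γ x Y, Vt G (F γ) x → Tg G Z (F γ) Y → To G (F γ) x Y → ∀ C : Set E, #C ≤ sz γ → To G C x Y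
  path : ∀ γ x Y (Q : Set E), Vt G (F (Order.succ γ)) x → Tg G Z (F (Order.succ γ)) Y → Q.Finite → Q ⊆ F (Order.succ γ) →
    To G (F γ ∪ Q) x Y → To G ((F (Order.succ γ))ᶜ ∪ F γ ∪ Q) x Y

lemma exFilt (G : MG V E) (Z : Set V) : ∃ F, Filt G Z F := by
  -- minimal separators
  have key : ∀ x Y, ∃ c : Set E, (∃ C, ¬ To G C x Y) → ¬ To G c x Y ∧ ∀ C : Set E, ¬ To G C x Y → #c ≤ #C := by
    intro x Y
    by_cases h : ∃ C, ¬ To G C x Y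
    · obtain ⟨c, hc1, hc2⟩ := exists_minimalFor_of_wellFoundedLT (fun C => ¬ To G C x Y) (fun C : Set E => #C) h
      refine ⟨c, fun _ => ⟨hc1, fun C hC => ?_⟩⟩
      rcases le_total (#c) (#C) with h' | h'
      · exact h'
      · exact hc2 hC h'
    · exact ⟨∅, fun h' => absurd h' h⟩
  choose c hc using key
  choose f hf1 hf2 using fun x Y => enumE (c x Y)
  have key2 : ∀ (B : Set E) x Y (Q : List E), ∃ p : List (Dart V E), To G (B ∪ {e | e ∈ Q}) x Y →
      ∃ y ∈ Y, Ch x p y ∧ ∀ d ∈ p, G.ok d ∧ d.e ∉ B ∪ {e | e ∈ Q} := by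
    intro B x Y Q
    by_cases h : To G (B ∪ {e | e ∈ Q}) x Y
    · obtain ⟨l, y, h1⟩ := h
      exact ⟨l, fun _ => ⟨y, h1⟩⟩
    · exact ⟨[], fun h' => absurd h' h⟩
  choose p hp using key2
  obtain ⟨fS, hS1, hS2⟩ := enumE G.S
  let Op : Ordinal.{v} → Set E → List E → Set E := fun δ B l => {e | e ∈ G.S ∧ ∃ x, Vt G {e | e ∈ l} x ∧ ∃ Y, Tg G Z {e | e ∈ l} Y ∧
    ((e ∈ c x Y ∧ f x Y e < Ordinal.omega0 + δ) ∨ ∃ k : ℕ, e ∈ edges (p B x Y (l.drop k)))}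
  have hOpc : ∀ δ B l, #(Op δ B l) ≤ sz δ := by
    intro δ B l
    have h1 : Op δ B l ⊆ ⋃ x ∈ {x | Vt G {e | e ∈ l} x}, ⋃ Y ∈ {Y | Tg G Z {e | e ∈ l} Y},
        ({e | e ∈ c x Y ∧ f x Y e < Ordinal.omega0 + δ} ∪ ⋃ k : ℕ, {e | e ∈ edges (p B x Y (l.drop k))}) := by
      rintro e ⟨-, x, hx, Y, hY, h⟩
      simp only [Set.mem_iUnion]
      refine ⟨x, hx, Y, hY, ?_⟩
      rcases h with h | ⟨k, h⟩
      · exact Or.inl h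
      · exact Or.inr (Set.mem_iUnion.2 ⟨k, h⟩)
    refine (mk_le_mk_of_subset h1).trans ?_
    refine card_finUnion (sz_inf δ) (Vt_fin G l) _ (fun x _ => ?_)
    refine card_finUnion (sz_inf δ) (Tg_fin G Z l) _ (fun Y _ => ?_)
    refine (mk_union_le _ _).trans (add_le_of_le (sz_inf δ) ?_ ?_)
    · refine (card_below (hf2 x Y) _).trans ?_
      rw [Ordinal.card_add, Ordinal.card_omega0]
      exact add_le_of_le (sz_inf δ) (sz_inf δ) (le_max_left _ _)
    · refine card_natUnion (sz_inf δ) _ (fun k => ?_)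
      exact (lt_aleph0_iff_set_finite.2 (List.finite_toSet _)).le.trans (sz_inf δ)
  have key3 : ∀ δ (B : Set E), ∃ C : Set E, B ⊆ G.S → #B ≤ sz δ → B ⊆ C ∧ C ⊆ G.S ∧ #C ≤ sz δ ∧ (∀ e ∈ G.S, fS e = δ → e ∈ C) ∧
      ∀ l, (∀ e ∈ l, e ∈ C) → Op δ B l ⊆ C := by
    intro δ B
    by_cases h : B ⊆ G.S ∧ #B ≤ sz δ
    · obtain ⟨h1, h2⟩ := h
      have h3 : #{e | e ∈ G.S ∧ fS e = δ} ≤ 1 := by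
        rw [mk_le_one_iff_set_subsingleton]
        intro a ha b hb
        exact hS2 _ ha.1 _ hb.1 (ha.2.trans hb.2.symm)
      obtain ⟨C, c1, c2, c3, c4⟩ := closeE (sz_inf δ) (hOpc δ B) (B := B ∪ {e | e ∈ G.S ∧ fS e = δ}) (S := G.S)
        ((mk_union_le _ _).trans (add_le_of_le (sz_inf δ) h2 (h3.trans (one_le_aleph0.trans (sz_inf δ)))))
        (Set.union_subset h1 (fun e he => he.1)) (fun l e he => he.1)
      exact ⟨C, fun _ _ => ⟨Set.subset_union_left.trans c1, c2, c3, fun e he hee => c1 (Or.inr ⟨he, hee⟩), c4⟩⟩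
    · exact ⟨∅, fun h1 h2 => absurd ⟨h1, h2⟩ h⟩
  choose Cl hCl using key3
  obtain ⟨F, hF⟩ : ∃ F : Ordinal.{v} → Set E, ∀ γ e, e ∈ F γ ↔ ∃ δ, δ < γ ∧ e ∈ Cl δ (F δ) := by
    refine ⟨Fseq Cl, fun γ e => ?_⟩
    rw [Fseq]
    simp only [exists_prop, Set.mem_setOf_eq]
  have hmono : Monotone F := by
    intro γ δ h e he
    obtain ⟨η, h1, h2⟩ := (hF γ e).1 he
    exact (hF δ e).2 ⟨η, h1.trans_le h, h2⟩
  have hboth : ∀ γ, F γ ⊆ G.S ∧ #(F γ) ≤ sz γ := by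
    intro γ
    induction γ using WellFoundedLT.induction with
    | _ γ ih =>
    have h1 : ∀ δ < γ, Cl δ (F δ) ⊆ G.S ∧ #(Cl δ (F δ)) ≤ sz δ := fun δ hδ =>
      ⟨(hCl δ (F δ) (ih δ hδ).1 (ih δ hδ).2).2.1, (hCl δ (F δ) (ih δ hδ).1 (ih δ hδ).2).2.2.1⟩
    constructor
    · intro e he
      obtain ⟨δ, hδ, h⟩ := (hF γ e).1 he
      exact (h1 δ hδ).1 h
    · have h2 : F γ = ⋃ δ : Set.Iio γ, Cl δ (F δ) := by
        ext e
        rw [hF]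
        simp
      have h3 := mk_iUnion_le_lift (fun δ : Set.Iio γ => Cl δ (F δ))
      rw [← h2, mk_Iio_ordinal] at h3
      have h4 : (⨆ i : Set.Iio γ, lift.{v+1} #(Cl i (F i))) ≤ lift.{v+1} (sz γ) :=
        ciSup_le' (fun i => lift_le.2 ((h1 i i.2).2.trans (sz_mono i.2.le)))
      have h5 : lift.{v+1} #(F γ) ≤ lift.{v+1} (sz γ) := by
        refine h3.trans ((mul_le_mul' (b := lift.{v+1} (sz γ)) ?_ h4).trans ?_)
        · rw [lift_lift]
          exact lift_le.{v+1, v}.2 (le_max_left _ _)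
        · rw [← lift_mul, mul_eq_self (sz_inf γ)]
      exact lift_le.1 h5
  have hC := fun δ => hCl δ (F δ) (hboth δ).1 (hboth δ).2
  have hsucc : ∀ δ, F (Order.succ δ) = Cl δ (F δ) := by
    intro δ
    apply Set.Subset.antisymm
    · intro e he
      obtain ⟨η, h1, h2⟩ := (hF _ e).1 he
      rcases (Order.lt_succ_iff.1 h1).lt_or_eq with h | h
      · exact (hC δ).1 ((hF _ e).2 ⟨η, h, h2⟩)
      · rw [h] at h2; exact h2
    · intro e he
      exact (hF _ e).2 ⟨δ, Order.lt_succ δ, he⟩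
  have hcont : ∀ γ e, e ∈ F γ ↔ ∃ δ, δ < γ ∧ e ∈ F (Order.succ δ) := by
    intro γ e
    simp only [hsucc]
    exact hF γ e
  -- lists for a vertex and a target
  have hlist : ∀ (B : Set E) x Y (Q : Set E), Vt G B x → Tg G Z B Y → Q.Finite → Q ⊆ B →
      ∃ l : List E, (∀ e ∈ l, e ∈ B) ∧ Vt G {e | e ∈ l} x ∧ Tg G Z {e | e ∈ l} Y ∧ ∃ k, {e | e ∈ l.drop k} = Q := by
    intro B x Y Q hx hY hQ hQB
    obtain ⟨d, hd1, hd2, hd3⟩ := hx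
    have hQl : ∃ q : List E, {e | e ∈ q} = Q := ⟨hQ.toFinset.toList, by ext; simp⟩
    obtain ⟨q, hq⟩ := hQl
    have hqB : ∀ e ∈ q, e ∈ B := fun e he => hQB (hq ▸ he)
    rcases hY with hY | ⟨y, ⟨d', h1', h2', h3'⟩, hY⟩
    · refine ⟨d.e :: q, ?_, ⟨d, hd1, hd2, by simp⟩, Or.inl hY, 1, by simpa using hq⟩
      intro e he
      rcases List.mem_cons.1 he with rfl | h
      · exact hd3
      · exact hqB e h
    · refine ⟨d.e :: d'.e :: q, ?_, ⟨d, hd1, hd2, by simp⟩, Or.inr ⟨y, ⟨d', h1', h2', by simp⟩, hY⟩, 2, by simpa using hq⟩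
      intro e he
      rcases List.mem_cons.1 he with rfl | h
      · exact hd3
      rcases List.mem_cons.1 h with rfl | h
      · exact h3'
      · exact hqB e h
  have ho1 : ∀ δ x Y, Vt G (F (Order.succ δ)) x → Tg G Z (F (Order.succ δ)) Y → ∀ e ∈ G.S, e ∈ c x Y →
      f x Y e < Ordinal.omega0 + δ → e ∈ F (Order.succ δ) := by
    intro δ x Y hx hY e heS hec hlt
    obtain ⟨l, hl, hlx, hlY, -⟩ := hlist _ x Y ∅ hx hY Set.finite_empty (Set.empty_subset _)
    rw [hsucc] at hl ⊢
    exact (hC δ).2.2.2.2 l hl ⟨heS, x, hlx, Y, hlY, Or.inl ⟨hec, hlt⟩⟩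
  refine ⟨F, hcont, fun γ => (hboth γ).1, ?_, fun γ => (hboth γ).2, ?_, ?_⟩
  · intro e he
    refine ⟨fS e, hS1 e he, ?_⟩
    rw [hsucc]
    exact (hC _).2.2.2.1 e he rfl
  · intro γ x Y hx hY hTo C hCc
    by_contra hno
    obtain ⟨hc1, hc2⟩ := hc x Y ⟨C, hno⟩
    have hcc : #(c x Y) ≤ sz γ := (hc2 C hno).trans hCc
    apply hc1
    refine hTo.mono (fun e heS hec => ?_)
    have hξ := hf1 x Y e hec
    have hξ2 : f x Y e < (sz γ).ord := hξ.trans_le (ord_le_ord.2 hcc)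
    rcases Ordinal.zero_or_succ_or_isSuccLimit γ with h0 | ⟨δ, rfl⟩ | hlim
    · obtain ⟨d, -, -, hd⟩ := hx
      obtain ⟨η, hη, -⟩ := (hF γ d.e).1 hd
      rw [h0] at hη
      exact absurd hη not_lt_zero'
    · apply ho1 δ x Y hx hY e heS hec
      refine hξ2.trans_le ?_
      rw [sz_succ, Cardinal.ord_le, Ordinal.card_add, Ordinal.card_omega0]
      exact max_le (self_le_add_left _ _) (self_le_add_right _ _)
    · have hω : Ordinal.omega0 ≤ γ := Ordinal.omega0_le_of_isSuccLimit hlim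
      have hξγ : f x Y e < γ := by
        refine hξ2.trans_le ?_
        rw [Cardinal.ord_le]
        refine max_le le_rfl ?_
        rw [← Ordinal.card_omega0]; exact Ordinal.card_le_card hω
      have hxδ : ∃ δ, δ < γ ∧ Vt G (F (Order.succ δ)) x := by
        obtain ⟨d, hd1, hd2, hd3⟩ := hx
        obtain ⟨δ, h1, h2⟩ := (hcont γ _).1 hd3
        exact ⟨δ, h1, d, hd1, hd2, h2⟩
      have hYδ : ∃ δ, δ < γ ∧ Tg G Z (F (Order.succ δ)) Y := by
        rcases hY with hY | ⟨y, ⟨d, hd1, hd2, hd3⟩, hY⟩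
        · exact ⟨_, hξγ, Or.inl hY⟩
        · obtain ⟨δ, h1, h2⟩ := (hcont γ _).1 hd3
          exact ⟨δ, h1, Or.inr ⟨y, ⟨d, hd1, hd2, h2⟩, hY⟩⟩
      obtain ⟨δ1, h1, h1'⟩ := hxδ
      obtain ⟨δ2, h2, h2'⟩ := hYδ
      set δ := max (max δ1 δ2) (Order.succ (f x Y e)) with hδ
      have hδγ : δ < γ := max_lt (max_lt h1 h2) (hlim.succ_lt hξγ)
      refine (hcont γ e).2 ⟨δ, hδγ, ?_⟩
      refine ho1 δ x Y (h1'.mono (hmono (Order.succ_le_succ ((le_max_left _ _).trans (le_max_left _ _)))))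
        (h2'.mono (hmono (Order.succ_le_succ ((le_max_right _ _).trans (le_max_left _ _))))) e heS hec ?_
      calc f x Y e < Order.succ (f x Y e) := Order.lt_succ _
        _ ≤ δ := le_max_right _ _
        _ ≤ Ordinal.omega0 + δ := le_add_self
  · intro γ x Y Q hx hY hQ hQF hTo
    obtain ⟨l, hl, hlx, hlY, k, hk⟩ := hlist _ x Y Q hx hY hQ hQF
    rw [← hk] at hTo ⊢
    obtain ⟨y, hy, h1, h2⟩ := hp (F γ) x Y _ hTo
    refine ⟨_, y, hy, h1, fun d hd => ⟨(h2 d hd).1, ?_⟩⟩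
    rintro ((h | h) | h)
    · apply h
      rw [hsucc] at hl ⊢
      exact (hC γ).2.2.2.2 l hl ⟨(h2 d hd).1.1, x, hlx, Y, hlY, Or.inr ⟨k, mem_edges_of hd⟩⟩
    · exact (h2 d hd).2 (Or.inl h)
    · exact (h2 d hd).2 (Or.inr h)

lemma Filt.mono {G : MG V E} {Z : Set V} {F : Ordinal.{v} → Set E} (h : Filt G Z F) : Monotone F := by
  intro γ δ hγ e he
  obtain ⟨η, h1, h2⟩ := (h.cont γ e).1 he
  exact (h.cont δ e).2 ⟨η, h1.trans_le hγ, h2⟩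

end LC

namespace LC
open Classical Cardinal
variable {V : Type u} {E : Type v}

/-- the contracted graph -/
def hat (G : MG V E) (J : Set E) (φ : V → V) : MG V E := ⟨fun e => (G.I e).map φ, G.S \ J⟩

structure Imm (G : MG V E) (J : Set E) (φ : V → V) (O : E → E → Prop) : Prop where
  own : ∀ e f f', O e f → O e f' → f = f'
  self : ∀ e ∈ G.S, e ∉ J → O e e
  col : ∀ d, G.ok d → d.e ∈ J → φ d.s = φ d.t
  route : ∀ d, G.ok d → d.e ∉ J → ∃ p, Ch (φ d.s) p d.s ∧
    ∀ d' ∈ p, G.ok d' ∧ φ d'.s = φ d.s ∧ φ d'.t = φ d.s ∧ O d'.e d.e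

lemma hat_ok {G : MG V E} {J : Set E} {φ : V → V} {d : Dart V E} (hd : G.ok d) (hJ : d.e ∉ J) :
    (hat G J φ).ok ⟨φ d.s, d.e, φ d.t⟩ := by
  refine ⟨⟨hd.1, hJ⟩, ?_⟩
  show (G.I d.e).map φ = _
  rw [hd.2]; rfl

lemma ok_hat {G : MG V E} {J : Set E} {φ : V → V} {d : Dart V E} (hd : (hat G J φ).ok d) :
    ∃ d', G.ok d' ∧ d'.e = d.e ∧ φ d'.s = d.s ∧ φ d'.t = d.t ∧ d.e ∉ J := by
  have h0 := en_ok G hd.1.1 true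
  have h1 := hat_ok (φ := φ) h0 hd.1.2
  rcases ok_same h1 hd rfl with h | h
  · exact ⟨_, h0, rfl, (congrArg Dart.s h).symm, (congrArg Dart.t h).symm, hd.1.2⟩
  · exact ⟨_, h0.rev, rfl, (congrArg Dart.s h).symm, (congrArg Dart.t h).symm, hd.1.2⟩

lemma Imm.cut {G : MG V E} {J : Set E} {φ : V → V} {O : E → E → Prop} (h : Imm G J φ O) (X : Set V) :
    (hat G J φ).cut X = G.cut (φ ⁻¹' X) := by
  ext e
  constructor
  · intro he
    obtain ⟨d0, hd0, rfl, -⟩ := id he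
    have hS := hd0.1
    have h0 := en_ok G hS.1 true
    have h1 := hat_ok (φ := φ) h0 hS.2
    exact h0.mem_cut.2 (h1.mem_cut.1 he)
  · intro he
    obtain ⟨d0, hd0, rfl, -⟩ := id he
    have hS := hd0.1
    have h0 := en_ok G hS true
    have h2 := h0.mem_cut.1 he
    have hJ : d0.e ∉ J := by
      intro hJ
      have := h.col _ h0 hJ
      simp only [Set.mem_preimage] at h2
      rw [this] at h2
      tauto
    exact (hat_ok (φ := φ) h0 hJ).mem_cut.2 h2

lemma Imm.liftCh {G : MG V E} {J : Set E} {φ : V → V} {O : E → E → Prop} (h : Imm G J φ O) (l : List (Dart V E)) :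
    ∀ (dh : Dart V E) (y : V), (hat G J φ).ok dh → (∀ d ∈ l, (hat G J φ).ok d) → Ch dh.t l y →
    ∃ d m y', G.ok d ∧ d.e = dh.e ∧ φ d.s = dh.s ∧ φ d.t = dh.t ∧ Ch d.t m y' ∧ φ y' = y ∧
      (∀ d' ∈ m, G.ok d' ∧ (∃ d1 ∈ dh :: l, φ d'.t = d1.t) ∧ ∃ d1 ∈ l, φ d'.s = d1.s) ∧
      (∀ e ∈ edges l, e ∈ edges m) ∧ ∀ e ∈ edges m, ∃ f ∈ edges (dh :: l), O e f := by
  induction l with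
  | nil =>
    intro dh y hdh _ hc
    obtain ⟨d, h1, h2, h3, h4, h5⟩ := ok_hat hdh
    refine ⟨d, [], d.t, h1, h2, h3, h4, rfl, h4.trans hc, by simp, by simp [edges], by simp [edges]⟩
  | cons d2 l2 ih =>
    intro dh y hdh hl hc
    obtain ⟨d, h1, h2, h3, h4, h5⟩ := ok_hat hdh
    obtain ⟨c, m, y', g1, g2, g3, g4, g5, g6, g7, g8, g9⟩ := ih d2 y (hl _ (by simp)) (fun d hd => hl d (by simp [hd])) hc.2
    have hcJ : c.e ∉ J := by rw [g2]; exact (hl d2 (by simp)).1.2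
    have hdt : dh.t = d2.s := hc.1.symm
    obtain ⟨p, hp1, hp2⟩ := h.route c g1 hcJ
    obtain ⟨q, hq1, hq2⟩ := h.route d.rev h1.rev (by simpa [h2] using h5)
    simp only [Dart.rev_s, Dart.rev_e] at hq1 hq2
    refine ⟨d, revL q ++ (p ++ c :: m), y', h1, h2, h3, h4, ?_, g6, ?_, ?_, ?_⟩
    · refine hq1.rev.append ?_
      rw [h4, hdt, ← g3]
      exact hp1.append ⟨rfl, g5⟩
    · intro d' hd'
      simp only [List.mem_append, List.mem_cons] at hd'
      rcases hd' with hd' | hd' | rfl | hd'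
      · have := hq2 _ (mem_revL.1 hd')
        simp only [Dart.rev_s, Dart.rev_t, Dart.rev_e] at this
        obtain ⟨a1, a2, a3, a4⟩ := this
        exact ⟨by simpa using a1.rev, ⟨dh, by simp, a2.trans h4⟩, ⟨d2, by simp, by rw [a3, h4, hdt]⟩⟩
      · obtain ⟨a1, a2, a3, a4⟩ := hp2 _ hd'
        exact ⟨a1, ⟨dh, by simp, by rw [a3, g3, hdt]⟩, ⟨d2, by simp, by rw [a2, g3]⟩⟩
      · exact ⟨g1, ⟨d2, by simp, g4⟩, ⟨d2, by simp, g3⟩⟩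
      · obtain ⟨a1, ⟨a, a2, a3⟩, ⟨b, a4, a5⟩⟩ := g7 _ hd'
        exact ⟨a1, ⟨a, List.mem_cons_of_mem _ a2, a3⟩, ⟨b, List.mem_cons_of_mem _ a4, a5⟩⟩
    · intro e he
      obtain ⟨d', hd', rfl⟩ := mem_edges.1 he
      rcases List.mem_cons.1 hd' with rfl | hd'
      · exact mem_edges.2 ⟨c, by simp, g2⟩
      · have := g8 _ (mem_edges_of hd')
        obtain ⟨b, hb, hbe⟩ := mem_edges.1 this
        exact mem_edges.2 ⟨b, by simp [hb], hbe⟩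
    · intro e he
      obtain ⟨d', hd', rfl⟩ := mem_edges.1 he
      simp only [List.mem_append, List.mem_cons] at hd'
      rcases hd' with hd' | hd' | rfl | hd'
      · have := hq2 _ (mem_revL.1 hd')
        exact ⟨d.e, mem_edges.2 ⟨dh, by simp, h2.symm⟩, this.2.2.2⟩
      · exact ⟨c.e, mem_edges.2 ⟨d2, by simp, g2.symm⟩, (hp2 _ hd').2.2.2⟩
      · exact ⟨d'.e, mem_edges.2 ⟨d2, by simp, g2.symm⟩, h.self _ g1.1 hcJ⟩
      · obtain ⟨f, hf, hO⟩ := g9 _ (mem_edges_of hd')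
        obtain ⟨b, hb, hbe⟩ := mem_edges.1 hf
        exact ⟨f, mem_edges.2 ⟨b, List.mem_cons_of_mem _ hb, hbe⟩, hO⟩

lemma Imm.liftSW {G : MG V E} {J : Set E} {φ : V → V} {O : E → E → Prop} (h : Imm G J φ O) {A X : Set V} (hAX : A ⊆ X)
    {l : List (Dart V E)} (hl : IsSW (hat G J φ) A X l) :
    ∃ m, IsSW G (φ ⁻¹' A) (φ ⁻¹' X) m ∧ (∀ e ∈ edges l, e ∈ edges m) ∧ ∀ e ∈ edges m, ∃ f ∈ edges l, O e f := by
  obtain ⟨dh, l', rfl, h1, h2⟩ := hl.cons hAX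
  obtain ⟨hl1, x, hx, y, hy, hc⟩ := hl
  obtain ⟨d, m, y', g1, g2, g3, g4, g5, g6, g7, g8, g9⟩ :=
    h.liftCh l' dh y (hl1 _ (by simp)).1 (fun d hd => (hl1 d (by simp [hd])).1) hc.2
  refine ⟨d :: m, ⟨?_, d.s, by simpa [g3] using h1, y', by simpa [g6] using hy, ⟨rfl, g5⟩⟩, ?_, ?_⟩
  · intro d' hd'
    rcases List.mem_cons.1 hd' with rfl | hd'
    · refine ⟨g1, by simpa [g3] using hAX h1, ?_⟩
      simpa [g4] using (hl1 dh (by simp)).2.2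
    · obtain ⟨a1, ⟨a, a2, a3⟩, ⟨b, a4, a5⟩⟩ := g7 _ hd'
      refine ⟨a1, ?_, ?_⟩
      · simpa [a5] using (hl1 b (by simp [a4])).2.1
      · simpa [a3] using (hl1 a a2).2.2
  · intro e he
    obtain ⟨d', hd', rfl⟩ := mem_edges.1 he
    rcases List.mem_cons.1 hd' with rfl | hd'
    · exact mem_edges.2 ⟨d, by simp, g2⟩
    · obtain ⟨b, hb, hbe⟩ := mem_edges.1 (g8 _ (mem_edges_of hd'))
      exact mem_edges.2 ⟨b, by simp [hb], hbe⟩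
  · intro e he
    obtain ⟨d', hd', rfl⟩ := mem_edges.1 he
    rcases List.mem_cons.1 hd' with rfl | hd'
    · refine ⟨d'.e, mem_edges.2 ⟨dh, by simp, g2.symm⟩, h.self _ g1.1 ?_⟩
      rw [g2]; exact (hl1 dh (by simp)).1.1.2
    · exact g9 _ (mem_edges_of hd')

lemma Imm.eul {G : MG V E} {J : Set E} {φ : V → V} {O : E → E → Prop} (h : Imm G J φ O) {N : Set V} (hN : φ ⁻¹' N = N)
    (hE : Eul G N) : Eul (hat G J φ) N := by
  intro X hX hf
  rw [h.cut] at hf ⊢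
  exact hE _ (by rw [← hN]; exact Set.preimage_mono hX) hf

lemma Imm.loose {G : MG V E} {J : Set E} {φ : V → V} {O : E → E → Prop} (h : Imm G J φ O) {A Y : Set V} (hA : φ ⁻¹' A = A)
    (hY : φ ⁻¹' Y = Y) (hL : Loose G A Y) : Loose (hat G J φ) A Y := by
  intro X W hW d hd hs ht
  obtain ⟨hAX, hXY, hS, hcut⟩ := hW
  choose f hf using fun l : W => h.liftSW hAX (hS.sw l.1 l.2)
  have hAX' : A ⊆ φ ⁻¹' X := by
    rw [← hA]; exact Set.preimage_mono hAX
  obtain ⟨W', h1, h2, h3, h4⟩ := mkSys hAX' f (fun i => by have := (hf i).1; rwa [hA] at this) (by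
    intro i j e hi hj
    obtain ⟨f1, a1, a2⟩ := (hf i).2.2 e hi
    obtain ⟨f2, b1, b2⟩ := (hf j).2.2 e hj
    have := h.own _ _ _ a2 b2
    subst this
    exact Subtype.ext (hS.disj i.1 i.2 j.1 j.2 f1 a1 b1))
  have hwave : Wave G A Y (φ ⁻¹' X) W' := by
    refine ⟨hAX', by rw [← hY]; exact Set.preimage_mono hXY, h1, ?_⟩
    intro e he
    have he' := he
    rw [← h.cut] at he'
    obtain ⟨l, hl, hel⟩ := hcut he'
    exact h3 e ⟨⟨l, hl⟩, (hf ⟨l, hl⟩).2.1 e hel⟩ he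
  obtain ⟨d', g1, g2, g3, g4, g5⟩ := ok_hat hd
  have := hL _ _ hwave d' g1 (by rw [← hA]; simpa [g3] using hs) (by rw [← hA]; simpa [g4] using ht)
  simpa [g4] using this

lemma Imm.ps {ι : Type*} {G : MG V E} {J : Set E} {φ : V → V} {O : E → E → Prop} (h : Imm G J φ O) {A : ι → Set V} {N : Set V}
    (dA : ∀ i j, i ≠ j → Disjoint (A i) (A j)) (dN : ∀ i, Disjoint (A i) N)
    (hA : ∀ i, φ ⁻¹' (A i) = A i) (hN : φ ⁻¹' N = N) {P} (hP : PS (hat G J φ) A N P) : ∃ P', PS G A N P' := by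
  have key : ∀ l : P, ∃ m, (∃ i, IsSW G (A i) (N ∪ A i) m) ∧ (∀ e ∈ edges l.1, e ∈ edges m) ∧ ∀ e ∈ edges m, ∃ f ∈ edges l.1, O e f := by
    intro l
    obtain ⟨i, hi⟩ := hP.sw l.1 l.2
    obtain ⟨m, hm⟩ := h.liftSW (Set.subset_union_right) hi
    refine ⟨m, ⟨i, ?_⟩, hm.2⟩
    have := hm.1
    rwa [Set.preimage_union, hA, hN] at this
  choose f hf using key
  refine mkPS dA dN f (fun k => (hf k).1) ?_ ?_
  · intro i j e hi hj
    obtain ⟨f1, a1, a2⟩ := (hf i).2.2 e hi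
    obtain ⟨f2, b1, b2⟩ := (hf j).2.2 e hj
    have := h.own _ _ _ a2 b2
    subst this
    exact Subtype.ext (hP.disj i.1 i.2 j.1 j.2 f1 a1 b1)
  · intro i e he
    have he' := he
    rw [← hA i, ← h.cut] at he'
    obtain ⟨l, hl, hel⟩ := hP.cov i he'
    exact ⟨⟨l, hl⟩, (hf ⟨l, hl⟩).2.1 e hel⟩

end LC

namespace LC
open Classical Cardinal
variable {V : Type u} {E : Type v}

lemma greedy {D : Type v} {μ : Cardinal.{v}} (hμ : ℵ₀ ≤ μ) (hD : #D ≤ μ) (P : D → List (Dart V E) → Prop)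
    (h : ∀ d (C : Set E), #C ≤ μ → ∃ l, P d l ∧ ∀ e ∈ edges l, e ∉ C) {B : Set E} (hB : #B ≤ μ) :
    ∃ r : D → List (Dart V E), (∀ d, P d (r d) ∧ ∀ e ∈ edges (r d), e ∉ B) ∧
      ∀ d d' e, e ∈ edges (r d) → e ∈ edges (r d') → d = d' := by
  have h' : ∀ d (C : Set E), ∃ l, #C ≤ μ → P d l ∧ ∀ e ∈ edges l, e ∉ C := by
    intro d C
    by_cases hC : #C ≤ μ
    · obtain ⟨l, hl⟩ := h d C hC; exact ⟨l, fun _ => hl⟩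
    · exact ⟨[], fun hh => absurd hh hC⟩
  choose c hc using h'
  obtain ⟨r, hr⟩ : ∃ r : D → List (Dart V E), ∀ d, r d = c d (B ∪ ⋃ d' : {d' // WellOrderingRel d' d}, {e | e ∈ edges (r d'.1)}) := by
    refine ⟨(IsWellFounded.wf (r := (WellOrderingRel : D → D → Prop))).fix
      (fun d rec => c d (B ∪ ⋃ d' : {d' // WellOrderingRel d' d}, {e | e ∈ edges (rec d'.1 d'.2)})), fun d => ?_⟩
    conv_lhs => rw [WellFounded.fix_eq]
  have hcard : ∀ d, #(B ∪ ⋃ d' : {d' // WellOrderingRel d' d}, {e | e ∈ edges (r d'.1)} : Set E) ≤ μ := by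
    intro d
    refine (mk_union_le _ _).trans (add_le_of_le hμ hB ?_)
    refine (mk_iUnion_le _).trans ?_
    have h1 : #{d' // WellOrderingRel d' d} ≤ μ := (mk_subtype_le _).trans hD
    refine (mul_le_mul' h1 (ciSup_le' (fun l => ?_))).trans (mul_eq_self hμ).le
    exact ((List.finite_toSet _).lt_aleph0.le).trans hμ
  have hr2 : ∀ d, P d (r d) ∧ ∀ e ∈ edges (r d), e ∉ B ∪ ⋃ d' : {d' // WellOrderingRel d' d}, {e | e ∈ edges (r d'.1)} := by
    intro d
    have := hc d _ (hcard d)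
    rwa [← hr d] at this
  refine ⟨r, fun d => ⟨(hr2 d).1, fun e he hB => (hr2 d).2 e he (Or.inl hB)⟩, ?_⟩
  intro d d' e he he'
  rcases trichotomous_of WellOrderingRel d d' with h | h | h
  · exact absurd (Or.inr (Set.mem_iUnion.2 ⟨⟨d, h⟩, he⟩)) ((hr2 d').2 e he')
  · exact h
  · exact absurd (Or.inr (Set.mem_iUnion.2 ⟨⟨d', h⟩, he'⟩)) ((hr2 d).2 e he)

lemma card_half {μ : Cardinal.{v}} (hμ : ℵ₀ ≤ μ) {H : Set (E × Bool)} {F : Set E} (hF : #F ≤ μ) (h : ∀ x ∈ H, x.1 ∈ F) : #H ≤ μ := by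
  have h1 : #H ≤ #(F × Bool) := mk_le_of_injective (f := fun x : H => ((⟨x.1.1, h _ x.2⟩, x.1.2) : F × Bool)) (by
    rintro ⟨⟨a, b⟩, ha⟩ ⟨⟨c, d⟩, hc⟩ hh
    simp only [Prod.mk.injEq, Subtype.mk.injEq] at hh
    simp [hh.1, hh.2])
  refine h1.trans ?_
  rw [mk_prod]
  simp only [lift_uzero]
  have h2 : Cardinal.lift.{v} (#Bool) ≤ ℵ₀ := by simp
  exact (mul_le_mul' hF (h2.trans hμ)).trans (mul_eq_self hμ).le

/-- separation rank of a vertex -/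
noncomputable def gam (G : MG V E) (Z : Set V) (F : Ordinal.{v} → Set E) (x : V) : Ordinal.{v} :=
  sInf {γ | ¬ To G (F γ) x Z}

lemma Filt.top {G : MG V E} {Z : Set V} {F : Ordinal.{v} → Set E} (hF : Filt G Z F) {e} (he : e ∈ G.S) : e ∈ F (#G.S).ord :=
  (hF.cont _ _).2 (hF.all e he)

lemma Filt.gam1 {G : MG V E} {Z : Set V} {F : Ordinal.{v} → Set E} (hF : Filt G Z F) {x : V} (hx : x ∉ Z) :
    ¬ To G (F (gam G Z F x)) x Z := by
  have : {γ | ¬ To G (F γ) x Z}.Nonempty := by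
    refine ⟨(#G.S).ord, ?_⟩
    rintro ⟨l, y, hy, hc, hl⟩
    cases l with
    | nil => exact hx (hc ▸ hy)
    | cons d l => exact (hl d (by simp)).2 (hF.top (hl d (by simp)).1.1)
  exact csInf_mem this

lemma gam2 {G : MG V E} {Z : Set V} {F : Ordinal.{v} → Set E} {x : V} {γ} (h : γ < gam G Z F x) : To G (F γ) x Z := by
  by_contra hh
  exact absurd (csInf_le' (s := {γ | ¬ To G (F γ) x Z}) hh) (not_le.2 h)

lemma gam_le {G : MG V E} {Z : Set V} {F : Ordinal.{v} → Set E} {x : V} {γ} (h : ¬ To G (F γ) x Z) : gam G Z F x ≤ γ :=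
  csInf_le' h

def Rel (G : MG V E) (Z : Set V) (F : Ordinal.{v} → Set E) (x y : V) : Prop :=
  x ∉ Z ∧ y ∉ Z ∧ gam G Z F x = gam G Z F y ∧ To G (F (gam G Z F x)) x {y}

lemma To.trans {G : MG V E} {C : Set E} {x y : V} {Y : Set V} (h : To G C x {y}) (h' : To G C y Y) : To G C x Y := by
  obtain ⟨l, z, rfl, h1, h2⟩ := h
  obtain ⟨m, w, hw, h3, h4⟩ := h'
  refine ⟨l ++ m, w, hw, h1.append h3, ?_⟩
  intro d hd
  rcases List.mem_append.1 hd with hd | hd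
  · exact h2 d hd
  · exact h4 d hd

lemma To.symm {G : MG V E} {C : Set E} {x y : V} (h : To G C x {y}) : To G C y {x} := by
  obtain ⟨l, z, rfl, h1, h2⟩ := h
  refine ⟨revL l, x, rfl, h1.rev, ?_⟩
  intro d hd
  have := h2 _ (mem_revL.1 hd)
  exact ⟨by simpa using this.1.rev, this.2⟩

lemma To.dart {G : MG V E} {C : Set E} {d : Dart V E} (hd : G.ok d) (h : d.e ∉ C) : To G C d.s {d.t} :=
  ⟨[d], d.t, rfl, ⟨rfl, rfl⟩, by simp [hd, h]⟩

lemma Rel.symm {G : MG V E} {Z : Set V} {F : Ordinal.{v} → Set E} {x y : V} (h : Rel G Z F x y) : Rel G Z F y x :=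
  ⟨h.2.1, h.1, h.2.2.1.symm, h.2.2.1 ▸ h.2.2.2.symm⟩

lemma Rel.trans {G : MG V E} {Z : Set V} {F : Ordinal.{v} → Set E} {x y z : V} (h : Rel G Z F x y) (h' : Rel G Z F y z) : Rel G Z F x z :=
  ⟨h.1, h'.2.1, h.2.2.1.trans h'.2.2.1, h.2.2.2.trans (h.2.2.1 ▸ h'.2.2.2)⟩

lemma Rel.refl {G : MG V E} {Z : Set V} {F : Ordinal.{v} → Set E} {x : V} (hx : x ∉ Z) : Rel G Z F x x :=
  ⟨hx, hx, rfl, [], x, rfl, rfl, by simp⟩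

lemma Filt.rel_dart {G : MG V E} {Z : Set V} {F : Ordinal.{v} → Set E} (hF : Filt G Z F) {d : Dart V E} (hd : G.ok d)
    (hs : d.s ∉ Z) (he : d.e ∉ F (gam G Z F d.s)) : Rel G Z F d.s d.t := by
  have h0 := To.dart hd he
  have h1 : ¬ To G (F (gam G Z F d.s)) d.t Z := fun h => hF.gam1 hs (h0.trans h)
  have ht : d.t ∉ Z := fun h => h1 ⟨[], d.t, h, rfl, by simp⟩
  have h2 := gam_le h1
  refine ⟨hs, ht, le_antisymm ?_ h2, h0⟩
  by_contra hlt
  push Not at hlt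
  refine hF.gam1 ht ((To.dart hd.rev ?_).trans (gam2 hlt))
  exact fun h => he (hF.mono h2 h)

def Jset (G : MG V E) (Z : Set V) (F : Ordinal.{v} → Set E) : Set E :=
  {e | ∃ d, G.ok d ∧ d.e = e ∧ d.s ∉ Z ∧ d.e ∉ F (gam G Z F d.s)}

def Pst (G : MG V E) (Z : Set V) (F : Ordinal.{v} → Set E) (x : V) : Set V :=
  {y | Rel G Z F x y ∧ ((∃ z, Rel G Z F x z ∧ Vt G (F (gam G Z F x)) z) → Vt G (F (gam G Z F x)) y)}

noncomputable def ph (G : MG V E) (Z : Set V) (F : Ordinal.{v} → Set E) (x : V) : V :=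
  if h : (Pst G Z F x).Nonempty then h.some else x

lemma ph_Z {G : MG V E} {Z : Set V} {F : Ordinal.{v} → Set E} {x : V} (hx : x ∈ Z) : ph G Z F x = x := by
  unfold ph
  rw [dif_neg]
  rintro ⟨y, hy⟩
  exact hy.1.1 hx

lemma ph_mem {G : MG V E} {Z : Set V} {F : Ordinal.{v} → Set E} {x : V} (hx : x ∉ Z) : ph G Z F x ∈ Pst G Z F x := by
  have : (Pst G Z F x).Nonempty := by
    by_cases h : ∃ z, Rel G Z F x z ∧ Vt G (F (gam G Z F x)) z
    · obtain ⟨z, h1, h2⟩ := h; exact ⟨z, h1, fun _ => h2⟩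
    · exact ⟨x, Rel.refl hx, fun hh => absurd hh h⟩
  unfold ph
  rw [dif_pos this]
  exact this.some_mem

lemma ph_rel {G : MG V E} {Z : Set V} {F : Ordinal.{v} → Set E} {x : V} (hx : x ∉ Z) : Rel G Z F x (ph G Z F x) := (ph_mem hx).1

lemma Rel.ph {G : MG V E} {Z : Set V} {F : Ordinal.{v} → Set E} {x y : V} (h : Rel G Z F x y) : ph G Z F x = ph G Z F y := by
  have : Pst G Z F x = Pst G Z F y := by
    ext z
    have h1 : ∀ z, Rel G Z F x z ↔ Rel G Z F y z := fun z => ⟨fun h' => h.symm.trans h', fun h' => h.trans h'⟩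
    simp only [Pst, Set.mem_setOf_eq, h1, h.2.2.1]
  have h2 : (Pst G Z F y).Nonempty := ⟨_, ph_mem h.2.1⟩
  unfold LC.ph
  simp only [this, dif_pos h2]

lemma rel_of_ph {G : MG V E} {Z : Set V} {F : Ordinal.{v} → Set E} {x y : V} (hx : x ∉ Z) (h : ph G Z F x = ph G Z F y) : Rel G Z F x y := by
  have h1 := ph_rel (G := G) (F := F) hx
  by_cases hy : y ∈ Z
  · rw [h, ph_Z hy] at h1; exact absurd hy h1.2.1
  · rw [h] at h1; exact h1.trans (ph_rel hy).symm

lemma ph_notZ {G : MG V E} {Z : Set V} {F : Ordinal.{v} → Set E} {x : V} (hx : x ∉ Z) : ph G Z F x ∉ Z := (ph_rel hx).2.1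

lemma ph_pre {G : MG V E} {Z : Set V} {F : Ordinal.{v} → Set E} {A : Set V} (h : A ⊆ Z) : ph G Z F ⁻¹' A = A := by
  ext x
  by_cases hx : x ∈ Z
  · simp [ph_Z hx]
  · simp only [Set.mem_preimage]
    exact ⟨fun h' => absurd (h h') (ph_notZ hx), fun h' => absurd (h h') hx⟩

lemma ph_pre' {G : MG V E} {Z : Set V} {F : Ordinal.{v} → Set E} : ph G Z F ⁻¹' Zᶜ = Zᶜ := by
  rw [Set.preimage_compl, ph_pre le_rfl]

lemma notJ {G : MG V E} {Z : Set V} {F : Ordinal.{v} → Set E} {d : Dart V E} (hd : G.ok d)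
    (hs : d.s ∉ Z) (he : d.e ∉ Jset G Z F) : d.e ∈ F (gam G Z F d.s) := by
  by_contra h
  exact he ⟨d, hd, rfl, hs, h⟩

lemma Filt.col {G : MG V E} {Z : Set V} {F : Ordinal.{v} → Set E} (hF : Filt G Z F) {d : Dart V E} (hd : G.ok d)
    (he : d.e ∈ Jset G Z F) : Rel G Z F d.s d.t := by
  obtain ⟨d', h1, h2, h3, h4⟩ := he
  have := hF.rel_dart h1 h3 h4
  rcases ok_same hd h1 h2.symm with h | h
  · rwa [h] at this
  · rw [h] at this; exact this.symm

lemma Filt.rel_chain {G : MG V E} {Z : Set V} {F : Ordinal.{v} → Set E} (hF : Filt G Z F) {γ} (l : List (Dart V E)) : ∀ {x y : V}, x ∉ Z →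
    γ = gam G Z F x → Ch x l y → (∀ d ∈ l, G.ok d ∧ d.e ∉ F γ) → ∀ d ∈ l, Rel G Z F x d.s ∧ Rel G Z F x d.t ∧ d.e ∈ Jset G Z F := by
  induction l with
  | nil => simp
  | cons c l ih =>
    intro x y hx hg hc hl d hd
    obtain ⟨rfl, hc⟩ := hc
    have h1 := hF.rel_dart (hl c (by simp)).1 hx (hg ▸ (hl c (by simp)).2)
    rcases List.mem_cons.1 hd with rfl | hd
    · exact ⟨Rel.refl hx, h1, d, (hl d (by simp)).1, rfl, hx, hg ▸ (hl d (by simp)).2⟩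
    · obtain ⟨a, b, c⟩ := ih h1.2.1 (hg.trans h1.2.2.1) hc (fun d hd => hl d (by simp [hd])) d hd
      exact ⟨h1.trans a, h1.trans b, c⟩

lemma Filt.vt_ph {G : MG V E} {Z : Set V} {F : Ordinal.{v} → Set E} {d : Dart V E} (hd : G.ok d)
    (hs : d.s ∉ Z) (he : d.e ∉ Jset G Z F) : Vt G (F (gam G Z F d.s)) (ph G Z F d.s) :=
  (ph_mem hs).2 ⟨d.s, Rel.refl hs, d, hd, rfl, notJ hd hs he⟩

lemma Filt.imm {G : MG V E} {Z : Set V} {F : Ordinal.{v} → Set E} (hF : Filt G Z F) :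
    ∃ O, Imm G (Jset G Z F) (ph G Z F) O := by
  let D : V → Set (E × Bool) := fun w => {h | h.1 ∈ G.S ∧ h.1 ∉ Jset G Z F ∧ en G h ∉ Z ∧ ph G Z F (en G h) = w}
  have key : ∀ w, ∃ r : D w → List (Dart V E), (∀ h : D w, (∃ y ∈ ({w} : Set V), Ch (en G h.1) (r h) y ∧ ∀ d ∈ r h, G.ok d) ∧
      ∀ e ∈ edges (r h), e ∉ F (gam G Z F w)) ∧ ∀ h h' e, e ∈ edges (r h) → e ∈ edges (r h') → h = h' := by
    intro w
    have hD : ∀ h ∈ D w, h.1 ∈ F (gam G Z F w) ∧ gam G Z F (en G h) = gam G Z F w := by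
      rintro h ⟨h1, h2, h3, h4⟩
      have h5 : gam G Z F (en G h) = gam G Z F w := by rw [← h4]; exact (ph_rel h3).2.2.1
      have := notJ (en_ok G h1 h.2) h3 h2
      exact ⟨h5 ▸ this, h5⟩
    refine greedy (sz_inf (gam G Z F w)) ?_ (fun (h : D w) l => ∃ y ∈ ({w} : Set V), Ch (en G h.1) l y ∧ ∀ d ∈ l, G.ok d) ?_ (hF.card (gam G Z F w))
    · exact card_half (sz_inf _) (hF.card _) (fun h hh => (hD h hh).1)
    · rintro ⟨h, hh⟩ C hC
      obtain ⟨h1, h2, h3, h4⟩ := id hh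
      have hd := en_ok G h1 h.2
      have hr := ph_rel (G := G) (F := F) h3
      have hg := (hD h hh).2
      have a1 : Vt G (F (gam G Z F w)) (en G h) := ⟨_, hd, rfl, (hD h hh).1⟩
      have a2 : Vt G (F (gam G Z F w)) w := by
        have := Filt.vt_ph (G := G) (Z := Z) (F := F) hd h3 h2
        rw [h4, hg] at this; exact this
      have a3 : To G (F (gam G Z F w)) (en G h) {w} := by
        have := hr.2.2.2; rwa [h4, hg] at this
      obtain ⟨l, y, hy, b1, b2⟩ := hF.star _ _ {w} a1 (Or.inr ⟨w, a2, rfl⟩) a3 C hC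
      refine ⟨l, ⟨y, hy, b1, fun d hd => (b2 d hd).1⟩, ?_⟩
      intro e he
      obtain ⟨d, hd, rfl⟩ := mem_edges.1 he
      exact (b2 d hd).2
  choose r hr1 hr2 using key
  -- facts about routes
  have hr3 : ∀ w h, ∀ d ∈ r w h, Rel G Z F (en G h.1) d.s ∧ Rel G Z F (en G h.1) d.t ∧ d.e ∈ Jset G Z F := by
    rintro w ⟨h, hh⟩
    obtain ⟨⟨y, hy, b1, b2⟩, b3⟩ := hr1 w ⟨h, hh⟩
    refine hF.rel_chain (γ := gam G Z F w) _ hh.2.2.1 ?_ b1 (fun d hd => ⟨b2 d hd, b3 _ (mem_edges_of hd)⟩)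
    obtain ⟨h1, h2, h3, h4⟩ := hh
    have := (ph_rel (G := G) (F := F) h3).2.2.1
    rw [h4] at this; exact this.symm
  refine ⟨fun e f => (e = f ∧ e ∉ Jset G Z F) ∨ (e ∈ Jset G Z F ∧ ∃ w h, e ∈ edges (r w h) ∧ h.1.1 = f), ?_, ?_, ?_, ?_⟩
  · rintro e f f' (⟨rfl, h1⟩ | ⟨h1, w, h, h2, rfl⟩) (⟨rfl, h3⟩ | ⟨h3, w', h', h4, rfl⟩)
    · rfl
    · exact absurd h3 h1
    · exact absurd h1 h3
    · have : w = w' := by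
        obtain ⟨d, hd, rfl⟩ := mem_edges.1 h2
        obtain ⟨d', hd', hde⟩ := mem_edges.1 h4
        have a1 := hr3 w h d hd
        have a2 := hr3 w' h' d' hd'
        obtain ⟨⟨-, -, b1, b2⟩, -⟩ := hr1 w h
        obtain ⟨⟨-, -, c1, c2⟩, -⟩ := hr1 w' h'
        have e1 := h.2.2.2.2
        have e2 := h'.2.2.2.2
        have : Rel G Z F (en G h.1) (en G h'.1) := by
          rcases ok_same (b2 d hd) (c2 d' hd') hde.symm with hx | hx
          · exact a1.1.trans (by rw [← hx]; exact a2.1.symm)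
          · refine a1.1.trans ?_
            have := a2.2.1.symm
            rwa [hx] at this
        rw [← e1, ← e2]; exact this.ph
      subst this
      rw [hr2 w h h' e h2 h4]
  · exact fun e he hJ => Or.inl ⟨rfl, hJ⟩
  · exact fun d hd hJ => (hF.col hd hJ).ph
  · intro d hd hJ
    by_cases hs : d.s ∈ Z
    · exact ⟨[], ph_Z hs, by simp⟩
    · obtain ⟨b, hb, -⟩ := ok_en hd
      have hm : (d.e, b) ∈ D (ph G Z F d.s) := ⟨hd.1, hJ, by rwa [← hb], by rw [← hb]⟩
      obtain ⟨⟨y, hy, b1, b2⟩, b3⟩ := hr1 _ ⟨_, hm⟩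
      have c := hr3 _ ⟨_, hm⟩
      simp only [← hb] at b1 c
      obtain rfl : y = _ := hy
      refine ⟨revL (r _ ⟨_, hm⟩), b1.rev, ?_⟩
      intro d' hd'
      have hd'' := mem_revL.1 hd'
      have c' := c _ hd''
      refine ⟨by simpa using (b2 _ hd'').rev, c'.2.1.ph.symm, c'.1.ph.symm, Or.inr ⟨c'.2.2, _, ⟨_, hm⟩, ?_, rfl⟩⟩
      exact mem_edges.2 ⟨_, hd'', rfl⟩

end LC

namespace LC
open Classical Cardinal
variable {V : Type u} {E : Type v}

lemma lift_selfC (c : Cardinal.{v+1}) : Cardinal.lift.{v} c = c := Cardinal.lift_id'.{v, v+1} c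

lemma card_blk {μ : Cardinal.{v}} (hμ : ℵ₀ ≤ μ) : Cardinal.lift.{v+1} (Order.succ μ) ≤ #{i : Ordinal.{v} | i.card = μ} := by
  have h1 : #(Set.Iio (Order.succ μ).ord) = Cardinal.lift.{v+1} (Order.succ μ) := by
    rw [mk_Iio_ordinal, card_ord]
  have h2 : #(Set.Iio μ.ord) = Cardinal.lift.{v+1} μ := by
    rw [mk_Iio_ordinal, card_ord]
  have h3 : Set.Iio (Order.succ μ).ord ⊆ {i : Ordinal.{v} | i.card = μ} ∪ Set.Iio μ.ord := by
    intro i hi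
    have h4 : i.card < Order.succ μ := lt_ord.1 hi
    rcases lt_or_eq_of_le (Order.le_of_lt_succ h4) with h5 | h5
    · exact Or.inr (lt_ord.2 h5)
    · exact Or.inl h5
  by_contra hlt
  push Not at hlt
  have h5 := (mk_le_mk_of_subset h3).trans (mk_union_le _ _)
  rw [h1, h2] at h5
  have h6 : Cardinal.lift.{v+1} μ < Cardinal.lift.{v+1} (Order.succ μ) := lift_lt.2 (Order.lt_succ μ)
  have h7 : ℵ₀ ≤ Cardinal.lift.{v+1} (Order.succ μ) := by
    rw [aleph0_le_lift]; exact hμ.trans (Order.le_succ μ)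
  exact absurd h5 (not_le.2 (add_lt_of_lt h7 hlt h6))

lemma parEx {α : Type v} [Nonempty α] {B : Ordinal.{v} → Set α} (hm : Monotone B) (hB : ∀ γ, #(B γ) ≤ sz γ) :
    ∃ par : Ordinal.{v} → α, ∀ θ : Cardinal.{v}, ℵ₀ < θ → ∀ γ0 < θ.ord, ∀ p ∈ B γ0,
      Cardinal.lift.{v+1} θ ≤ #{i : Ordinal.{v} | par i = p ∧ γ0 < i ∧ i < θ.ord} := by
  have key : ∀ μ : Cardinal.{v}, ∃ q : Ordinal.{v} → α, ℵ₀ ≤ μ → ∀ p ∈ B (Order.succ μ).ord,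
      Cardinal.lift.{v+1} (Order.succ μ) ≤ #{i : Ordinal.{v} | i.card = μ ∧ q i = p} := by
    intro μ
    by_cases hμ : ℵ₀ ≤ μ
    swap
    · exact ⟨fun _ => Classical.arbitrary α, fun h => absurd h hμ⟩
    have hs : ℵ₀ ≤ Order.succ μ := hμ.trans (Order.le_succ μ)
    have h1 : #(B (Order.succ μ).ord × (Order.succ μ).out) ≤ Order.succ μ := by
      rw [mk_prod, lift_id, lift_id, mk_out]
      refine (mul_le_mul_left (hB _) _).trans ?_
      have : sz (Order.succ μ).ord = Order.succ μ := by
        unfold sz; rw [card_ord]; exact max_eq_left hs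
      rw [this]; exact (mul_eq_self hs).le
    have h2 : Cardinal.lift.{v+1} #(B (Order.succ μ).ord × (Order.succ μ).out) ≤ Cardinal.lift.{v} #{i : Ordinal.{v} | i.card = μ} := by
      refine (lift_le.2 h1).trans ?_
      have := card_blk hμ
      rwa [lift_selfC] 
    obtain ⟨j⟩ := lift_mk_le'.1 h2
    refine ⟨fun i => if h : ∃ x, (j x).1 = i then (h.choose.1 : α) else Classical.arbitrary α, fun _ p hp => ?_⟩
    have h3 : Cardinal.lift.{v+1} #((Order.succ μ).out) ≤ Cardinal.lift.{v} #{i : Ordinal.{v} | i.card = μ ∧ (if h : ∃ x, (j x).1 = i then (h.choose.1 : α) else Classical.arbitrary α) = p} := by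
      rw [lift_mk_le']
      refine ⟨⟨fun c => ⟨(j (⟨p, hp⟩, c)).1, (j (⟨p, hp⟩, c)).2, ?_⟩, ?_⟩⟩
      · have h : ∃ x, (j x).1 = (j (⟨p, hp⟩, c)).1 := ⟨_, rfl⟩
        rw [dif_pos h]
        have := j.injective (Subtype.ext h.choose_spec)
        rw [this]
      · intro c c' hcc
        have h0 : (j (⟨p, hp⟩, c)).1 = (j (⟨p, hp⟩, c')).1 := by simpa only [Subtype.mk.injEq] using hcc
        have := j.injective (Subtype.ext h0)
        simpa using this
    rw [mk_out] at h3
    rwa [lift_selfC] at h3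
  choose q hq using key
  refine ⟨fun i => q i.card i, fun θ hθ γ0 hγ p hp => ?_⟩
  by_contra hlt
  push Not at hlt
  obtain ⟨ν, hν⟩ := Cardinal.mem_range_lift_of_le hlt.le
  rw [← hν, lift_lt] at hlt
  set μ := max (max ν γ0.card) ℵ₀ with hμ
  have hμθ : μ < θ := max_lt (max_lt hlt (lt_ord.1 hγ)) hθ
  have hμ0 : ℵ₀ ≤ μ := le_max_right _ _
  have hγμ : γ0.card < Order.succ μ := Order.lt_succ_of_le ((le_max_right _ _).trans (le_max_left _ _))
  have h1 := hq μ hμ0 p (hm (lt_ord.2 hγμ).le hp)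
  have h2 : {i : Ordinal.{v} | i.card = μ ∧ q μ i = p} ⊆ {i : Ordinal.{v} | q i.card i = p ∧ γ0 < i ∧ i < θ.ord} ∪ Set.Iio (Order.succ γ0) := by
    rintro i ⟨a, b⟩
    by_cases hi : γ0 < i
    · refine Or.inl ⟨by rw [a]; exact b, hi, lt_ord.2 (by rw [a]; exact hμθ)⟩
    · exact Or.inr (Order.lt_succ_of_le (not_lt.1 hi))
  have h3 := h1.trans ((mk_le_mk_of_subset h2).trans (mk_union_le _ _))
  rw [← hν, mk_Iio_ordinal, ← lift_add, lift_le] at h3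
  have h4 : ν + (Order.succ γ0).card ≤ μ := by
    refine add_le_of_le hμ0 ((le_max_left _ _).trans (le_max_left _ _)) ?_
    rw [Ordinal.card_succ]
    exact add_le_of_le hμ0 ((le_max_right _ _).trans (le_max_left _ _)) (one_le_aleph0.trans hμ0)
  exact absurd (h3.trans h4) (not_le.2 (Order.lt_succ μ))

end LC

namespace LC
open Classical Cardinal
variable {V : Type u} {E : Type v}

noncomputable def stg (F : Ordinal.{v} → Set E) (e : E) : Ordinal.{v} := sInf {γ | e ∈ F (Order.succ γ)}

lemma Filt.stg1 {G : MG V E} {Z : Set V} {F : Ordinal.{v} → Set E} (hF : Filt G Z F) {e} (he : e ∈ G.S) :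
    e ∈ F (Order.succ (stg F e)) ∧ stg F e < (#G.S).ord := by
  obtain ⟨δ, h1, h2⟩ := hF.all e he
  exact ⟨csInf_mem (s := {γ | e ∈ F (Order.succ γ)}) ⟨δ, h2⟩, (csInf_le' (s := {γ | e ∈ F (Order.succ γ)}) h2).trans_lt h1⟩

lemma Filt.stg2 {G : MG V E} {Z : Set V} {F : Ordinal.{v} → Set E} (hF : Filt G Z F) {e} (he : e ∈ G.S) (γ) :
    e ∈ F γ ↔ stg F e < γ := by
  rw [hF.cont]
  constructor
  · rintro ⟨δ, h1, h2⟩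
    exact (csInf_le' (s := {γ | e ∈ F (Order.succ γ)}) h2).trans_lt h1
  · exact fun h => ⟨_, h, (hF.stg1 he).1⟩

def Kst (G : MG V E) (Z : Set V) (F : Ordinal.{v} → Set E) : Set V :=
  {w | w ∉ Z ∧ ∃ d d', G.ok d ∧ G.ok d' ∧ d.e ∉ Jset G Z F ∧ d'.e ∉ Jset G Z F ∧ ph G Z F d.s = w ∧ ph G Z F d'.s = w ∧ stg F d.e < stg F d'.e}

lemma Filt.gam_ph {G : MG V E} {Z : Set V} {F : Ordinal.{v} → Set E} {x : V} (hx : ph G Z F x ∉ Z) :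
    x ∉ Z ∧ gam G Z F x = gam G Z F (ph G Z F x) := by
  have h : x ∉ Z := fun h => hx (by rwa [ph_Z h])
  exact ⟨h, (ph_rel h).2.2.1⟩

lemma Filt.stg_lt {G : MG V E} {Z : Set V} {F : Ordinal.{v} → Set E} (hF : Filt G Z F) {d : Dart V E} (hd : G.ok d)
    (hJ : d.e ∉ Jset G Z F) (hx : ph G Z F d.s ∉ Z) : stg F d.e < gam G Z F (ph G Z F d.s) := by
  obtain ⟨h1, h2⟩ := Filt.gam_ph hx
  rw [← h2]
  exact (hF.stg2 hd.1 _).1 (notJ hd h1 hJ)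

/-- leaving a class inside one stage -/
lemma Filt.leave {G : MG V E} {Z : Set V} {F : Ordinal.{v} → Set E} (hF : Filt G Z F) {i : Ordinal.{v}} {x : V} {Q : Set E} {X : Set V}
    (hX : X ⊆ Zᶜ) (hx : ph G Z F x ∈ X) (hv : Vt G (F (Order.succ i)) x) (hQ : Q.Finite) (hQ2 : Q ⊆ F (Order.succ i))
    (hT : To G (F i ∪ Q) x Z) : ∃ c, G.ok c ∧ c.e ∉ Jset G Z F ∧ stg F c.e = i ∧ c.e ∉ Q ∧ ph G Z F c.s ∈ X ∧ ph G Z F c.t ∉ X := by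
  obtain ⟨l, y, hy, h1, h2⟩ := hF.path i x Z Q hv (Or.inl rfl) hQ hQ2 hT
  obtain ⟨l1, c, l2, rfl, -, -, h3, h4, -⟩ := h1.exit (X := ph G Z F ⁻¹' X) hx (fun h => by
    have h' : ph G Z F y ∈ X := h
    rw [ph_Z hy] at h'
    exact hX h' hy)
  obtain ⟨h5, h6⟩ := h2 c (by simp)
  simp only [Set.mem_union, Set.mem_compl_iff, not_or, not_not] at h6
  refine ⟨c, h5, fun hJ => ?_, le_antisymm ?_ ?_, h6.2, h3, h4⟩
  · have h7 := (hF.col h5 hJ).ph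
    simp only [Set.mem_preimage] at h3 h4
    rw [h7] at h3; exact h4 h3
  · exact Order.le_of_lt_succ ((hF.stg2 h5.1 _).1 h6.1.1)
  · have := h6.1.2
    rw [hF.stg2 h5.1] at this
    exact not_lt.1 this

lemma Filt.hub {G : MG V E} {Z : Set V} {F : Ordinal.{v} → Set E} (hF : Filt G Z F) {w : V} (hw : w ∈ Kst G Z F) :
    ∃ x γ2, ph G Z F x = w ∧ γ2 < gam G Z F w ∧ Vt G (F γ2) x ∧
      ∀ γ, γ2 ≤ γ → γ < gam G Z F w → ∀ C : Set E, #C ≤ sz γ → To G C x Z := by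
  obtain ⟨hwZ, d, d', h1, h2, h3, h4, h5, h6, h7⟩ := hw
  have a2 := hF.stg_lt h2 h4 (by rwa [h6])
  rw [h6] at a2
  have hv : Vt G (F (stg F d'.e)) d.s := ⟨d, h1, rfl, (hF.stg2 h1.1 _).2 h7⟩
  refine ⟨d.s, stg F d'.e, h5, a2, hv, fun γ hγ hγ' C hC => ?_⟩
  obtain ⟨-, b⟩ := Filt.gam_ph (x := d.s) (by rwa [h5])
  rw [h5] at b
  exact hF.star γ d.s Z (hv.mono (hF.mono hγ)) (Or.inl rfl) (gam2 (by rwa [b])) C hC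

lemma Filt.hub_card {G : MG V E} {Z : Set V} {F : Ordinal.{v} → Set E} (hF : Filt G Z F) {w : V} (hw : w ∈ Kst G Z F) :
    ∃ θ : Cardinal.{v}, ℵ₀ < θ ∧ gam G Z F w = θ.ord := by
  obtain ⟨x, γ2, h1, h2, h3, h4⟩ := hF.hub hw
  have hwZ := hw.1
  obtain ⟨hx, b⟩ := Filt.gam_ph (G := G) (Z := Z) (F := F) (x := x) (by rwa [h1])
  rw [h1] at b
  have key : ∀ γ, γ2 ≤ γ → γ < gam G Z F w → sz γ < sz (gam G Z F w) := by
    intro γ hγ hγ'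
    by_contra hh
    push Not at hh
    have := h4 γ hγ hγ' (F (gam G Z F w)) ((hF.card _).trans hh)
    rw [← b] at this
    exact hF.gam1 hx this
  have h0 : ℵ₀ < sz (gam G Z F w) := (sz_inf γ2).trans_lt (key γ2 le_rfl h2)
  have h5 : sz (gam G Z F w) = (gam G Z F w).card := by
    unfold sz at h0 ⊢
    rcases lt_max_iff.1 h0 with h | h
    · exact max_eq_left h.le
    · exact absurd h (lt_irrefl _)
  refine ⟨(gam G Z F w).card, h5 ▸ h0, le_antisymm ?_ (Cardinal.ord_card_le _)⟩
  by_contra hlt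
  push Not at hlt
  have h6 := key _ (le_max_left γ2 _) (max_lt h2 hlt)
  have h7 : sz (gam G Z F w).card.ord ≤ sz (max γ2 (gam G Z F w).card.ord) := sz_mono (le_max_right _ _)
  have h8 : sz (gam G Z F w).card.ord = sz (gam G Z F w) := by
    unfold sz; rw [card_ord]
  rw [h8] at h7
  exact absurd h6 (not_lt.2 h7)

theorem Filt.dec [Nonempty E] {G : MG V E} {Z : Set V} {F : Ordinal.{v} → Set E} (hF : Filt G Z F) :
    ∃ par, Dec (hat G (Jset G Z F) (ph G Z F)) Zᶜ (stg F) par (Kst G Z F) := by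
  let B : Ordinal.{v} → Set ((E × Bool) × E) := fun γ => {p | p.1.1 ∈ F γ ∧ p.2 ∈ F γ}
  have hBm : Monotone B := fun γ δ h p hp => ⟨hF.mono h hp.1, hF.mono h hp.2⟩
  have hBc : ∀ γ, #(B γ) ≤ sz γ := by
    intro γ
    let H : Set (E × Bool) := {h | h.1 ∈ F γ}
    have h1 : #H ≤ sz γ := card_half (sz_inf γ) (hF.card γ) (fun h hh => hh)
    have h2 : #(B γ) ≤ #(H × F γ) := mk_le_of_injective (f := fun p : B γ => ((⟨p.1.1, p.2.1⟩, ⟨p.1.2, p.2.2⟩) : H × F γ)) (by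
      rintro ⟨⟨a, b⟩, ha⟩ ⟨⟨c, d⟩, hc⟩ hh
      simp only [Prod.mk.injEq, Subtype.mk.injEq] at hh
      simp [hh.1, hh.2])
    refine h2.trans ?_
    rw [mk_prod, lift_id, lift_id]
    exact (mul_le_mul' h1 (hF.card γ)).trans (mul_eq_self (sz_inf γ)).le
  obtain ⟨par, hpar⟩ := parEx hBm hBc
  refine ⟨fun i => (ph G Z F (en G (par i).1), (par i).2), ⟨fun w hw => hw.1, ?_, ?_, ?_⟩⟩
  · intro d d' hd hd' hs hN hK
    obtain ⟨c, h1, h2, h3, h4, h5⟩ := ok_hat hd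
    obtain ⟨c', h1', h2', h3', h4', h5'⟩ := ok_hat hd'
    rw [← h2, ← h2']
    rw [← h2] at h5
    rw [← h2'] at h5'
    rcases lt_trichotomy (stg F c.e) (stg F c'.e) with h | h | h
    · exact absurd ⟨hN, c, c', h1, h1', h5, h5', h3, by rw [h3', hs], h⟩ hK
    · exact h
    · exact absurd ⟨hN, c', c, h1', h1, h5', h5, by rw [h3', hs], h3, h⟩ hK
  · intro d hd hK X hX hdX hfin
    obtain ⟨c, h1, h2, h3, h4, h5⟩ := ok_hat hd
    set Q := ((hat G (Jset G Z F) (ph G Z F)).piece (stg F) (stg F d.e)).cut X with hQ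
    have hQ2 : ∀ e ∈ Q, e ∈ G.S ∧ stg F e = stg F d.e := by
      rintro e ⟨f, hf, rfl, -⟩
      have := ok_piece.1 hf
      exact ⟨this.1.1.1, this.2⟩
    have hwZ := hK.1
    have key : ∃ x, ph G Z F x = d.s ∧ Vt G (F (Order.succ (stg F d.e))) x ∧ ∀ C : Set E, #C ≤ sz (stg F d.e) → To G C x Z := by
      have hi := hF.stg_lt h1 (by rwa [h2]) (by rwa [h3])
      rw [h2, h3] at hi
      have gen : ∀ a b, G.ok a → ph G Z F a.s = d.s → stg F a.e < b → stg F a.e ≤ stg F d.e → stg F d.e ≤ b → b < gam G Z F d.s →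
          ∃ x, ph G Z F x = d.s ∧ Vt G (F (Order.succ (stg F d.e))) x ∧ ∀ C : Set E, #C ≤ sz (stg F d.e) → To G C x Z := by
        intro a b ha has hab hai hib hbg
        have hv : Vt G (F b) a.s := ⟨a, ha, rfl, (hF.stg2 ha.1 _).2 hab⟩
        refine ⟨a.s, has, ⟨a, ha, rfl, (hF.stg2 ha.1 _).2 (Order.lt_succ_of_le hai)⟩, fun C hC => ?_⟩
        obtain ⟨-, bb⟩ := Filt.gam_ph (x := a.s) (by rwa [has])
        rw [has] at bb
        exact hF.star b a.s Z hv (Or.inl rfl) (gam2 (by rwa [bb])) C (hC.trans (sz_mono hib))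
      obtain ⟨-, a, b, g1, g2, g3, g4, g5, g6, g7⟩ := hK
      have hb := hF.stg_lt g2 g4 (by rwa [g6])
      rw [g6] at hb
      rcases lt_or_ge (stg F a.e) (stg F d.e) with h | h
      · exact gen a _ g1 g5 h h.le le_rfl hi
      · refine gen c (stg F b.e) h1 h3 ?_ ?_ ?_ hb
        · rw [h2]; exact h.trans_lt g7
        · rw [h2]
        · exact (h.trans_lt g7).le
    obtain ⟨x, k1, k2, k3⟩ := key
    have hT : To G (F (stg F d.e) ∪ Q) x Z := by
      refine k3 _ ((mk_union_le _ _).trans (add_le_of_le (sz_inf _) (hF.card _) ?_))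
      exact hfin.lt_aleph0.le.trans (sz_inf _)
    obtain ⟨b, b1, b2, b3, b4, b5, b6⟩ := hF.leave hX (by rwa [k1]) k2 hfin
      (fun e he => (hF.stg2 (hQ2 e he).1 _).2 (by rw [(hQ2 e he).2]; exact Order.lt_succ _)) hT
    exact b4 ⟨_, ok_piece.2 ⟨hat_ok b1 b2, b3⟩, rfl, b5, b6⟩
  · intro d hd hK a ha hle
    have hwZ := hK.1
    obtain ⟨x, γ2, h1, h2, h3, h4⟩ := hF.hub hK
    obtain ⟨θ, hθ, hg⟩ := hF.hub_card hK
    obtain ⟨hx, bx⟩ := Filt.gam_ph (G := G) (Z := Z) (F := F) (x := x) (by rwa [h1])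
    rw [h1] at bx
    have hdst : ∀ d1, (hat G (Jset G Z F) (ph G Z F)).ok d1 → d1.s = d.s → stg F d1.e < gam G Z F d.s := by
      intro d1 hd1 hs
      obtain ⟨c, k1, k2, k3, k4, k5⟩ := ok_hat hd1
      have := hF.stg_lt k1 (by rwa [k2]) (by rwa [k3, hs])
      rwa [k2, k3, hs] at this
    have hsa : stg F a < θ.ord := hg ▸ (hle.trans_lt (hdst d hd rfl))
    have hlim : Order.succ (stg F a) < θ.ord := (Cardinal.isSuccLimit_ord hθ.le).succ_lt hsa
    obtain ⟨c, c1, c2, c3⟩ := h3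
    obtain ⟨b, hb, -⟩ := ok_en c1
    set γ0 := max γ2 (Order.succ (stg F a)) with hγ0
    have hp : ((c.e, b), a) ∈ B γ0 := ⟨hF.mono (le_max_left _ _) c3, hF.mono (le_max_right _ _) (hF.stg1 ha.1).1⟩
    have hcard := hpar θ hθ γ0 (max_lt (hg ▸ h2) hlim) _ hp
    let Dw : Set E := {e | ∃ d1, (hat G (Jset G Z F) (ph G Z F)).ok d1 ∧ d1.s = d.s ∧ d1.e = e}
    have hDw : #Dw ≤ θ := by
      have : Dw ⊆ F (gam G Z F d.s) := by
        rintro e ⟨d1, k1, k2, rfl⟩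
        exact (hF.stg2 k1.1.1 _).2 (hdst d1 k1 k2)
      refine (mk_le_mk_of_subset this).trans ((hF.card _).trans ?_)
      rw [hg]; unfold sz; rw [card_ord]; exact max_le le_rfl hθ.le
    obtain ⟨j⟩ := lift_mk_le'.1 (show Cardinal.lift.{v+1} #Dw ≤ Cardinal.lift.{v} #{i : Ordinal.{v} | par i = ((c.e, b), a) ∧ γ0 < i ∧ i < θ.ord} from by
      rw [lift_selfC]; exact (lift_le.2 hDw).trans hcard)
    refine ⟨fun e => if h : e ∈ Dw then (j ⟨e, h⟩).1 else 0, ?_, ?_⟩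
    · intro d1 d2 k1 k2 s1 s2 heq
      have m1 : d1.e ∈ Dw := ⟨d1, k1, s1, rfl⟩
      have m2 : d2.e ∈ Dw := ⟨d2, k2, s2, rfl⟩
      beta_reduce at heq
      rw [dif_pos m1, dif_pos m2] at heq
      have := j.injective (Subtype.ext heq)
      simpa using this
    · intro d1 k1 s1
      have m1 : d1.e ∈ Dw := ⟨d1, k1, s1, rfl⟩
      beta_reduce
      rw [dif_pos m1]
      obtain ⟨i, i1, i2, i3⟩ := j ⟨d1.e, m1⟩
      simp only
      refine ⟨?_, (Order.lt_succ _).trans_le (le_max_right _ _) |>.trans i2, ?_⟩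
      · rw [i1]
        simp only
        rw [← hb, c2, h1]
      · have hi2 : γ2 ≤ i := (le_max_left _ _).trans i2.le
        obtain ⟨f, f1, f2, f3, f4, f5, f6⟩ := hF.leave (i := i) (x := x) (Q := ∅) (X := {d.s}) (by simpa using hwZ) h1
          ⟨c, c1, c2, hF.mono (hi2.trans (Order.le_succ i)) c3⟩ Set.finite_empty (Set.empty_subset _)
          (by rw [Set.union_empty]; exact gam2 (by rw [bx, hg]; exact i3))
        exact ⟨_, hat_ok f1 f2, f5, f3⟩

end LC

namespace LC
open Classical Cardinal
variable {V : Type u} {E : Type v}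

theorem M_all (κ : Cardinal.{v}) : ∀ (G : MG V E), #G.S = κ → ∀ {ι : Type w} (A : ι → Set V) (N : Set V),
    (∀ i j, i ≠ j → Disjoint (A i) (A j)) → (∀ i, Disjoint (A i) N) → Eul G N → (∀ i, Loose G (A i) (N ∪ A i)) →
    ∃ P, PS G A N P := by
  induction κ using WellFoundedLT.induction with
  | ind κ ih =>
  intro G hκ ι A N dA dN hE hlo
  rcases le_or_gt κ ℵ₀ with hc | hc
  · have hS : G.S.Countable := by
      rw [← Set.countable_coe_iff, ← mk_le_aleph0_iff, hκ]; exact hc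
    refine C_omega hS dA dN hE (fun j => ?_)
    refine BH_omega hS G le_rfl (A j) (N ∪ A j) Set.subset_union_right ?_ (hlo j)
    refine hE.mono ?_
    rintro x ⟨h1 | h1, h2⟩
    · exact h1
    · exact absurd h1 h2
  · have hne : Nonempty E := by
      by_contra hn
      rw [not_nonempty_iff] at hn
      have : #G.S = 0 := mk_eq_zero_iff.2 inferInstance
      rw [← hκ, this] at hc
      exact absurd hc (by simp)
    obtain ⟨F, hF⟩ := exFilt G Nᶜ
    obtain ⟨par, hD⟩ := hF.dec
    obtain ⟨O, hO⟩ := hF.imm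
    rw [compl_compl] at hD
    have hAN : ∀ i, A i ⊆ Nᶜ := fun i => Set.disjoint_left.1 (dN i)
    have pA : ∀ i, ph G Nᶜ F ⁻¹' (A i) = A i := fun i => ph_pre (hAN i)
    have pN : ph G Nᶜ F ⁻¹' N = N := by
      have := ph_pre' (G := G) (Z := Nᶜ) (F := F)
      rwa [compl_compl] at this
    have hsmall : ∀ i, #((hat G (Jset G Nᶜ F) (ph G Nᶜ F)).piece (stg F) i).S < κ := by
      intro i
      rcases lt_or_ge i κ.ord with hi | hi
      · have h1 : ((hat G (Jset G Nᶜ F) (ph G Nᶜ F)).piece (stg F) i).S ⊆ F (Order.succ i) := by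
          rintro e ⟨h1, h2⟩
          exact (hF.stg2 h1.1 _).2 (by rw [h2]; exact Order.lt_succ i)
        refine (mk_le_mk_of_subset h1).trans_lt ((hF.card _).trans_lt ?_)
        rw [sz_succ]
        exact max_lt (lt_ord.1 hi) hc
      · have h1 : ((hat G (Jset G Nᶜ F) (ph G Nᶜ F)).piece (stg F) i).S = ∅ := by
          ext e
          simp only [Set.mem_empty_iff_false, iff_false]
          rintro ⟨h1, h2⟩
          have := (hF.stg1 h1.1).2
          rw [hκ, h2] at this
          exact absurd this (not_lt.2 hi)
        rw [h1, mk_eq_zero]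
        exact aleph0_pos.trans hc
    have hM : ∀ i, ∀ (H : MG V E), H.S ⊆ ((hat G (Jset G Nᶜ F) (ph G Nᶜ F)).piece (stg F) i).S → #H.S < κ :=
      fun i H hH => (mk_le_mk_of_subset hH).trans_lt (hsmall i)
    obtain ⟨P, hP⟩ := M_of_Dec hD dA dN (hO.eul pN hE)
      (fun j => hO.loose (pA j) (by rw [Set.preimage_union, pA, pN]) (hlo j)) (by
        intro i H hH A Y hAY hEH hL
        obtain ⟨P, hP⟩ := ih _ (hM i H hH) H rfl (ι := PUnit.{w+1}) (fun _ => A) (Y \ A) (fun i j h => absurd rfl h)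
          (fun _ => Set.disjoint_sdiff_right) hEH (fun _ => by rwa [Set.sdiff_union_of_subset hAY])
        refine ⟨P, ⟨fun l hl => ?_, hP.nodup, hP.disj⟩, hP.cov PUnit.unit⟩
        obtain ⟨-, h⟩ := hP.sw l hl
        rwa [Set.sdiff_union_of_subset hAY] at h) (by
        intro i H N' hH dN' hE' hL'
        exact C_of_M dA dN' hE' hL' (fun X N'' d1 d2 e l => ih _ (hM i H hH) H rfl X N'' d1 d2 e l))
    exact hO.ps dA dN pA pN hP

end LC

namespace LC
open Classical Cardinal
variable {V : Type u} {E : Type v}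

/-- The chain form of the theorem. -/
lemma final_chain (G : MG V E) (T : Set V) (hE : Eul G Tᶜ) :
    ∃ (X : T → Set V) (Q : Set (List (Dart V E))),
      (∀ t : T, t.1 ∈ X t) ∧ (∀ t : T, ∀ x ∈ X t, x ∈ T → x = t) ∧
      (∀ q ∈ Q, (∀ g ∈ q, G.ok g) ∧ ∃ i j : T, i ≠ j ∧ Ch i.1 q j.1 ∧ (i.1 :: q.map Dart.t).Nodup ∧
        (∀ g ∈ q, g.t ∈ T → g.t = j) ∧
        ∃ e f, ∀ g ∈ q, ∀ k, g.e ∈ G.cut (X k) → (k = i ∧ g.e = e) ∨ (k = j ∧ g.e = f)) ∧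
      (∀ q ∈ Q, ∀ q' ∈ Q, ∀ e, e ∈ edges q → e ∈ edges q' → q = q') ∧
      ∀ k, G.cut (X k) ⊆ used Q := by
  obtain ⟨X, W, hF, hlo⟩ := fam G (fun t : T => ({t.1} : Set V)) Tᶜ (fun i j hij => by
    rw [Set.disjoint_singleton]; exact fun h => hij (Subtype.ext h))
  have hXU : ∀ i, ∀ x ∈ X i, x ∈ ⋃ i, X i := fun i x hx => Set.mem_iUnion.2 ⟨i, hx⟩
  obtain ⟨P, hP⟩ := M_all _ G rfl X (Tᶜ \ ⋃ i, X i) hF.disj (fun j => by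
    rw [Set.disjoint_left]; exact fun x hx h => h.2 (hXU j x hx)) (hE.mono Set.sdiff_subset) hlo
  have hsub : ∀ t : T, t.1 ∈ X t := fun t => hF.sub t rfl
  have hXT : ∀ t : T, ∀ x ∈ X t, x ∈ T → x = t := fun t x hx hT =>
    (hF.sup t hx).resolve_left (fun h => h hT)
  have dX : ∀ i j x, x ∈ X i → x ∈ X j → i = j := fun i j x h h' => by
    by_contra hne; exact Set.disjoint_left.1 (hF.disj i j hne) h h'
  have key : ∀ l : P, ∃ q : List (Dart V E), ((∀ g ∈ q, G.ok g) ∧ ∃ i j : T, i ≠ j ∧ Ch i.1 q j.1 ∧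
        (i.1 :: q.map Dart.t).Nodup ∧ (∀ g ∈ q, g.t ∈ T → g.t = j) ∧
        ∃ e f, ∀ g ∈ q, ∀ k, g.e ∈ G.cut (X k) → (k = i ∧ g.e = e) ∨ (k = j ∧ g.e = f)) ∧
      (∀ g ∈ q, G.ok g ∧ (g ∈ l.1 ∨ ∃ k m b, m ++ [b] ∈ W k ∧ g.e ∈ edges m ∧ b.e ∈ edges l.1 ∧
        g.s ∈ X k ∧ g.t ∈ X k)) ∧
      (∀ g ∈ l.1, G.ok g ∧ ∀ k, g.s ∈ X k → g.t ∈ X k → False) ∧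
      (∀ c ∈ edges l.1, ∀ k, c ∈ G.cut (X k) → c ∈ edges q) := by
    rintro ⟨l, hl⟩
    obtain ⟨i, hi⟩ := hP.sw l hl
    obtain ⟨d, l', rfl, hds, hl'⟩ := hi.cons Set.subset_union_right
    obtain ⟨hi1, x, hx, y, hy, hc⟩ := hi
    have hxd : d.s = x := hc.1
    have h0 := hi1 d (by simp)
    obtain ⟨m1, hm1⟩ := hF.cont (d := d.rev) h0.1.rev h0.2.2 hds
    rw [Dart.rev_rev] at hm1
    obtain ⟨⟨a, ha, hca⟩, hseg1⟩ := hF.seg hm1 h0.2.2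
    rw [hxd] at hca
    obtain ⟨j, hj⟩ : ∃ j, y ∈ X j := by
      by_contra hne
      by_cases hyT : y ∈ T
      · exact hne ⟨⟨y, hyT⟩, hsub ⟨y, hyT⟩⟩
      · exact hy (Or.inl ⟨hyT, fun h => hne (Set.mem_iUnion.1 h)⟩)
    have hij : i ≠ j := fun h => hy (Or.inr (h ▸ hj))
    obtain ⟨p, b, hpb, hby, hcp⟩ := hc.getlast (by simp)
    have hsk : ∀ g ∈ d :: l', ∀ k, g.s ∈ X k → k = i := by
      intro g hg k hk
      rcases (hi1 g hg).2.1 with h' | h'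
      · exact absurd (hXU k _ hk) h'.2
      · exact dX _ _ _ hk h'
    have hb0 := hi1 b (by rw [hpb]; simp)
    have hbs : b.s ∉ X j := fun h => hij (hsk b (by rw [hpb]; simp) j h).symm
    obtain ⟨m2, hm2⟩ := hF.cont hb0.1 hbs (hby ▸ hj)
    obtain ⟨⟨a2, ha2, hca2⟩, hseg2⟩ := hF.seg hm2 hbs
    have hca2' : Ch a2 m2 y := hby ▸ hca2
    have ha' : a = i.1 := ha
    have ha2' : a2 = j.1 := ha2
    subst ha' ha2'
    have htg : ∀ g ∈ d :: l', g = b ∨ ∃ g' ∈ d :: l', g'.s = g.t := by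
      intro g hg
      rw [hpb] at hg hc
      rcases List.mem_append.1 hg with h | h
      · obtain ⟨l1, l2, rfl⟩ := List.append_of_mem h
        have hc2 := hc
        simp only [List.append_assoc, List.cons_append] at hc2
        obtain ⟨z, -, hz⟩ := Ch_append.1 hc2
        cases l2 with
        | nil => exact Or.inr ⟨b, by rw [hpb]; simp, hz.2.1⟩
        | cons b2 l2 => exact Or.inr ⟨b2, by rw [hpb]; simp, hz.2.1⟩
      · exact Or.inl (by simpa using h)
    have htk : ∀ g ∈ d :: l', ∀ k, g.t ∈ X k → k = j ∧ g = b := by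
      intro g hg k hk
      rcases htg g hg with h | ⟨g', hg', h⟩
      · subst h; exact ⟨dX _ _ _ hk (hby ▸ hj), rfl⟩
      · exfalso
        have := hsk g' hg' k (h ▸ hk)
        subst this
        exact (hi1 g hg).2.2 hk
    have hsi : ∀ g ∈ d :: l', g.s ∈ X i → g = d := by
      intro g hg h
      rcases List.mem_cons.1 hg with h' | h'
      · exact h'
      · exact absurd h (hl' g h')
    have hbl : ∀ g ∈ d :: l', G.ok g ∧ ∀ k, g.s ∈ X k → g.t ∈ X k → False := fun g hg =>
      ⟨(hi1 g hg).1, fun k h1 h2 => hij ((hsk g hg k h1).symm.trans (htk g hg k h2).1)⟩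
    have hcrl : ∀ g ∈ d :: l', ∀ k, g.e ∈ G.cut (X k) → (k = i ∧ g.e = d.e) ∨ (k = j ∧ g.e = b.e) := by
      intro g hg k hk
      rcases ((hi1 g hg).1.mem_cut).1 hk with h | h
      · have := hsk g hg k h.1
        subst this
        exact Or.inl ⟨rfl, by rw [hsi g hg h.1]⟩
      · have := htk g hg k h.2
        exact Or.inr ⟨this.1, by rw [this.2]⟩
    have hin : ∀ g k k', G.ok g → g.s ∈ X k → g.t ∈ X k → g.e ∉ G.cut (X k') := by
      intro g k k' hg h1 h2 h
      rcases (hg.mem_cut).1 h with h | h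
      · exact h.2 (dX _ _ _ h1 h.1 ▸ h2)
      · exact h.1 (dX _ _ _ h2 h.2 ▸ h1)
    have hfull : Ch i.1 (m1 ++ d :: l' ++ revL m2) j.1 := (hca.append hc).append hca2'.rev
    -- properties of the long walk
    have hall : ∀ g ∈ m1 ++ d :: l' ++ revL m2, G.ok g ∧ (g.t ∈ T → g.t = j.1) ∧
        (∀ k, g.e ∈ G.cut (X k) → (k = i ∧ g.e = d.e) ∨ (k = j ∧ g.e = b.e)) ∧
        (g ∈ d :: l' ∨ ∃ k m b, m ++ [b] ∈ W k ∧ g.e ∈ edges m ∧ b.e ∈ edges (d :: l') ∧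
        g.s ∈ X k ∧ g.t ∈ X k) := by
      intro g hg
      rcases List.mem_append.1 hg with h | h
      · rcases List.mem_append.1 h with h | h
        · have h3 := hseg1 g h
          exact ⟨h3.1, fun hT => absurd (hXT i _ h3.2.2.1 hT) h3.2.2.2,
            fun k hk => absurd hk (hin g i k h3.1 h3.2.1 h3.2.2.1),
            Or.inr ⟨i, m1, d, hm1, mem_edges_of h, by simp, h3.2.1, h3.2.2.1⟩⟩
        · refine ⟨(hi1 g h).1, fun hT => ?_, hcrl g h, Or.inl h⟩
          have := htk g h ⟨g.t, hT⟩ (hsub _)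
          rw [← this.1]
      · have h3 := hseg2 _ (mem_revL.1 h)
        refine ⟨h3.1.rev, fun hT => hXT j _ h3.2.1 hT,
            fun k hk => absurd hk (hin g j k h3.1.rev h3.2.2.1 h3.2.1),
            Or.inr ⟨j, m2, b.rev, hm2, mem_edges.2 ⟨g.rev, mem_revL.1 h, rfl⟩, ?_, h3.2.2.1, h3.2.1⟩⟩
        exact mem_edges.2 ⟨b, by rw [hpb]; simp, rfl⟩
    obtain ⟨q, hq, hqs, hqn⟩ := hfull.shorten
    have hnij : ∀ k k' : T, k ≠ k' → k.1 ∉ X k' := fun k k' hne h => hne (dX _ _ _ (hsub k) h)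
    refine ⟨q, ⟨fun g hg => (hall g (hqs hg)).1, i, j, hij, hq, hqn, fun g hg => (hall g (hqs hg)).2.1,
      d.e, b.e, fun g hg => (hall g (hqs hg)).2.2.1⟩, fun g hg => ⟨(hall g (hqs hg)).1, (hall g (hqs hg)).2.2.2⟩,
      hbl, ?_⟩
    intro c hcl k hk
    obtain ⟨g, hg, rfl⟩ := mem_edges.1 hcl
    rcases hcrl g hg k hk with ⟨rfl, he⟩ | ⟨rfl, he⟩
    · obtain ⟨l1, g', l2, h1, -, -, h2, h3, -⟩ := hq.exit (hsub k) (hnij j k hij.symm)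
      have hg' : g' ∈ q := by rw [h1]; simp
      have hg0 := hall g' (hqs hg')
      rcases hg0.2.2.1 k ((hg0.1.mem_cut).2 (Or.inl ⟨h2, h3⟩)) with h | h
      · rw [he, ← h.2]; exact mem_edges_of hg'
      · exact absurd h.1 hij
    · obtain ⟨l1, g', l2, h1, -, -, h2, h3, -⟩ := hq.exit (X := (X k)ᶜ) (hnij i k hij) (fun h => h (hsub k))
      have hg' : g' ∈ q := by rw [h1]; simp
      have hg0 := hall g' (hqs hg')
      rcases hg0.2.2.1 k ((hg0.1.mem_cut).2 (Or.inr ⟨h2, not_not.1 h3⟩)) with h | h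
      · exact absurd h.1.symm hij
      · rw [he, ← h.2]; exact mem_edges_of hg'
  choose q hq1 hq2 hq3 hq4 using key
  refine ⟨X, Set.range q, hsub, hXT, ?_, ?_, ?_⟩
  · rintro _ ⟨l, rfl⟩; exact hq1 l
  · rintro _ ⟨l, rfl⟩ _ ⟨l', rfl⟩ e he he'
    suffices l = l' by rw [this]
    obtain ⟨g, hg, rfl⟩ := mem_edges.1 he
    obtain ⟨g', hg', hgg⟩ := mem_edges.1 he'
    have h1 := hq2 l g hg
    have h2 := hq2 l' g' hg'
    apply Subtype.ext
    have hsame := ok_same h1.1 h2.1 hgg.symm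
    rcases h1.2 with a1 | ⟨k, m, b, hm, hgm, hbl, hs, ht⟩
    · rcases h2.2 with a2 | ⟨k', m', b', hm', hgm', hbl', hs', ht'⟩
      · exact hP.disj _ l.2 _ l'.2 g.e (mem_edges_of a1) (hgg ▸ mem_edges_of a2)
      · exfalso
        rcases hsame with rfl | rfl
        · exact (hq3 l _ a1).2 k' hs' ht'
        · exact (hq3 l _ a1).2 k' ht' hs'
    · rcases h2.2 with a2 | ⟨k', m', b', hm', hgm', hbl', hs', ht'⟩
      · exfalso
        rcases hsame with rfl | rfl
        · exact (hq3 l' _ a2).2 k hs ht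
        · exact (hq3 l' _ a2).2 k ht hs
      · have hk : k = k' := by
          rcases hsame with rfl | rfl
          · exact dX _ _ _ hs hs'
          · exact dX _ _ _ hs ht'
        subst hk
        have hb := (hF.sys k).disj _ hm _ hm' g.e (by simp [hgm]) (by rw [hgg] at hgm'; simp [hgm'])
        have hbb : [b] = [b'] := (List.append_inj' hb rfl).2
        have hbb : b = b' := by simpa using hbb
        subst hbb
        exact hP.disj _ l.2 _ l'.2 b.e hbl hbl'
  · intro k c hc
    obtain ⟨l, hl, hcl⟩ := hP.cov k hc
    exact ⟨_, ⟨⟨l, hl⟩, rfl⟩, hq4 ⟨l, hl⟩ c hcl k hc⟩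
end LC

namespace LC
open Classical Cardinal
variable {V : Type u} {E : Type v}

/-- The underlying multigraph of a grapht. -/
def toMG (G : Grapht V E) : MG V E := ⟨G.I, Set.univ⟩

lemma toMG_cut (G : Grapht V E) (X : Set V) : (toMG G).cut X = G.edgeCut X := by
  ext e
  constructor
  · rintro ⟨d, hd, rfl, hs, ht⟩
    exact ⟨d.s, d.t, hd.2, hs, ht⟩
  · rintro ⟨a, b, h, ha, hb⟩
    exact ⟨⟨a, e, b⟩, ⟨trivial, h⟩, rfl, ha, hb⟩

lemma isWalk_of_chain (G : Grapht V E) : ∀ (l : List (Dart V E)) (x y : V), Ch x l y →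
    (∀ g ∈ l, (toMG G).ok g) → G.IsWalk (x :: l.map Dart.t) (edges l)
  | [], x, _, _, _ => Grapht.IsWalk.nil x
  | d :: l, x, y, h, hok => by
    have hs : d.s = x := h.1
    subst hs
    exact Grapht.IsWalk.cons (hok d (by simp)).2
      (isWalk_of_chain G l d.t y h.2 (fun g hg => hok g (by simp [hg])))

lemma chain_getLast : ∀ (l : List (Dart V E)) (x y : V), Ch x l y →
    (x :: l.map Dart.t).getLast? = some y
  | [], x, y, h => by
    have h' : x = y := h
    simp [h']
  | d :: l, x, y, h => by
    have := chain_getLast l d.t y h.2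
    rw [List.map_cons, List.getLast?_cons_cons]
    exact this

lemma chain_of_isWalk (G : Grapht V E) {vs : List V} {es : List E} (h : G.IsWalk vs es) :
    ∀ x y, vs.head? = some x → vs.getLast? = some y →
    ∃ l, Ch x l y ∧ (∀ g ∈ l, (toMG G).ok g) ∧ edges l = es := by
  induction h with
  | nil v =>
    intro x y hx hy
    refine ⟨[], ?_, by simp, rfl⟩
    have h1 : v = x := by simpa using hx
    have h2 : v = y := by simpa using hy
    exact h1.symm.trans h2
  | @cons a w vs e es he _ ih =>
    intro x y hx hy
    have h1 : a = x := by simpa using hx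
    subst h1
    rw [List.getLast?_cons_cons] at hy
    obtain ⟨l, hl, hok, hes⟩ := ih w y rfl hy
    refine ⟨⟨a, e, w⟩ :: l, ⟨rfl, hl⟩, ?_, by simp [hes]⟩
    intro g hg
    rcases List.mem_cons.1 hg with rfl | hg
    · exact ⟨trivial, he⟩
    · exact hok g hg

/-- The path given by a chain without repeated vertices. -/
def toPath (G : Grapht V E) {l : List (Dart V E)} {x y : V} (h : Ch x l y)
    (hok : ∀ g ∈ l, (toMG G).ok g) (hn : (x :: l.map Dart.t).Nodup) : G.Path where
  first := x
  last := y
  verts := x :: l.map Dart.t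
  edges := edges l
  isWalk := isWalk_of_chain G l x y h hok
  nodup := hn
  head_eq := rfl
  getLast_eq := chain_getLast l x y h

lemma toPath_inner (G : Grapht V E) {l : List (Dart V E)} {x y : V} (h : Ch x l y)
    (hok : ∀ g ∈ l, (toMG G).ok g) (hn : (x :: l.map Dart.t).Nodup) :
    ∀ v ∈ (toPath G h hok hn).inner, v ≠ y ∧ ∃ g ∈ l, g.t = v := by
  intro v hv
  have hv : v ∈ (l.map Dart.t).dropLast := hv
  have hl : l ≠ [] := by rintro rfl; simp at hv
  obtain ⟨m, d, rfl, hd, -⟩ := h.getlast hl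
  have hv' : v ∈ m.map Dart.t := by simpa using hv
  constructor
  · rintro rfl
    have hn' := (List.nodup_cons.1 hn).2
    rw [List.map_append] at hn'
    exact (List.disjoint_of_nodup_append hn') hv' (by simp [hd])
  · obtain ⟨g, hg, hgv⟩ := List.mem_map.1 hv'
    exact ⟨g, by simp [hg], hgv⟩

theorem final (G : Grapht V E) (hG : G.InnerEulerian) :
    ∃ Ps : Set G.Path, G.IsTPathSystem Ps ∧
      ∀ t ∈ G.T, ∃ C : Set E, (∃ X : Set V, C = G.edgeCut X) ∧
        G.Separates C {t} (G.T \ {t}) ∧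
        G.Orthogonal C {P ∈ Ps | P.first = t ∨ P.last = t} := by
  have hE : Eul (toMG G) G.Tᶜ := by
    intro X hX hf
    rw [toMG_cut] at hf ⊢
    rw [← Nat.not_odd_iff_even]
    exact fun ho => hG X (Set.disjoint_left.2 hX) ⟨hf, ho⟩
  obtain ⟨X, Q, hsub, hXT, hQ, hdisj, hcov⟩ := final_chain (toMG G) G.T hE
  have dX : ∀ i j : G.T, i.1 ∈ X j → i = j := fun i j h => Subtype.ext (hXT j _ h i.2)
  have key : ∀ q : Q, ∃ p : G.Path, p.edges = edges q.1 ∧ G.IsTPath p ∧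
      ∃ i j : G.T, i ≠ j ∧ p.first = i ∧ p.last = j ∧ Ch i.1 q.1 j.1 ∧ (∀ g ∈ q.1, (toMG G).ok g) ∧
      ∃ e f, ∀ g ∈ q.1, ∀ k, g.e ∈ (toMG G).cut (X k) → (k = i ∧ g.e = e) ∨ (k = j ∧ g.e = f) := by
    rintro ⟨q, hq⟩
    obtain ⟨hok, i, j, hij, hc, hn, hT, e, f, hef⟩ := hQ q hq
    refine ⟨toPath G hc hok hn, rfl, ⟨i.2, j.2, fun h => hij (Subtype.ext h), ?_⟩,
      i, j, hij, rfl, rfl, hc, hok, e, f, hef⟩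
    intro v hv hvT
    obtain ⟨hne, g, hg, rfl⟩ := toPath_inner G hc hok hn v hv
    exact hne (hT g hg hvT)
  choose p hpe hpT hp using key
  refine ⟨Set.range p, ⟨?_, ?_⟩, ?_⟩
  · rintro _ ⟨q, rfl⟩ _ ⟨q', rfl⟩ hne e he he'
    rw [hpe] at he he'
    exact hne (congrArg p (Subtype.ext (hdisj _ q.2 _ q'.2 e he he')))
  · rintro _ ⟨q, rfl⟩; exact hpT q
  · intro t ht
    refine ⟨G.edgeCut (X ⟨t, ht⟩), ⟨_, rfl⟩, ?_, ?_, ?_⟩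
    · rintro R ⟨hf, hl, -⟩
      have hf : R.first = t := hf
      obtain ⟨l, hl1, hok, hed⟩ := chain_of_isWalk G R.isWalk _ _ R.head_eq R.getLast_eq
      obtain ⟨l1, d, l2, h1, -, -, h2, h3, -⟩ := hl1.exit (X := X ⟨t, ht⟩) (by rw [hf]; exact hsub ⟨t, ht⟩)
        (fun h => hl.2 (hXT ⟨t, ht⟩ _ h hl.1))
      have hd : d ∈ l := by rw [h1]; simp
      refine ⟨d.e, ?_, hed ▸ mem_edges_of hd⟩
      rw [← toMG_cut]
      exact ((hok d hd).mem_cut).2 (Or.inl ⟨h2, h3⟩)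
    · rintro _ ⟨⟨q, rfl⟩, hend⟩
      obtain ⟨i, j, hij, hfi, hlj, hc, hok, e, f, hef⟩ := hp q
      rw [hfi, hlj] at hend
      rw [hpe, ← toMG_cut]
      have hu : ∃ c, ∀ g ∈ q.1, g.e ∈ (toMG G).cut (X ⟨t, ht⟩) → g.e = c := by
        rcases hend with h | h
        · refine ⟨e, fun g hg hk => ?_⟩
          rcases hef g hg _ hk with h' | h'
          · exact h'.2
          · exact absurd (Subtype.ext (h.trans (congrArg Subtype.val h'.1))) hij
        · refine ⟨f, fun g hg hk => ?_⟩
          rcases hef g hg _ hk with h' | h'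
          · exact absurd (Subtype.ext (h.trans (congrArg Subtype.val h'.1))) hij.symm
          · exact h'.2
      obtain ⟨c, hcu⟩ := hu
      have hx : ∃ g ∈ q.1, g.e ∈ (toMG G).cut (X ⟨t, ht⟩) := by
        rcases hend with h | h
        · have hi : i = ⟨t, ht⟩ := Subtype.ext h
          obtain ⟨l1, d, l2, h1, -, -, h2, h3, -⟩ := hc.exit (X := X ⟨t, ht⟩) (by rw [h]; exact hsub ⟨t, ht⟩)
            (fun h' => hij (hi.trans (dX j _ h').symm))
          have hd : d ∈ q.1 := by rw [h1]; simp
          exact ⟨d, hd, ((hok d hd).mem_cut).2 (Or.inl ⟨h2, h3⟩)⟩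
        · have hj : j = ⟨t, ht⟩ := Subtype.ext h
          obtain ⟨l1, d, l2, h1, -, -, h2, h3, -⟩ := hc.exit (X := (X ⟨t, ht⟩)ᶜ)
            (fun h' => hij ((dX i _ h').trans hj.symm)) (fun h' => h' (by rw [h]; exact hsub ⟨t, ht⟩))
          have hd : d ∈ q.1 := by rw [h1]; simp
          exact ⟨d, hd, ((hok d hd).mem_cut).2 (Or.inr ⟨h2, not_not.1 h3⟩)⟩
      obtain ⟨g, hg, hgc⟩ := hx
      refine ⟨g.e, ⟨hgc, mem_edges_of hg⟩, ?_⟩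
      rintro c' ⟨hc1, hc2⟩
      obtain ⟨g', hg', rfl⟩ := mem_edges.1 hc2
      exact (hcu g' hg' hc1).trans (hcu g hg hgc).symm
    · intro c hc
      rw [← toMG_cut] at hc
      obtain ⟨q, hq, hcq⟩ := hcov _ hc
      refine ⟨p ⟨q, hq⟩, ⟨⟨_, rfl⟩, ?_⟩, by rw [hpe]; exact hcq⟩
      obtain ⟨i, j, hij, hfi, hlj, -, -, e, f, hef⟩ := hp ⟨q, hq⟩
      obtain ⟨g, hg, rfl⟩ := mem_edges.1 hcq
      rcases hef g hg _ hc with h | h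
      · left; rw [hfi, ← h.1]
      · right; rw [hlj, ← h.1]
end LC

/-- **Infinite Lovász–Cherkassky theorem.** Every inner Eulerian grapht has a system of
pairwise edge-disjoint `T`-paths such that for every `t ∈ T` some cut separating `t`
and `T − t` consists of exactly one edge from each path of the system ending at `t`. -/
theorem infinite_lovasz_cherkassky {V : Type u} {E : Type v} (G : Grapht V E)
    (hG : G.InnerEulerian) :
    ∃ Ps : Set G.Path, G.IsTPathSystem Ps ∧
      ∀ t ∈ G.T, ∃ C : Set E, (∃ X : Set V, C = G.edgeCut X) ∧
        G.Separates C {t} (G.T \ {t}) ∧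
        G.Orthogonal C {P ∈ Ps | P.first = t ∨ P.last = t} := by
  exact LC.final G hG
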